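/- Let n ≥ 3, 0 < α < 1, ζ > 1 and ζ' > 0. Let f : ℝⁿ → ℝ be α-Hölder continuous on every compact set, with finite limit f(∞) = lim_{|x|→∞} f(x), satisfying limsup_{|x|→∞} ( |x|^ζ |f(x) − f(∞)| + |x|^{α+ζ'} [f]_{C^α(B̄_{|x|/2}(x))} ) < ∞. Let u ∈ C²(ℝⁿ) satisfy det D²u(x) = e^{n f(x)} for all x ∈ ℝⁿ with D²u(x) positive definite for every x. Then there exist ε > 0, C > 0 and a symmetric positive definite n×n matrix A with det A = e^{n f(∞)} such that sup_{ℝⁿ}|D²u| + [D²u]_{C^α(ℝⁿ)} ≤ C and |D²u(x) − A| ≤ C |x|^{−ε} for all |x| ≥ 1. -/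

import Mathlib

open Filter

/-- The Hessian matrix `(∂ᵢ∂ⱼ u(x))` of a function on Euclidean space. -/
noncomputable def hess {n : ℕ} (u : EuclideanSpace ℝ (Fin n) → ℝ)
    (x : EuclideanSpace ℝ (Fin n)) : Matrix (Fin n) (Fin n) ℝ :=
  Matrix.of fun i j =>
    iteratedFDeriv ℝ 2 u x ![EuclideanSpace.single i 1, EuclideanSpace.single j 1]

open Matrix MeasureTheory Set Metric Topology
open scoped RealInnerProductSpace

abbrev EE (n : ℕ) := EuclideanSpace ℝ (Fin n)
abbrev MM (n : ℕ) := Matrix (Fin n) (Fin n) ℝ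

noncomputable def TM {n : ℕ} (A : MM n) : EE n →L[ℝ] EE n := Matrix.toEuclideanCLM (𝕜 := ℝ) A
def vv {n : ℕ} (x y : EE n) : MM n := vecMulVec x.ofLp y.ofLp

section mat
variable {n : ℕ} {A B C : MM n} {x y z : EE n}

@[simp] lemma TM_mul (A B : MM n) (x : EE n) : TM (A * B) x = TM A (TM B x) := by
  simp [TM, map_mul]
@[simp] lemma TM_one (x : EE n) : TM (1 : MM n) x = x := by simp [TM]
@[simp] lemma TM_zero (x : EE n) : TM (0 : MM n) x = 0 := by simp [TM]
@[simp] lemma TM_add (A B : MM n) (x : EE n) : TM (A + B) x = TM A x + TM B x := by simp [TM]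
@[simp] lemma TM_sub (A B : MM n) (x : EE n) : TM (A - B) x = TM A x - TM B x := by simp [TM]
@[simp] lemma TM_neg (A : MM n) (x : EE n) : TM (-A) x = -TM A x := by simp [TM]
@[simp] lemma TM_smul (c : ℝ) (A : MM n) (x : EE n) : TM (c • A) x = c • TM A x := by simp [TM]
lemma TM_inj (h : TM A = TM B) : A = B := (Matrix.toEuclideanCLM (𝕜 := ℝ)).injective h
lemma inner_vec (x y : EE n) : ⟪x, y⟫ = x.ofLp ⬝ᵥ y.ofLp := by
  simp [PiLp.inner_apply, dotProduct, mul_comm]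
lemma TM_ofLp (A : MM n) (x : EE n) : (TM A x).ofLp = A *ᵥ x.ofLp := by
  simp [TM, Matrix.ofLp_toEuclideanCLM]
@[simp] lemma TM_vv (x y z : EE n) : TM (vv x y) z = ⟪y, z⟫ • x := by
  ext i; simp [TM_ofLp, vv, inner_vec, Matrix.vecMulVec_mulVec, mul_comm]
lemma inner_TM (A : MM n) (x y : EE n) : ⟪TM A x, y⟫ = ⟪x, TM Aᵀ y⟫ := by
  simp [inner_vec, TM_ofLp, Matrix.dotProduct_mulVec, Matrix.vecMul_transpose]
lemma inner_TM_symm (h : A.IsHermitian) (x y : EE n) : ⟪TM A x, y⟫ = ⟪x, TM A y⟫ := by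
  rw [inner_TM]; congr 2; simpa [conjTranspose_eq_transpose_of_trivial] using congrArg TM h
lemma pd_pos (h : A.PosDef) (hx : x ≠ 0) : 0 < ⟪TM A x, x⟫ := by
  rw [real_inner_comm, inner_vec, TM_ofLp]
  simpa using h.dotProduct_mulVec_pos (x := x.ofLp) (by simpa using hx)
lemma psd_nonneg (h : A.PosSemidef) (x : EE n) : 0 ≤ ⟪TM A x, x⟫ := by
  rw [real_inner_comm, inner_vec, TM_ofLp]
  simpa using h.dotProduct_mulVec_nonneg x.ofLp
lemma psd_of (hs : Aᵀ = A) (h : ∀ x : EE n, 0 ≤ ⟪TM A x, x⟫) : A.PosSemidef := by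
  refine Matrix.PosSemidef.of_dotProduct_mulVec_nonneg (by simpa [IsHermitian, conjTranspose_eq_transpose_of_trivial] using hs) fun v => ?_
  have := h (WithLp.toLp 2 v)
  rw [real_inner_comm, inner_vec, TM_ofLp] at this
  simpa using this
lemma pd_of (hs : Aᵀ = A) (h : ∀ x : EE n, x ≠ 0 → 0 < ⟪TM A x, x⟫) : A.PosDef := by
  refine Matrix.PosDef.of_dotProduct_mulVec_pos (by simpa [IsHermitian, conjTranspose_eq_transpose_of_trivial] using hs) fun v hv => ?_
  have := h (WithLp.toLp 2 v) (by simpa using hv)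
  rw [real_inner_comm, inner_vec, TM_ofLp] at this
  simpa using this
lemma pd_symm (h : A.PosDef) : Aᵀ = A := by
  simpa [IsHermitian, conjTranspose_eq_transpose_of_trivial] using h.isHermitian
lemma TM_inv (h : 0 < A.det) (x : EE n) : TM A (TM A⁻¹ x) = x := by
  rw [← TM_mul, Matrix.mul_nonsing_inv _ (isUnit_iff_ne_zero.2 h.ne'), TM_one]
lemma TM_inv' (h : 0 < A.det) (x : EE n) : TM A⁻¹ (TM A x) = x := by
  rw [← TM_mul, Matrix.nonsing_inv_mul _ (isUnit_iff_ne_zero.2 h.ne'), TM_one]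
lemma trace_mul_vv (A : MM n) (x y : EE n) : (A * vv x y).trace = ⟪TM A x, y⟫ := by
  simp [vv, Matrix.mul_vecMulVec, Matrix.trace_vecMulVec, inner_vec, TM_ofLp]
lemma trace_vv (x y : EE n) : (vv x y).trace = ⟪x, y⟫ := by
  simpa using trace_mul_vv 1 x y
lemma TM_det (A : MM n) : (TM A).det = A.det := by
  rw [ContinuousLinearMap.det, TM]
  have : ((Matrix.toEuclideanCLM (n := Fin n) (𝕜 := ℝ) A : EE n →L[ℝ] EE n) : EE n →ₗ[ℝ] EE n) = Matrix.toLin (EuclideanSpace.basisFun (Fin n) ℝ).toBasis (EuclideanSpace.basisFun (Fin n) ℝ).toBasis A := rfl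
  rw [this, LinearMap.det_toLin]

open scoped MatrixOrder in
lemma psd_sqrt (h : A.PosSemidef) : ∃ Q : MM n, A = Qᵀ * Q := by
  obtain ⟨Q, hQ⟩ := CStarAlgebra.nonneg_iff_eq_star_mul_self.1 (Matrix.nonneg_iff_posSemidef.2 h)
  exact ⟨Q, by simpa [star_eq_conjTranspose, conjTranspose_eq_transpose_of_trivial] using hQ⟩

/-- trace of product of psd matrices is nonneg -/
lemma trace_mul_nonneg (hA : A.PosSemidef) (hB : B.PosSemidef) : 0 ≤ (A * B).trace := by
  obtain ⟨Q, rfl⟩ := psd_sqrt hB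
  rw [← Matrix.mul_assoc, Matrix.trace_mul_comm, ← Matrix.mul_assoc]
  exact (by simpa [conjTranspose_eq_transpose_of_trivial] using hA.mul_mul_conjTranspose_same Q : (Q * A * Qᵀ).PosSemidef).trace_nonneg

lemma log_amgm (hA : A.PosDef) : (n : ℝ) + Real.log A.det ≤ A.trace := by
  have h := hA.isHermitian
  rw [h.det_eq_prod_eigenvalues, h.trace_eq_sum_eigenvalues]
  simp only [RCLike.ofReal_real_eq_id, id]
  rw [Real.log_prod (fun i _ => (hA.eigenvalues_pos i).ne')]
  have : ∑ i : Fin n, (1 + Real.log (h.eigenvalues i)) ≤ ∑ i, h.eigenvalues i :=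
    Finset.sum_le_sum fun i _ => by linarith [Real.log_le_sub_one_of_pos (hA.eigenvalues_pos i)]
  simpa [Finset.sum_add_distrib] using this

lemma pd_congr {P : MM n} (hB : B.PosDef) (hP : P.det ≠ 0) : (Pᵀ * B * P).PosDef := by
  refine pd_of (by simp [Matrix.mul_assoc, pd_symm hB]) fun x hx => ?_
  simp only [TM_mul]
  rw [inner_TM, transpose_transpose]
  refine pd_pos hB fun h0 => hx ?_
  have := congrArg (TM P⁻¹) h0
  rwa [← TM_mul, Matrix.nonsing_inv_mul _ (isUnit_iff_ne_zero.2 hP), TM_one, map_zero] at this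

lemma trace_ge (hA : A.PosDef) (hB : B.PosDef) :
    (n : ℝ) + Real.log (B.det / A.det) ≤ (A⁻¹ * B).trace := by
  obtain ⟨Q, hQ⟩ := psd_sqrt hA.inv.posSemidef
  have hd : Q.det * Q.det = A.det⁻¹ := by
    have := congrArg Matrix.det hQ
    rw [det_nonsing_inv, Ring.inverse_eq_inv', det_mul, det_transpose] at this
    exact this.symm
  have hQ0 : Qᵀ.det ≠ 0 := by
    rw [det_transpose]; intro h; rw [h, zero_mul] at hd
    exact (inv_ne_zero hA.det_pos.ne') hd.symm
  have := log_amgm (pd_congr hB hQ0)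
  rw [transpose_transpose, trace_mul_comm, ← Matrix.mul_assoc, ← hQ] at this
  convert this using 3
  rw [det_mul, det_mul, det_transpose, div_eq_mul_inv, ← hd]; ring

/-- key inequality -/
lemma key_def (hA : A.PosDef) (hB : B.PosDef) (e : EE n) :
    (√⟪TM B e, e⟫ - √⟪TM A e, e⟫) ^ 2 ≤
      ⟪TM A e, e⟫ * ((A⁻¹ * B).trace - n - Real.log (B.det / A.det)) := by
  rcases eq_or_ne e 0 with rfl | he
  · simp
  set a := ⟪TM A e, e⟫ with ha
  set b := ⟪TM B e, e⟫ with hb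
  have ap : 0 < a := pd_pos hA he
  have bp : 0 < b := pd_pos hB he
  -- D A D-type modification
  set s := √(a / b) with hs
  have sp : 0 < s := Real.sqrt_pos.2 (div_pos ap bp)
  have s2 : s ^ 2 = a / b := Real.sq_sqrt (div_pos ap bp).le
  -- P = 1 + ((s-1)/a) e (Ae)ᵀ
  let P : MM n := 1 + vv (((s - 1) / a) • e) (TM A e)
  have hP : P.det = s := by
    have : P = 1 + replicateCol Unit (((s - 1) / a) • e).ofLp * replicateRow Unit (TM A e).ofLp := by
      simp [P, vv, Matrix.vecMulVec_eq Unit]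
    rw [this, Matrix.det_one_add_replicateCol_mul_replicateRow, ← inner_vec, inner_smul_right, ← ha]
    field_simp; ring
  have h1 := trace_ge hA (pd_congr hB (P := P) (by rw [hP]; exact sp.ne'))
  have hd : (Pᵀ * B * P).det = s ^ 2 * B.det := by
    rw [det_mul, det_mul, det_transpose, hP]; ring
  have ht : (A⁻¹ * (Pᵀ * B * P)).trace = (A⁻¹ * B).trace + a⁻¹ * (s ^ 2 - 1) * b := by
    have e1 : P * A⁻¹ * Pᵀ = A⁻¹ + vv ((a⁻¹ * (s ^ 2 - 1)) • e) e := by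
      apply TM_inj
      ext1 x
      have hPt : Pᵀ = 1 + vv (TM A e) (((s - 1) / a) • e) := by
        simp [P, vv, Matrix.transpose_vecMulVec]
      rw [hPt]
      simp only [TM_mul, TM_add, TM_one, TM_vv, P, map_add, map_smul, TM_inv' hA.det_pos, inner_add_right, inner_smul_right, ← ha, inner_smul_left]
      have : ⟪TM A e, TM A⁻¹ x⟫ = ⟪e, x⟫ := by
        rw [inner_TM_symm hA.isHermitian, TM_inv hA.det_pos]
      rw [this]
      simp only [smul_smul, add_assoc, ← add_smul, conj_trivial]
      congr 1
      match_scalars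
      field_simp; ring
    have : (A⁻¹ * (Pᵀ * B * P)).trace = (P * A⁻¹ * Pᵀ * B).trace := by
      rw [Matrix.trace_mul_comm (P * A⁻¹ * Pᵀ), Matrix.trace_mul_comm, Matrix.mul_assoc, Matrix.trace_mul_comm]
      rw [Matrix.trace_mul_comm B, Matrix.mul_assoc (P * A⁻¹), Matrix.trace_mul_comm, ← Matrix.mul_assoc]
    rw [this, e1, Matrix.add_mul, trace_add, Matrix.trace_mul_comm (vv _ _), trace_mul_vv]
    rw [map_smul, inner_smul_left]; simp [hb]
  rw [hd, ht, mul_div_assoc, Real.log_mul (by positivity) (div_pos hB.det_pos hA.det_pos).ne', s2] at h1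
  have e3 : a⁻¹ * (a / b - 1) * b = 1 - b / a := by field_simp
  rw [e3] at h1
  have h2 : (√b - √a) ^ 2 = b + a - 2 * (√a * √b) := by
    rw [sub_sq, Real.sq_sqrt bp.le, Real.sq_sqrt ap.le]; ring
  have h3 : Real.log (a / b) = -2 * Real.log (√b / √a) := by
    rw [← Real.sqrt_div bp.le, Real.log_sqrt (by positivity), ← inv_div, Real.log_inv]; ring
  have h4 := Real.log_le_sub_one_of_pos (x := √b / √a) (by positivity)
  have h5 : a * (√b / √a) = √a * √b := by
    nth_rw 1 [← Real.mul_self_sqrt ap.le]; field_simp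
  have h6 : a * (b / a) = b := by field_simp
  rw [h2]
  rw [h3] at h1
  nlinarith [mul_le_mul_of_nonneg_left h1 ap.le, mul_le_mul_of_nonneg_left h4 ap.le]

lemma det_mono (hA : A.PosDef) (hB : B.PosDef) (h : ∀ x : EE n, ⟪TM B x, x⟫ ≤ ⟪TM A x, x⟫) :
    B.det ≤ A.det := by
  have h1 : (A - B).PosSemidef := psd_of (by simp [pd_symm hA, pd_symm hB]) fun x => by
    simp [inner_sub_left]; exact h x
  have h2 := trace_mul_nonneg hA.inv.posSemidef h1
  rw [Matrix.mul_sub, Matrix.nonsing_inv_mul _ (isUnit_iff_ne_zero.2 hA.det_pos.ne'), trace_sub, trace_one] at h2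
  have h3 := trace_ge hA hB
  simp at h2
  have : Real.log (B.det / A.det) ≤ 0 := by linarith
  rw [Real.log_nonpos_iff (div_pos hB.det_pos hA.det_pos).le, div_le_one hA.det_pos] at this
  exact this

lemma quad_le_trace (hA : A.PosSemidef) (x : EE n) : ⟪TM A x, x⟫ ≤ A.trace * ‖x‖ ^ 2 := by
  have h : ((‖x‖ ^ 2) • (1 : MM n) - vv x x).PosSemidef := by
    refine psd_of (by simp [vv, Matrix.transpose_vecMulVec]) fun y => ?_
    simp only [TM_sub, TM_smul, TM_one, TM_vv, inner_sub_left, inner_smul_left, real_inner_self_eq_norm_sq]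
    have := real_inner_mul_inner_self_le x y
    simp only [real_inner_self_eq_norm_sq, conj_trivial] at this ⊢
    nlinarith
  have := trace_mul_nonneg hA h
  rw [Matrix.mul_sub, trace_sub, trace_mul_vv] at this
  simp at this; linarith

lemma normsq_TM_le (hA : A.PosSemidef) (x : EE n) : ‖TM A x‖ ^ 2 ≤ A.trace * ⟪TM A x, x⟫ := by
  obtain ⟨Q, hQ⟩ := psd_sqrt hA
  have e1 : ‖TM A x‖ ^ 2 = ⟪TM (Q * Qᵀ) (TM Q x), TM Q x⟫ := by
    rw [← real_inner_self_eq_norm_sq, hQ]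
    simp only [TM_mul]; rw [inner_TM (Q)]
  have e2 : ⟪TM A x, x⟫ = ‖TM Q x‖ ^ 2 := by
    rw [← real_inner_self_eq_norm_sq, hQ]; simp only [TM_mul]; rw [inner_TM, transpose_transpose]
  rw [e1, e2, hQ, Matrix.trace_mul_comm]
  exact quad_le_trace (by simpa [conjTranspose_eq_transpose_of_trivial] using posSemidef_self_mul_conjTranspose Q) _
end mat


def HG {n : ℕ} (u : EE n → ℝ) (G : EE n → EE n) : Prop := ∀ x, HasFDerivAt u (innerSL ℝ (G x)) x
def HJ {n : ℕ} (G : EE n → EE n) (A : EE n → MM n) : Prop := ∀ x, HasFDerivAt G (TM (A x)) x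

structure MAS {n : ℕ} (u : EE n → ℝ) (G : EE n → EE n) (A : EE n → MM n) : Prop where
  du : HG u G
  dG : HJ G A
  cA : Continuous A
  pA : ∀ x, (A x).PosDef

section basics
variable {n : ℕ} {u : EE n → ℝ} {G : EE n → EE n} {A : EE n → MM n}

lemma HG.cont (h : HG u G) : Continuous u := continuous_iff_continuousAt.2 fun x => (h x).continuousAt
lemma HJ.cont (h : HJ G A) : Continuous G := continuous_iff_continuousAt.2 fun x => (h x).continuousAt
lemma HG.line (h : HG u G) (x v : EE n) (t : ℝ) :
    HasDerivAt (fun t : ℝ => u (x + t • v)) ⟪G (x + t • v), v⟫ t := by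
  have h1 : HasDerivAt (fun t : ℝ => x + t • v) v t := by
    simpa using ((hasDerivAt_id t).smul_const v).const_add x
  exact (h (x + t • v)).comp_hasDerivAt t h1
lemma HJ.line (h : HJ G A) (x v : EE n) (t : ℝ) :
    HasDerivAt (fun t : ℝ => G (x + t • v)) (TM (A (x + t • v)) v) t := by
  have h1 : HasDerivAt (fun t : ℝ => x + t • v) v t := by
    simpa using ((hasDerivAt_id t).smul_const v).const_add x
  exact (h (x + t • v)).comp_hasDerivAt t h1
lemma HJ.line' (h : HJ G A) (x v w : EE n) (t : ℝ) :
    HasDerivAt (fun t : ℝ => ⟪G (x + t • v), w⟫) ⟪TM (A (x + t • v)) v, w⟫ t := by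
  simpa using (h.line x v t).inner ℝ (hasDerivAt_const t w)
lemma MAS.cu (h : MAS u G A) : Continuous u := h.du.cont
lemma MAS.cG (h : MAS u G A) : Continuous G := h.dG.cont
lemma MAS.dp (h : MAS u G A) (x : EE n) : 0 < (A x).det := (h.pA x).det_pos
lemma MAS.cg (h : MAS u G A) : Continuous fun x => (A x).det := h.cA.matrix_det
lemma MAS.cinv (h : MAS u G A) : Continuous fun x => (A x)⁻¹ := by
  have : (fun x => (A x)⁻¹) = fun x => (A x).det⁻¹ • (A x).adjugate := by
    ext1 x; rw [Matrix.inv_def, Ring.inverse_eq_inv']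
  rw [this]
  exact (h.cg.inv₀ fun x => (h.dp x).ne').smul h.cA.matrix_adjugate

lemma cont_TM {X : Type*} [TopologicalSpace X] {B : X → MM n} {f : X → EE n} (hB : Continuous B)
    (hf : Continuous f) : Continuous fun x => TM (B x) (f x) := by
  have : (fun x => TM (B x) (f x)) = fun x => WithLp.toLp 2 (B x *ᵥ (f x).ofLp) := by
    ext1 x; rw [← TM_ofLp]
  rw [this]
  exact (PiLp.continuous_toLp 2 _).comp (hB.matrix_mulVec ((PiLp.continuous_ofLp 2 _).comp hf))

lemma MAS.mono_ge (h : MAS u G A) {S : Set (EE n)} (hS : Convex ℝ S) {m : ℝ}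
    (hm : ∀ x ∈ S, ∀ v, m * ‖v‖ ^ 2 ≤ ⟪TM (A x) v, v⟫) {x y : EE n} (hx : x ∈ S) (hy : y ∈ S) :
    m * ‖x - y‖ ^ 2 ≤ ⟪G x - G y, x - y⟫ := by
  obtain ⟨c, hc, h1⟩ := exists_hasDerivAt_eq_slope (fun t : ℝ => ⟪G (y + t • (x - y)), x - y⟫) _ zero_lt_one
    (fun t _ => (h.dG.line' y (x - y) (x - y) t).continuousAt.continuousWithinAt)
    (fun t _ => h.dG.line' y (x - y) (x - y) t)
  have h2 := hm (y + c • (x - y)) (hS.add_smul_sub_mem hy hx ⟨hc.1.le, hc.2.le⟩) (x - y)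
  simp [-map_sub] at h1
  rw [h1] at h2
  rw [inner_sub_left]; linarith

lemma MAS.mono (h : MAS u G A) {x y : EE n} (hxy : x ≠ y) : 0 < ⟪G x - G y, x - y⟫ := by
  obtain ⟨c, hc, h1⟩ := exists_hasDerivAt_eq_slope (fun t : ℝ => ⟪G (y + t • (x - y)), x - y⟫) _ zero_lt_one
    (fun t _ => (h.dG.line' y (x - y) (x - y) t).continuousAt.continuousWithinAt)
    (fun t _ => h.dG.line' y (x - y) (x - y) t)
  have h2 := pd_pos (h.pA (y + c • (x - y))) (sub_ne_zero.2 hxy)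
  simp [-map_sub] at h1
  rw [h1] at h2
  rw [inner_sub_left]; linarith

lemma MAS.inj (h : MAS u G A) : Function.Injective G := fun x y hxy => by
  by_contra hne
  simpa [hxy] using h.mono hne

lemma MAS.conv (h : MAS u G A) (x y : EE n) : u x + ⟪G x, y - x⟫ ≤ u y := by
  rcases eq_or_ne y x with rfl | hxy
  · simp
  obtain ⟨c, hc, h1⟩ := exists_hasDerivAt_eq_slope (fun t : ℝ => u (x + t • (y - x))) _ zero_lt_one
    (fun t _ => (h.du.line x (y - x) t).continuousAt.continuousWithinAt)
    (fun t _ => h.du.line x (y - x) t)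
  simp at h1
  have hne : x + c • (y - x) ≠ x := by simp [sub_eq_zero, hxy, hc.1.ne']
  have h2 := h.mono hne
  simp only [add_sub_cancel_left, inner_smul_right, inner_sub_left] at h2
  nlinarith [(mul_pos_iff_of_pos_left hc.1).1 h2]

lemma deriv_int {F F' : ℝ → EE n → ℝ} {K : Set (EE n)} (hK : IsCompact K) {a b t0 : ℝ}
    (ht : t0 ∈ Ioo a b) (hF : ContinuousOn (Function.uncurry F) (Icc a b ×ˢ K))
    (hF' : ContinuousOn (Function.uncurry F') (Icc a b ×ˢ K))
    (hd : ∀ t ∈ Icc a b, ∀ x ∈ K, HasDerivAt (F · x) (F' t x) t) :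
    HasDerivAt (fun t => ∫ x in K, F t x) (∫ x in K, F' t0 x) t0 := by
  have sl : ∀ t ∈ Icc a b, ∀ H : ℝ → EE n → ℝ, ContinuousOn (Function.uncurry H) (Icc a b ×ˢ K) → ContinuousOn (H t) K :=
    fun t ht H hH => hH.comp (f := fun x => (t, x)) (by fun_prop) fun x hx => ⟨ht, hx⟩
  obtain ⟨C, hC⟩ := (isCompact_Icc.prod hK).exists_bound_of_continuousOn hF'
  refine (hasDerivAt_integral_of_dominated_loc_of_deriv_le (s := Icc a b) (bound := fun _ => C) (Icc_mem_nhds ht.1 ht.2)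
    ?_ ?_ ?_ ?_ ?_ ?_).2
  · filter_upwards [Icc_mem_nhds ht.1 ht.2] with t ht
    exact (sl t ht F hF).aestronglyMeasurable hK.measurableSet
  · exact (sl t0 ⟨ht.1.le, ht.2.le⟩ F hF).integrableOn_compact hK
  · exact (sl t0 ⟨ht.1.le, ht.2.le⟩ F' hF').aestronglyMeasurable hK.measurableSet
  · filter_upwards [ae_restrict_mem hK.measurableSet] with x hx t ht
    exact hC (t, x) ⟨ht, hx⟩
  · exact (continuousOn_const (c := C)).integrableOn_compact hK
  · filter_upwards [ae_restrict_mem hK.measurableSet] with x hx t ht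
    exact hd t ht x hx

lemma det_deriv_exists : ∃ D : MM n → MM n → ℝ → ℝ, Continuous (fun p : MM n × MM n × ℝ => D p.1 p.2.1 p.2.2) ∧
    ∀ A N t, HasDerivAt (fun t : ℝ => (A + t • N).det) (D A N t) t := by
  refine ⟨fun A N t => ∑ σ : Equiv.Perm (Fin n), ((Equiv.Perm.sign σ : ℤ) : ℝ) * ∑ i, (∏ j ∈ Finset.univ.erase i, (A + t • N) (σ j) j) • N (σ i) i, ?_, ?_⟩
  · refine continuous_finsetSum _ fun σ _ => Continuous.mul (M := ℝ) continuous_const (continuous_finsetSum _ fun i _ => ?_)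
    simp only [smul_eq_mul, Matrix.add_apply, Matrix.smul_apply]
    refine Continuous.mul (continuous_finsetProd _ fun j _ => ?_) ?_
    · have h1 : Continuous fun p : MM n × MM n × ℝ => p.1 (σ j) j := by fun_prop
      have h2 : Continuous fun p : MM n × MM n × ℝ => p.2.1 (σ j) j := by fun_prop
      exact h1.add ((continuous_snd.comp continuous_snd).mul h2)
    · have h2 : Continuous fun p : MM n × MM n × ℝ => p.2.1 (σ i) i := by fun_prop
      exact h2
  · intro A N t
    simp only [Matrix.det_apply']
    refine HasDerivAt.fun_sum fun σ _ => HasDerivAt.const_mul _ ?_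
    refine HasDerivAt.fun_finsetProd fun i _ => ?_
    simpa using ((hasDerivAt_id t).mul_const (N (σ i) i)).const_add (A (σ i) i)

lemma det_deriv_zero {A N : MM n} (hA : A.det ≠ 0) : HasDerivAt (fun t : ℝ => (A + t • N).det) (A.det * (A⁻¹ * N).trace) 0 := by
  have : (fun t : ℝ => (A + t • N).det) = fun t => A.det * (1 + (A⁻¹ * N).trace * t + (det (1 + (Polynomial.X : Polynomial ℝ) • (A⁻¹ * N).map Polynomial.C)).divX.divX.eval t * t ^ 2) := by
    ext t
    rw [← Matrix.det_one_add_smul, ← Matrix.det_mul, Matrix.mul_add, Matrix.mul_one, Matrix.mul_smul, ← Matrix.mul_assoc,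
      Matrix.mul_nonsing_inv _ (isUnit_iff_ne_zero.2 hA), Matrix.one_mul]
  rw [this]
  refine HasDerivAt.const_mul _ ?_
  have h1 := ((Polynomial.hasDerivAt (det (1 + (Polynomial.X : Polynomial ℝ) • (A⁻¹ * N).map Polynomial.C)).divX.divX (0:ℝ))).mul (hasDerivAt_pow 2 (0:ℝ))
  have h2 := (((hasDerivAt_id (0:ℝ)).const_mul (A⁻¹ * N).trace).const_add 1).add h1
  refine (h2.congr_deriv ?_)
  simp
end basics

section i0
variable {n : ℕ} {u : EE n → ℝ} {G : EE n → EE n} {A : EE n → MM n}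

lemma pd_lower {A : MM n} (hA : A.PosDef) (v : EE n) : ‖v‖ ^ 2 ≤ (A⁻¹).trace * ⟪TM A v, v⟫ := by
  have := normsq_TM_le hA.inv.posSemidef (TM A v)
  rwa [TM_inv' hA.det_pos, real_inner_comm] at this

lemma MAS.lower (h : MAS u G A) {K : Set (EE n)} (hK : IsCompact K) :
    ∃ m > 0, ∀ x ∈ K, ∀ v, m * ‖v‖ ^ 2 ≤ ⟪TM (A x) v, v⟫ := by
  obtain ⟨C, hC⟩ := hK.exists_bound_of_continuousOn (f := fun x => ((A x)⁻¹).trace) h.cinv.matrix_trace.continuousOn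
  refine ⟨(|C| + 1)⁻¹, by positivity, fun x hx v => ?_⟩
  rw [inv_mul_le_iff₀ (by positivity)]
  have h1 := hC x hx
  rw [Real.norm_eq_abs] at h1
  have h2 := pd_lower (h.pA x) v
  have h3 := psd_nonneg (h.pA x).posSemidef v
  nlinarith [le_abs_self ((A x)⁻¹).trace, le_abs_self C]

lemma HJ.zero_of {F : EE n → EE n} {N : EE n → MM n} (hF : HJ F N) {R : ℝ} (hR : ∀ x, R ≤ ‖x‖ → F x = 0)
    {x : EE n} (hx : R < ‖x‖) : N x = 0 := by
  have h1 : F =ᶠ[𝓝 x] fun _ => (0 : EE n) := by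
    filter_upwards [(isOpen_lt continuous_const continuous_norm).mem_nhds hx] with y hy
    exact hR y (le_of_lt hy)
  have h2 := (hF x).unique ((hasFDerivAt_const (0 : EE n) x).congr_of_eventuallyEq h1)
  exact TM_inj (h2.trans (by ext1 y; simp))

theorem I0 (h : MAS u G A) {F : EE n → EE n} {N : EE n → MM n} (hF : HJ F N) (cN : Continuous N) {R : ℝ}
    (hR : ∀ x, R ≤ ‖x‖ → F x = 0) : ∫ x, (A x).det * ((A x)⁻¹ * N x).trace = 0 := by
  set R1 := max R 0 + 1 with hR1
  have hRR : R < R1 := by linarith [le_max_left R 0]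
  set K := closedBall (0 : EE n) R1
  have hK : IsCompact K := isCompact_closedBall _ _
  have hKc : Convex ℝ K := convex_closedBall _ _
  obtain ⟨m, hm, hmK⟩ := h.lower hK
  obtain ⟨L, hL0, hL⟩ : ∃ L > 0, ∀ x ∈ K, ∀ y ∈ K, ‖F y - F x‖ ≤ L * ‖y - x‖ := by
    have cT : Continuous fun x => TM (N x) := by
      have : Continuous (Matrix.toEuclideanCLM (n := Fin n) (𝕜 := ℝ)) :=
        LinearMap.continuous_of_finiteDimensional (Matrix.toEuclideanCLM (n := Fin n) (𝕜 := ℝ)).toAlgEquiv.toLinearMap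
      exact this.comp cN
    obtain ⟨L, hL⟩ := hK.exists_bound_of_continuousOn cT.continuousOn
    refine ⟨|L| + 1, by positivity, fun x hx y hy => ?_⟩
    exact hKc.norm_image_sub_le_of_norm_hasFDerivWithin_le (f' := fun x => TM (N x)) (fun x hx => (hF x).hasFDerivWithinAt)
      (fun x hx => (hL x hx).trans (by linarith [le_abs_self L])) hx hy
  set Φ : ℝ → EE n → EE n := fun t x => G x + t • F x with hΦ
  have hmono : ∀ t : ℝ, |t| * L < m → ∀ x ∈ K, ∀ y ∈ K, ⟪Φ t x - Φ t y, x - y⟫ ≤ 0 → x = y := by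
    intro t ht x hx y hy hle
    have h1 := h.mono_ge hKc hmK hx hy
    have h2 : ‖⟪t • (F x - F y), x - y⟫‖ ≤ |t| * L * ‖x - y‖ ^ 2 := by
      refine (norm_inner_le_norm _ _).trans ?_
      rw [norm_smul, Real.norm_eq_abs]
      have := mul_le_mul_of_nonneg_left (hL y hy x hx) (abs_nonneg t)
      nlinarith [norm_nonneg (x - y)]
    have e : Φ t x - Φ t y = (G x - G y) + t • (F x - F y) := by simp only [hΦ, smul_sub]; abel
    rw [e, inner_add_left] at hle
    have h3 := neg_le_of_abs_le h2
    have h4 : ‖x - y‖ ^ 2 ≤ 0 := by nlinarith [sq_nonneg ‖x - y‖]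
    have : ‖x - y‖ = 0 := by nlinarith [norm_nonneg (x - y)]
    exact sub_eq_zero.1 (norm_eq_zero.1 this)
  have hincl : ∀ t : ℝ, |t| * L < m → Φ t '' K ⊆ G '' K := by
    rintro t ht _ ⟨x', hx', rfl⟩
    set y := Φ t x' with hy
    have cφ : Continuous fun x => u x - ⟪y, x⟫ := h.cu.sub (by fun_prop)
    obtain ⟨xs, hxs, hmin⟩ := hK.exists_isMinOn ⟨x', hx'⟩ cφ.continuousOn
    have hder : HasFDerivAt (fun x => u x - ⟪y, x⟫) (innerSL ℝ (G xs) - innerSL ℝ y) xs :=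
      (h.du xs).sub (innerSL ℝ y).hasFDerivAt
    rcases lt_or_ge ‖xs‖ R1 with hlt | hge
    · have h1 : IsLocalMin (fun x => u x - ⟪y, x⟫) xs :=
        hmin.isLocalMin (closedBall_mem_nhds_of_mem (by simpa using hlt))
      have h2 := h1.hasFDerivAt_eq_zero hder
      refine ⟨xs, hxs, ?_⟩
      rw [← map_sub] at h2
      have h3 := congrArg (fun l => l (G xs - y)) h2
      simpa [-map_sub, sub_eq_zero] using h3
    · have h1 : 0 ≤ (innerSL ℝ (G xs) - innerSL ℝ y) (x' - xs) :=
        (hmin.localize).hasFDerivWithinAt_nonneg hder.hasFDerivWithinAt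
          (sub_mem_posTangentConeAt_of_segment_subset (hKc.segment_subset hxs hx'))
      have h2 : Φ t xs = G xs := by simp [hΦ, hR xs (hRR.le.trans hge)]
      have : xs = x' := by
        refine hmono t ht xs hxs x' hx' ?_
        rw [h2, ← hy, ← neg_sub x' xs, inner_neg_right]
        simp only [ContinuousLinearMap.sub_apply, innerSL_apply_apply] at h1
        rw [inner_sub_left]; linarith
      refine ⟨xs, hxs, ?_⟩
      rw [← h2, this]
  -- areas
  have harea : ∀ t : ℝ, |t| * L < m → ∫⁻ x in K, ENNReal.ofReal |(A x + t • N x).det| = volume (Φ t '' K) := by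
    intro t ht
    have := lintegral_abs_det_fderiv_eq_addHaar_image volume (f := Φ t) (f' := fun x => TM (A x + t • N x)) hK.measurableSet
      (fun x hx => ?_) (fun x hx y hy hxy => hmono t ht x hx y hy (by simp [hxy]))
    · simpa only [TM_det] using this
    · have h1 : HasFDerivAt (Φ t) (TM (A x) + t • TM (N x)) x := (h.dG x).add ((hF x).const_smul t)
      have : TM (A x + t • N x) = TM (A x) + t • TM (N x) := by ext1 y; simp
      rw [this]; exact h1.hasFDerivWithinAt
  have cD : ∀ t : ℝ, Continuous fun x => (A x + t • N x).det := fun t => (h.cA.add (cN.const_smul t)).matrix_det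
  have hle : ∀ t : ℝ, |t| * L < m → ∫ x in K, (A x + t • N x).det ≤ ∫ x in K, (A x + (0:ℝ) • N x).det := by
    intro t ht
    have i1 : ∀ t : ℝ, IntegrableOn (fun x => (A x + t • N x).det) K := fun t => (cD t).continuousOn.integrableOn_compact hK
    calc _ ≤ ∫ x in K, |(A x + t • N x).det| := integral_mono (i1 t) (i1 t).abs fun x => le_abs_self _
      _ ≤ ∫ x in K, |(A x + (0:ℝ) • N x).det| := by
        rw [integral_eq_lintegral_of_nonneg_ae (.of_forall fun x => abs_nonneg _) (cD t).abs.aestronglyMeasurable,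
          integral_eq_lintegral_of_nonneg_ae (.of_forall fun x => abs_nonneg _) (cD 0).abs.aestronglyMeasurable,
          harea t ht, harea 0 (by simpa using hm)]
        refine ENNReal.toReal_mono ?_ (measure_mono ((hincl t ht).trans (by simp [hΦ])))
        have : Φ 0 = G := by ext1 x; simp [hΦ]
        rw [this]; exact (hK.image h.cG).measure_lt_top.ne
      _ = _ := by
        refine setIntegral_congr_fun hK.measurableSet fun x _ => ?_
        simp [abs_of_pos (h.dp x)]
  obtain ⟨D, cD', hD⟩ := det_deriv_exists (n := n)
  have hder := deriv_int (F := fun t x => (A x + t • N x).det) (F' := fun t x => D (A x) (N x) t) hK (a := -1) (b := 1) (t0 := 0)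
    (by norm_num) ?_ ?_ (fun t _ x _ => hD (A x) (N x) t)
  · have hmax : IsLocalMax (fun t : ℝ => ∫ x in K, (A x + t • N x).det) 0 := by
      have : ∀ᶠ t : ℝ in 𝓝 0, |t| * L < m := by
        have : Tendsto (fun t : ℝ => |t| * L) (𝓝 0) (𝓝 (|0| * L)) := by
          exact (continuous_abs.mul continuous_const).tendsto 0
        exact this.eventually (gt_mem_nhds (by simpa using hm))
      filter_upwards [this] with t ht using hle t ht
    have h0 := hmax.hasDerivAt_eq_zero hder
    rw [← h0, ← setIntegral_eq_integral_of_forall_compl_eq_zero (s := K)]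
    · refine setIntegral_congr_fun hK.measurableSet fun x _ => ?_
      exact (det_deriv_zero (h.dp x).ne').unique (hD _ _ _)
    · intro x hx
      rw [hF.zero_of hR (x := x) (hRR.trans (by simpa [K] using hx))]; simp
  · refine Continuous.continuousOn ?_
    exact ((h.cA.comp continuous_snd).add (continuous_fst.smul (cN.comp continuous_snd))).matrix_det
  · refine Continuous.continuousOn ?_
    exact cD'.comp ((h.cA.comp continuous_snd).prodMk ((cN.comp continuous_snd).prodMk continuous_fst))

/-- integration by parts -/
theorem I1 (h : MAS u G A) {V : EE n → EE n} {N : EE n → MM n} (hV : HJ V N) (cN : Continuous N)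
    {Ψ : EE n → ℝ} {p : EE n → EE n} (hΨ : HG Ψ p) (cp : Continuous p) {R : ℝ} (hR : ∀ x, R ≤ ‖x‖ → Ψ x = 0) :
    ∫ x, (A x).det * (Ψ x * ((A x)⁻¹ * N x).trace + ⟪TM (A x)⁻¹ (V x), p x⟫) = 0 := by
  have hF : HJ (fun x => Ψ x • V x) (fun x => Ψ x • N x + vv (V x) (p x)) := by
    intro x
    have := (hΨ x).smul (hV x)
    have e : TM (Ψ x • N x + vv (V x) (p x)) = Ψ x • TM (N x) + (innerSL ℝ (p x)).smulRight (V x) := by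
      ext1 y; simp [innerSL_apply_apply]
    show HasFDerivAt _ (TM _) x
    rw [e]; exact this
  have := I0 h hF ?_ (R := R) (fun x hx => by simp [hR x hx])
  · rw [← this]; congr 1; ext1 x
    simp [Matrix.mul_add, trace_mul_vv]
  · have : Continuous fun x => vv (V x) (p x) := by
      unfold vv
      refine Continuous.matrix_vecMulVec ?_ ?_
      · exact (PiLp.continuous_ofLp 2 _).comp hV.cont
      · exact (PiLp.continuous_ofLp 2 _).comp cp
    exact (hΨ.cont.smul cN).add this

lemma MAS_one : MAS (n := n) (fun x => ‖x‖ ^ 2 / 2) id (fun _ => 1) where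
  du x := by
    have := (hasStrictFDerivAt_norm_sq x).hasFDerivAt.const_mul (1/2 : ℝ)
    have e : innerSL ℝ (id x) = (1/2 : ℝ) • (2 • innerSL ℝ x) := by ext y; simp
    have e2 : (fun x : EE n => ‖x‖ ^ 2 / 2) = fun x => 1 / 2 * ‖x‖ ^ 2 := by ext y; ring
    rw [e2, e]; exact this
  dG x := by
    have e : TM (1 : MM n) = ContinuousLinearMap.id ℝ _ := by ext1 y; simp
    show HasFDerivAt _ (TM _) x
    rw [e]; exact hasFDerivAt_id x
  cA := continuous_const
  pA x := Matrix.PosDef.one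

theorem I2 {V : EE n → EE n} {N : EE n → MM n} (hV : HJ V N) (cN : Continuous N)
    {Ψ : EE n → ℝ} {p : EE n → EE n} (hΨ : HG Ψ p) (cp : Continuous p) {R : ℝ} (hR : ∀ x, R ≤ ‖x‖ → Ψ x = 0) :
    ∫ x, (Ψ x * (N x).trace + ⟪V x, p x⟫) = 0 := by
  simpa using I1 MAS_one hV cN hΨ cp hR
end i0


section calcu
variable {n : ℕ} {u w : EE n → ℝ} {G p q V W : EE n → EE n} {A N M : EE n → MM n}

lemma HG.of {u : EE n → ℝ} {p : EE n → EE n} {L : EE n → (EE n →L[ℝ] ℝ)} (h : ∀ x, HasFDerivAt u (L x) x)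
    (e : ∀ x y, L x y = ⟪p x, y⟫) : HG u p := fun x => by
  have : innerSL ℝ (p x) = L x := by ext y; simp [e]
  rw [this]; exact h x
lemma HJ.of {u : EE n → EE n} {N : EE n → MM n} {L : EE n → (EE n →L[ℝ] EE n)} (h : ∀ x, HasFDerivAt u (L x) x)
    (e : ∀ x y, L x y = TM (N x) y) : HJ u N := fun x => by
  have : TM (N x) = L x := by ext1 y; simp [e]
  show HasFDerivAt _ (TM _) x
  rw [this]; exact h x
lemma HG.add (h : HG u p) (k : HG w q) : HG (fun x => u x + w x) (fun x => p x + q x) :=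
  HG.of (fun x => (h x).add (k x)) (by intro x y; simp [inner_add_left])
lemma HG.sub (h : HG u p) (k : HG w q) : HG (fun x => u x - w x) (fun x => p x - q x) :=
  HG.of (fun x => (h x).sub (k x)) (by intro x y; simp [inner_sub_left])
lemma HG.cmul (h : HG u p) (c : ℝ) : HG (fun x => c * u x) (fun x => c • p x) :=
  HG.of (fun x => (h x).const_mul c) (by intro x y; simp [inner_smul_left])
lemma HG.cst (c : ℝ) : HG (fun _ : EE n => c) (fun _ => 0) :=
  HG.of (fun x => hasFDerivAt_const c x) (by intro x y; simp)
lemma HG.comp (h : HG u p) {φ φ' : ℝ → ℝ} (hφ : ∀ t, HasDerivAt φ (φ' t) t) :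
    HG (fun x => φ (u x)) (fun x => φ' (u x) • p x) :=
  HG.of (fun x => (hφ (u x)).comp_hasFDerivAt x (h x)) (by intro x y; simp [inner_smul_left])
lemma HG.inner (h : HJ V N) (k : HJ W M) :
    HG (fun x => ⟪V x, W x⟫) (fun x => TM (N x)ᵀ (W x) + TM (M x)ᵀ (V x)) :=
  HG.of (fun x => (h x).inner ℝ (k x)) (by
    intro x y
    simp only [inner_add_left, inner_TM, transpose_transpose, fderivInnerCLM_apply, ContinuousLinearMap.comp_apply, ContinuousLinearMap.prod_apply]
    rw [← inner_TM, real_inner_comm _ (W x), add_comm])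
lemma HJ.add (h : HJ V N) (k : HJ W M) : HJ (fun x => V x + W x) (fun x => N x + M x) :=
  HJ.of (fun x => (h x).add (k x)) (by intro x y; simp)
lemma HJ.sub (h : HJ V N) (k : HJ W M) : HJ (fun x => V x - W x) (fun x => N x - M x) :=
  HJ.of (fun x => (h x).sub (k x)) (by intro x y; simp)
lemma HJ.cmul (h : HJ V N) (c : ℝ) : HJ (fun x => c • V x) (fun x => c • N x) :=
  HJ.of (fun x => (h x).const_smul c) (by intro x y; simp)
lemma HJ.cst (c : EE n) : HJ (fun _ : EE n => c) (fun _ => 0) :=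
  HJ.of (fun x => hasFDerivAt_const c x) (by intro x y; simp)
lemma HJ.lin (B : MM n) : HJ (fun x => TM B x) (fun _ => B) := fun x => (TM B).hasFDerivAt
lemma HJ.idd : HJ (fun x : EE n => x) (fun _ => 1) := MAS_one.dG
lemma HJ.smul (h : HG u p) (k : HJ V N) : HJ (fun x => u x • V x) (fun x => u x • N x + vv (V x) (p x)) :=
  HJ.of (fun x => (h x).smul (k x)) (by intro x y; simp)
lemma HJ.comp (h : HJ V N) (k : HJ W M) : HJ (fun x => V (W x)) (fun x => N (W x) * M x) :=
  HJ.of (fun x => (h (W x)).comp x (k x)) (by intro x y; simp)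
lemma HG.compJ (h : HG u p) (k : HJ W M) : HG (fun x => u (W x)) (fun x => TM (M x)ᵀ (p (W x))) :=
  HG.of (fun x => (h (W x)).comp x (k x)) (by intro x y; simp [inner_TM])
lemma HG.lin (b : EE n) : HG (fun x => ⟪b, x⟫) (fun _ => b) :=
  HG.of (fun x => (innerSL ℝ b).hasFDerivAt) (by intro x y; simp)
lemma HG.quad {B : MM n} (hB : Bᵀ = B) : HG (fun x => ⟪TM B x, x⟫ / 2) (fun x => TM B x) := by
  have := (HG.inner (HJ.lin B) HJ.idd).cmul (1/2)
  have h := HG.of (p := fun x => TM B x) this (fun x y => by simp [hB, inner_add_left, inner_smul_left]; ring)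
  convert h using 2; ring
lemma contvv {X : Type*} [TopologicalSpace X] {V W : X → EE n} (h : Continuous V) (k : Continuous W) :
    Continuous fun x => vv (V x) (W x) := by
  unfold vv
  exact Continuous.matrix_vecMulVec ((PiLp.continuous_ofLp 2 _).comp h) ((PiLp.continuous_ofLp 2 _).comp k)

/-- second order necessary condition -/
lemma HG.min (h : HG u p) (k : HJ p N) (cN : Continuous N) {x : EE n} (hx : IsLocalMin u x) :
    p x = 0 ∧ ∀ v, 0 ≤ ⟪TM (N x) v, v⟫ := by
  have h0 : p x = 0 := by
    have := hx.hasFDerivAt_eq_zero (h x)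
    have e : innerSL ℝ (p x) (p x) = 0 := by rw [this]; rfl
    simpa using e
  refine ⟨h0, fun v => ?_⟩
  by_contra! hv
  have c1 : Continuous fun t : ℝ => ⟪TM (N (x + t • v)) v, v⟫ :=
    (cont_TM (cN.comp (by fun_prop)) continuous_const).inner continuous_const
  have e1 : ∀ᶠ t : ℝ in 𝓝 0, ⟪TM (N (x + t • v)) v, v⟫ < 0 :=
    c1.continuousAt.eventually (gt_mem_nhds (by simpa using hv))
  have e2 : ∀ᶠ t : ℝ in 𝓝 0, u x ≤ u (x + t • v) := by
    have c2 : Tendsto (fun t : ℝ => x + t • v) (𝓝 0) (𝓝 x) := by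
      have : Continuous fun t : ℝ => x + t • v := by fun_prop
      simpa using this.tendsto 0
    exact c2.eventually hx
  obtain ⟨ε, hε, hh⟩ := Metric.eventually_nhds_iff.1 (e1.and e2)
  have key : ∀ t ∈ Ioo 0 ε, ⟪p (x + t • v), v⟫ < 0 := by
    intro t ht
    have : StrictAntiOn (fun t : ℝ => ⟪p (x + t • v), v⟫) (Icc 0 t) := by
      refine strictAntiOn_of_deriv_neg (convex_Icc _ _) ?_ ?_
      · exact fun s _ => (k.line' x v v s).continuousAt.continuousWithinAt
      · intro s hs
        rw [interior_Icc] at hs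
        rw [(k.line' x v v s).deriv]
        exact (hh (by rw [Real.dist_eq, sub_zero, abs_of_pos hs.1]; linarith [hs.2, ht.2])).1
    have := this (left_mem_Icc.2 ht.1.le) (right_mem_Icc.2 ht.1.le) ht.1
    simpa [h0] using this
  have : StrictAntiOn (fun t : ℝ => u (x + t • v)) (Icc 0 (ε/2)) := by
    refine strictAntiOn_of_deriv_neg (convex_Icc _ _) ?_ ?_
    · exact fun s _ => (h.line x v s).continuousAt.continuousWithinAt
    · intro s hs
      rw [interior_Icc] at hs
      rw [(h.line x v s).deriv]
      exact key s ⟨hs.1, by linarith [hs.2]⟩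
  have h3 := this (left_mem_Icc.2 (by linarith)) (right_mem_Icc.2 (by linarith)) (half_pos hε)
  have h4 := (hh (y := ε/2) (by rw [Real.dist_eq, sub_zero, abs_of_pos (half_pos hε)]; linarith)).2
  simp at h3; linarith

lemma MAS.aff (h : MAS u G A) {κ : ℝ} (hκ : 0 < κ) {P : MM n} (hP : P.det ≠ 0) (x0 b : EE n) (c : ℝ) :
    MAS (fun x => κ * u (x0 + TM P x) - ⟪b, x⟫ - c) (fun x => κ • TM Pᵀ (G (x0 + TM P x)) - b)
      (fun x => κ • (Pᵀ * A (x0 + TM P x) * P)) := by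
  have k0 : HJ (fun x => x0 + TM P x) (fun _ => P) := by simpa using (HJ.cst x0).add (HJ.lin P)
  have ca : Continuous fun x => A (x0 + TM P x) := h.cA.comp k0.cont
  constructor
  · simpa using (((h.du.compJ k0).cmul κ).sub (HG.lin b)).sub (HG.cst c)
  · simpa [Matrix.mul_assoc] using (((HJ.lin Pᵀ).comp (h.dG.comp k0)).cmul κ).sub (HJ.cst b)
  · exact ((continuous_const.mul ca).mul continuous_const).const_smul κ
  · exact fun x => (pd_congr (h.pA _) hP).smul hκ

lemma det_aff (κ : ℝ) (P A : MM n) : (κ • (Pᵀ * A * P)).det = κ ^ n * P.det ^ 2 * A.det := by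
  simp [det_smul, det_mul]; ring

lemma det_rank1 {a b : ℝ} (ha : a ≠ 0) {ν : EE n} (hν : ‖ν‖ = 1) (hn : n ≠ 0) :
    (a • (1 : MM n) + b • vv ν ν).det = a ^ (n-1) * (a + b) := by
  have e : (a • (1 : MM n) + b • vv ν ν) = a • (1 + vv ((b/a) • ν) ν) := by
    rw [smul_add]; congr 1
    unfold vv; ext i j; simp [vecMulVec_apply]; field_simp
  have e2 : ν.ofLp ⬝ᵥ ((b/a) • ν).ofLp = b / a := by
    rw [← inner_vec]; simp [inner_smul_left, inner_smul_right, hν]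
  rw [e, det_smul, vv, vecMulVec_eq Unit, det_one_add_replicateCol_mul_replicateRow, e2]
  obtain ⟨m, rfl⟩ := Nat.exists_eq_succ_of_ne_zero hn
  simp [pow_succ]; field_simp
end calcu


structure MZ {n : ℕ} (lam Lam : ℝ) (u : EE n → ℝ) (G : EE n → EE n) (A : EE n → MM n) : Prop extends MAS u G A where
  lo : ∀ x, lam ≤ (A x).det
  hi : ∀ x, (A x).det ≤ Lam
  u0 : u 0 = 0
  G0 : G 0 = 0

section normal
variable {n : ℕ} {u : EE n → ℝ} {G : EE n → EE n} {A : EE n → MM n} {lam Lam : ℝ}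

lemma MZ.nonneg (h : MZ lam Lam u G A) (x : EE n) : 0 ≤ u x := by
  have := h.conv 0 x; simpa [h.u0, h.G0] using this
lemma MZ.le_z (h : MZ lam Lam u G A) (x : EE n) : u x ≤ ⟪x, G x⟫ := by
  have := h.conv x 0; rw [h.u0, zero_sub, inner_neg_right, real_inner_comm] at this; linarith
lemma MZ.pos (h : MZ lam Lam u G A) {x : EE n} (hx : x ≠ 0) : 0 < u x := by
  refine lt_of_le_of_ne (h.nonneg x) fun e => hx ?_
  have : IsLocalMin u x := Eventually.of_forall fun y => by rw [← e]; exact h.nonneg y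
  exact h.inj (((h.du.min h.dG h.cA this).1).trans h.G0.symm)
lemma MZ.scale (h : MZ lam Lam u G A) (x : EE n) {s : ℝ} (h0 : 0 ≤ s) (h1 : s ≤ 1) : u (s • x) ≤ s * u x := by
  have a := h.conv (s • x) x
  have b := h.conv (s • x) 0
  have e : x - s • x = (1 - s) • x := by module
  rw [e, inner_smul_right] at a
  rw [h.u0, zero_sub, inner_neg_right, inner_smul_right] at b
  nlinarith [mul_le_mul_of_nonneg_left a h0, mul_le_mul_of_nonneg_left b (sub_nonneg.2 h1)]
lemma MZ.scale' (h : MZ lam Lam u G A) (x : EE n) {s : ℝ} (h1 : 1 ≤ s) : s * u x ≤ u (s • x) := by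
  have := h.scale (s • x) (s := s⁻¹) (by positivity) (inv_le_one_of_one_le₀ h1)
  rw [smul_smul, inv_mul_cancel₀ (by positivity), one_smul] at this
  rwa [inv_mul_eq_div, le_div_iff₀' (by positivity)] at this
lemma MZ.coer (h : MZ lam Lam u G A) : ∃ m > 0, ∀ x, 1 ≤ ‖x‖ → m * ‖x‖ ≤ u x := by
  have key : ∃ m > 0, ∀ x, ‖x‖ = 1 → m ≤ u x := by
    rcases (sphere (0 : EE n) 1).eq_empty_or_nonempty with he | he
    · refine ⟨1, one_pos, fun x hx => ?_⟩
      have : x ∈ sphere (0 : EE n) 1 := by simpa using hx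
      simp [he] at this
    · obtain ⟨y, hy, hm⟩ := (isCompact_sphere (0 : EE n) 1).exists_isMinOn he h.cu.continuousOn
      refine ⟨u y, h.pos ?_, fun x hx => hm (by simpa using hx)⟩
      rintro rfl; simp at hy
  obtain ⟨m, hm, hh⟩ := key
  refine ⟨m, hm, fun x hx => ?_⟩
  have h1 := hh (‖x‖⁻¹ • x) (by rw [norm_smul]; simp; field_simp)
  have h2 := h.scale' (‖x‖⁻¹ • x) hx
  rw [smul_smul, mul_inv_cancel₀ (by positivity), one_smul] at h2
  nlinarith
lemma MZ.cpt (h : MZ lam Lam u G A) (t : ℝ) : IsCompact {x | u x ≤ t} := by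
  obtain ⟨m, hm, hh⟩ := h.coer
  refine Metric.isCompact_of_isClosed_isBounded (isClosed_le h.cu continuous_const) ?_
  refine (isBounded_closedBall (x := (0 : EE n)) (r := max 1 (t/m))).subset fun x hx => ?_
  simp only [mem_closedBall, dist_zero_right, le_max_iff]
  by_contra! hc
  have := hh x hc.1.le
  have h3 := (div_lt_iff₀ hm).1 hc.2
  simp only [mem_ofPred_eq] at hx; linarith

lemma TM_col (p : Fin n → EE n) (j : Fin n) : TM (Matrix.of fun i j => p j i) (EuclideanSpace.single j 1) = p j := by
  ext i; rw [TM_ofLp]; simp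
lemma TM_single_sum (x : EE n) : x = ∑ i, x i • EuclideanSpace.single i (1 : ℝ) := by
  ext j
  rw [WithLp.ofLp_sum, Finset.sum_apply]
  simp [Pi.single_apply]

lemma john {S : Set (EE n)} (hS : IsCompact S) {r : ℝ} (hr : 0 < r) (hb : closedBall 0 r ⊆ S) :
    ∃ P : MM n, P.det ≠ 0 ∧ (∀ i, TM P (EuclideanSpace.single i 1) ∈ S) ∧ ∀ c, TM P c ∈ S → ∀ i, |c i| ≤ 1 := by
  set M : (Fin n → EE n) → MM n := fun p => Matrix.of fun i j => p j i with hM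
  have cM : Continuous M := by
    refine continuous_matrix fun i j => ?_
    exact ((continuous_apply i).comp ((PiLp.continuous_ofLp 2 _).comp (continuous_apply j)))
  have hK : IsCompact (Set.pi univ fun _ : Fin n => S) := isCompact_univ_pi fun _ => hS
  have hq : (fun i : Fin n => r • EuclideanSpace.single i (1:ℝ)) ∈ (Set.pi univ fun _ : Fin n => S) := by
    intro i _; refine hb ?_; simp [norm_smul, abs_of_pos hr]
  obtain ⟨p, hp, hmax⟩ := hK.exists_isMaxOn ⟨_, hq⟩ (f := fun p => |(M p).det|) (cM.matrix_det.abs.continuousOn)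
  have hd : (M p).det ≠ 0 := by
    have h1 : |(M fun i : Fin n => r • EuclideanSpace.single i (1:ℝ)).det| ≤ |(M p).det| := hmax hq
    have h2 : (M fun i : Fin n => r • EuclideanSpace.single i (1:ℝ)) = r • (1 : MM n) := by
      ext i j; simp [hM, Matrix.one_apply, Pi.single_apply]
    rw [h2, det_smul, det_one, mul_one] at h1
    have : 0 < |r ^ Fintype.card (Fin n)| := by positivity
    exact abs_pos.1 (this.trans_le h1)
  refine ⟨M p, hd, fun i => by rw [TM_col]; exact hp i trivial, fun c hc i => ?_⟩
  have h1 : |(M (Function.update p i (TM (M p) c))).det| ≤ |(M p).det| := by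
    refine hmax (a := Function.update p i (TM (M p) c)) ?_
    intro j _
    by_cases hj : j = i
    · subst hj; simpa using hc
    · simpa [hj] using hp j trivial
  have h2 : M (Function.update p i (TM (M p) c)) = (M p).updateCol i (M p *ᵥ c.ofLp) := by
    ext a b
    by_cases hb : b = i
    · subst hb; simp [hM, ← TM_ofLp]
    · simp [hM, hb]
  have h3 := congrFun (Matrix.mulVec_cramer (M p) (M p *ᵥ c.ofLp)) 
  have h4 : cramer (M p) (M p *ᵥ c.ofLp) = (M p).det • c.ofLp := by
    rw [cramer_eq_adjugate_mulVec, mulVec_mulVec, adjugate_mul, smul_mulVec, one_mulVec]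
  have h5 := congrFun h4 i
  rw [cramer_apply] at h5
  rw [h2, h5] at h1
  simp only [Pi.smul_apply, smul_eq_mul, abs_mul] at h1
  have := abs_pos.2 hd
  nlinarith

variable (n lam Lam)
/-- normalized at height h -/
structure NZ (u : EE n → ℝ) (G : EE n → EE n) (A : EE n → MM n) (h : ℝ) : Prop extends MZ lam Lam u G A where
  hp : 0 < h
  he : ∀ i, u (EuclideanSpace.single i 1) ≤ h
  hb : ∀ x, u x ≤ h → ‖x‖ ≤ √n
variable {n lam Lam}

lemma cmp_min {h : ℝ} (hu : MZ lam Lam u G A) {B : MM n} (hB : Bᵀ = B) (hBp : ∀ x ≠ 0, 0 < ⟪TM B x, x⟫) (hBd : Lam < B.det) (b : EE n) (c : ℝ)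
    (hbd : ∀ x, u x = h → ⟪TM B x, x⟫/2 + ⟪b, x⟫ + c ≤ h) (x : EE n) (hx : u x ≤ h) :
    ⟪TM B x, x⟫/2 + ⟪b, x⟫ + c ≤ u x := by
  have k1 : HG (fun x => u x - (⟪TM B x, x⟫/2 + ⟪b, x⟫ + c)) (fun x => G x - (TM B x + b)) := by
    simpa using hu.du.sub (((HG.quad hB).add (HG.lin b)).add (HG.cst c))
  have k2 : HJ (fun x => G x - (TM B x + b)) (fun x => A x - B) := by
    simpa using hu.dG.sub ((HJ.lin B).add (HJ.cst b))
  obtain ⟨y, hy, hm⟩ := (hu.cpt h).exists_isMinOn ⟨x, hx⟩ k1.cont.continuousOn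
  have hxy := hm hx
  simp only [mem_ofPred_eq] at hxy hy
  rcases hy.lt_or_eq with hlt | heq
  · exfalso
    have loc : IsLocalMin (fun x => u x - (⟪TM B x, x⟫/2 + ⟪b, x⟫ + c)) y := by
      refine hm.isLocalMin ?_
      exact mem_of_superset ((isOpen_lt hu.cu continuous_const).mem_nhds hlt) fun z hz => by
        simp only [mem_ofPred_eq] at hz ⊢; exact hz.le
    have := (k1.min k2 (hu.cA.sub continuous_const) loc).2
    have := det_mono (hu.pA y) (pd_of hB hBp) fun v => by
      have := this v
      simp only [TM_sub, inner_sub_left] at this; linarith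
    linarith [hu.hi y]
  · have := hbd y heq; linarith

lemma nz_low (hn : 1 ≤ n) (hl : 0 < lam) : ∃ hm > 0, ∀ (Lam : ℝ) u G A h, NZ n lam Lam u G A h → hm ≤ h := by
  set κ := min lam 1 / 2 with hκ
  have hκ0 : 0 < κ := by positivity
  have hκ1 : κ < 1 := by have := min_le_right lam 1; linarith
  have hκl : κ < lam := by have := min_le_left lam 1; linarith
  have hκn : κ ^ n < lam := (pow_le_of_le_one hκ0.le hκ1.le (by omega)).trans_lt hκl
  set r : ℝ := 1 / (2 * n) with hr
  have hn' : (1:ℝ) ≤ n := by exact_mod_cast hn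
  have hr0 : 0 < r := by positivity
  refine ⟨κ * r ^ 2 / 2, by positivity, fun Lam u G A h hu => ?_⟩
  set c : EE n := WithLp.toLp 2 fun _ => r with hc
  have hball : ∀ x ∈ closedBall c r, u x ≤ h := by
    intro x hx
    have hxi : ∀ i, 0 ≤ x i ∧ x i ≤ 1 / n := by
      intro i
      have h1 : |x i - r| ≤ r := by
        have := PiLp.norm_apply_le (x - c) i
        simp only [mem_closedBall, dist_eq_norm] at hx
        simpa [hc] using this.trans hx
      rw [abs_le] at h1
      have : (1:ℝ)/n = r + r := by rw [hr]; field_simp; ring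
      constructor <;> linarith only [h1, this]
    have hsum : ∑ i, x i ≤ 1 := by
      calc ∑ i, x i ≤ ∑ i : Fin n, (1:ℝ)/n := Finset.sum_le_sum fun i _ => (hxi i).2
        _ = 1 := by simp; field_simp
    have a : ∑ i, x i * (u x + ⟪G x, EuclideanSpace.single i 1 - x⟫) ≤ ∑ i, x i * h :=
      Finset.sum_le_sum fun i _ => mul_le_mul_of_nonneg_left ((hu.conv x _).trans (hu.he i)) (hxi i).1
    have b := hu.conv x 0
    rw [hu.u0, zero_sub, inner_neg_right] at b
    have e : ⟪G x, x⟫ = ∑ i, x i * ⟪G x, EuclideanSpace.single i 1⟫ := by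
      conv_lhs => rw [TM_single_sum x, inner_sum]
      simp only [inner_smul_right, ← TM_single_sum x]
    simp only [inner_sub_right, mul_add, mul_sub, Finset.sum_add_distrib, Finset.sum_sub_distrib, ← Finset.sum_mul] at a
    rw [← e] at a
    have := hu.hp
    nlinarith
  have hBs : (κ • (1 : MM n))ᵀ = κ • 1 := by simp
  have k1 : HG (fun x => (⟪TM (κ • (1:MM n)) x, x⟫/2 + ⟪-κ • c, x⟫) - u x) (fun x => (TM (κ • (1:MM n)) x + -κ • c) - G x) :=
    ((HG.quad hBs).add (HG.lin _)).sub hu.du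
  have k2 : HJ (fun x => (TM (κ • (1:MM n)) x + -κ • c) - G x) (fun x => κ • 1 - A x) := by
    simpa using ((HJ.lin (κ • (1:MM n))).add (HJ.cst (-κ • c))).sub hu.dG
  have hq : ∀ x : EE n, ⟪TM (κ • (1:MM n)) x, x⟫/2 + ⟪-κ • c, x⟫ = κ/2 * ‖x - c‖^2 - κ/2*‖c‖^2 := by
    intro x; rw [norm_sub_sq_real]; simp [inner_smul_left, real_inner_comm]; ring
  obtain ⟨y, hy, hm⟩ := (isCompact_closedBall c r).exists_isMinOn ⟨c, mem_closedBall_self hr0.le⟩ k1.cont.continuousOn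
  have h0 := hm (mem_closedBall_self (x := c) hr0.le)
  simp only [mem_ofPred_eq, hq, mem_closedBall, dist_eq_norm] at h0 hy
  simp only [sub_self, norm_zero] at h0
  have uc := hu.nonneg c
  rcases hy.lt_or_eq with hlt | heq
  · exfalso
    have loc := hm.isLocalMin (mem_of_superset (isOpen_ball.mem_nhds (by simpa [dist_eq_norm] using hlt : y ∈ ball c r)) ball_subset_closedBall)
    have := (k1.min k2 (continuous_const.sub hu.cA) loc).2
    have := det_mono (Matrix.PosDef.one.smul hκ0) (hu.pA y) fun v => by
      have := this v
      simp only [TM_sub, inner_sub_left] at this; linarith only [this]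
    simp [det_smul] at this
    linarith only [hκn, this, hu.lo y]
  · have := hball y (by simp [dist_eq_norm, heq])
    rw [heq] at h0
    linarith only [h0, uc, this]

lemma nz_up (hn : 1 ≤ n) : ∃ hM > 0, ∀ (lam : ℝ) u G A h, NZ n lam Lam u G A h → h ≤ hM := by
  set κ := max Lam 1 + 1 with hκ
  have hκ1 : 1 ≤ κ := by have := le_max_right Lam 1; linarith
  have hκl : Lam < κ := by have := le_max_left Lam 1; linarith
  have hκn : Lam < κ ^ n := hκl.trans_le (le_self_pow₀ hκ1 (by omega))
  have hn' : (1:ℝ) ≤ n := by exact_mod_cast hn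
  refine ⟨κ * n / 2, by positivity, fun lam u G A h hu => ?_⟩
  have := cmp_min (h := h) hu.toMZ (B := κ • 1) (by simp) (fun x hx => by
      simp [inner_smul_left]; positivity) (by simpa [det_smul] using hκn) 0 (h - κ * n / 2) (fun x hx => ?_) 0 (by rw [hu.u0]; exact hu.hp.le)
  · simp [hu.u0] at this; linarith
  · have := hu.hb x hx.le
    have : ‖x‖ ^ 2 ≤ n := by
      have := pow_le_pow_left₀ (norm_nonneg x) this 2
      rwa [Real.sq_sqrt (by positivity)] at this
    simp [inner_smul_left]; nlinarith

lemma nz_bar (hn : 1 ≤ n) (hl : 0 < lam) : ∃ s0 > 0, s0 ≤ 1 ∧ ∀ u G A h, NZ n lam Lam u G A h →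
    ∀ x y, u x ≤ h / 2 → ‖y - x‖ < s0 → u y < h := by
  obtain ⟨hm, hm0, hlow⟩ := nz_low hn hl
  have hn' : (1:ℝ) ≤ n := by exact_mod_cast hn
  set τ := hm / (8 * n) with hτ
  have hτ0 : 0 < τ := by positivity
  set β := (|Lam| + 1) / (2 * τ) ^ (n - 1) with hβ
  have hβ0 : 0 < β := by positivity
  set L := 2 * √n + 1 with hL
  have hL0 : 0 < L := by positivity
  have hdet : ∀ ν : EE n, ‖ν‖ = 1 → Lam < ((2 * τ) • (1 : MM n) + (2 * β) • vv ν ν).det := by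
    intro ν hν
    rw [det_rank1 (by positivity) hν (by omega), mul_add]
    have h1 : (2 * τ) ^ (n-1) * (2 * β) = 2 * (|Lam| + 1) := by rw [hβ]; field_simp
    have h2 : 0 < (2 * τ) ^ (n-1) * (2 * τ) := by positivity
    have := le_abs_self Lam
    have := abs_nonneg Lam
    linarith
  refine ⟨min 1 (hm / (4 * β * L)), by positivity, min_le_left _ _, fun u G A h hu x y hx hxy => ?_⟩
  have hxy1 := hxy.trans_le (min_le_left _ _)
  have hxy2 := hxy.trans_le (min_le_right _ _)
  have hh := hlow _ _ _ _ _ hu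
  by_contra! hy
  have hy0 : y ≠ 0 := by rintro rfl; rw [hu.u0] at hy; linarith only [hy, hu.hp]
  have hG : G y ≠ 0 := fun e => hy0 (hu.inj (e.trans hu.G0.symm))
  set ν := ‖G y‖⁻¹ • G y with hν
  have hν1 : ‖ν‖ = 1 := by rw [hν, norm_smul]; simp; field_simp
  have hs : ∀ z, u z ≤ h → 0 ≤ ⟪ν, y - z⟫ := by
    intro z hz
    have := hu.conv y z
    have e : ⟪ν, y - z⟫ = - (‖G y‖⁻¹ * ⟪G y, z - y⟫) := by
      rw [hν, inner_smul_left, ← neg_sub z y, inner_neg_right]; simp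
    rw [e]
    have : ‖G y‖⁻¹ * ⟪G y, z - y⟫ ≤ 0 := mul_nonpos_of_nonneg_of_nonpos (by positivity) (by linarith only [hy, hz, this])
    linarith only [this]
  have hsL : ∀ z, u z ≤ h → ⟪ν, y - z⟫ ≤ L := by
    intro z hz
    have h1 := real_inner_le_norm ν (y - z)
    have h2 : y - z = (y - x) + (x - z) := by abel
    have h3 : ‖y - z‖ ≤ ‖y - x‖ + ‖x - z‖ := by rw [h2]; exact norm_add_le _ _
    have h4 := norm_sub_le x z
    have h5 := hu.hb x (by linarith only [hx, hu.hp])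
    have h6 := hu.hb z hz
    rw [hν1, one_mul] at h1
    linarith only [hxy1, h1, h3, h4, h5, h6]
  set a := ⟪ν, y⟫ with ha
  have hq : ∀ z : EE n, ⟪TM ((2 * τ) • (1 : MM n) + (2 * β) • vv ν ν) z, z⟫ / 2 + ⟪(β * (L - 2 * a)) • ν, z⟫ + (h - τ * n - β * (L * a - a ^ 2))
      = h + τ * (‖z‖ ^ 2 - n) - β * (⟪ν, y - z⟫ * (L - ⟪ν, y - z⟫)) := by
    intro z
    rw [inner_sub_right, ← ha]
    simp [inner_add_left, inner_smul_left]; ring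
  have := cmp_min (h := h) hu.toMZ (B := (2 * τ) • (1 : MM n) + (2 * β) • vv ν ν) (by
      simp [vv]) (fun z hz => by
      have : 0 < ‖z‖ := norm_pos_iff.2 hz
      simp [inner_smul_left, inner_add_left]
      have := mul_self_nonneg ⟪ν, z⟫
      positivity) (hdet ν hν1) ((β * (L - 2 * a)) • ν) (h - τ * n - β * (L * a - a ^ 2)) (fun z hz => ?_) x (by linarith only [hx, hu.hp])
  · rw [hq] at this
    have h1 := hs x (by linarith only [hx, hu.hp])
    have h2 := real_inner_le_norm ν (y - x)
    rw [hν1, one_mul] at h2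
    have h3 : β * (⟪ν, y - x⟫ * (L - ⟪ν, y - x⟫)) ≤ β * (‖y - x‖ * L) := by
      refine mul_le_mul_of_nonneg_left ?_ hβ0.le
      nlinarith [norm_nonneg (y - x)]
    have h4 : β * (‖y - x‖ * L) < hm / 4 := by
      rw [lt_div_iff₀ (by positivity)] at hxy2; linarith only [hxy2]
    have h5 : τ * n = hm / 8 := by rw [hτ]; field_simp
    have h6 : 0 ≤ τ * ‖x‖ ^ 2 := by positivity
    linarith
  · rw [hq]
    have h1 : ‖z‖ ^ 2 ≤ n := by
      have := pow_le_pow_left₀ (norm_nonneg z) (hu.hb z hz.le) 2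
      rwa [Real.sq_sqrt (by positivity)] at this
    have h2 := mul_nonneg (hs z hz.le) (sub_nonneg.2 (hsL z hz.le))
    have := mul_nonneg hβ0.le h2
    nlinarith

/-- affine renormalization -/
noncomputable def nu (P : MM n) (u : EE n → ℝ) : EE n → ℝ := fun x => |P.det| ^ (-2 / (n:ℝ)) * u (TM P x)
noncomputable def nG (P : MM n) (G : EE n → EE n) : EE n → EE n := fun x => |P.det| ^ (-2 / (n:ℝ)) • TM Pᵀ (G (TM P x))
noncomputable def nA (P : MM n) (A : EE n → MM n) : EE n → MM n := fun x => |P.det| ^ (-2 / (n:ℝ)) • (Pᵀ * A (TM P x) * P)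

lemma kpow (hn : 1 ≤ n) {d : ℝ} (hd : d ≠ 0) : (|d| ^ (-2 / (n:ℝ))) ^ n * d ^ 2 = 1 := by
  have hn' : (n:ℝ) ≠ 0 := by positivity
  rw [← Real.rpow_natCast, ← Real.rpow_mul (abs_nonneg _), div_mul_cancel₀ _ hn', ← sq_abs d,
    ← Real.rpow_natCast |d| 2, ← Real.rpow_add (abs_pos.2 hd)]
  norm_num

lemma nA_det (hn : 1 ≤ n) {P : MM n} (hP : P.det ≠ 0) (A : EE n → MM n) (x : EE n) :
    (nA P A x).det = (A (TM P x)).det := by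
  rw [nA, det_aff, kpow hn hP, one_mul]

lemma MZ.norm (hn : 1 ≤ n) {P : MM n} (hP : P.det ≠ 0) (h : MZ lam Lam u G A) : MZ lam Lam (nu P u) (nG P G) (nA P A) := by
  have := h.toMAS.aff (κ := |P.det| ^ (-2 / (n:ℝ))) (by positivity) hP 0 0 0
  refine { toMAS := ?_, lo := ?_, hi := ?_, u0 := ?_, G0 := ?_ }
  · unfold nu nG nA; simpa using this
  · intro x; rw [nA_det hn hP]; exact h.lo _
  · intro x; rw [nA_det hn hP]; exact h.hi _
  · simp [nu, h.u0]
  · simp [nG, h.G0]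

lemma MZ.exN (hn : 1 ≤ n) (h : MZ lam Lam u G A) {t : ℝ} (ht : 0 < t) :
    ∃ P : MM n, P.det ≠ 0 ∧ NZ n lam Lam (nu P u) (nG P G) (nA P A) (|P.det| ^ (-2 / (n:ℝ)) * t) ∧
      ∀ c, u (TM P c) ≤ t → ∀ i, |c i| ≤ 1 := by
  have : {x | u x < t} ∈ 𝓝 (0 : EE n) := (isOpen_lt h.cu continuous_const).mem_nhds (by simpa [h.u0] using ht)
  obtain ⟨r, hr, hb⟩ := Metric.nhds_basis_closedBall.mem_iff.1 this
  obtain ⟨P, hP, h1, h2⟩ := john (h.cpt t) hr (hb.trans fun x hx => by simp only [mem_ofPred_eq] at hx ⊢; exact hx.le)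
  simp only [mem_ofPred_eq] at h1 h2
  have hk : 0 < |P.det| ^ (-2 / (n:ℝ)) := by positivity
  refine ⟨P, hP, { toMZ := h.norm hn hP, hp := by positivity, he := fun i => ?_, hb := fun x hx => ?_ }, h2⟩
  · exact mul_le_mul_of_nonneg_left (h1 i) hk.le
  · have := h2 x (le_of_mul_le_mul_left hx hk)
    rw [EuclideanSpace.norm_eq]
    refine Real.sqrt_le_sqrt ?_
    calc ∑ i, ‖x i‖ ^ 2 ≤ ∑ i : Fin n, (1:ℝ) := Finset.sum_le_sum fun i _ => by
          rw [Real.norm_eq_abs]; exact pow_le_one₀ (abs_nonneg _) (this i)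
      _ = n := by simp

/-- doubling -/
lemma mz_doub (hn : 1 ≤ n) (hl : 0 < lam) : ∃ c : ℝ, 0 < c ∧ ∀ u G A, MZ (n := n) lam Lam u G A →
    ∀ x t, 0 < t → u x ≤ t → u ((1 + c) • x) ≤ 2 * t := by
  obtain ⟨s0, h0, h01, hb⟩ := nz_bar (n := n) (Lam := Lam) hn hl
  have hn' : (1:ℝ) ≤ √n := by rw [Real.one_le_sqrt]; exact_mod_cast hn
  refine ⟨s0 / (2 * √n), by positivity, fun u G A hu x t ht hx => ?_⟩
  obtain ⟨P, hP, hN, -⟩ := hu.exN hn (t := 2 * t) (by positivity)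
  have hk : 0 < |P.det| ^ (-2 / (n:ℝ)) := by positivity
  have hdx : TM P (TM P⁻¹ x) = x := by
    rw [← TM_mul, Matrix.mul_nonsing_inv _ (isUnit_iff_ne_zero.2 hP), TM_one]
  have e1 : nu P u (TM P⁻¹ x) = |P.det| ^ (-2 / (n:ℝ)) * u x := by simp [nu, hdx]
  have e2 : nu P u ((1 + s0 / (2 * √n)) • TM P⁻¹ x) = |P.det| ^ (-2 / (n:ℝ)) * u ((1 + s0 / (2 * √n)) • x) := by simp [nu, hdx]
  have h3 := hN.hb (TM P⁻¹ x) (by rw [e1]; exact mul_le_mul_of_nonneg_left (by linarith only [ht, hx]) hk.le)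
  have := hb _ _ _ _ hN (TM P⁻¹ x) ((1 + s0 / (2 * √n)) • TM P⁻¹ x) (by rw [e1]; nlinarith) ?_
  · rw [e2] at this
    exact (lt_of_mul_lt_mul_left this hk.le).le
  · have : (1 + s0 / (2 * √n)) • TM P⁻¹ x - TM P⁻¹ x = (s0 / (2 * √n)) • TM P⁻¹ x := by module
    rw [this, norm_smul, Real.norm_of_nonneg (by positivity)]
    calc s0 / (2 * √n) * ‖TM P⁻¹ x‖ ≤ s0 / (2 * √n) * √n := by gcongr
      _ = s0 / 2 := by field_simp
      _ < s0 := by linarith only [h0]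

/-- growth bounds -/
structure GRW (K : ℝ → ℝ) (c0 : ℝ) (u : EE n → ℝ) : Prop where
  up : ∀ R x, ‖x‖ ≤ R → u x ≤ K R
  lw : ∀ x, 2 * √n ≤ ‖x‖ → c0 * ‖x‖ ≤ u x

theorem mz_norm (hn : 1 ≤ n) (hl : 0 < lam) : ∃ (hm hM c0 : ℝ) (K : ℝ → ℝ), 0 < hm ∧ 0 < hM ∧ 0 < c0 ∧ (∀ R, 0 < K R) ∧
    ∀ u G A, MZ (n := n) lam Lam u G A → ∀ t > 0, ∃ P : MM n, P.det ≠ 0 ∧ hm ≤ |P.det| ^ (-2 / (n:ℝ)) * t ∧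
      |P.det| ^ (-2 / (n:ℝ)) * t ≤ hM ∧ GRW K c0 (nu P u) ∧ ∀ c, u (TM P c) ≤ t → ∀ i, |c i| ≤ 1 := by
  obtain ⟨hm, hm0, hlow⟩ := nz_low (n := n) hn hl
  obtain ⟨hM, hM0, hup⟩ := nz_up (n := n) (Lam := Lam) hn
  obtain ⟨s0, hs0, h01, hb⟩ := nz_bar (n := n) (Lam := Lam) hn hl
  obtain ⟨c, hc, hd⟩ := mz_doub (n := n) (Lam := Lam) hn hl
  have hn' : (1:ℝ) ≤ √n := by rw [Real.one_le_sqrt]; exact_mod_cast hn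
  have hk : ∀ R : ℝ, ∃ k : ℕ, R < s0 / 2 * (1 + c) ^ k := fun R => by
    obtain ⟨k, hk⟩ := pow_unbounded_of_one_lt (R / (s0 / 2)) (by linarith : 1 < 1 + c)
    exact ⟨k, by rwa [div_lt_iff₀' (by positivity)] at hk⟩
  choose k hk using hk
  refine ⟨hm, hM, hm / (2 * √n), fun R => 2 ^ k R * hM, hm0, hM0, by positivity, fun R => by positivity, fun u G A hu t ht => ?_⟩
  obtain ⟨P, hP, hN, hcube⟩ := hu.exN hn ht
  have hhm := hlow _ _ _ _ _ hN
  have hhM := hup _ _ _ _ _ hN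
  refine ⟨P, hP, hhm, hhM, ⟨?_, ?_⟩, hcube⟩
  · have base : ∀ x, ‖x‖ ≤ s0 / 2 → nu P u x ≤ hM := fun x hx =>
      ((hb _ _ _ _ hN 0 x (by rw [hN.u0]; linarith only [hN.hp]) (by rw [sub_zero]; linarith)).le).trans hhM
    have ind : ∀ (k : ℕ) x, ‖x‖ ≤ s0 / 2 * (1 + c) ^ k → nu P u x ≤ 2 ^ k * hM := by
      intro k
      induction k with
      | zero => intro x hx; simpa using base x (by simpa using hx)
      | succ k ih =>
        intro x hx
        have h1 := ih ((1 + c)⁻¹ • x) (by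
          rw [norm_smul, Real.norm_of_nonneg (by positivity), inv_mul_le_iff₀ (by positivity)]
          rw [pow_succ] at hx; linarith only [hx])
        have h2 := hd _ _ _ hN.toMZ _ (2 ^ k * hM) (by positivity) h1
        rw [smul_smul, mul_inv_cancel₀ (by positivity), one_smul] at h2
        rw [pow_succ]; linarith only [h2]
    exact fun R x hx => ind _ x (hx.trans (hk R).le)
  · intro x hx
    have hx0 : 0 < ‖x‖ := by linarith
    have h1 : hm ≤ nu P u ((2 * √n / ‖x‖) • x) := by
      by_contra! hlt
      have := hN.hb _ (hlt.le.trans hhm)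
      rw [norm_smul, Real.norm_of_nonneg (by positivity), div_mul_cancel₀ _ hx0.ne'] at this
      linarith only [hn', this]
    have h2 := hN.scale x (s := 2 * √n / ‖x‖) (by positivity) (by rw [div_le_one hx0]; exact hx)
    have h3 := h1.trans h2
    rw [div_mul_eq_mul_div, div_le_iff₀ (by positivity)]
    rw [div_mul_eq_mul_div, le_div_iff₀ hx0] at h3
    linarith only [h3]
end normal


lemma pw (k : ℕ) (t : ℝ) : HasDerivAt (fun t : ℝ => max t 0 ^ (k+2)) ((k+2) * max t 0 ^ (k+1)) t := by
  rcases lt_trichotomy t 0 with h | h | h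
  · have : (fun t : ℝ => max t 0 ^ (k+2)) =ᶠ[𝓝 t] fun _ => 0 := by
      filter_upwards [gt_mem_nhds h] with s hs
      rw [max_eq_right hs.le]; simp
    rw [max_eq_right h.le]
    simpa using (hasDerivAt_const t (0:ℝ)).congr_of_eventuallyEq this
  · subst h
    rw [hasDerivAt_iff_isLittleO_nhds_zero]
    simp only [zero_add, max_self, ne_eq, Nat.add_eq_zero_iff, OfNat.ofNat_ne_zero, and_false, not_false_eq_true,
      zero_pow, sub_zero, one_ne_zero, mul_zero, smul_zero, smul_eq_mul]
    refine (Asymptotics.IsBigO.of_bound 1 (Eventually.of_forall fun x => ?_)).trans_isLittleO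
      (Asymptotics.isLittleO_pow_id (𝕜 := ℝ) (n := k+2) (by omega))
    rw [one_mul, norm_pow, norm_pow]
    refine pow_le_pow_left₀ (norm_nonneg _) ?_ _
    rw [Real.norm_eq_abs, Real.norm_eq_abs, abs_of_nonneg (le_max_right _ _)]
    exact max_le (le_abs_self _) (abs_nonneg _)
  · have : (fun t : ℝ => max t 0 ^ (k+2)) =ᶠ[𝓝 t] fun t => t ^ (k+2) := by
      filter_upwards [lt_mem_nhds h] with s hs
      rw [max_eq_left hs.le]
    rw [max_eq_left h.le]
    simpa using (hasDerivAt_pow (k+2) t).congr_of_eventuallyEq this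

section mono
variable {n : ℕ} {u : EE n → ℝ} {G : EE n → EE n} {A : EE n → MM n} {lam Lam : ℝ}

noncomputable def eta (G : EE n → EE n) (A : EE n → MM n) (x : EE n) : EE n := √(A x).det • G x - TM (A x) x
noncomputable def dd (G : EE n → EE n) (A : EE n → MM n) (x : EE n) : ℝ := ⟪TM (A x)⁻¹ (eta G A x), eta G A x⟫

lemma MAS.cdd (h : MAS u G A) : Continuous (dd G A) := by
  have : Continuous (eta G A) := (h.cg.sqrt.smul h.cG).sub (cont_TM h.cA continuous_id)
  exact (cont_TM h.cinv this).inner this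
lemma MAS.dd_nonneg (h : MAS u G A) (x : EE n) : 0 ≤ dd G A x := psd_nonneg (h.pA x).inv.posSemidef _
lemma MAS.dd_eq (h : MAS u G A) (x : EE n) :
    dd G A x = (A x).det * ⟪TM (A x)⁻¹ (G x), G x⟫ + ⟪TM (A x) x, x⟫ - 2 * √(A x).det * ⟪x, G x⟫ := by
  unfold dd eta
  rw [map_sub, map_smul, TM_inv' (h.dp x)]
  simp only [inner_sub_left, inner_sub_right, inner_smul_left, inner_smul_right]
  have h1 : ⟪TM (A x)⁻¹ (G x), TM (A x) x⟫ = ⟪x, G x⟫ := by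
    rw [real_inner_comm, inner_TM_symm (h.pA x).isHermitian, TM_inv (h.dp x)]
  have h2 := Real.mul_self_sqrt (h.dp x).le
  rw [h1, real_inner_comm x (TM (A x) x)]
  simp only [conj_trivial]
  linear_combination ⟪TM (A x)⁻¹ (G x), G x⟫ * h2

lemma MZ.cz (h : MZ lam Lam u G A) : Continuous fun x => ⟪x, G x⟫ := continuous_id.inner h.cG
lemma MZ.z_nonneg (h : MZ lam Lam u G A) (x : EE n) : 0 ≤ ⟪x, G x⟫ := (h.nonneg x).trans (h.le_z x)
lemma MAS.dz (h : MAS u G A) : HG (fun x => ⟪x, G x⟫) (fun x => G x + TM (A x) x) := by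
  have := HG.inner HJ.idd h.dG
  have e : ∀ x, (A x)ᵀ = A x := fun x => pd_symm (h.pA x)
  simpa [e] using this

/-- radius beyond which u exceeds t -/
lemma MZ.rad (h : MZ lam Lam u G A) (t : ℝ) : ∃ R > 0, ∀ x, R ≤ ‖x‖ → t < u x := by
  obtain ⟨R, hR⟩ := (h.cpt t).isBounded.subset_closedBall 0
  refine ⟨|R| + 1, by positivity, fun x hx => ?_⟩
  by_contra! hc
  have := hR (show x ∈ {x | u x ≤ t} by simpa using hc)
  simp only [mem_closedBall, dist_zero_right] at this
  linarith [le_abs_self R]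

/-- integral of continuous function vanishing outside ball -/
lemma intb {f : EE n → ℝ} (hf : Continuous f) {R : ℝ} (h : ∀ x, R ≤ ‖x‖ → f x = 0) : Integrable f := by
  refine hf.integrable_of_hasCompactSupport ?_
  refine HasCompactSupport.of_support_subset_isCompact (isCompact_closedBall 0 R) fun x hx => ?_
  simp only [mem_closedBall, dist_zero_right]
  by_contra! hc
  exact hx (h x hc.le)

noncomputable def qq (G : EE n → EE n) (s : ℝ) (x : EE n) : ℝ := 2 / s * max (1 - ⟪x, G x⟫ / s) 0
noncomputable def ph (G : EE n → EE n) (s : ℝ) (x : EE n) : ℝ := max (1 - ⟪x, G x⟫ / s) 0 ^ 2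
noncomputable def II (G : EE n → EE n) (s : ℝ) : ℝ := ∫ x, ph G s x

lemma MZ.cqq (h : MZ lam Lam u G A) (s : ℝ) : Continuous (qq G s) := by
  unfold qq; exact continuous_const.mul ((continuous_const.sub (h.cz.div_const s)).max continuous_const)
lemma MZ.cph (h : MZ lam Lam u G A) (s : ℝ) : Continuous (ph G s) := by
  unfold ph; exact ((continuous_const.sub (h.cz.div_const s)).max continuous_const).pow 2
lemma MZ.dph (h : MZ lam Lam u G A) (s : ℝ) : HG (ph G s) (fun x => (-qq G s x) • (G x + TM (A x) x)) := by
  have := h.dz.comp (φ := fun t => max (1 - t / s) 0 ^ 2) (φ' := fun t => - (2 / s * max (1 - t / s) 0)) (fun t => by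
    have h1 : HasDerivAt (fun t : ℝ => 1 - t / s) (-(1/s)) t := by
      simpa using ((hasDerivAt_id t).div_const s).const_sub 1
    refine ((pw 0 (1 - t/s)).comp t h1).congr_deriv ?_
    norm_num; ring)
  exact this
lemma MZ.zero_out (h : MZ lam Lam u G A) {s : ℝ} (hs : 0 < s) {x : EE n} (hx : s ≤ ⟪x, G x⟫) : max (1 - ⟪x, G x⟫ / s) 0 = 0 := by
  rw [max_eq_right]; rw [sub_nonpos, le_div_iff₀ hs]; linarith

lemma MZ.ident (h : MZ lam Lam u G A) {s : ℝ} (hs : 0 < s) :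
    n * ∫ x, (1 + (A x).det) * ph G s x = ∫ x, qq G s x * (dd G A x + (1 + √(A x).det) ^ 2 * ⟪x, G x⟫) := by
  obtain ⟨R, hR0, hR⟩ := h.rad s
  have hz : ∀ x, R ≤ ‖x‖ → max (1 - ⟪x, G x⟫ / s) 0 = 0 := fun x hx => h.zero_out hs ((hR x hx).le.trans (h.le_z x))
  have hp0 : ∀ x, R ≤ ‖x‖ → ph G s x = 0 := fun x hx => by simp [ph, hz x hx]
  have hq0 : ∀ x, R ≤ ‖x‖ → qq G s x = 0 := fun x hx => by simp [qq, hz x hx]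
  have cAx : Continuous fun x => TM (A x) x := cont_TM h.cA continuous_id
  have cp : Continuous fun x => (-qq G s x) • (G x + TM (A x) x) := (h.cqq s).neg.smul (h.cG.add cAx)
  have e1 := I1 h.toMAS h.dG h.cA (h.dph s) cp hp0
  have e2 := I2 HJ.idd continuous_const (h.dph s) cp hp0
  have cc : Continuous fun x => ⟪TM (A x)⁻¹ (G x), (-qq G s x) • (G x + TM (A x) x)⟫ := (cont_TM h.cinv h.cG).inner cp
  have cq := h.cqq s
  have cph := h.cph s
  have cd := h.cdd
  have cz := h.cz
  have cg := h.cg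
  have e1' : ∫ x, ((A x).det * (ph G s x * ((A x)⁻¹ * A x).trace + ⟪TM (A x)⁻¹ (G x), (-qq G s x) • (G x + TM (A x) x)⟫)
      + (ph G s x * (1 : MM n).trace + ⟪x, (-qq G s x) • (G x + TM (A x) x)⟫)) = 0 := by
    rw [integral_add, e1, e2, add_zero]
    · refine intb (R := R) (cg.mul ((cph.mul ((h.cinv.mul h.cA).matrix_trace)).add cc)) fun x hx => ?_
      simp [hp0 x hx, hq0 x hx]
    · refine intb (R := R) ((cph.mul continuous_const).add (continuous_id.inner cp)) fun x hx => ?_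
      simp [hp0 x hx, hq0 x hx]
  rw [← integral_const_mul, ← sub_eq_zero, ← integral_sub]
  · rw [← e1']
    refine integral_congr_ae (Eventually.of_forall fun x => ?_)
    simp only []
    have t1 : ((A x)⁻¹ * A x).trace = n := by
      rw [Matrix.nonsing_inv_mul _ (isUnit_iff_ne_zero.2 (h.dp x).ne')]; simp
    have t2 : (1 : MM n).trace = n := by simp
    rw [t1, t2, h.dd_eq]
    have h1 : ⟪TM (A x)⁻¹ (G x), TM (A x) x⟫ = ⟪x, G x⟫ := by
      rw [real_inner_comm, inner_TM_symm (h.pA x).isHermitian, TM_inv (h.dp x)]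
    have h2 := Real.mul_self_sqrt (h.dp x).le
    simp only [inner_smul_right, inner_add_right, h1]
    rw [real_inner_comm (TM (A x) x) x]
    linear_combination (- qq G s x * ⟪x, G x⟫) * h2
  · exact intb (R := R) (continuous_const.mul ((continuous_const.add cg).mul cph)) fun x hx => by simp [hp0 x hx]
  · exact intb (R := R) (cq.mul (cd.add (((continuous_const.add cg.sqrt).pow 2).mul cz))) fun x hx => by simp [hq0 x hx]

lemma MZ.dI (h : MZ lam Lam u G A) {s : ℝ} (hs : 0 < s) :
    HasDerivAt (II G) (s⁻¹ * ∫ x, qq G s x * ⟪x, G x⟫) s := by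
  obtain ⟨R, hR0, hR⟩ := h.rad (2 * s)
  have hz : ∀ t, 0 < t → t ≤ 2 * s → ∀ x, x ∉ closedBall (0 : EE n) R → max (1 - ⟪x, G x⟫ / t) 0 = 0 := fun t ht ht2 x hx =>
    h.zero_out ht (by
      simp only [mem_closedBall, dist_zero_right, not_le] at hx
      exact ht2.trans ((hR x hx.le).le.trans (h.le_z x)))
  have key := deriv_int (F := fun t x => ph G t x) (F' := fun t x => t⁻¹ * (qq G t x * ⟪x, G x⟫))
    (isCompact_closedBall (0 : EE n) R) (a := s/2) (b := 2 * s) (t0 := s) ⟨by linarith, by linarith⟩ ?_ ?_ ?_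
  · rw [← integral_const_mul]
    rw [setIntegral_eq_integral_of_forall_compl_eq_zero] at key
    · refine key.congr_of_eventuallyEq ?_
      filter_upwards [Ioo_mem_nhds (show s / 2 < s by linarith) (show s < 2 * s by linarith)] with t ht
      rw [II, setIntegral_eq_integral_of_forall_compl_eq_zero]
      intro x hx
      simp [ph, hz t (by linarith [ht.1]) ht.2.le x hx]
    · intro x hx
      simp [qq, hz s hs (by linarith) x hx]
  · have : ContinuousOn (fun p : ℝ × EE n => ⟪p.2, G p.2⟫ / p.1) (Icc (s/2) (2*s) ×ˢ closedBall 0 R) :=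
      (h.cz.comp continuous_snd).continuousOn.div continuous_fst.continuousOn fun p hp => by
        have := hp.1.1; linarith
    exact ((continuousOn_const.sub this).sup continuousOn_const).pow 2
  · have h1 : ∀ p ∈ Icc (s/2) (2*s) ×ˢ closedBall (0:EE n) R, p.1 ≠ 0 := fun p hp => by have := hp.1.1; linarith
    have h2 : ContinuousOn (fun p : ℝ × EE n => ⟪p.2, G p.2⟫) (Icc (s/2) (2*s) ×ˢ closedBall 0 R) :=
      (h.cz.comp continuous_snd).continuousOn
    have h3 : ContinuousOn (fun p : ℝ × EE n => p.1) (Icc (s/2) (2*s) ×ˢ closedBall 0 R) := continuous_fst.continuousOn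
    exact (h3.inv₀ h1).mul (((continuousOn_const.div h3 h1).mul ((continuousOn_const.sub (h2.div h3 h1)).sup continuousOn_const)).mul h2)
  · intro t ht x _
    have ht0 : t ≠ 0 := by linarith [ht.1]
    have h1 : HasDerivAt (fun t : ℝ => 1 - ⟪x, G x⟫ / t) (⟪x, G x⟫ / t ^ 2) t := by
      have := ((hasDerivAt_inv ht0).const_mul ⟪x, G x⟫).const_sub 1
      simp only [← div_eq_mul_inv] at this
      exact this.congr_deriv (by field_simp)
    refine ((pw 0 (1 - ⟪x, G x⟫/t)).comp t h1).congr_deriv ?_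
    simp [qq]; field_simp
end mono


def HM {n : ℕ} (M σ : ℝ) (g : EE n → ℝ) : Prop := ∀ S : Set (EE n), MeasurableSet S → volume S ≠ ⊤ →
  ∫ x in S, |g x - 1| ≤ M * (volume.real S) ^ (1 - σ / n)

section mono2
variable {n : ℕ} {u : EE n → ℝ} {G : EE n → EE n} {A : EE n → MM n} {lam Lam : ℝ}

lemma vol_TM (P : MM n) (S : Set (EE n)) : volume.real (TM P '' S) = |P.det| * volume.real S := by
  rw [measureReal_def, measureReal_def, Measure.addHaar_image_continuousLinearMap, ← ContinuousLinearMap.det, TM_det, ENNReal.toReal_mul, ENNReal.toReal_ofReal (abs_nonneg _)]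

lemma kinv (hn : 1 ≤ n) {d κ a : ℝ} (hd : d ≠ 0) (ha : 0 < a) (h : a ≤ |d| ^ (-2 / (n:ℝ))) : |d| ≤ (1 / a) ^ ((n:ℝ)/2) := by
  have hn' : (0:ℝ) < n := by exact_mod_cast hn
  have h1 : |d| = (1 / |d| ^ (-2 / (n:ℝ))) ^ ((n:ℝ)/2) := by
    rw [one_div, ← Real.rpow_neg (abs_nonneg _), ← Real.rpow_mul (abs_nonneg _)]
    have : -(-2 / (n:ℝ)) * (n / 2) = 1 := by field_simp
    rw [this, Real.rpow_one]
  rw [h1]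
  refine Real.rpow_le_rpow (by positivity) ?_ (by positivity)
  exact one_div_le_one_div_of_le ha h

lemma mz_vol (hn : 1 ≤ n) (hl : 0 < lam) : ∃ C > 0, ∀ u G A, MZ (n := n) lam Lam u G A → ∀ t > 0,
    volume.real {x | u x ≤ t} ≤ C * t ^ ((n:ℝ)/2) := by
  obtain ⟨hm, hM, c0, K, hm0, hM0, hc0, hK, hh⟩ := mz_norm (n := n) (Lam := Lam) hn hl
  refine ⟨(1 / hm) ^ ((n:ℝ)/2) * (volume.real (closedBall (0 : EE n) √n) + 1), by positivity, fun u G A hu t ht => ?_⟩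
  obtain ⟨P, hP, h1, h2, -, h4⟩ := hh u G A hu t ht
  have hsub : {x | u x ≤ t} ⊆ TM P '' closedBall 0 √n := by
    intro x hx
    have e : TM P (TM P⁻¹ x) = x := by
      rw [← TM_mul, Matrix.mul_nonsing_inv _ (isUnit_iff_ne_zero.2 hP), TM_one]
    refine ⟨TM P⁻¹ x, ?_, e⟩
    have := h4 (TM P⁻¹ x) (by rw [e]; simpa using hx)
    rw [mem_closedBall, dist_zero_right, EuclideanSpace.norm_eq]
    refine Real.sqrt_le_sqrt ?_
    calc ∑ i, ‖(TM P⁻¹ x) i‖ ^ 2 ≤ ∑ i : Fin n, (1:ℝ) := Finset.sum_le_sum fun i _ => by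
          rw [Real.norm_eq_abs]; exact pow_le_one₀ (abs_nonneg _) (this i)
      _ = n := by simp
  have hfin : volume (TM P '' closedBall 0 √n) ≠ ⊤ := ((isCompact_closedBall _ _).image (TM P).continuous).measure_lt_top.ne
  have h5 := measureReal_mono hsub hfin
  rw [vol_TM] at h5
  have h6 := kinv (κ := 0) hn hP (div_pos hm0 ht) (by rwa [div_le_iff₀ ht])
  have h7 : (1 / (hm / t)) ^ ((n:ℝ)/2) = (1 / hm) ^ ((n:ℝ)/2) * t ^ ((n:ℝ)/2) := by
    rw [← Real.mul_rpow (by positivity) ht.le]; congr 1; field_simp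
  rw [h7] at h6
  have h8 : 0 ≤ volume.real (closedBall (0 : EE n) √n) := measureReal_nonneg
  calc _ ≤ _ := h5
    _ ≤ ((1 / hm) ^ ((n:ℝ)/2) * t ^ ((n:ℝ)/2)) * (volume.real (closedBall (0 : EE n) √n) + 1) := by gcongr; linarith only []
    _ = _ := by ring

lemma MZ.meas (h : MZ lam Lam u G A) (t : ℝ) : MeasurableSet {x | u x ≤ t} ∧ volume {x | u x ≤ t} ≠ ⊤ :=
  ⟨(h.cpt t).measurableSet, (h.cpt t).measure_lt_top.ne⟩

/-- main differential inequality -/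
lemma MZ.ineq (hn : 1 ≤ n) (hl : 0 < lam) (h : MZ lam Lam u G A) {M σ : ℝ} (hM0 : 0 ≤ M) (hσ : σ < n)
    (hM : HM M σ fun x => (A x).det) : ∃ C > 0, ∀ s > 0,
    4 * (∫ x, qq G s x * ⟪x, G x⟫) ≤ 2 * n * II G s - (∫ x, qq G s x * dd G A x) + C * s ^ (((n:ℝ) - σ)/2) := by
  obtain ⟨C, hC, hv⟩ := mz_vol (n := n) (Lam := Lam) hn hl
  have hn' : (0:ℝ) < n := by exact_mod_cast hn
  refine ⟨(n + 6) * (M * C ^ (1 - σ / n)) + 1, by positivity, fun s hs => ?_⟩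
  obtain ⟨R, hR0, hR⟩ := h.rad s
  have hz : ∀ x, s < u x → max (1 - ⟪x, G x⟫ / s) 0 = 0 := fun x hx => h.zero_out hs (hx.le.trans (h.le_z x))
  have hp0 : ∀ x, R ≤ ‖x‖ → ph G s x = 0 := fun x hx => by simp [ph, hz x (hR x hx)]
  have hq0 : ∀ x, R ≤ ‖x‖ → qq G s x = 0 := fun x hx => by simp [qq, hz x (hR x hx)]
  have cq := h.cqq s
  have cph := h.cph s
  have cd := h.cdd
  have cz := h.cz
  have cg := h.cg
  have i1 : Integrable fun x => qq G s x * ⟪x, G x⟫ := intb (R := R) (cq.mul cz) fun x hx => by simp [hq0 x hx]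
  have i2 : Integrable fun x => qq G s x * dd G A x := intb (R := R) (cq.mul cd) fun x hx => by simp [hq0 x hx]
  have i3 : Integrable (ph G s) := intb cph hp0
  have i4 : Integrable fun x => (1 + (A x).det) * ph G s x := intb (R := R) ((continuous_const.add cg).mul cph) fun x hx => by simp [hp0 x hx]
  have i5 : Integrable fun x => qq G s x * (dd G A x + (1 + √(A x).det) ^ 2 * ⟪x, G x⟫) :=
    intb (R := R) (cq.mul (cd.add (((continuous_const.add cg.sqrt).pow 2).mul cz))) fun x hx => by simp [hq0 x hx]
  have hid := h.ident hs
  have hm := h.meas s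
  have i6 : IntegrableOn (fun x => |(A x).det - 1|) {x | u x ≤ s} :=
    ((cg.sub continuous_const).abs).continuousOn.integrableOn_compact (h.cpt s)
  have i7 : Integrable ({x | u x ≤ s}.indicator fun x => |(A x).det - 1|) := i6.integrable_indicator hm.1
  have hpt : ∀ x, 4 * (qq G s x * ⟪x, G x⟫) - 2 * n * ph G s x + qq G s x * dd G A x
      + (n * ((1 + (A x).det) * ph G s x) - qq G s x * (dd G A x + (1 + √(A x).det) ^ 2 * ⟪x, G x⟫))
      ≤ (n + 6) * {x | u x ≤ s}.indicator (fun x => |(A x).det - 1|) x := by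
    intro x
    by_cases hx : u x ≤ s
    · rw [indicator_of_mem (by simpa using hx)]
      set m := max (1 - ⟪x, G x⟫ / s) 0 with hm
      have z0 := h.z_nonneg x
      have m0 : 0 ≤ m := le_max_right _ _
      have m1 : m ≤ 1 := max_le (by have : 0 ≤ ⟪x, G x⟫ / s := by positivity
                                    linarith) (by norm_num)
      have p1 : ph G s x ≤ 1 := by
        show m ^ 2 ≤ 1
        exact pow_le_one₀ m0 m1
      have p0 : 0 ≤ ph G s x := by show 0 ≤ m ^ 2; positivity
      have q0 : 0 ≤ qq G s x * ⟪x, G x⟫ := mul_nonneg (by show 0 ≤ 2 / s * m; positivity) z0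
      have q1 : qq G s x * ⟪x, G x⟫ ≤ 2 := by
        show 2 / s * m * ⟪x, G x⟫ ≤ 2
        by_cases hzs : ⟪x, G x⟫ ≤ s
        · have : ⟪x, G x⟫ / s ≤ 1 := by rw [div_le_one hs]; exact hzs
          calc 2 / s * m * ⟪x, G x⟫ = 2 * m * (⟪x, G x⟫ / s) := by ring
            _ ≤ 2 * 1 * 1 := by gcongr
            _ = 2 := by norm_num
        · rw [hm, h.zero_out hs (not_le.1 hzs).le]; simp
      have g0 := (h.dp x).le
      have hs1 := Real.mul_self_sqrt g0
      have hs0 := Real.sqrt_nonneg (A x).det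
      have a1 : |√(A x).det - 1| ≤ |(A x).det - 1| := by
        have : (A x).det - 1 = (√(A x).det - 1) * (√(A x).det + 1) := by linear_combination -hs1
        rw [this, abs_mul]
        refine le_mul_of_one_le_right (abs_nonneg _) ?_
        rw [abs_of_nonneg (by linarith)]; linarith
      have e : 4 * (qq G s x * ⟪x, G x⟫) - 2 * n * ph G s x + qq G s x * dd G A x
        + (n * ((1 + (A x).det) * ph G s x) - qq G s x * (dd G A x + (1 + √(A x).det) ^ 2 * ⟪x, G x⟫))
        = n * (((A x).det - 1) * ph G s x) - (((A x).det - 1) + 2 * (√(A x).det - 1)) * (qq G s x * ⟪x, G x⟫) := by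
        linear_combination (-(qq G s x * ⟪x, G x⟫)) * hs1
      rw [e]
      have b1 : ((A x).det - 1) * ph G s x ≤ |(A x).det - 1| := by
        calc _ ≤ |(A x).det - 1| * ph G s x := by gcongr; exact le_abs_self _
          _ ≤ _ := mul_le_of_le_one_right (abs_nonneg _) p1
      have b2 : -((((A x).det - 1) + 2 * (√(A x).det - 1)) * (qq G s x * ⟪x, G x⟫)) ≤ 6 * |(A x).det - 1| := by
        have : -(((A x).det - 1) + 2 * (√(A x).det - 1)) ≤ 3 * |(A x).det - 1| := by
          linarith only [a1, neg_abs_le ((A x).det - 1), neg_abs_le (√(A x).det - 1)]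
        calc _ = -(((A x).det - 1) + 2 * (√(A x).det - 1)) * (qq G s x * ⟪x, G x⟫) := by ring
          _ ≤ 3 * |(A x).det - 1| * (qq G s x * ⟪x, G x⟫) := by gcongr
          _ ≤ 3 * |(A x).det - 1| * 2 := by gcongr
          _ = _ := by ring
      have := mul_le_mul_of_nonneg_left b1 hn'.le
      linarith only [b2, this]
    · rw [indicator_of_notMem (by simpa using hx)]
      have := hz x (not_le.1 hx)
      simp [ph, qq, this]
  have hint := integral_mono (by fun_prop) (i7.const_mul _) hpt
  rw [integral_const_mul, integral_indicator hm.1, integral_add (by fun_prop) (by fun_prop),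
    integral_add (by fun_prop) (by fun_prop), integral_sub (by fun_prop) (by fun_prop), integral_sub (by fun_prop) (by fun_prop),
    integral_const_mul, integral_const_mul, integral_const_mul, hid, sub_self, add_zero] at hint
  have h9 := hM _ hm.1 hm.2
  have h10 : (volume.real {x | u x ≤ s}) ^ (1 - σ / n) ≤ C ^ (1 - σ/n) * s ^ (((n:ℝ) - σ)/2) := by
    have hσn : 0 ≤ 1 - σ / n := by rw [sub_nonneg, div_le_one hn']; exact hσ.le
    calc _ ≤ (C * s ^ ((n:ℝ)/2)) ^ (1 - σ / n) := Real.rpow_le_rpow measureReal_nonneg (hv u G A h s hs) hσn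
      _ = _ := by
        rw [Real.mul_rpow hC.le (by positivity), ← Real.rpow_mul hs.le]
        congr 2; field_simp
  have h11 : 0 < s ^ (((n:ℝ) - σ)/2) := by positivity
  have h12 : (n + 6) * (∫ x in {x | u x ≤ s}, |(A x).det - 1|) ≤ (n + 6) * (M * (C ^ (1 - σ/n) * s ^ (((n:ℝ) - σ)/2))) := by
    gcongr; exact h9.trans (by gcongr)
  simp only [II]
  nlinarith

lemma MZ.decay (hn : 1 ≤ n) (hl : 0 < lam) (h : MZ lam Lam u G A) {M σ : ℝ} (hM0 : 0 ≤ M) (hσ0 : 0 < σ) (hσ : σ < n)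
    (hM : HM M σ fun x => (A x).det) {δ : ℝ} (hδ : 0 < δ) : ∃ T > 0, ∀ s ≥ T,
    s ^ (-((n:ℝ)/2) - 1) * ∫ x in {x | ⟪x, G x⟫ ≤ s / 2}, dd G A x ≤ δ := by
  obtain ⟨C, hC, hin⟩ := h.ineq hn hl hM0 hσ hM
  have hn' : (0:ℝ) < n := by exact_mod_cast hn
  set Φ : ℝ → ℝ := fun s => s ^ (-((n:ℝ)/2)) * II G s + C / (2 * σ) * s ^ (-(σ/2)) with hΦ
  set Φ' : ℝ → ℝ := fun s => (-((n:ℝ)/2)) * s ^ (-((n:ℝ)/2) - 1) * II G s + s ^ (-((n:ℝ)/2)) * (s⁻¹ * ∫ x, qq G s x * ⟪x, G x⟫)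
    + C / (2 * σ) * (-(σ/2) * s ^ (-(σ/2) - 1)) with hΦ'
  have hd : ∀ s > 0, HasDerivAt Φ (Φ' s) s := fun s hs =>
    ((Real.hasDerivAt_rpow_const (Or.inl hs.ne')).mul (h.dI hs)).add
      ((Real.hasDerivAt_rpow_const (Or.inl hs.ne')).const_mul _)
  have hle : ∀ s > 0, Φ' s ≤ - (s ^ (-((n:ℝ)/2) - 1) * (∫ x, qq G s x * dd G A x) / 4) := by
    intro s hs
    have e1 : s ^ (-((n:ℝ)/2)) = s ^ (-((n:ℝ)/2) - 1) * s := by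
      rw [← Real.rpow_add_one hs.ne']; congr 1; ring
    have e2 : s ^ (-(σ/2) - 1) = s ^ (-((n:ℝ)/2) - 1) * s ^ (((n:ℝ) - σ)/2) := by
      rw [← Real.rpow_add hs]; congr 1; ring
    have e3 : Φ' s = s ^ (-((n:ℝ)/2) - 1) * ((∫ x, qq G s x * ⟪x, G x⟫) - n / 2 * II G s - C / 4 * s ^ (((n:ℝ) - σ)/2)) := by
      simp only [hΦ']
      rw [e1, e2]; field_simp; ring
    rw [e3]
    have := hin s hs
    have h1 : 0 < s ^ (-((n:ℝ)/2) - 1) := by positivity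
    have h2 : (∫ x, qq G s x * ⟪x, G x⟫) - n / 2 * II G s - C / 4 * s ^ (((n:ℝ) - σ)/2) ≤ - ((∫ x, qq G s x * dd G A x) / 4) := by linarith only [this]
    have := mul_le_mul_of_nonneg_left h2 h1.le
    linarith only [this]
  have hqd : ∀ s > 0, ∀ x, 0 ≤ qq G s x * dd G A x := fun s hs x => mul_nonneg (by
    unfold qq; have := le_max_right (1 - ⟪x, G x⟫ / s) 0; positivity) (h.dd_nonneg x)
  have hII : ∀ s, 0 ≤ II G s := fun s => integral_nonneg fun x => by
    simp only [Pi.zero_apply, ph]; positivity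
  have hΦ0 : ∀ s > 0, 0 ≤ Φ s := fun s hs => by have := hII s; simp only [hΦ]; positivity
  have hneg : ∀ s > 0, Φ' s ≤ 0 := fun s hs => (hle s hs).trans (by
    have := integral_nonneg (μ := volume) (f := fun x => qq G s x * dd G A x) (fun x => hqd s hs x)
    have : 0 ≤ s ^ (-((n:ℝ)/2) - 1) * (∫ x, qq G s x * dd G A x) / 4 := by positivity
    linarith only [this])
  have hanti : AntitoneOn Φ (Ioi 0) := by
    refine antitoneOn_of_deriv_nonpos (convex_Ioi 0) (fun s hs => (hd s hs).continuousAt.continuousWithinAt) ?_ ?_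
    · intro s hs; rw [interior_Ioi] at hs; exact (hd s hs).differentiableAt.differentiableWithinAt
    · intro s hs; rw [interior_Ioi] at hs; rw [(hd s hs).deriv]; exact hneg s hs
  set c : ℝ := 2 ^ (-((n:ℝ)/2) - 1) / 8 with hc
  have hc0 : 0 < c := by positivity
  obtain ⟨s1, hs1, hlim⟩ : ∃ s1 > 0, ∀ s > 0, Φ s1 - c * δ ≤ Φ s := by
    have hbd : BddBelow (Φ '' Ioi 0) := ⟨0, by rintro _ ⟨s, hs, rfl⟩; exact hΦ0 s hs⟩
    obtain ⟨_, ⟨s1, hs1, rfl⟩, hlt⟩ := Real.lt_sInf_add_pos (s := Φ '' Ioi 0) ⟨Φ 1, 1, by simp, rfl⟩ (show 0 < c * δ by positivity)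
    refine ⟨s1, hs1, fun s hs => ?_⟩
    have := csInf_le hbd ⟨s, hs, rfl⟩
    linarith only [hlt, this]
  refine ⟨s1, hs1, fun s hs => ?_⟩
  have hs0 : 0 < s := hs1.trans_le hs
  have hmono : Φ s ≤ Φ s1 := hanti hs1 hs0 hs
  obtain ⟨ξ, hξ, hξe⟩ := exists_hasDerivAt_eq_slope Φ Φ' (show s < 2 * s by linarith only [hs1, hs])
    (fun t ht => (hd t (by linarith only [hs1, hs, ht.1])).continuousAt.continuousWithinAt) (fun t ht => hd t (by linarith only [hs1, hs, ht.1]))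
  have hξ0 : 0 < ξ := by linarith only [hs1, hs, hξ.1]
  have hl2 := hlim (2 * s) (by positivity)
  have h3 : -(c * δ) / s ≤ Φ' ξ := by
    rw [hξe]; have : 2 * s - s = s := by ring
    rw [this]; gcongr; linarith only [hmono, hl2]
  have h4 := h3.trans (hle ξ hξ0)
  obtain ⟨R, hR0, hR⟩ := h.rad ξ
  have hq0 : ∀ x, R ≤ ‖x‖ → qq G ξ x = 0 := fun x hx => by simp [qq, h.zero_out hξ0 ((hR x hx).le.trans (h.le_z x))]
  have hi : Integrable fun x => qq G ξ x * dd G A x := intb (R := R) ((h.cqq ξ).mul h.cdd) fun x hx => by simp [hq0 x hx]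
  have hms : MeasurableSet {x | ⟪x, G x⟫ ≤ s / 2} := (isClosed_le h.cz continuous_const).measurableSet
  have hsub : {x | ⟪x, G x⟫ ≤ s / 2} ⊆ {x | u x ≤ s / 2} := fun x hx => by
    simp only [mem_ofPred_eq] at hx ⊢; exact (h.le_z x).trans hx
  have h5 : (∫ x in {x | ⟪x, G x⟫ ≤ s / 2}, (1 / (2 * s)) * dd G A x) ≤ ∫ x, qq G ξ x * dd G A x := by
    refine le_trans ?_ (setIntegral_le_integral (s := {x | ⟪x, G x⟫ ≤ s / 2}) hi (Eventually.of_forall (hqd ξ hξ0)))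
    refine setIntegral_mono_on ?_ hi.integrableOn hms fun x hx => ?_
    · exact ((continuous_const.mul h.cdd).continuousOn.integrableOn_compact (h.cpt (s/2))).mono_set hsub
    · refine mul_le_mul_of_nonneg_right ?_ (h.dd_nonneg x)
      simp only [mem_ofPred_eq] at hx
      unfold qq
      have a1 : (1:ℝ)/2 ≤ max (1 - ⟪x, G x⟫ / ξ) 0 := by
        refine le_max_of_le_left ?_
        have : ⟪x, G x⟫ / ξ ≤ 1 / 2 := by rw [div_le_iff₀ hξ0]; linarith only [hx, hξ.1]
        linarith only [this]
      have a2 : 1 / s ≤ 2 / ξ := by rw [div_le_div_iff₀ hs0 hξ0]; linarith only [hξ.2]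
      calc 1 / (2 * s) = 1 / s * (1 / 2) := by field_simp
        _ ≤ _ := by gcongr
  rw [integral_const_mul] at h5
  set D := ∫ x in {x | ⟪x, G x⟫ ≤ s / 2}, dd G A x with hD
  have hD0 : 0 ≤ D := setIntegral_nonneg hms fun x _ => h.dd_nonneg x
  have h6 : (2 * s) ^ (-((n:ℝ)/2) - 1) ≤ ξ ^ (-((n:ℝ)/2) - 1) :=
    Real.rpow_le_rpow_of_nonpos hξ0 hξ.2.le (by linarith only [hσ])
  rw [Real.mul_rpow (by norm_num) hs0.le] at h6
  have h7 : 2 ^ (-((n:ℝ)/2) - 1) * s ^ (-((n:ℝ)/2) - 1) * (1 / (2 * s) * D) ≤ c * δ / s * 4 := by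
    calc _ ≤ ξ ^ (-((n:ℝ)/2) - 1) * (∫ x, qq G ξ x * dd G A x) := by gcongr
      _ ≤ _ := by rw [neg_div] at h4; linarith only [h4]
  have h8 : 2 ^ (-((n:ℝ)/2) - 1) * s ^ (-((n:ℝ)/2) - 1) * (1 / (2 * s) * D) = c * (s ^ (-((n:ℝ)/2) - 1) * D) / s * 4 := by
    rw [hc]; field_simp; ring
  rw [h8] at h7
  have h9 : c * (s ^ (-((n:ℝ)/2) - 1) * D) ≤ c * δ := by
    have := le_of_mul_le_mul_right h7 (by norm_num)
    exact (div_le_div_iff_of_pos_right hs0).1 this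
  exact le_of_mul_le_mul_left h9 hc0
end mono2


section qn
variable {n : ℕ} {u : EE n → ℝ} {G : EE n → EE n} {A : EE n → MM n} {lam Lam : ℝ}

lemma TM_PP {P : MM n} (hP : P.det ≠ 0) (x : EE n) : TM P (TM P⁻¹ x) = x := by
  rw [← TM_mul, Matrix.mul_nonsing_inv _ (isUnit_iff_ne_zero.2 hP), TM_one]
lemma TM_PP' {P : MM n} (hP : P.det ≠ 0) (x : EE n) : TM P⁻¹ (TM P x) = x := by
  rw [← TM_mul, Matrix.nonsing_inv_mul _ (isUnit_iff_ne_zero.2 hP), TM_one]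

lemma cov {P : MM n} (hP : P.det ≠ 0) {S : Set (EE n)} (hS : MeasurableSet S) (f : EE n → ℝ) :
    ∫ x in S, f (TM P x) = |P.det|⁻¹ * ∫ x in TM P '' S, f x := by
  rw [integral_image_eq_integral_abs_det_fderiv_smul volume hS (f' := fun _ => TM P)
    (fun x _ => (TM P).hasFDerivAt.hasFDerivWithinAt)
    (fun x _ y _ e => by rw [← TM_PP' hP x, ← TM_PP' hP y]; exact congrArg _ e)]
  have : (TM P).det = P.det := TM_det P
  simp only [this, smul_eq_mul]
  rw [integral_const_mul, ← mul_assoc, inv_mul_cancel₀ (abs_ne_zero.2 hP), one_mul]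

lemma z_norm (P : MM n) (G : EE n → EE n) (x : EE n) :
    ⟪x, nG P G x⟫ = |P.det| ^ (-2 / (n:ℝ)) * ⟪TM P x, G (TM P x)⟫ := by
  rw [nG, inner_smul_right, inner_TM]

lemma dd_norm (hn : 1 ≤ n) {P : MM n} (hP : P.det ≠ 0) (h : MAS u G A) (h' : MAS (nu P u) (nG P G) (nA P A)) (x : EE n) :
    dd (nG P G) (nA P A) x = |P.det| ^ (-2 / (n:ℝ)) * dd G A (TM P x) := by
  have e1 : eta (nG P G) (nA P A) x = |P.det| ^ (-2 / (n:ℝ)) • TM Pᵀ (eta G A (TM P x)) := by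
    unfold eta
    rw [nA_det hn hP, nG, nA, TM_smul, TM_mul, TM_mul, map_sub, map_smul]; module
  have e2 : eta (nG P G) (nA P A) x = TM (nA P A x) (TM P⁻¹ (TM (A (TM P x))⁻¹ (eta G A (TM P x)))) := by
    rw [e1, nA, TM_smul, TM_mul, TM_mul, TM_PP hP, TM_inv (h.dp _)]
  have e3 : TM (nA P A x)⁻¹ (eta (nG P G) (nA P A) x) = TM P⁻¹ (TM (A (TM P x))⁻¹ (eta G A (TM P x))) := by
    rw [e2, TM_inv' (h'.dp x)]
  rw [dd, e3, e1, inner_smul_right, ← inner_TM, TM_PP hP, dd]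

lemma MZ.z_le (h : MZ lam Lam u G A) (x : EE n) : ⟪x, G x⟫ ≤ u ((2:ℝ) • x) := by
  have := h.conv x ((2:ℝ) • x)
  rw [two_smul, add_sub_cancel_right, real_inner_comm, ← two_smul ℝ] at this
  linarith [h.nonneg x]

theorem QN (hn : 1 ≤ n) (hl : 0 < lam) (h : MZ lam Lam u G A) {M σ : ℝ} (hM0 : 0 ≤ M) (hσ0 : 0 < σ) (hσ : σ < n)
    (hM : HM M σ fun x => (A x).det) : ∃ (c0 : ℝ) (K : ℝ → ℝ), 0 < c0 ∧ (∀ R, 0 < K R) ∧ ∀ δ > 0, ∀ κ0 > 0, ∀ R > 0,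
    ∃ P : MM n, P.det ≠ 0 ∧ |P.det| ^ (-2 / (n:ℝ)) ≤ κ0 ∧ GRW K c0 (nu P u) ∧
    ∫ x in closedBall 0 R, dd (nG P G) (nA P A) x ≤ δ ∧ ∫ x in closedBall 0 R, |(nA P A x).det - 1| ≤ δ := by
  obtain ⟨hm, hM', c0, K, hm0, hM0', hc0, hK, hh⟩ := mz_norm (n := n) (Lam := Lam) hn hl
  have hn' : (0:ℝ) < n := by exact_mod_cast hn
  refine ⟨c0, K, hc0, hK, fun δ hδ κ0 hκ0 R hR => ?_⟩
  set s' := 2 * K (2 * R) with hs'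
  have hs0 : 0 < s' := by have := hK (2*R); positivity
  obtain ⟨T, hT, hdec⟩ := h.decay hn hl hM0 hσ0 hσ hM (δ := δ / s' ^ ((n:ℝ)/2+1)) (by positivity)
  set V := volume.real (closedBall (0 : EE n) R) with hV
  have hV0 : 0 ≤ V := measureReal_nonneg
  obtain ⟨κ1, hκ1, hκ1'⟩ : ∃ κ1 > 0, ∀ κ, 0 < κ → κ ≤ κ1 → M * V ^ (1 - σ/n) * κ ^ (σ/2) ≤ δ := by
    have h1 : Tendsto (fun κ : ℝ => M * V ^ (1 - σ/n) * κ ^ (σ/2)) (𝓝 0) (𝓝 (M * V ^ (1 - σ/n) * 0 ^ (σ/2))) :=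
      ((Real.continuousAt_rpow_const 0 (σ/2) (Or.inr (by positivity))).tendsto).const_mul _
    rw [Real.zero_rpow (by positivity), mul_zero] at h1
    obtain ⟨r, hr, hb⟩ := Metric.eventually_nhds_iff.1 (h1.eventually (gt_mem_nhds hδ))
    refine ⟨r/2, by positivity, fun κ h0 h1 => (hb ?_).le⟩
    rw [Real.dist_eq, sub_zero, abs_of_pos h0]; linarith
  set κm := min (min κ0 κ1) (s' / T) with hκm
  have hκm0 : 0 < κm := by positivity
  obtain ⟨P, hP, h1, h2, h3, -⟩ := hh u G A h (hM' / κm) (by positivity)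
  set κ := |P.det| ^ (-2 / (n:ℝ)) with hκ
  have hp0 : 0 < |P.det| := abs_pos.2 hP
  have hκp : 0 < κ := by positivity
  have hκle : κ ≤ κm := by
    have : κ * (hM' / κm) = κ / κm * hM' := by field_simp
    rw [this] at h2
    have := le_of_mul_le_mul_right (h2.trans_eq (one_mul _).symm) hM0'
    rwa [div_le_one hκm0] at this
  have hN := h.norm hn hP
  have hinv : |P.det|⁻¹ = κ ^ ((n:ℝ)/2) := by
    rw [hκ, ← Real.rpow_mul hp0.le, ← Real.rpow_neg_one]; congr 1; field_simp
  refine ⟨P, hP, hκle.trans ((min_le_left _ _).trans (min_le_left _ _)), h3, ?_, ?_⟩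
  · have hms : MeasurableSet {x : EE n | ⟪x, nG P G x⟫ ≤ s' / 2} := (isClosed_le hN.cz continuous_const).measurableSet
    have hsT : T ≤ s' / κ := by
      rw [le_div_iff₀ hκp, ← le_div_iff₀' hT]; exact hκle.trans (min_le_right _ _)
    have hint : IntegrableOn (dd (nG P G) (nA P A)) {x : EE n | ⟪x, nG P G x⟫ ≤ s' / 2} := by
      refine (hN.cdd.continuousOn.integrableOn_compact (hN.cpt (s'/2))).mono_set fun x hx => ?_
      simp only [Set.mem_ofPred_eq] at hx ⊢; exact (hN.le_z x).trans hx
    have himg : TM P '' {x : EE n | ⟪x, nG P G x⟫ ≤ s' / 2} = {x | ⟪x, G x⟫ ≤ s' / κ / 2} := by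
      ext y; simp only [Set.mem_image, Set.mem_ofPred_eq]
      have hq : ∀ t, κ * t ≤ s' / 2 ↔ t ≤ s' / κ / 2 := fun t => by
        rw [div_right_comm, le_div_iff₀ hκp, mul_comm]
      constructor
      · rintro ⟨x, hx, rfl⟩; rw [z_norm] at hx; exact (hq _).1 hx
      · intro hy; exact ⟨TM P⁻¹ y, by rw [z_norm, TM_PP hP]; exact (hq _).2 hy, TM_PP hP y⟩
    have hd := hdec _ hsT
    calc _ ≤ ∫ x in {x : EE n | ⟪x, nG P G x⟫ ≤ s' / 2}, dd (nG P G) (nA P A) x := by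
          refine setIntegral_mono_set hint (ae_of_all _ fun x => hN.dd_nonneg x) (HasSubset.Subset.eventuallyLE fun x hx => ?_)
          simp only [mem_closedBall, dist_zero_right, Set.mem_ofPred_eq] at hx ⊢
          have := h3.up (2*R) ((2:ℝ) • x) (by rw [norm_smul]; norm_num; linarith only [hx])
          have := hN.z_le x
          rw [hs']; linarith
      _ = κ * (κ ^ ((n:ℝ)/2) * ∫ x in {x | ⟪x, G x⟫ ≤ s' / κ / 2}, dd G A x) := by
          simp_rw [dd_norm hn hP h.toMAS hN.toMAS]
          rw [integral_const_mul, cov hP hms, himg, hinv]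
      _ = s' ^ ((n:ℝ)/2+1) * ((s' / κ) ^ (-((n:ℝ)/2) - 1) * ∫ x in {x | ⟪x, G x⟫ ≤ s' / κ / 2}, dd G A x) := by
          rw [Real.div_rpow hs0.le hκp.le, ← mul_assoc, ← mul_assoc]
          congr 1
          have e : -((n:ℝ)/2) - 1 = -((n:ℝ)/2 + 1) := by ring
          rw [e, Real.rpow_neg hs0.le, Real.rpow_neg hκp.le, Real.rpow_add hκp, Real.rpow_one]
          field_simp
      _ ≤ s' ^ ((n:ℝ)/2+1) * (δ / s' ^ ((n:ℝ)/2+1)) := by gcongr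
      _ = δ := by field_simp
  · simp_rw [nA_det hn hP]
    rw [cov hP isClosed_closedBall.measurableSet (fun x => |(A x).det - 1|)]
    have hc : IsCompact (TM P '' closedBall (0 : EE n) R) := (isCompact_closedBall _ _).image (TM P).continuous
    have := hM _ hc.measurableSet hc.measure_lt_top.ne
    rw [vol_TM, ← hV, Real.mul_rpow hp0.le hV0] at this
    refine le_trans ?_ (hκ1' κ hκp (hκle.trans ((min_le_left _ _).trans (min_le_right _ _))))
    calc _ ≤ |P.det|⁻¹ * (M * (|P.det| ^ (1 - σ / (n:ℝ)) * V ^ (1 - σ / (n:ℝ)))) := by gcongr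
      _ = _ := by
        have e : κ ^ (σ/2) = |P.det|⁻¹ * |P.det| ^ (1 - σ / (n:ℝ)) := by
          rw [hκ, ← Real.rpow_mul hp0.le, ← Real.rpow_neg_one, ← Real.rpow_add hp0]; congr 1; field_simp; ring
        rw [e]; ring
end qn


section gb
variable {n : ℕ} {u : EE n → ℝ} {G : EE n → EE n} {A : EE n → MM n} {lam Lam c0 : ℝ} {K : ℝ → ℝ}

lemma ib {f : EE n → ℝ} (hf : Continuous f) (x0 : EE n) (R : ℝ) : IntegrableOn f (closedBall x0 R) :=
  hf.continuousOn.integrableOn_compact (isCompact_closedBall x0 R)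
lemma gi {f : EE n → ℝ} {R : ℝ} (hz : ∀ x, R ≤ ‖x‖ → f x = 0) : ∫ x, f x = ∫ x in closedBall 0 R, f x := by
  refine (setIntegral_eq_integral_of_forall_compl_eq_zero fun x hx => hz x ?_).symm
  simp only [mem_closedBall, dist_zero_right, not_le] at hx; exact hx.le
lemma cb {f g : EE n → ℝ} (hf : Continuous f) (hg : Continuous g) {x0 : EE n} {R : ℝ} (h : ∀ x, ‖x - x0‖ ≤ R → f x ≤ g x) :
    ∫ x in closedBall x0 R, f x ≤ ∫ x in closedBall x0 R, g x :=
  setIntegral_mono_on (ib hf _ _) (ib hg _ _) isClosed_closedBall.measurableSet fun x hx => h x (by rwa [mem_closedBall, dist_eq_norm] at hx)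
lemma cb' {f : EE n → ℝ} (hf : Continuous f) {C : ℝ} {x0 : EE n} {R : ℝ} (h : ∀ x, ‖x - x0‖ ≤ R → f x ≤ C) :
    ∫ x in closedBall x0 R, f x ≤ C * volume.real (closedBall x0 R) := by
  refine (cb hf (continuous_const (y := C)) h).trans_eq ?_
  simp [mul_comm]
lemma bmono {f : EE n → ℝ} (hf : Continuous f) (h : ∀ x, 0 ≤ f x) {x0 x1 : EE n} {R R' : ℝ} (hs : closedBall x0 R ⊆ closedBall x1 R') :
    ∫ x in closedBall x0 R, f x ≤ ∫ x in closedBall x1 R', f x :=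
  setIntegral_mono_set (ib hf _ _) (ae_of_all _ h) (LE.le.eventuallyLE hs)
lemma bnn {f : EE n → ℝ} (h : ∀ x, 0 ≤ f x) (x0 : EE n) (R : ℝ) : 0 ≤ ∫ x in closedBall x0 R, f x :=
  setIntegral_nonneg isClosed_closedBall.measurableSet fun x _ => h x
lemma cs {f a b : EE n → ℝ} (hf : Continuous f) (ha : Continuous a) (hb : Continuous b) (x0 : EE n) (R : ℝ)
    (a0 : ∀ x, 0 ≤ a x) (b0 : ∀ x, 0 ≤ b x) (h : ∀ x, f x ^ 2 ≤ a x * b x) :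
    (∫ x in closedBall x0 R, |f x|) ^ 2 ≤ (∫ x in closedBall x0 R, a x) * ∫ x in closedBall x0 R, b x := by
  have key : ∀ t : ℝ, 0 ≤ (∫ x in closedBall x0 R, a x) * (t * t) + (-2 * ∫ x in closedBall x0 R, |f x|) * t + ∫ x in closedBall x0 R, b x := by
    intro t
    have : 0 ≤ ∫ x in closedBall x0 R, (a x * (t * t) + (-2 * |f x|) * t + b x) := bnn (fun x => by
      have h1 : |f x| ≤ √(a x) * √(b x) := by rw [← Real.sqrt_mul (a0 x)]; exact Real.abs_le_sqrt (h x)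
      have h2 := Real.sq_sqrt (a0 x)
      have h3 := Real.sq_sqrt (b0 x)
      have h4 : |f x| * t ≤ √(a x) * √(b x) * |t| :=
        (mul_le_mul_of_nonneg_left (le_abs_self t) (abs_nonneg _)).trans (mul_le_mul_of_nonneg_right h1 (abs_nonneg _))
      nlinarith [sq_nonneg (√(a x) * |t| - √(b x)), sq_abs t]) x0 R
    rw [integral_add, integral_add, integral_mul_const, integral_mul_const, integral_const_mul] at this
    · exact this
    · exact ib (by fun_prop) _ _
    · exact ib (by fun_prop) _ _
    · exact ib (by fun_prop) _ _
    · exact ib (by fun_prop) _ _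
  have := discrim_le_zero key
  rw [discrim] at this; nlinarith

lemma GRW.rad (hg : GRW K c0 u) (hc : 0 < c0) {T : ℝ} {x : EE n} (h : max (2 * √n) (T / c0) ≤ ‖x‖) : T ≤ u x := by
  have h1 := hg.lw x ((le_max_left _ _).trans h)
  have h2 := (le_max_right _ _).trans h
  rw [div_le_iff₀' hc] at h2; linarith
lemma MZ.Gle (h : MZ lam Lam u G A) (hg : GRW K c0 u) {R : ℝ} {x : EE n} (hx : ‖x‖ ≤ R) : ‖G x‖ ≤ K (R + 1) := by
  rcases eq_or_ne (G x) 0 with e | e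
  · rw [e, norm_zero]; exact (h.nonneg x).trans (hg.up _ _ (by linarith))
  have h1 := h.conv x (x + (‖G x‖⁻¹) • G x)
  have h2 := hg.up (R+1) (x + (‖G x‖⁻¹) • G x) (by
    refine (norm_add_le _ _).trans ?_
    rw [norm_smul, norm_inv, norm_norm, inv_mul_cancel₀ (norm_ne_zero_iff.2 e)]; linarith)
  rw [add_sub_cancel_left, inner_smul_right, real_inner_self_eq_norm_sq, sq, ← mul_assoc,
    inv_mul_cancel₀ (norm_ne_zero_iff.2 e), one_mul] at h1
  linarith [h.nonneg x]

noncomputable def ct (T : ℝ) (u : EE n → ℝ) (j : ℕ) (x : EE n) : ℝ := max (T - u x) 0 ^ j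
lemma ct0 (T : ℝ) (u : EE n → ℝ) (j : ℕ) (x : EE n) : 0 ≤ ct T u j x := by
  have := le_max_right (T - u x) 0; unfold ct; positivity
lemma ct_le {T : ℝ} (hT : 0 ≤ T) (h : MZ lam Lam u G A) (j : ℕ) (x : EE n) : ct T u j x ≤ T ^ j :=
  pow_le_pow_left₀ (le_max_right _ _) (max_le (by linarith [h.nonneg x]) hT) _
lemma ct_ge {T : ℝ} (j : ℕ) {x : EE n} (hx : u x ≤ T - 1) : 1 ≤ ct T u j x :=
  one_le_pow₀ (le_max_of_le_left (by linarith))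
lemma MAS.cct (h : MAS u G A) (T : ℝ) (j : ℕ) : Continuous (ct T u j) :=
  ((continuous_const.sub h.cu).max continuous_const).pow j
lemma ct_zero {T : ℝ} {j : ℕ} (hj : j ≠ 0) {x : EE n} (hx : T ≤ u x) : ct T u j x = 0 := by
  rw [ct, max_eq_right (by linarith), zero_pow hj]
lemma MAS.dct (h : MAS u G A) (T : ℝ) (j : ℕ) : HG (ct T u (j+2)) (fun x => (-((j+2) * ct T u (j+1) x)) • G x) := by
  have := h.du.comp (φ := fun t => max (T - t) 0 ^ (j+2)) (φ' := fun t => - ((j+2) * max (T - t) 0 ^ (j+1))) (fun t => by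
    refine ((pw j (T - t)).comp t ((hasDerivAt_id t).const_sub T)).congr_deriv ?_
    ring)
  exact this
lemma MAS.cdct (h : MAS u G A) (T : ℝ) (j : ℕ) : Continuous (fun x => (-((j+2) * ct T u (j+1) x)) • G x) :=
  (continuous_const.mul (h.cct T _)).neg.smul h.cG

lemma B1 (hl : 0 < lam) (hc : 0 < c0) (hK : ∀ R, 0 < K R) (R : ℝ) : ∃ C > 0, ∀ u G A, MZ (n := n) lam Lam u G A → GRW K c0 u →
    ∫ x in closedBall 0 R, (A x).trace ≤ C ∧ ∫ x in closedBall 0 R, (A x).det * ((A x)⁻¹).trace ≤ C := by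
  set T := K R + 1 with hT
  have hT0 : 0 < T := by have := hK R; linarith
  set R0 := max (2 * √n) (T / c0) with hR0
  have hR00 : 0 < R0 := lt_max_of_lt_right (by positivity)
  set L := K (R0 + 1) with hL
  set v := volume.real (closedBall (0 : EE n) R0) with hv
  have hv0 : 0 ≤ v := measureReal_nonneg
  have hLam : 0 ≤ max Lam 0 := le_max_right _ _
  refine ⟨2 * T * L ^ 2 * v + 9/2 * R0 ^ 2 * (n * (max Lam 0 * T ^ 2 * v)) + 1, by positivity, fun u G A h hg => ?_⟩
  have hz : ∀ j, j ≠ 0 → ∀ x, R0 ≤ ‖x‖ → ct T u j x = 0 := fun j hj x hx => ct_zero hj (hg.rad hc hx)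
  have cT : ∀ j, Continuous (ct T u j) := h.cct T
  have ctr : Continuous fun x => (A x).trace := h.cA.matrix_trace
  have ctri : Continuous fun x => ((A x)⁻¹).trace := h.cinv.matrix_trace
  have cG := h.cG
  have cg := h.cg
  have ca : Continuous fun x => ⟪TM (A x)⁻¹ (G x), G x⟫ := (cont_TM h.cinv cG).inner cG
  have ca2 : Continuous fun x => ⟪TM (A x)⁻¹ x, G x⟫ := (cont_TM h.cinv continuous_id).inner cG
  have tr0 : ∀ x, 0 ≤ (A x).trace := fun x => (h.pA x).posSemidef.trace_nonneg
  have tri0 : ∀ x, 0 ≤ ((A x)⁻¹).trace := fun x => (h.pA x).inv.posSemidef.trace_nonneg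
  have hge : ∀ j x, ‖x - 0‖ ≤ R → 1 ≤ ct T u j x := fun j x hx => ct_ge j (by rw [sub_zero] at hx; linarith [hg.up R x hx])
  have hIg : ∀ {f : EE n → ℝ}, Continuous f → (∀ x, R0 ≤ ‖x‖ → f x = 0) → Integrable f := fun h1 h2 => intb h1 h2
  have hex : ∀ {f g : EE n → ℝ}, Continuous f → Continuous g → (∀ x, 0 ≤ g x) → (∀ x, R0 ≤ ‖x‖ → g x = 0) →
      (∀ x, ‖x - 0‖ ≤ R → f x ≤ g x) → ∫ x in closedBall 0 R, f x ≤ ∫ x, g x := fun hf hg0 h0 hz0 hle =>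
    (cb hf hg0 hle).trans (setIntegral_le_integral (hIg hg0 hz0) (ae_of_all _ h0))
  constructor
  · have e := I2 h.dG h.cA (h.dct T 0) (h.cdct T 0) (hz 2 (by norm_num))
    simp only [Nat.cast_zero, zero_add, inner_smul_right, real_inner_self_eq_norm_sq] at e
    rw [integral_add (hIg (by fun_prop) fun x hx => by simp [hz 2 _ x hx]) (hIg (by fun_prop) fun x hx => by simp [hz 1 _ x hx])] at e
    have h1 : ∫ x in closedBall 0 R, (A x).trace ≤ ∫ x, ct T u 2 x * (A x).trace :=
      hex ctr (by fun_prop) (fun x => mul_nonneg (ct0 _ _ _ _) (tr0 x)) (fun x hx => by simp [hz 2 _ x hx])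
        fun x hx => le_mul_of_one_le_left (tr0 x) (hge _ x hx)
    have h2 : ∫ x, 2 * ct T u 1 x * ‖G x‖ ^ 2 ≤ 2 * T * L ^ 2 * v := by
      rw [gi (R := R0) fun x hx => by simp [hz 1 _ x hx]]
      refine cb' (by fun_prop) fun x hx => ?_
      have := ct_le hT0.le h 1 x
      rw [pow_one] at this
      gcongr
      exact h.Gle hg (by rwa [sub_zero] at hx)
    have h3 : ∫ x, -(2 * ct T u 1 x) * ‖G x‖ ^ 2 = - ∫ x, 2 * ct T u 1 x * ‖G x‖ ^ 2 := by
      rw [← integral_neg]; simp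
    rw [h3] at e
    have : 0 ≤ 9/2 * R0 ^ 2 * (n * (max Lam 0 * T ^ 2 * v)) := by positivity
    linarith
  · have e := I1 h.toMAS HJ.idd continuous_const (h.dct T 1) (h.cdct T 1) (hz 3 (by norm_num))
    have e2 := I1 h.toMAS h.dG h.cA (h.dct T 0) (h.cdct T 0) (hz 2 (by norm_num))
    have hi : ∀ x, (A x)⁻¹ * A x = 1 := fun x => Matrix.nonsing_inv_mul _ (isUnit_iff_ne_zero.2 (h.dp x).ne')
    simp only [Nat.cast_zero, Nat.cast_one, zero_add, inner_smul_right, mul_one, hi, trace_one, Fintype.card_fin] at e e2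
    have hn2 : ((1:ℝ)+2) = 3 := by norm_num
    norm_num [hn2] at e e2
    have s1 : ∫ x, (A x).det * (ct T u 3 x * ((A x)⁻¹).trace) = ∫ x, (A x).det * (3 * ct T u 2 x * ⟪TM (A x)⁻¹ x, G x⟫) := by
      rw [← sub_eq_zero, ← integral_sub (hIg (by fun_prop) fun x hx => by simp [hz 3 _ x hx]) (hIg (by fun_prop) fun x hx => by simp [hz 2 _ x hx]), ← e]
      congr 1; ext x; ring
    have s2 : ∫ x, (A x).det * (2 * ct T u 1 x * ⟪TM (A x)⁻¹ (G x), G x⟫) = ∫ x, (A x).det * (ct T u 2 x * n) := by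
      rw [eq_comm, ← sub_eq_zero, ← integral_sub (hIg (by fun_prop) fun x hx => by simp [hz 2 _ x hx]) (hIg (by fun_prop) fun x hx => by simp [hz 1 _ x hx]), ← e2]
      congr 1; ext x; ring
    have s3 : ∫ x, (A x).det * (ct T u 2 x * n) ≤ n * (max Lam 0 * T ^ 2 * v) := by
      rw [gi (R := R0) fun x hx => by simp [hz 2 _ x hx]]
      refine (cb' (C := max Lam 0 * (T^2 * n)) (by fun_prop) fun x hx => ?_).trans_eq (by ring)
      have := ct_le hT0.le h 2 x
      have := (h.hi x).trans (le_max_left Lam 0)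
      have := ct0 T u 2 x
      gcongr
    have s4 : ∫ x, (A x).det * (3 * ct T u 2 x * ⟪TM (A x)⁻¹ x, G x⟫) ≤
        ∫ x, (1/2 * ((A x).det * (ct T u 3 x * ((A x)⁻¹).trace)) + 9/4 * R0^2 * ((A x).det * (2 * ct T u 1 x * ⟪TM (A x)⁻¹ (G x), G x⟫))) := by
      refine integral_mono (hIg (by fun_prop) fun x hx => by simp [hz 2 _ x hx])
        (hIg (by fun_prop) fun x hx => by simp [hz 3 _ x hx, hz 1 _ x hx]) fun x => ?_
      rcases le_total R0 ‖x‖ with hx | hx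
      · simp [hz 1 _ x hx, hz 2 _ x hx, hz 3 _ x hx]
      have q := psd_nonneg (h.pA x).inv.posSemidef ((max (T - u x) 0) • x - (3 * R0^2) • G x)
      have q2 := quad_le_trace (h.pA x).inv.posSemidef x
      have q3 : ((A x)⁻¹).trace * ‖x‖^2 ≤ ((A x)⁻¹).trace * R0^2 := by have := tri0 x; gcongr
      have sy : ⟪TM (A x)⁻¹ (G x), x⟫ = ⟪TM (A x)⁻¹ x, G x⟫ := by
        rw [inner_TM_symm (h.pA x).inv.isHermitian, real_inner_comm]
      simp only [map_sub, map_smul, inner_sub_left, inner_sub_right, inner_smul_left, inner_smul_right, conj_trivial, sy] at q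
      have hg0 := (h.dp x)
      simp only [ct]
      set m := max (T - u x) 0
      have hm : 0 ≤ m := le_max_right _ _
      have : 6 * R0^2 * m * ⟪TM (A x)⁻¹ x, G x⟫ ≤ m^2 * (((A x)⁻¹).trace * R0^2) + 9 * R0^4 * ⟪TM (A x)⁻¹ (G x), G x⟫ := by
        nlinarith [mul_le_mul_of_nonneg_left (q2.trans q3) (sq_nonneg m)]
      have h5 : R0^2 * (6 * m * ⟪TM (A x)⁻¹ x, G x⟫) ≤ R0^2 * (m^2 * ((A x)⁻¹).trace + 9 * R0^2 * ⟪TM (A x)⁻¹ (G x), G x⟫) := by linarith only [this]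
      have h6 := le_of_mul_le_mul_left h5 (by positivity)
      have h7 := mul_le_mul_of_nonneg_left h6 (by positivity : 0 ≤ m * (A x).det / 2)
      rw [pow_one]
      linarith only [h7]
    rw [integral_add (hIg (by fun_prop) fun x hx => by simp [hz 3 _ x hx]) (hIg (by fun_prop) fun x hx => by simp [hz 1 _ x hx]),
      integral_const_mul, integral_const_mul, ← s1, s2] at s4
    have h1 : ∫ x in closedBall 0 R, (A x).det * ((A x)⁻¹).trace ≤ ∫ x, (A x).det * (ct T u 3 x * ((A x)⁻¹).trace) :=
      hex (cg.mul ctri) (by fun_prop) (fun x => mul_nonneg (h.dp x).le (mul_nonneg (ct0 _ _ _ _) (tri0 x))) (fun x hx => by simp [hz 3 _ x hx])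
        fun x hx => mul_le_mul_of_nonneg_left (le_mul_of_one_le_left (tri0 x) (hge _ x hx)) (h.dp x).le
    have : 0 ≤ 2 * T * L ^ 2 * v := by positivity
    have : 9/4 * R0^2 * (∫ x, (A x).det * (ct T u 2 x * n)) ≤ 9/4 * R0^2 * (n * (max Lam 0 * T ^ 2 * v)) := by gcongr
    linarith
end gb


structure SQ {n : ℕ} (lam Lam c0 : ℝ) (K : ℝ → ℝ) (u : ℕ → EE n → ℝ) (G : ℕ → EE n → EE n) (A : ℕ → EE n → MM n) : Prop where
  l0 : 0 < lam
  cp : 0 < c0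
  K0 : ∀ R, 0 < K R
  mz : ∀ k, MZ lam Lam (u k) (G k) (A k)
  gr : ∀ k, GRW K c0 (u k)
  d0 : ∀ R, Tendsto (fun k => ∫ x in closedBall 0 R, dd (G k) (A k) x) atTop (𝓝 0)
  g0 : ∀ R, Tendsto (fun k => ∫ x in closedBall 0 R, |(A k x).det - 1|) atTop (𝓝 0)

lemma sq0 {I D : ℕ → ℝ} {C : ℝ} (h0 : ∀ k, 0 ≤ I k) (h : ∀ k, I k ^ 2 ≤ C * D k) (hD : Tendsto D atTop (𝓝 0)) :
    Tendsto I atTop (𝓝 0) := by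
  refine squeeze_zero h0 (fun k => (Real.le_sqrt (h0 k) ((sq_nonneg _).trans (h k))).2 (h k)) ?_
  simpa using (hD.const_mul C).sqrt

section sq
variable {n : ℕ} {u : ℕ → EE n → ℝ} {G : ℕ → EE n → EE n} {A : ℕ → EE n → MM n} {lam Lam c0 : ℝ} {K : ℝ → ℝ}

lemma sqrt_sub_one {g : ℝ} (hg : 0 < g) : |√g - 1| ≤ |g - 1| := by
  have h1 := Real.sqrt_nonneg g
  have : g - 1 = (√g - 1) * (√g + 1) := by nlinarith [Real.sq_sqrt hg.le]
  rw [this, abs_mul]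
  exact le_mul_of_one_le_right (abs_nonneg _) (by rw [abs_of_pos (by linarith)]; linarith)

lemma SQ.e1 (h : SQ lam Lam c0 K u G A) (R : ℝ) :
    Tendsto (fun k => ∫ x in closedBall 0 R, ‖TM (A k x) x - G k x‖) atTop (𝓝 0) := by
  obtain ⟨C, hC, hB⟩ := B1 (n := n) (Lam := Lam) h.l0 h.cp h.K0 R
  have ce : ∀ k, Continuous (eta (G k) (A k)) := fun k =>
    ((h.mz k).cg.sqrt.smul (h.mz k).cG).sub (cont_TM (h.mz k).cA continuous_id)
  have h1 : Tendsto (fun k => ∫ x in closedBall 0 R, ‖eta (G k) (A k) x‖) atTop (𝓝 0) := by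
    refine sq0 (C := C) (fun k => bnn (fun x => norm_nonneg _) _ _) (fun k => ?_) (h.d0 R)
    have := cs (f := fun x => ‖eta (G k) (A k) x‖) (ce k).norm (h.mz k).cA.matrix_trace (h.mz k).cdd 0 R
      (fun x => ((h.mz k).pA x).posSemidef.trace_nonneg) (h.mz k).dd_nonneg (fun x => by
        have := normsq_TM_le ((h.mz k).pA x).posSemidef (TM (A k x)⁻¹ (eta (G k) (A k) x))
        rwa [TM_inv ((h.mz k).dp x), real_inner_comm] at this)
    simp only [abs_norm] at this
    exact this.trans (mul_le_mul_of_nonneg_right (hB _ _ _ (h.mz k) (h.gr k)).1 (bnn (h.mz k).dd_nonneg _ _))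
  have h2 := h1.add ((h.g0 R).mul_const (K (R+1)))
  rw [zero_mul, add_zero] at h2
  refine squeeze_zero (fun k => bnn (fun x => norm_nonneg _) _ _) (fun k => ?_) h2
  have cg := (h.mz k).cg
  have cA := cont_TM (h.mz k).cA continuous_id
  have cG := (h.mz k).cG
  have ce := ce k
  rw [← integral_mul_const, ← integral_add (ib (by fun_prop) _ _) (ib (by fun_prop) _ _)]
  simp only [id] at cA
  refine cb (by fun_prop) (by fun_prop) fun x hx => ?_
  have e : TM (A k x) x - G k x = (√(A k x).det - 1) • G k x - eta (G k) (A k) x := by unfold eta; module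
  rw [e]
  refine (norm_sub_le _ _).trans ?_
  rw [norm_smul, Real.norm_eq_abs, add_comm]
  have := sqrt_sub_one ((h.mz k).dp x)
  gcongr
  exact (h.mz k).Gle (h.gr k) (by rwa [sub_zero] at hx)

lemma SQ.e2 (h : SQ lam Lam c0 K u G A) (R : ℝ) :
    Tendsto (fun k => ∫ x in closedBall 0 R, ‖(A k x).det • TM (A k x)⁻¹ (G k x) - x‖) atTop (𝓝 0) := by
  obtain ⟨C, hC, hB⟩ := B1 (n := n) (Lam := Lam) h.l0 h.cp h.K0 R
  have ce : ∀ k, Continuous (fun x => √(A k x).det • TM (A k x)⁻¹ (eta (G k) (A k) x)) := fun k =>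
    (h.mz k).cg.sqrt.smul (cont_TM (h.mz k).cinv (((h.mz k).cg.sqrt.smul (h.mz k).cG).sub (cont_TM (h.mz k).cA continuous_id)))
  have h1 : Tendsto (fun k => ∫ x in closedBall 0 R, ‖√(A k x).det • TM (A k x)⁻¹ (eta (G k) (A k) x)‖) atTop (𝓝 0) := by
    refine sq0 (C := C) (fun k => bnn (fun x => norm_nonneg _) _ _) (fun k => ?_) (h.d0 R)
    have := cs (f := fun x => ‖√(A k x).det • TM (A k x)⁻¹ (eta (G k) (A k) x)‖) (ce k).norm
      (a := fun x => (A k x).det * ((A k x)⁻¹).trace) ((h.mz k).cg.mul (h.mz k).cinv.matrix_trace) (h.mz k).cdd 0 R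
      (fun x => mul_nonneg ((h.mz k).dp x).le ((h.mz k).pA x).inv.posSemidef.trace_nonneg) (h.mz k).dd_nonneg (fun x => by
        have := normsq_TM_le ((h.mz k).pA x).inv.posSemidef (eta (G k) (A k) x)
        rw [norm_smul, mul_pow, Real.norm_eq_abs, sq_abs, Real.sq_sqrt ((h.mz k).dp x).le, mul_assoc]
        exact mul_le_mul_of_nonneg_left this ((h.mz k).dp x).le)
    simp only [abs_norm] at this
    exact this.trans (mul_le_mul_of_nonneg_right (hB _ _ _ (h.mz k) (h.gr k)).2 (bnn (h.mz k).dd_nonneg _ _))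
  have h2 := h1.add ((h.g0 R).mul_const R)
  rw [zero_mul, add_zero] at h2
  refine squeeze_zero (fun k => bnn (fun x => norm_nonneg _) _ _) (fun k => ?_) h2
  have cg := (h.mz k).cg
  have cA := cont_TM (h.mz k).cinv (h.mz k).cG
  have ce := ce k
  rw [← integral_mul_const, ← integral_add (ib (by fun_prop) _ _) (ib (by fun_prop) _ _)]
  refine cb (by fun_prop) (by fun_prop) fun x hx => ?_
  have e : (A k x).det • TM (A k x)⁻¹ (G k x) - x = √(A k x).det • TM (A k x)⁻¹ (eta (G k) (A k) x) + (√(A k x).det - 1) • x := by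
    unfold eta
    rw [map_sub, map_smul, TM_inv' ((h.mz k).dp x), smul_sub, smul_smul, Real.mul_self_sqrt ((h.mz k).dp x).le]; module
  rw [e]
  refine (norm_add_le _ _).trans ?_
  rw [norm_smul (√(A k x).det - 1), Real.norm_eq_abs]
  have := sqrt_sub_one ((h.mz k).dp x)
  gcongr
  rwa [sub_zero] at hx

lemma covA {f : EE n → ℝ} (hf : Continuous f) (f0 : ∀ x, 0 ≤ f x) {s c R r : ℝ} (hs : 0 < s) (hc : s ≤ c) (hc1 : c ≤ 1) {w : EE n}
    (hw : ‖w‖ ≤ r) : ∫ x in closedBall 0 R, f (c • x + w) ≤ s⁻¹ ^ n * ∫ x in closedBall 0 (R + r), f x := by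
  have hc0 : 0 < c := hs.trans_le hc
  have h1 := integral_image_eq_integral_abs_det_fderiv_smul volume (s := closedBall (0 : EE n) R) (f := fun x => c • x + w)
    isClosed_closedBall.measurableSet (f' := fun _ => TM (c • (1 : MM n)))
    (fun x _ => by
      have := ((TM (c • (1 : MM n))).hasFDerivAt (x := x)).add_const w
      simpa using this.hasFDerivWithinAt)
    (fun x _ y _ e => smul_right_injective _ hc0.ne' (add_right_cancel e)) f
  have hd : (TM (c • (1 : MM n))).det = c ^ n := (TM_det _).trans (by simp [det_smul])
  simp only [hd, smul_eq_mul] at h1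
  rw [integral_const_mul, abs_of_pos (by positivity)] at h1
  have h2 : ∫ x in closedBall 0 R, f (c • x + w) = c⁻¹ ^ n * ∫ x in (fun x : EE n => c • x + w) '' closedBall 0 R, f x := by
    rw [h1, ← mul_assoc, ← mul_pow, inv_mul_cancel₀ hc0.ne', one_pow, one_mul]
  rw [h2]
  have h3 : ∫ x in (fun x : EE n => c • x + w) '' closedBall 0 R, f x ≤ ∫ x in closedBall 0 (R + r), f x := by
    refine setIntegral_mono_set (ib hf _ _) (ae_of_all _ f0) (LE.le.eventuallyLE ?_)
    rintro _ ⟨x, hx, rfl⟩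
    simp only [mem_closedBall, dist_zero_right] at hx ⊢
    have : ‖c • x‖ ≤ R := by
      rw [norm_smul, Real.norm_eq_abs, abs_of_pos hc0]
      exact (mul_le_of_le_one_left (norm_nonneg _) hc1).trans hx
    exact (norm_add_le _ _).trans (by linarith)
  have h4 : c⁻¹ ≤ s⁻¹ := inv_anti₀ hs hc
  have h5 := bnn f0 (0 : EE n) (R + r)
  calc _ ≤ c⁻¹ ^ n * ∫ x in closedBall 0 (R + r), f x := by gcongr
    _ ≤ _ := by gcongr

lemma LL {z : EE n → ℝ} {q : EE n → EE n} (hz : HG z q) (cq : Continuous q) {k : EE n → ℝ} (ck : Continuous k) {C R s : ℝ}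
    (hk : ∀ x, |k x| ≤ C) (hR : 0 ≤ R) (hs : 0 < s) (hs1 : s ≤ 1) (h : EE n) :
    |∫ x in closedBall 0 R, k x * (z (x + h) - z (s • x))| ≤ C * (R + ‖h‖) * (s⁻¹ ^ n * ∫ x in closedBall 0 (R + ‖h‖), ‖q x‖) := by
  have cz := hz.cont
  have C0 : 0 ≤ C := (abs_nonneg _).trans (hk 0)
  set m : ℝ → ℝ := fun t => ∫ x in closedBall 0 R, k x * z (s • x + t • ((1 - s) • x + h)) with hm
  set m' : ℝ → ℝ := fun t => ∫ x in closedBall 0 R, k x * ⟪q (s • x + t • ((1 - s) • x + h)), (1 - s) • x + h⟫ with hm'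
  have hd : ∀ t ∈ Icc (0:ℝ) 1, HasDerivAt m (m' t) t := fun t ht =>
    deriv_int (isCompact_closedBall 0 R) (a := -1) (b := 2) ⟨by linarith [ht.1], by linarith [ht.2]⟩
      (by unfold Function.uncurry; fun_prop) (by unfold Function.uncurry; fun_prop)
      fun t _ x _ => (hz.line (s • x) ((1 - s) • x + h) t).const_mul (k x)
  have hb : ∀ t ∈ Ico (0:ℝ) 1, ‖m' t‖ ≤ C * (R + ‖h‖) * (s⁻¹ ^ n * ∫ x in closedBall 0 (R + ‖h‖), ‖q x‖) := by
    intro t ht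
    have e : ∀ x : EE n, s • x + t • ((1 - s) • x + h) = (s + t * (1 - s)) • x + t • h := fun x => by module
    have h1 := covA (f := fun x => ‖q x‖) cq.norm (fun x => norm_nonneg _) (R := R) (c := s + t * (1 - s)) hs
      (by nlinarith [ht.1]) (by nlinarith [ht.2]) (w := t • h) (r := ‖h‖) (by
        rw [norm_smul, Real.norm_eq_abs, abs_of_nonneg ht.1]; exact mul_le_of_le_one_left (norm_nonneg _) ht.2.le)
    refine le_trans ?_ (mul_le_mul_of_nonneg_left h1 (by positivity))
    rw [← integral_const_mul]
    refine (norm_integral_le_integral_norm _).trans (cb (by fun_prop) (by fun_prop) fun x hx => ?_)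
    rw [sub_zero] at hx
    rw [norm_mul, ← e, mul_assoc]
    refine mul_le_mul (hk x) ?_ (norm_nonneg _) C0
    refine (norm_inner_le_norm _ _).trans ?_
    rw [mul_comm]
    refine mul_le_mul_of_nonneg_right ((norm_add_le _ _).trans ?_) (norm_nonneg _)
    rw [norm_smul, Real.norm_eq_abs, abs_of_nonneg (by linarith)]
    have : (1 - s) * ‖x‖ ≤ ‖x‖ := mul_le_of_le_one_left (norm_nonneg _) (by linarith)
    linarith
  have := norm_image_sub_le_of_norm_deriv_le_segment_01' (fun t ht => (hd t ht).hasDerivWithinAt) hb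
  have e2 : m 1 - m 0 = ∫ x in closedBall 0 R, k x * (z (x + h) - z (s • x)) := by
    simp only [hm]
    rw [← integral_sub (ib (by fun_prop) _ _) (ib (by fun_prop) _ _)]
    congr 1; ext x
    have a1 : s • x + (1:ℝ) • ((1 - s) • x + h) = x + h := by module
    have a2 : s • x + (0:ℝ) • ((1 - s) • x + h) = s • x := by module
    rw [a1, a2]; ring
  rwa [e2] at this

lemma third {m0 m1 m2 m3 : ℝ → ℝ} {B : ℝ} (h0 : ∀ t, HasDerivAt m0 (m1 t) t) (h1 : ∀ t, HasDerivAt m1 (m2 t) t)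
    (h2 : ∀ t, HasDerivAt m2 (m3 t) t) (hB : ∀ t, |t| ≤ 1 → |m3 t| ≤ B) :
    |2 * (m0 1 + m0 (-1) - 2 * m0 0) - (m1 1 - m1 (-1))| ≤ 2 * B := by
  have hn : ∀ (f f' : ℝ → ℝ) t, (∀ t, HasDerivAt f (f' t) t) → HasDerivAt (fun t => f (-t)) (-f' (-t)) t := fun f f' t hf => by
    exact ((hf (-t)).comp t (hasDerivAt_neg t)).congr_deriv (by ring)
  have B0 : 0 ≤ B := (abs_nonneg _).trans (hB 0 (by simp))
  have d1 : ∀ t, HasDerivAt (fun t => (m1 t - m1 (-t)) - t * (m2 t + m2 (-t))) (-(t * (m3 t - m3 (-t)))) t := fun t => by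
    have := ((h1 t).sub (hn _ _ t h1)).sub ((hasDerivAt_id t).mul ((h2 t).add (hn _ _ t h2)))
    exact this.congr_deriv (by simp only [Pi.add_apply, Pi.sub_apply, id]; ring)
  have d0 : ∀ t, HasDerivAt (fun t => 2 * (m0 t + m0 (-t) - 2 * m0 0) - t * (m1 t - m1 (-t)))
      ((m1 t - m1 (-t)) - t * (m2 t + m2 (-t))) t := fun t => by
    have := ((((h0 t).add (hn _ _ t h0)).sub_const (2 * m0 0)).const_mul 2).sub ((hasDerivAt_id t).mul ((h1 t).sub (hn _ _ t h1)))
    exact this.congr_deriv (by simp only [Pi.add_apply, Pi.sub_apply, id]; ring)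
  have b1 : ∀ t ∈ Icc (0:ℝ) 1, |(m1 t - m1 (-t)) - t * (m2 t + m2 (-t))| ≤ 2 * B := fun t ht => by
    have := norm_image_sub_le_of_norm_deriv_le_segment' (a := 0) (b := 1) (C := 2 * B) (fun t _ => (d1 t).hasDerivWithinAt) (fun s hs => by
      rw [norm_neg, norm_mul, Real.norm_eq_abs, Real.norm_eq_abs, abs_of_nonneg hs.1]
      refine (mul_le_of_le_one_left (abs_nonneg _) hs.2.le).trans ((abs_sub _ _).trans ?_)
      have := abs_of_nonneg hs.1
      linarith [hB s (by linarith [hs.2]), hB (-s) (by rw [abs_neg]; linarith [hs.2])]) t ht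
    simp at this
    refine this.trans ?_
    nlinarith [ht.2]
  have := norm_image_sub_le_of_norm_deriv_le_segment_01' (fun t _ => (d0 t).hasDerivWithinAt) (fun t ht => b1 t ⟨ht.1, ht.2.le⟩)
  simp at this
  convert this using 2
  ring
end sq


section s2a
variable {n : ℕ} {u : EE n → ℝ} {G : EE n → EE n} {A : EE n → MM n} {lam Lam c0 : ℝ} {K : ℝ → ℝ}

lemma ca {f g : EE n → ℝ} {x0 : EE n} {R : ℝ} (hf : Continuous f) (hg : Continuous g) (h : ∀ x, ‖x - x0‖ ≤ R → |f x| ≤ g x) :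
    |∫ x in closedBall x0 R, f x| ≤ ∫ x in closedBall x0 R, g x :=
  (norm_integral_le_integral_norm _).trans (cb hf.norm hg h)
lemma MAS.sh (h : MAS u G A) (v : EE n) : MAS (fun x => u (x + v)) (fun x => G (x + v)) (fun x => A (x + v)) := by
  have := h.aff (κ := 1) one_pos (P := 1) (by simp) v 0 0
  simpa [add_comm v] using this
lemma MAS.dGh (h : MAS u G A) (v : EE n) : HG (fun x => ⟪G x, v⟫) (fun x => TM (A x) v) := by
  have := HG.inner h.dG (HJ.cst v)
  simpa [pd_symm (h.pA _)] using this

set_option maxHeartbeats 2000000 in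
lemma mm3 (hl : 0 < lam) (hc : 0 < c0) (hK : ∀ R, 0 < K R) {T : ℝ} (hT : 0 < T) {R0 : ℝ} (hR0 : R0 = max (2 * √n) (T / c0)) :
    ∃ C, ∀ u G A, MZ (n := n) lam Lam u G A → GRW K c0 u → ∀ h : EE n, ‖h‖ ≤ 1 →
    |2 * ((∫ x in closedBall 0 R0, ct T u 3 x * u (x + h)) + (∫ x in closedBall 0 R0, ct T u 3 x * u (x - h)) -
        2 * ∫ x in closedBall 0 R0, ct T u 3 x * u x)
      - ((∫ x in closedBall 0 R0, ct T u 3 x * ⟪G (x + h), h⟫) - ∫ x in closedBall 0 R0, ct T u 3 x * ⟪G (x - h), h⟫)| ≤ C * ‖h‖ ^ 3 := by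
  obtain ⟨C, hC, hB⟩ := B1 (n := n) (Lam := Lam) hl hc hK R0
  set v := volume.real (closedBall (0 : EE n) R0) with hv
  set L := K (R0 + 2) with hL
  have L0 : 0 < L := hK _
  refine ⟨2 * (3 * (T ^ 2 * L * C + 2 * T * L ^ 3 * v)), fun u G A hu hg h hh => ?_⟩
  have hR00 : 0 ≤ R0 := by rw [hR0]; exact le_max_of_le_right (by positivity)
  have hz : ∀ j, j ≠ 0 → ∀ x, R0 ≤ ‖x‖ → ct T u j x = 0 := fun j hj x hx => ct_zero hj (hg.rad hc (hR0 ▸ hx))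
  have c1 := hu.cct T 1
  have c2 := hu.cct T 2
  have c3 := hu.cct T 3
  have cu := hu.cu
  have cG := hu.cG
  have cA := hu.cA
  have sh := fun t : ℝ => hu.toMAS.sh (t • h)
  have cAh : Continuous fun x => TM (A x) h := cont_TM cA continuous_const
  have cp : ∀ t : ℝ, Continuous fun x => TM (A (x + t • h)) h := fun t => cont_TM (sh t).cA continuous_const
  have cq : ∀ t : ℝ, Continuous fun x => G (x + t • h) := fun t => (sh t).cG
  have hGL : ∀ t : ℝ, |t| ≤ 1 → ∀ x : EE n, ‖x‖ ≤ R0 → |⟪G (x + t • h), h⟫| ≤ L * ‖h‖ := fun t ht x hx => by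
    have : ‖t • h‖ ≤ 1 := by rw [norm_smul]; exact mul_le_one₀ ht (norm_nonneg _) hh
    have h1 := hu.Gle hg (x := x + t • h) (R := R0 + 1) ((norm_add_le _ _).trans (by linarith))
    rw [show R0 + 1 + 1 = R0 + 2 by ring] at h1
    exact (abs_real_inner_le_norm _ _).trans (by gcongr)
  set m0 : ℝ → ℝ := fun t => ∫ x in closedBall 0 R0, ct T u 3 x * u (x + t • h) with hm0
  set m1 : ℝ → ℝ := fun t => ∫ x in closedBall 0 R0, ct T u 3 x * ⟪G (x + t • h), h⟫ with hm1
  set m2 : ℝ → ℝ := fun t => ∫ x in closedBall 0 R0, 3 * ct T u 2 x * ⟪G x, h⟫ * ⟪G (x + t • h), h⟫ with hm2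
  set m3 : ℝ → ℝ := fun t => ∫ x in closedBall 0 R0, 3 * ct T u 2 x * ⟪G x, h⟫ * ⟪TM (A (x + t • h)) h, h⟫ with hm3
  have ch : Continuous fun z : ℝ × EE n => z.2 + z.1 • h := continuous_snd.add (continuous_fst.smul continuous_const)
  have cAA : Continuous fun z : ℝ × EE n => TM (A (z.2 + z.1 • h)) h := cont_TM (cA.comp ch) continuous_const
  have cGG : Continuous fun z : ℝ × EE n => G (z.2 + z.1 • h) := cG.comp ch
  have s3 : Continuous fun z : ℝ × EE n => ct T u 3 z.2 := c3.comp continuous_snd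
  have s2 : Continuous fun z : ℝ × EE n => 3 * ct T u 2 z.2 * ⟪G z.2, h⟫ := (continuous_const.mul (c2.comp continuous_snd)).mul ((cG.comp continuous_snd).inner continuous_const)
  have d0 : ∀ t, HasDerivAt m0 (m1 t) t := fun t =>
    deriv_int (isCompact_closedBall 0 R0) (a := t - 1) (b := t + 1) ⟨by linarith, by linarith⟩
      (s3.mul (cu.comp ch)).continuousOn (s3.mul (cGG.inner continuous_const)).continuousOn
      fun t _ x _ => (hu.du.line x h t).const_mul _
  have d1 : ∀ t, HasDerivAt m1 (m2 t) t := fun t => by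
    have e := I2 (HJ.smul ((sh t).dGh h) (HJ.cst h)) (by simp only [smul_zero, zero_add]; exact contvv continuous_const (cp t))
      (hu.dct T 1) (hu.cdct T 1) (hz 3 (by norm_num))
    have e2 : (∫ x in closedBall 0 R0, ct T u 3 x * ⟪TM (A (x + t • h)) h, h⟫) = m2 t := by
      rw [gi (R := R0) fun x hx => by simp [hz 2 _ x hx, hz 3 _ x hx]] at e
      rw [← sub_eq_zero, hm2, ← integral_sub (ib (by have := cp t; fun_prop) _ _) (ib (by have := cq t; fun_prop) _ _), ← e]
      congr 1; ext x
      simp only [smul_zero, zero_add, trace_vv, inner_smul_left, inner_smul_right, conj_trivial]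
      rw [real_inner_comm h (TM _ h), real_inner_comm h (G x)]; push_cast; ring
    rw [← e2]
    exact deriv_int (isCompact_closedBall 0 R0) (a := t - 1) (b := t + 1) ⟨by linarith, by linarith⟩
      (s3.mul (cGG.inner continuous_const)).continuousOn (s3.mul (cAA.inner continuous_const)).continuousOn
      fun t _ x _ => (hu.dG.line' x h h t).const_mul _
  have d2 : ∀ t, HasDerivAt m2 (m3 t) t := fun t =>
    deriv_int (isCompact_closedBall 0 R0) (a := t - 1) (b := t + 1) ⟨by linarith, by linarith⟩
      (s2.mul (cGG.inner continuous_const)).continuousOn (s2.mul (cAA.inner continuous_const)).continuousOn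
      fun t _ x _ => (hu.dG.line' x h h t).const_mul _
  have hb : ∀ t, |t| ≤ 1 → |m3 t| ≤ 3 * (T ^ 2 * L * C + 2 * T * L ^ 3 * v) * ‖h‖ ^ 3 := fun t ht => by
    have e := I2 (HJ.smul (hu.dGh h) (HJ.smul ((sh t).dGh h) (HJ.cst h)))
      (by
        simp only [smul_zero, zero_add]
        have := contvv (continuous_const (y := h)) (cp t)
        have := contvv (show Continuous fun x => ⟪G (x + t • h), h⟫ • h by have := cq t; fun_prop) cAh
        fun_prop)
      (hu.dct T 0) (hu.cdct T 0) (hz 2 (by norm_num))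
    rw [gi (R := R0) fun x hx => by simp [hz 1 _ x hx, hz 2 _ x hx]] at e
    have e2 : m3 t = ∫ x in closedBall 0 R0, (3 * (2 * ct T u 1 x * ⟪G x, h⟫ * ⟪G x, h⟫ * ⟪G (x + t • h), h⟫ - ct T u 2 x * ⟪G (x + t • h), h⟫ * ⟪TM (A x) h, h⟫)) := by
      have := cp t
      have := cq t
      rw [← sub_eq_zero, hm3, ← integral_sub (ib (by fun_prop) _ _) (ib (by fun_prop) _ _)]
      have e3 := congrArg (3 * ·) e
      simp only [mul_zero] at e3
      rw [← e3, ← integral_const_mul]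
      congr 1; ext x
      simp only [smul_zero, zero_add, trace_add, trace_smul, trace_vv, inner_smul_left, inner_smul_right, conj_trivial, smul_eq_mul]
      rw [real_inner_comm h (TM (A (x + t • h)) h), real_inner_comm h (TM (A x) h), real_inner_comm h (G x)]; push_cast; ring
    have e4 : 3 * (T ^ 2 * L * C + 2 * T * L ^ 3 * v) * ‖h‖ ^ 3 ≥ ∫ x in closedBall 0 R0, (3 * (2 * T * L^3 * ‖h‖^3 + T^2 * L * ‖h‖^3 * (A x).trace)) := by
      have := hu.cA.matrix_trace
      rw [integral_const_mul, integral_add (ib (by fun_prop) _ _) (ib (by fun_prop) _ _), integral_const, integral_const_mul (T ^ 2 * L * ‖h‖ ^ 3)]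
      simp only [measureReal_restrict_apply_univ, smul_eq_mul, ← hv]
      have := mul_le_mul_of_nonneg_left (hB u G A hu hg).1 (by positivity : 0 ≤ T^2 * L * ‖h‖^3)
      linarith
    rw [e2]
    refine le_trans ?_ e4
    refine ca ?_ ?_ fun x hx => ?_
    · have := cp t
      have := cq t
      fun_prop
    · have := hu.cA.matrix_trace
      fun_prop
    rw [sub_zero] at hx
    rw [abs_mul, abs_of_pos (by norm_num : (0:ℝ) < 3)]
    refine mul_le_mul_of_nonneg_left ((abs_sub _ _).trans ?_) (by norm_num)
    simp only [abs_mul, abs_of_nonneg (ct0 T u _ x), abs_of_pos (by norm_num : (0:ℝ) < 2)]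
    have g1 := hGL t ht x hx
    have g2 := hGL 0 (by simp) x hx
    rw [zero_smul, add_zero] at g2
    have k1 := ct_le hT.le hu 1 x
    have k2 := ct_le hT.le hu 2 x
    rw [pow_one] at k1
    have q0 := psd_nonneg (hu.pA x).posSemidef h
    have q := quad_le_trace (hu.pA x).posSemidef h
    rw [abs_of_nonneg q0]
    refine add_le_add ?_ ?_
    · calc _ ≤ 2 * T * (L * ‖h‖) * (L * ‖h‖) * (L * ‖h‖) := by have := ct0 T u 1 x; gcongr
        _ = _ := by ring
    · calc _ ≤ T ^ 2 * (L * ‖h‖) * ((A x).trace * ‖h‖^2) := by have := ct0 T u 2 x; gcongr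
        _ = _ := by ring
  have := third d0 d1 d2 hb
  simp only [hm0, hm1, one_smul, neg_smul, zero_smul, add_zero, ← sub_eq_add_neg] at this
  linarith
end s2a


noncomputable def DF {n : ℕ} (A : EE n → MM n) (h x : EE n) : ℝ :=
  ((A x)⁻¹ * A (x + h)).trace - n - Real.log ((A (x + h)).det / (A x).det)
noncomputable def er {n : ℕ} (G : EE n → EE n) (A : EE n → MM n) (R : ℝ) : ℝ :=
  (∫ x in closedBall 0 R, |(A x).det - 1|) + (∫ x in closedBall 0 R, ‖(A x).det • TM (A x)⁻¹ (G x) - x‖) +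
    ∫ x in closedBall 0 R, ‖TM (A x) x - G x‖

section s2b
variable {n : ℕ} {u : EE n → ℝ} {G : EE n → EE n} {A : EE n → MM n} {lam Lam c0 : ℝ} {K : ℝ → ℝ}

lemma SQ.er {u : ℕ → EE n → ℝ} {G : ℕ → EE n → EE n} {A : ℕ → EE n → MM n} (h : SQ lam Lam c0 K u G A) (R : ℝ) :
    Tendsto (fun k => er (G k) (A k) R) atTop (𝓝 0) := by
  unfold _root_.er; simpa using ((h.g0 R).add (h.e2 R)).add (h.e1 R)
lemma abs_log_le {lam g : ℝ} (hl : 0 < lam) (hg : lam ≤ g) : |Real.log g| ≤ (1 + lam⁻¹) * |g - 1| := by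
  have g0 : 0 < g := hl.trans_le hg
  have h1 := Real.log_le_sub_one_of_pos g0
  have h2 := Real.log_le_sub_one_of_pos (inv_pos.2 g0)
  rw [Real.log_inv] at h2
  have h3 : g⁻¹ - 1 ≤ lam⁻¹ * |g - 1| := by
    have : g⁻¹ - 1 = g⁻¹ * (1 - g) := by field_simp
    rw [this]
    calc _ ≤ g⁻¹ * |g - 1| := by gcongr; rw [abs_sub_comm]; exact le_abs_self _
      _ ≤ _ := by gcongr
  have h4 := le_abs_self (g - 1)
  have h5 : 0 ≤ lam⁻¹ * |g - 1| := by positivity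
  have h6 := abs_nonneg (g - 1)
  exact abs_le.2 ⟨by linarith, by linarith⟩
lemma MAS.DF0 (h : MAS u G A) (v x : EE n) : 0 ≤ DF A v x := by
  have := trace_ge (h.pA x) (h.pA (x + v)); unfold DF; linarith
lemma MAS.cDF (h : MAS u G A) (v : EE n) : Continuous (DF A v) := by
  have c0 := h.cinv
  have c1 := h.cg
  have c2 := (h.sh v).cg
  have c3 := (h.sh v).cA
  unfold DF
  refine ((Continuous.matrix_trace (c0.matrix_mul c3)).sub continuous_const).sub (Continuous.log (c2.div₀ c1 fun x => (h.dp x).ne') fun x => ?_)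
  exact (div_pos (h.dp _) (h.dp x)).ne'

set_option maxHeartbeats 2000000 in
lemma s2k (hl : 0 < lam) (hc : 0 < c0) (hK : ∀ R, 0 < K R) {T : ℝ} (hT : 0 < T) {R0 : ℝ} (hR0 : R0 = max (2 * √n) (T / c0)) :
    ∃ C > 0, ∀ u G A, MZ (n := n) lam Lam u G A → GRW K c0 u → ∀ h : EE n, ‖h‖ ≤ 1 →
      ∫ x in closedBall 0 R0, (A x).det * ct T u 4 x * DF A h x ≤ C * (‖h‖ ^ 3 + er G A (R0 + 1)) := by
  obtain ⟨C, hC⟩ := mm3 (n := n) (Lam := Lam) hl hc hK hT hR0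
  set c1 := 1 + lam⁻¹ with hc1
  have c10 : 0 < c1 := by positivity
  set L := K (R0 + 2) with hL
  have L0 : 0 < L := hK _
  have hR00 : 0 ≤ R0 := by rw [hR0]; exact le_max_of_le_right (by positivity)
  refine ⟨4 * |C| + |Lam| * T ^ 4 * c1 * 4 + 16 * T ^ 3 * L + 8 * T ^ 3 * (R0 + 1) + 1, by positivity, fun u G A hu hg h hh => ?_⟩
  have hLam : 0 ≤ |Lam| := abs_nonneg _
  have C3 := hC u G A hu hg h hh
  have hz : ∀ j, j ≠ 0 → ∀ x, R0 ≤ ‖x‖ → ct T u j x = 0 := fun j hj x hx => ct_zero hj (hg.rad hc (hR0 ▸ hx))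
  have k3 := hu.cct T 3
  have k4 := hu.cct T 4
  have cu := hu.cu
  have cG := hu.cG
  have cA := hu.cA
  have cg := hu.cg
  have ci := hu.cinv
  have ciG := cont_TM hu.cinv hu.cG
  have cAx := cont_TM hu.cA continuous_id
  simp only [id] at cAx
  have cDF := hu.cDF h
  have sp := hu.toMAS.sh h
  have sm := hu.toMAS.sh (-h)
  simp only [← sub_eq_add_neg] at sm
  have cgp := sp.cg
  have cgm := sm.cg
  -- identity
  set p : EE n → EE n := fun x => G (x + h) + G (x - h) - (2:ℝ) • G x with hp
  have cp : Continuous p := by fun_prop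
  have cN : Continuous fun x => A (x + h) + A (x - h) - (2:ℝ) • A x := by fun_prop
  have e := I1 hu.toMAS ((sp.dG.add sm.dG).sub (hu.dG.cmul 2)) cN (hu.dct T 2) (hu.cdct T 2) (hz 4 (by norm_num))
  rw [gi (R := R0) fun x hx => by simp [hz 3 _ x hx, hz 4 _ x hx]] at e
  have ctr : Continuous fun x => ((A x)⁻¹ * (A (x + h) + A (x - h) - (2:ℝ) • A x)).trace := (ci.mul cN).matrix_trace
  have e1 : (∫ x in closedBall 0 R0, (A x).det * ct T u 4 x * ((A x)⁻¹ * (A (x + h) + A (x - h) - (2:ℝ) • A x)).trace)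
      = ∫ x in closedBall 0 R0, 4 * ct T u 3 x * ⟪p x, (A x).det • TM (A x)⁻¹ (G x)⟫ := by
    rw [← sub_eq_zero, ← integral_sub (ib (by fun_prop) _ _) (ib (by fun_prop) _ _), ← e]
    congr 1; ext x
    simp only [inner_smul_right]
    rw [inner_TM_symm (hu.pA x).inv.isHermitian]; push_cast; ring
  have gb : ∀ x : EE n, ‖x‖ ≤ R0 → ‖p x‖ ≤ 4 * L := fun x hx => by
    have f1 : ∀ w : EE n, ‖w‖ ≤ 1 → ‖G (x + w)‖ ≤ L := fun w hw => by
      have := hu.Gle hg (x := x + w) (R := R0 + 1) ((norm_add_le _ _).trans (by linarith only [hx, hw]))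
      rwa [show R0 + 1 + 1 = R0 + 2 by ring] at this
    have a1 := f1 h hh
    have a2 := f1 (-h) (by rwa [norm_neg])
    have a3 := f1 0 (by simp)
    rw [add_zero] at a3
    rw [← sub_eq_add_neg] at a2
    calc _ ≤ ‖G (x + h)‖ + ‖G (x - h)‖ + ‖(2:ℝ) • G x‖ := (norm_sub_le _ _).trans (add_le_add_left (norm_add_le _ _) _)
      _ ≤ 4 * L := by rw [norm_smul, Real.norm_two]; linarith only [a1, a2, a3]
  have e2 : (∫ x in closedBall 0 R0, 4 * ct T u 3 x * ⟪p x, (A x).det • TM (A x)⁻¹ (G x)⟫) ≤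
      4 * (∫ x in closedBall 0 R0, ct T u 3 x * ⟪p x, x⟫) + 16 * T ^ 3 * L * ∫ x in closedBall 0 R0, ‖(A x).det • TM (A x)⁻¹ (G x) - x‖ := by
    rw [← integral_const_mul, ← integral_const_mul, ← integral_add (ib (by fun_prop) _ _) (ib (by fun_prop) _ _)]
    refine cb (by fun_prop) (by fun_prop) fun x hx => ?_
    rw [sub_zero] at hx
    have := real_inner_le_norm (p x) ((A x).det • TM (A x)⁻¹ (G x) - x)
    rw [inner_sub_right] at this
    have k0 := ct0 T u 3 x
    have f1 : ct T u 3 x * (⟪p x, (A x).det • TM (A x)⁻¹ (G x)⟫ - ⟪p x, x⟫) ≤ T ^ 3 * (4 * L * ‖(A x).det • TM (A x)⁻¹ (G x) - x‖) :=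
      calc _ ≤ ct T u 3 x * (‖p x‖ * ‖(A x).det • TM (A x)⁻¹ (G x) - x‖) := by gcongr
        _ ≤ _ := by have := ct_le hT.le hu 3 x; have := gb x hx; gcongr
    linarith only [f1]
  -- zeta
  set ζ : EE n → ℝ := fun x => ⟪x, G x⟫ - 2 * u x with hζ
  have dζ : HG ζ (fun x => TM (A x) x - G x) := by
    have := hu.dz.sub (hu.du.cmul 2)
    have e : (fun x => TM (A x) x - G x) = fun x => G x + TM (A x) x - (2:ℝ) • G x := by ext1 x; module
    rw [e]; exact this
  have cζ := dζ.cont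
  have hL' : ∀ v : EE n, ‖v‖ ≤ 1 → (∫ x in closedBall 0 R0, ct T u 3 x * (ζ (x + v) - ζ x)) ≤ T ^ 3 * (R0 + 1) * ∫ x in closedBall 0 (R0 + 1), ‖TM (A x) x - G x‖ := fun v hv => by
    have := LL dζ (cAx.sub cG) k3 (C := T ^ 3) (fun x => by rw [abs_of_nonneg (ct0 _ _ _ _)]; exact ct_le hT.le hu 3 x) hR00 one_pos le_rfl v
    simp only [one_smul, inv_one, one_pow, one_mul] at this
    refine (le_abs_self _).trans (this.trans ?_)
    have b := bmono (x0 := (0 : EE n)) (x1 := 0) (R := R0 + ‖v‖) (R' := R0 + 1) (cAx.sub cG).norm (fun x => norm_nonneg _) (closedBall_subset_closedBall (by linarith only [hv]))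
    simp only [Pi.sub_apply] at b
    have := bnn (f := fun x => ‖TM (A x) x - G x‖) (fun x => norm_nonneg _) 0 (R0 + ‖v‖)
    gcongr
  have z1 := hL' h hh
  have z2 := hL' (-h) (by rwa [norm_neg])
  simp only [← sub_eq_add_neg] at z2
  have e3 : (∫ x in closedBall 0 R0, ct T u 3 x * ⟪p x, x⟫) = (∫ x in closedBall 0 R0, ct T u 3 x * (ζ (x + h) - ζ x)) + (∫ x in closedBall 0 R0, ct T u 3 x * (ζ (x - h) - ζ x)) +
      (2 * ((∫ x in closedBall 0 R0, ct T u 3 x * u (x + h)) + (∫ x in closedBall 0 R0, ct T u 3 x * u (x - h)) -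
        2 * ∫ x in closedBall 0 R0, ct T u 3 x * u x)
      - ((∫ x in closedBall 0 R0, ct T u 3 x * ⟪G (x + h), h⟫) - ∫ x in closedBall 0 R0, ct T u 3 x * ⟪G (x - h), h⟫)) := by
    rw [← integral_add (ib (by fun_prop) _ _) (ib (by fun_prop) _ _), ← integral_add (ib (by fun_prop) _ _) (ib (by fun_prop) _ _), ← integral_const_mul 2, ← integral_sub (ib (by fun_prop) _ _) (ib (by fun_prop) _ _),
      ← integral_const_mul 2, ← integral_sub (ib (by fun_prop) _ _) (ib (by fun_prop) _ _), ← integral_sub (ib (by fun_prop) _ _) (ib (by fun_prop) _ _), ← integral_add (ib (by fun_prop) _ _) (ib (by fun_prop) _ _)]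
    congr 1; ext x
    simp only [hζ, hp, inner_add_left, inner_sub_left, inner_smul_left, conj_trivial, Pi.add_apply, Pi.sub_apply]
    rw [real_inner_comm (G (x + h)) x, real_inner_comm (G (x - h)) x, real_inner_comm (G x) x, real_inner_comm (G (x + h)) h, real_inner_comm (G (x - h)) h]; ring
  -- logs
  have e4 : (∫ x in closedBall 0 R0, (A x).det * ct T u 4 x * DF A h x) ≤
      (∫ x in closedBall 0 R0, (A x).det * ct T u 4 x * ((A x)⁻¹ * (A (x + h) + A (x - h) - (2:ℝ) • A x)).trace) +
      |Lam| * T ^ 4 * c1 * ((∫ x in closedBall 0 R0, |(A (x + h)).det - 1|) + (∫ x in closedBall 0 R0, |(A (x - h)).det - 1|) + 2 * ∫ x in closedBall 0 R0, |(A x).det - 1|) := by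
    rw [← integral_add (ib (by fun_prop) _ _) (ib (by fun_prop) _ _), ← integral_const_mul 2,
      ← integral_add (ib (by fun_prop) _ _) (ib (by fun_prop) _ _), ← integral_const_mul, ← integral_add (ib (by fun_prop) _ _) (ib (by fun_prop) _ _)]
    refine cb (by fun_prop) (by fun_prop) fun x hx => ?_
    have d1 := hu.toMAS.DF0 (-h) x
    have id1 : ((A x)⁻¹ * (A (x + h) + A (x - h) - (2:ℝ) • A x)).trace = DF A h x + DF A (-h) x + (Real.log (A (x + h)).det + Real.log (A (x - h)).det - 2 * Real.log (A x).det) := by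
      unfold DF
      rw [Real.log_div (hu.dp _).ne' (hu.dp _).ne', Real.log_div (hu.dp _).ne' (hu.dp _).ne', ← sub_eq_add_neg, Matrix.mul_sub, Matrix.mul_add, Matrix.mul_smul,
        Matrix.nonsing_inv_mul _ (hu.dp x).ne'.isUnit, trace_sub, trace_add, trace_smul, trace_one, Fintype.card_fin, smul_eq_mul]; ring
    have l1 := abs_le.1 (abs_log_le hl (hu.lo (x + h)))
    have l2 := abs_le.1 (abs_log_le hl (hu.lo (x - h)))
    have l3 := abs_le.1 (abs_log_le hl (hu.lo x))
    rw [id1]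
    have w0 : 0 ≤ (A x).det * ct T u 4 x := mul_nonneg (hu.dp x).le (ct0 _ _ _ _)
    have w1 : (A x).det * ct T u 4 x ≤ |Lam| * T ^ 4 := mul_le_mul ((hu.hi x).trans (le_abs_self _)) (ct_le hT.le hu 4 x) (ct0 _ _ _ _) hLam
    set s := |(A (x + h)).det - 1| + |(A (x - h)).det - 1| + 2 * |(A x).det - 1| with hs
    have s0 : 0 ≤ c1 * s := by positivity
    have t1 := mul_le_mul_of_nonneg_right w1 s0
    have t2 : 0 ≤ DF A (-h) x + (Real.log (A (x + h)).det + Real.log (A (x - h)).det - 2 * Real.log (A x).det) + c1 * s := by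
      rw [hs]; rw [← hc1] at l1 l2 l3; linarith only [d1, l1.1, l2.1, l3.2]
    have t3 := mul_nonneg w0 t2
    linarith only [t1, t3]
  have q : ∀ v : EE n, ‖v‖ ≤ 1 → (∫ x in closedBall 0 R0, |(A (x + v)).det - 1|) ≤ ∫ x in closedBall 0 (R0 + 1), |(A x).det - 1| := fun v hv => by
    simpa using covA (f := fun x => |(A x).det - 1|) (by fun_prop) (fun x => abs_nonneg _) (R := R0) one_pos le_rfl le_rfl hv
  have q1 := q h hh
  have q2 := q (-h) (by rwa [norm_neg])
  have q3 := q 0 (by simp)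
  simp only [← sub_eq_add_neg, add_zero] at q2 q3
  have q4 := bmono (x0 := (0 : EE n)) (x1 := 0) (R := R0) (R' := R0 + 1) (f := fun x => ‖(A x).det • TM (A x)⁻¹ (G x) - x‖) (by fun_prop) (fun x => norm_nonneg _) (closedBall_subset_closedBall (by linarith only []))
  unfold er
  have n1 := bnn (f := fun x => |(A x).det - 1|) (fun x => abs_nonneg _) 0 (R0 + 1)
  have n2 := bnn (f := fun x => ‖(A x).det • TM (A x)⁻¹ (G x) - x‖) (fun x => norm_nonneg _) 0 (R0 + 1)
  have n3 := bnn (f := fun x => ‖TM (A x) x - G x‖) (fun x => norm_nonneg _) 0 (R0 + 1)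
  set E1 := ∫ x in closedBall 0 (R0 + 1), |(A x).det - 1|
  set E2 := ∫ x in closedBall 0 (R0 + 1), ‖(A x).det • TM (A x)⁻¹ (G x) - x‖
  set E3 := ∫ x in closedBall 0 (R0 + 1), ‖TM (A x) x - G x‖
  have C3' := (le_abs_self _).trans (C3.trans (mul_le_mul_of_nonneg_right (le_abs_self C) (by positivity : 0 ≤ ‖h‖ ^ 3)))
  have r1 := mul_le_mul_of_nonneg_left (add_le_add (add_le_add q1 q2) (mul_le_mul_of_nonneg_left q3 zero_le_two)) (by positivity : 0 ≤ |Lam| * T ^ 4 * c1)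
  have r2 := mul_le_mul_of_nonneg_left q4 (by positivity : 0 ≤ 16 * T ^ 3 * L)
  have hh3 : 0 ≤ ‖h‖ ^ 3 := by positivity
  set a1 := 4 * |C| with ha1
  set a2 := |Lam| * T ^ 4 * c1 with ha2
  set a3 := 16 * T ^ 3 * L
  set a4 := T ^ 3 * (R0 + 1) with ha4
  have p1 : 0 ≤ a1 := by positivity
  have p2 : 0 ≤ a2 := by positivity
  have p3 : 0 ≤ a3 := by positivity
  have p4 : 0 ≤ a4 := by positivity
  refine le_trans (b := a1 * ‖h‖^3 + a2 * 4 * E1 + a3 * E2 + 8 * a4 * E3) (by linarith only [e1, e3, C3', e4, r1, e2, r2, z1, z2]) ?_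
  have : 8 * T ^ 3 * (R0 + 1) = 8 * a4 := by rw [ha4]; ring
  rw [this]
  set H := ‖h‖ ^ 3
  have m1 : a1 * H ≤ (a1 + a2 * 4 + a3 + 8 * a4 + 1) * H := by gcongr; linarith only [p2, p3, p4]
  have m2 : a2 * 4 * E1 ≤ (a1 + a2 * 4 + a3 + 8 * a4 + 1) * E1 := by gcongr; linarith only [p1, p3, p4]
  have m3 : a3 * E2 ≤ (a1 + a2 * 4 + a3 + 8 * a4 + 1) * E2 := by gcongr; linarith only [p1, p2, p4]
  have m4 : 8 * a4 * E3 ≤ (a1 + a2 * 4 + a3 + 8 * a4 + 1) * E3 := by gcongr; linarith only [p1, p2, p3]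
  linarith only [m1, m2, m3, m4]
end s2b


section s3
variable {n : ℕ} {u : EE n → ℝ} {G : EE n → EE n} {A : EE n → MM n} {lam Lam c0 : ℝ} {K : ℝ → ℝ}

noncomputable def SS (B : MM n) (e : EE n) : ℝ := √⟪TM B e, e⟫
noncomputable def eij (i j : Fin n) : EE n := EuclideanSpace.single i 1 + EuclideanSpace.single j 1
noncomputable def sd (B B' : MM n) : ℝ := ∑ i, ∑ j, |SS B (eij i j) - SS B' (eij i j)|
lemma sd0 (B B' : MM n) : 0 ≤ sd B B' := Finset.sum_nonneg fun _ _ => Finset.sum_nonneg fun _ _ => abs_nonneg _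
lemma eij_norm (i j : Fin n) : ‖(eij i j : EE n)‖ ≤ 2 := (norm_add_le _ _).trans (by simp; norm_num)
lemma cSS {X : Type*} [TopologicalSpace X] {B : X → MM n} (h : Continuous B) (e : EE n) : Continuous fun x => SS (B x) e :=
  ((cont_TM h continuous_const).inner continuous_const).sqrt
lemma csd {X : Type*} [TopologicalSpace X] {B B' : X → MM n} (h : Continuous B) (h' : Continuous B') : Continuous fun x => sd (B x) (B' x) :=
  continuous_finsetSum _ fun _ _ => continuous_finsetSum _ fun _ _ => ((cSS h _).sub (cSS h' _)).abs

lemma s3a (hl : 0 < lam) (hc : 0 < c0) (hK : ∀ R, 0 < K R) (R : ℝ) :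
    ∃ C > 0, ∃ R1, ∀ u G A, MZ (n := n) lam Lam u G A → GRW K c0 u → ∀ h : EE n, ‖h‖ ≤ 1 → ∀ e : EE n, ‖e‖ ≤ 2 →
      (∫ x in closedBall 0 R, |SS (A (x + h)) e - SS (A x) e|) ^ 2 ≤ C * (‖h‖ ^ 3 + er G A R1) := by
  obtain ⟨C1, hC1, hB⟩ := B1 (n := n) (Lam := Lam) hl hc hK R
  set T := K R + 1 with hT
  have T0 : 0 < T := by have := hK R; linarith
  obtain ⟨C2, hC2, hS⟩ := s2k (n := n) (Lam := Lam) hl hc hK T0 rfl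
  set R0 := max (2 * √n) (T / c0) with hR0
  refine ⟨C1 * 4 * (lam⁻¹ * C2), by positivity, R0 + 1, fun u G A hu hg h hh e he => ?_⟩
  have cA := hu.cA
  have cAh := (hu.toMAS.sh h).cA
  have cD := hu.cDF h
  have cg := hu.cg
  have c4 := hu.cct T 4
  have cq : Continuous fun x => ⟪TM (A x) e, e⟫ := (cont_TM cA continuous_const).inner continuous_const
  have h1 := cs (f := fun x => SS (A (x + h)) e - SS (A x) e) ((cSS cAh e).sub (cSS cA e)) cq cD 0 R
    (fun x => psd_nonneg (hu.pA x).posSemidef e) (hu.toMAS.DF0 h) fun x => key_def (hu.pA x) (hu.pA _) e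
  refine h1.trans ?_
  have h2 : ∫ x in closedBall 0 R, ⟪TM (A x) e, e⟫ ≤ C1 * 4 := by
    have ct := cA.matrix_trace
    calc _ ≤ ∫ x in closedBall 0 R, (A x).trace * 4 := cb cq (by fun_prop) fun x _ => by
          refine (quad_le_trace (hu.pA x).posSemidef e).trans ?_
          have := (hu.pA x).posSemidef.trace_nonneg
          gcongr; nlinarith [norm_nonneg e]
      _ ≤ _ := by rw [integral_mul_const]; gcongr; exact (hB u G A hu hg).1
  have hz : ∀ x : EE n, R0 ≤ ‖x‖ → lam⁻¹ * ((A x).det * ct T u 4 x * DF A h x) = 0 := fun x hx => by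
    rw [ct_zero (by norm_num) (hg.rad hc hx)]; ring
  have f0 : ∀ x, 0 ≤ lam⁻¹ * ((A x).det * ct T u 4 x * DF A h x) := fun x => by
    have := hu.toMAS.DF0 h x; have := hu.dp x; have := ct0 T u 4 x; positivity
  have h3 : ∫ x in closedBall 0 R, DF A h x ≤ lam⁻¹ * C2 * (‖h‖ ^ 3 + er G A (R0 + 1)) := by
    calc _ ≤ ∫ x in closedBall 0 R, lam⁻¹ * ((A x).det * ct T u 4 x * DF A h x) := cb cD (by fun_prop) fun x hx => by
          rw [sub_zero] at hx
          have k1 := ct_ge (T := T) 4 (x := x) (u := u) (by rw [hT, add_sub_cancel_right]; exact hg.up _ _ hx)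
          have k2 := hu.lo x
          have k3 := hu.toMAS.DF0 h x
          have : 1 ≤ lam⁻¹ * (A x).det * ct T u 4 x := by
            have a : 1 ≤ lam⁻¹ * (A x).det := by rw [inv_mul_eq_div, one_le_div hl]; exact k2
            nlinarith
          nlinarith
      _ ≤ ∫ x in closedBall 0 (max R R0), lam⁻¹ * ((A x).det * ct T u 4 x * DF A h x) :=
          bmono (by fun_prop) f0 (closedBall_subset_closedBall (le_max_left _ _))
      _ = ∫ x in closedBall 0 R0, lam⁻¹ * ((A x).det * ct T u 4 x * DF A h x) := by
          rw [← gi hz, ← gi fun x hx => hz x ((le_max_right _ _).trans hx)]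
      _ ≤ _ := by rw [integral_const_mul, mul_assoc]; gcongr; exact hS u G A hu hg h hh
  have h4 : 0 ≤ ∫ x in closedBall 0 R, DF A h x := bnn (hu.toMAS.DF0 h) _ _
  calc _ ≤ C1 * 4 * (lam⁻¹ * C2 * (‖h‖ ^ 3 + er G A (R0 + 1))) := mul_le_mul h2 h3 h4 (by positivity)
    _ = _ := by ring

lemma s3b (hl : 0 < lam) (hc : 0 < c0) (hK : ∀ R, 0 < K R) {R δ : ℝ} (hR : 0 < R) (hδ : 0 < δ) :
    ∃ η > 0, ∃ R1, ∀ u G A, MZ (n := n) lam Lam u G A → GRW K c0 u → er G A R1 ≤ η → ∀ H : EE n, ‖H‖ ≤ R → ∀ e : EE n, ‖e‖ ≤ 2 →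
      ∫ x in closedBall 0 R, |SS (A (x + H)) e - SS (A x) e| ≤ δ := by
  obtain ⟨C, hC, R1, hS⟩ := s3a (n := n) (Lam := Lam) hl hc hK (R + R)
  obtain ⟨N, hN⟩ := exists_nat_gt (max R (2 * C * R ^ 3 / δ ^ 2))
  have hNR := (le_max_left _ _).trans_lt hN
  have hN2 := (le_max_right _ _).trans_lt hN
  have N0 : (0:ℝ) < N := hR.trans hNR
  refine ⟨δ ^ 2 / (2 * C * N ^ 2), by positivity, R1, fun u G A hu hg hη H hH e he => ?_⟩
  obtain ⟨h, hh⟩ : ∃ h, h = ((N:ℝ)⁻¹) • H := ⟨_, rfl⟩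
  have hhn : ‖h‖ ≤ R / N := by rw [hh, norm_smul, norm_inv, Real.norm_natCast, inv_mul_eq_div]; gcongr
  set s := ∫ x in closedBall 0 (R + R), |SS (A (x + h)) e - SS (A x) e| with hs
  have s0 : 0 ≤ s := bnn (fun x => abs_nonneg _) _ _
  have h1 := hS u G A hu hg h (hhn.trans ((div_le_one N0).2 hNR.le)) e he
  rw [← hs] at h1
  have h2 : s * N ≤ δ := by
    refine abs_le_of_sq_le_sq' ?_ hδ.le |>.2
    rw [mul_pow]
    calc _ ≤ C * ((R / N) ^ 3 + δ ^ 2 / (2 * C * N ^ 2)) * N ^ 2 := by gcongr; exact h1.trans (by gcongr)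
      _ = C * R ^ 3 / N + δ ^ 2 / 2 := by field_simp
      _ ≤ _ := by
        rw [div_lt_iff₀ (by positivity)] at hN2
        have : C * R ^ 3 / N ≤ δ ^ 2 / 2 := by rw [div_le_div_iff₀ N0 two_pos]; linarith
        linarith only [this]
  have c0 : ∀ v : EE n, Continuous fun x => SS (A (x + v)) e := fun v => cSS (hu.toMAS.sh v).cA e
  have c1 := cSS hu.cA e
  have ind : ∀ j : ℕ, j ≤ N → ∫ x in closedBall 0 R, |SS (A (x + (j:ℝ) • h)) e - SS (A x) e| ≤ j * s := by
    intro j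
    induction j with
    | zero => simp
    | succ j ih =>
      intro hj
      have h3 := ih (by omega)
      have hjh : ‖(j:ℝ) • h‖ ≤ R := by
        rw [norm_smul, Real.norm_natCast]
        have : (j:ℝ) ≤ N := by exact_mod_cast (by omega : j ≤ N)
        calc _ ≤ N * (R / N) := by gcongr
          _ = R := by field_simp
      have := c0 ((j:ℝ) • h)
      have := c0 (((j+1:ℕ):ℝ) • h)
      have h4 := covA (f := fun x => |SS (A (x + h)) e - SS (A x) e|) ((c0 h).sub c1).abs (fun x => abs_nonneg _) (R := R) one_pos le_rfl le_rfl hjh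
      clear c0
      simp only [one_smul, inv_one, one_pow, one_mul] at h4
      have e5 : ∀ x : EE n, x + (j:ℝ) • h + h = x + ((j+1:ℕ):ℝ) • h := fun x => by rw [Nat.cast_succ, add_smul, one_smul, add_assoc]
      simp only [e5] at h4
      have e6 : ((j+1:ℕ):ℝ) * s = s + j * s := by push_cast; ring
      rw [e6]
      generalize ((j+1:ℕ):ℝ) • h = w1 at *
      generalize (j:ℝ) • h = w2 at *
      calc _ ≤ (∫ x in closedBall 0 R, |SS (A (x + w1)) e - SS (A (x + w2)) e|) + ∫ x in closedBall 0 R, |SS (A (x + w2)) e - SS (A x) e| := by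
            rw [← integral_add (ib (by fun_prop) _ _) (ib (by fun_prop) _ _)]
            exact cb (by fun_prop) (by fun_prop) fun x _ => abs_sub_le _ _ _
        _ ≤ _ := add_le_add h4 h3
  have h6 := ind N le_rfl
  rw [hh, smul_inv_smul₀ N0.ne'] at h6
  linarith only [h2, h6]

lemma s3c (hl : 0 < lam) (hc : 0 < c0) (hK : ∀ R, 0 < K R) {R δ : ℝ} (hR : 0 < R) (hδ : 0 < δ) :
    ∃ η > 0, ∃ R1, ∀ u G A, MZ (n := n) lam Lam u G A → GRW K c0 u → er G A R1 ≤ η → ∀ H : EE n, ‖H‖ ≤ R →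
      ∫ x in closedBall 0 R, sd (A (x + H)) (A x) ≤ δ := by
  obtain ⟨η, hη, R1, h⟩ := s3b (n := n) (Lam := Lam) hl hc hK hR (δ := δ / (n ^ 2 + 1)) (by positivity)
  refine ⟨η, hη, R1, fun u G A hu hg he H hH => ?_⟩
  have c0 := fun e => cSS (hu.toMAS.sh H).cA e
  have c1 := fun e => cSS hu.cA e
  unfold sd
  have ii : ∀ i j : Fin n, IntegrableOn (fun x => |SS (A (x + H)) (eij i j) - SS (A x) (eij i j)|) (closedBall 0 R) := fun i j => by
    have := c0 (eij i j); have := c1 (eij i j)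
    exact ib (by fun_prop) _ _
  rw [integral_finsetSum _ fun i _ => integrable_finsetSum _ fun j _ => ii i j]
  simp_rw [integral_finsetSum Finset.univ fun j _ => ii _ j]
  calc _ ≤ ∑ i : Fin n, ∑ j : Fin n, δ / ((n:ℝ) ^ 2 + 1) := Finset.sum_le_sum fun i _ => Finset.sum_le_sum fun j _ => h u G A hu hg he H hH _ (eij_norm i j)
    _ = n ^ 2 * (δ / ((n:ℝ) ^ 2 + 1)) := by simp; ring
    _ ≤ δ := by rw [mul_div_assoc', div_le_iff₀ (by positivity)]; nlinarith

lemma pick (hl : 0 < lam) (hc : 0 < c0) (hK : ∀ R, 0 < K R) :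
    ∃ C1 > 0, ∀ R > 0, ∀ δ > 0, ∃ η > 0, ∃ R1, ∀ u G A, MZ (n := n) lam Lam u G A → GRW K c0 u → er G A R1 ≤ η →
      (∫ x in closedBall 0 1, |(A x).det - 1|) ≤ η →
      ∃ A0 : MM n, A0.PosDef ∧ A0.trace ≤ C1 ∧ A0⁻¹.trace ≤ C1 ∧ |A0.det - 1| ≤ δ ∧ ∫ x in closedBall 0 R, sd (A x) A0 ≤ δ := by
  obtain ⟨C, hC, hB⟩ := B1 (n := n) (Lam := Lam) hl hc hK 1
  set v := volume.real (closedBall (0 : EE n) 1) with hv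
  have v0 : 0 < v := ENNReal.toReal_pos (measure_closedBall_pos _ _ one_pos).ne' measure_closedBall_lt_top.ne
  set B := (2 * C + 2) / v with hBd
  have B0 : 0 < B := by positivity
  refine ⟨B * (1 + lam⁻¹), by positivity, fun R hR δ hδ => ?_⟩
  set v' := volume.real (closedBall (0 : EE n) (R + 1)) with hv'
  set M := B / δ with hM
  have M0 : 0 < M := by positivity
  obtain ⟨η, hη, R1, h⟩ := s3c (n := n) (Lam := Lam) hl hc hK (R := R + 1) (by linarith) (δ := 1 / (M * (v' + 1))) (by positivity)
  refine ⟨min η (1 / M), by positivity, R1, fun u G A hu hg he h1 => ?_⟩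
  have cA := hu.cA
  have cg := hu.cg
  have ctr := hu.cA.matrix_trace
  have cti := hu.cinv.matrix_trace
  have c2 : Continuous fun z : EE n × EE n => sd (A (z.1 + z.2)) (A z.1) := csd (by fun_prop) (by fun_prop)
  set F : EE n → ℝ := fun y => ∫ H in closedBall 0 (R + 1), sd (A (y + H)) (A y) with hF
  have cF : Continuous F := continuous_parametric_integral_of_continuous (f := fun y H => sd (A (y + H)) (A y)) c2 (isCompact_closedBall _ _)
  have F0 : ∀ y, 0 ≤ F y := fun y => bnn (fun x => sd0 _ _) _ _
  have hFi : M * ∫ y in closedBall 0 1, F y ≤ 1 := by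
    have sw : ∫ y in closedBall 0 1, F y = ∫ H in closedBall 0 (R + 1), ∫ y in closedBall 0 1, sd (A (y + H)) (A y) := by
      refine integral_integral_swap ?_
      rw [Measure.prod_restrict]
      exact c2.continuousOn.integrableOn_compact ((isCompact_closedBall (0 : EE n) 1).prod (isCompact_closedBall (0 : EE n) (R + 1)))
    rw [sw]
    have c3 : Continuous fun H : EE n => ∫ y in closedBall 0 1, sd (A (y + H)) (A y) :=
      continuous_parametric_integral_of_continuous (f := fun H y => sd (A (y + H)) (A y)) (csd (by fun_prop) (by fun_prop)) (isCompact_closedBall _ _)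
    have h3 := cb' c3 (x0 := 0) (R := R + 1) (C := 1 / (M * (v' + 1))) fun H hH => by
      rw [sub_zero] at hH
      refine le_trans (bmono ?_ (fun x => sd0 _ _) (closedBall_subset_closedBall (by linarith only [hR]))) (h u G A hu hg (he.trans (min_le_left _ _)) H hH)
      exact csd (hu.toMAS.sh H).cA cA
    rw [← hv'] at h3
    calc _ ≤ M * (1 / (M * (v' + 1)) * v') := by gcongr
      _ = v' / (v' + 1) := by field_simp
      _ ≤ 1 := by have : 0 ≤ v' := measureReal_nonneg
                  rw [div_le_one (by positivity)]; linarith only []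
  have hgi : M * ∫ x in closedBall 0 1, |(A x).det - 1| ≤ 1 := by
    have := mul_le_mul_of_nonneg_left (h1.trans (min_le_right _ _)) M0.le
    rwa [mul_one_div_cancel M0.ne'] at this
  set f : EE n → ℝ := fun y => (A y).trace + (A y).det * ((A y)⁻¹).trace + (M * F y + M * |(A y).det - 1|) with hf
  have hfi : ∫ y in closedBall 0 1, f y ≤ 2 * C + 2 := by
    rw [hf, integral_add (ib (by fun_prop) _ _) (ib (by fun_prop) _ _), integral_add (ib (by fun_prop) _ _) (ib (by fun_prop) _ _),
      integral_add (ib (by fun_prop) _ _) (ib (by fun_prop) _ _), integral_const_mul, integral_const_mul]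
    linarith only [hFi, hgi, (hB u G A hu hg).1, (hB u G A hu hg).2]
  obtain ⟨y0, hy0, hy⟩ := exists_le_setAverage (μ := volume) (s := closedBall (0 : EE n) 1) (f := f) (measure_closedBall_pos _ _ one_pos).ne' measure_closedBall_lt_top.ne (ib (by fun_prop) _ _)
  rw [setAverage_eq, smul_eq_mul, ← hv, inv_mul_eq_div] at hy
  have hy2 : f y0 ≤ B := hy.trans (by rw [hBd]; gcongr)
  have t1 := (hu.pA y0).posSemidef.trace_nonneg
  have t2 := (hu.pA y0).inv.posSemidef.trace_nonneg
  have t3 := hu.dp y0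
  have t4 := hu.lo y0
  have t5 := F0 y0
  have t6 := abs_nonneg ((A y0).det - 1)
  have t7 : 0 ≤ (A y0).det * ((A y0)⁻¹).trace := by positivity
  have t8 : 0 ≤ M * F y0 := by positivity
  have t9 : 0 ≤ M * |(A y0).det - 1| := by positivity
  simp only [hf] at hy2
  have d1 : ∀ t, M * t ≤ B → t ≤ δ := fun t ht => by
    have : M * δ = B := by rw [hM]; field_simp
    rw [← this] at ht
    exact le_of_mul_le_mul_left ht M0
  refine ⟨A y0, hu.pA y0, ?_, ?_, d1 _ (by linarith), (le_trans ?_ (d1 (F y0) (by linarith only [t1, t7, t9, hy2])))⟩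
  · have : 0 ≤ B * lam⁻¹ := by positivity
    linarith only [t7, t8, t9, hy2, this]
  · have : lam * ((A y0)⁻¹).trace ≤ B := by nlinarith
    have : ((A y0)⁻¹).trace ≤ B * lam⁻¹ := by rw [← div_eq_mul_inv, le_div_iff₀ hl]; linarith only [this]
    linarith only [B0, this]
  · have h5 := covA (f := fun H => sd (A (y0 + H)) (A y0)) (csd (by fun_prop) (by fun_prop)) (fun x => sd0 _ _) (R := R) (r := 1) one_pos le_rfl le_rfl
      (w := -y0) (by rw [norm_neg]; simpa using hy0)
    simpa using h5
end s3


section s4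
variable {n : ℕ} {u : EE n → ℝ} {G : EE n → EE n} {A : EE n → MM n} {lam Lam c0 : ℝ} {K : ℝ → ℝ}

lemma quad_sum (B : MM n) (v : EE n) : ⟪TM B v, v⟫ = ∑ i, ∑ j, B i j * v i * v j := by
  rw [inner_vec, TM_ofLp, dotProduct]
  refine Finset.sum_congr rfl fun i _ => ?_
  rw [mulVec, dotProduct, Finset.sum_mul]
  exact Finset.sum_congr rfl fun j _ => by ring
lemma quad_eij (B : MM n) (i j : Fin n) : ⟪TM B (eij i j), eij i j⟫ = B i i + B i j + (B j i + B j j) := by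
  have h : ∀ a b : Fin n, ⟪TM B (EuclideanSpace.single a 1), EuclideanSpace.single b 1⟫ = B b a := fun a b => by
    rw [inner_vec, TM_ofLp]; simp
  unfold eij
  rw [map_add, inner_add_left, inner_add_right, inner_add_right, h, h, h, h]; ring
lemma abs_coord (v : EE n) (i : Fin n) : |v i| ≤ ‖v‖ := PiLp.norm_apply_le v i
lemma quad_bd {B : MM n} {m : ℝ} (h : ∀ i j, |B i j| ≤ m) (v : EE n) : |⟪TM B v, v⟫| ≤ n ^ 2 * m * ‖v‖ ^ 2 := by
  rw [quad_sum]
  refine (Finset.abs_sum_le_sum_abs _ _).trans ((Finset.sum_le_sum fun i _ => Finset.abs_sum_le_sum_abs _ _).trans ?_)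
  calc _ ≤ ∑ i : Fin n, ∑ j : Fin n, m * ‖v‖ ^ 2 := Finset.sum_le_sum fun i _ => Finset.sum_le_sum fun j _ => by
        rw [abs_mul, abs_mul]
        have h1 := h i j
        have h2 := abs_coord v i
        have h3 := abs_coord v j
        have : 0 ≤ m := (abs_nonneg _).trans h1
        calc _ ≤ m * ‖v‖ * ‖v‖ := by gcongr
          _ = _ := by ring
    _ = _ := by simp; ring

lemma sd_lower {B B' : MM n} (hB : B.PosDef) (hB' : B'.PosDef) {C1 : ℝ} (hC : B'.trace ≤ C1) (v : EE n) :
    -((n ^ 2 * (4 * √C1 + 1) + C1) * sd B B') * ‖v‖ ^ 2 ≤ ⟪TM (B - B') v, v⟫ := by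
  have C0 : 0 ≤ C1 := hB'.posSemidef.trace_nonneg.trans hC
  have s0 := sd0 B B'
  rcases le_total 1 (sd B B') with h | h
  · have h1 := psd_nonneg hB.posSemidef v
    have h2 := quad_le_trace hB'.posSemidef v
    have h3 : B'.trace * ‖v‖ ^ 2 ≤ C1 * sd B B' * ‖v‖ ^ 2 := by gcongr; nlinarith
    have h4 : 0 ≤ n ^ 2 * (4 * √C1 + 1) * sd B B' * ‖v‖ ^ 2 := by positivity
    rw [TM_sub, inner_sub_left]; linarith
  · set m := (4 * √C1 + 1) * sd B B' with hm
    have q : ∀ i j, |⟪TM B (eij i j), eij i j⟫ - ⟪TM B' (eij i j), eij i j⟫| ≤ m := fun i j => by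
      have e : |SS B (eij i j) - SS B' (eij i j)| ≤ sd B B' :=
        (Finset.single_le_sum (f := fun j => |SS B (eij i j) - SS B' (eij i j)|) (fun _ _ => abs_nonneg _) (Finset.mem_univ j)).trans
          (Finset.single_le_sum (f := fun i => ∑ j, |SS B (eij i j) - SS B' (eij i j)|) (fun _ _ => Finset.sum_nonneg fun _ _ => abs_nonneg _) (Finset.mem_univ i))
      have a1 := Real.sq_sqrt (psd_nonneg hB.posSemidef (eij i j))
      have a2 := Real.sq_sqrt (psd_nonneg hB'.posSemidef (eij i j))
      change SS B (eij i j) ^ 2 = _ at a1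
      change SS B' (eij i j) ^ 2 = _ at a2
      have s1 : 0 ≤ SS B (eij i j) := Real.sqrt_nonneg _
      have s2 : 0 ≤ SS B' (eij i j) := Real.sqrt_nonneg _
      have s3 : SS B' (eij i j) ≤ 2 * √C1 := by
        have : SS B' (eij i j) ≤ √(2 ^ 2 * C1) := Real.sqrt_le_sqrt (by
          refine (quad_le_trace hB'.posSemidef _).trans ?_
          have := eij_norm i j
          have h0 := norm_nonneg (eij i j)
          have := hB'.posSemidef.trace_nonneg
          calc _ ≤ C1 * 2 ^ 2 := by gcongr
            _ = _ := by ring)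
        rwa [Real.sqrt_mul (by norm_num), Real.sqrt_sq (by norm_num)] at this
      rw [← a1, ← a2, show SS B (eij i j) ^ 2 - SS B' (eij i j) ^ 2 = (SS B (eij i j) + SS B' (eij i j)) * (SS B (eij i j) - SS B' (eij i j)) by ring,
        abs_mul, abs_of_nonneg (by positivity)]
      have := (abs_le.1 e).2
      exact mul_le_mul (by linarith) e (abs_nonneg _) (by positivity)
    have en : ∀ i j, |(B - B') i j| ≤ m := fun i j => by
      have h1 := abs_le.1 (q i j)
      have h2 := abs_le.1 (q i i)
      have h3 := abs_le.1 (q j j)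
      simp only [quad_eij] at h1 h2 h3
      have t1 : B j i = B i j := congrFun (congrFun (pd_symm hB) i) j
      have t2 : B' j i = B' i j := congrFun (congrFun (pd_symm hB') i) j
      rw [Matrix.sub_apply, abs_le]
      constructor <;> linarith
    have h1 := (abs_le.1 (quad_bd en v)).1
    have : 0 ≤ C1 * sd B B' * ‖v‖ ^ 2 := by positivity
    rw [hm] at h1
    linarith

lemma lip_ball {w : EE n → ℝ} {p : EE n → EE n} (dw : HG w p) {R L : ℝ} (hL : ∀ x, ‖x‖ ≤ R → ‖p x‖ ≤ L) {x y : EE n} (hx : ‖x‖ ≤ R) (hy : ‖y‖ ≤ R) :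
    |w x - w y| ≤ L * ‖x - y‖ :=
  (convex_closedBall (0 : EE n) R).norm_image_sub_le_of_norm_hasFDerivWithin_le (f' := fun x => innerSL ℝ (p x)) (fun x _ => (dw x).hasFDerivWithinAt)
    (fun x hx => by rw [innerSL_apply_norm]; exact hL x (by simpa using hx)) (by simpa using hy) (by simpa using hx)

lemma vpos (x : EE n) {r : ℝ} (hr : 0 < r) : 0 < volume.real (closedBall x r) :=
  ENNReal.toReal_pos (measure_closedBall_pos _ _ hr).ne' measure_closedBall_lt_top.ne

lemma cvx_avg {w : EE n → ℝ} {p : EE n → EE n} {M : EE n → MM n} (dw : HG w p) (dp : HJ p M) (cM : Continuous M) {R r L c δ : ℝ} {D : EE n → ℝ}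
    (hr : 0 < r) (hr1 : r ≤ 1) (hR : 0 ≤ R) (hL : ∀ x, ‖x‖ ≤ R + 1 → ‖p x‖ ≤ L) (cD : Continuous D) (hD0 : ∀ x, 0 ≤ D x) (hc : 0 ≤ c)
    (hlow : ∀ x v, -(c * D x) * ‖v‖ ^ 2 ≤ ⟪TM (M x) v, v⟫) (hD : ∫ x in closedBall 0 (R + 1), D x ≤ δ) :
    ∃ b : EE n, ‖b‖ ≤ L ∧ ∀ x, ‖x‖ ≤ R → w 0 + ⟪b, x⟫ - 2 * L * r - c * R ^ 2 * δ / volume.real (closedBall (0 : EE n) r) ≤ w x := by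
  set v := volume.real (closedBall (0 : EE n) r) with hv
  have v0 : 0 < v := vpos 0 hr
  have cw := dw.cont
  have cp := dp.cont
  have L0 : 0 ≤ L := (norm_nonneg _).trans (hL 0 (by simp; linarith))
  have hb0 : ‖∫ y in closedBall 0 r, p y‖ ≤ L * v :=
    norm_setIntegral_le_of_norm_le_const measure_closedBall_lt_top fun y hy => hL y (by
      have : ‖y‖ ≤ r := by simpa using hy
      linarith)
  refine ⟨v⁻¹ • ∫ y in closedBall 0 r, p y, ?_, fun x hx => ?_⟩
  · rw [norm_smul, norm_inv, Real.norm_of_nonneg v0.le, inv_mul_eq_div, div_le_iff₀ v0]; exact hb0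
  have d1 : ∀ t, HasDerivAt (fun t : ℝ => ∫ y in closedBall 0 r, w (y + t • x)) (∫ y in closedBall 0 r, ⟪p (y + t • x), x⟫) t := fun t =>
    deriv_int (isCompact_closedBall 0 r) (a := t - 1) (b := t + 1) ⟨by linarith, by linarith⟩
      (by unfold Function.uncurry; fun_prop) (by unfold Function.uncurry; fun_prop)
      fun t _ y _ => dw.line y x t
  have cAA : Continuous fun z : ℝ × EE n => TM (M (z.2 + z.1 • x)) x := cont_TM (by fun_prop) continuous_const
  have d2 : ∀ t, HasDerivAt (fun t : ℝ => ∫ y in closedBall 0 r, ⟪p (y + t • x), x⟫) (∫ y in closedBall 0 r, ⟪TM (M (y + t • x)) x, x⟫) t := fun t =>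
    deriv_int (isCompact_closedBall 0 r) (a := t - 1) (b := t + 1) ⟨by linarith, by linarith⟩
      (by unfold Function.uncurry; fun_prop) (cAA.inner continuous_const).continuousOn
      fun t _ y _ => dp.line' y x x t
  have low : ∀ t : ℝ, t ∈ Icc (0:ℝ) 1 → -(c * R ^ 2 * δ) ≤ ∫ y in closedBall 0 r, ⟪TM (M (y + t • x)) x, x⟫ := fun t ht => by
    have ct : Continuous fun y => TM (M (y + t • x)) x := cont_TM (by fun_prop) continuous_const
    have htx : ‖t • x‖ ≤ R := by
      rw [norm_smul, Real.norm_of_nonneg ht.1]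
      calc _ ≤ 1 * R := by gcongr; exact ht.2
        _ = R := one_mul R
    have h1 := covA cD hD0 (R := r) one_pos le_rfl le_rfl htx
    simp only [one_smul, inv_one, one_pow, one_mul] at h1
    have h2 := h1.trans ((bmono cD hD0 (x1 := 0) (R' := R + 1) (closedBall_subset_closedBall (by linarith))).trans hD)
    have h3 : 0 ≤ ∫ y in closedBall 0 r, D (y + t • x) := bnn (fun y => hD0 _) _ _
    calc _ ≤ -(c * ‖x‖ ^ 2 * ∫ y in closedBall 0 r, D (y + t • x)) := by gcongr
      _ = ∫ y in closedBall 0 r, -(c * D (y + t • x)) * ‖x‖ ^ 2 := by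
        rw [← integral_const_mul, ← integral_neg]; congr 1; ext y; ring
      _ ≤ _ := cb (by fun_prop) (by fun_prop) fun y _ => hlow _ _
  obtain ⟨s, hs, e1⟩ := exists_hasDerivAt_eq_slope _ _ zero_lt_one (fun t _ => (d1 t).continuousAt.continuousWithinAt) (fun t _ => d1 t)
  obtain ⟨s', hs', e2⟩ := exists_hasDerivAt_eq_slope _ _ hs.1 (fun t _ => (d2 t).continuousAt.continuousWithinAt) (fun t _ => d2 t)
  have l2 := low s' ⟨hs'.1.le, hs'.2.le.trans hs.2.le⟩
  rw [e2, e1, sub_zero, sub_zero, le_div_iff₀ hs.1] at l2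
  simp only [zero_smul, add_zero, one_smul, div_one] at l2
  have Q0 : 0 ≤ c * R ^ 2 * δ := by
    have : 0 ≤ δ := (bnn hD0 _ _).trans hD
    positivity
  have e3 : ∫ y in closedBall 0 r, ⟪p y, x⟫ = ⟪∫ y in closedBall 0 r, p y, x⟫ := by
    have := integral_inner (𝕜 := ℝ) (μ := volume.restrict (closedBall (0 : EE n) r)) (f := p) (cp.continuousOn.integrableOn_compact (isCompact_closedBall _ _)) x
    rw [real_inner_comm, ← this]; simp only [real_inner_comm]
  have f1 : ∫ y in closedBall 0 r, w (y + x) ≤ (w x + L * r) * v := cb' (by fun_prop) fun y hy => by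
    rw [sub_zero] at hy
    have := lip_ball dw hL (x := y + x) (y := x) ((norm_add_le _ _).trans (by linarith)) (by linarith)
    rw [add_sub_cancel_right] at this
    have : L * ‖y‖ ≤ L * r := by gcongr
    linarith [le_abs_self (w (y + x) - w x)]
  have f2 : ∫ y in closedBall 0 r, - w y ≤ (- w 0 + L * r) * v := cb' (by fun_prop) fun y hy => by
    rw [sub_zero] at hy
    have := lip_ball dw hL (x := y) (y := 0) (by linarith) (by simp; linarith)
    rw [sub_zero] at this
    have : L * ‖y‖ ≤ L * r := by gcongr
    linarith [neg_abs_le (w y - w 0)]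
  rw [integral_neg] at f2
  rw [e3] at l2
  rw [inner_smul_left, conj_trivial, inv_mul_eq_div]
  have : s * (c * R ^ 2 * δ) ≤ c * R ^ 2 * δ := by nlinarith [hs.2]
  have : ⟪∫ y in closedBall 0 r, p y, x⟫ - c * R ^ 2 * δ ≤ (w x - w 0 + 2 * L * r) * v := by linarith
  have h5 : (⟪∫ y in closedBall 0 r, p y, x⟫ - c * R ^ 2 * δ) / v ≤ w x - w 0 + 2 * L * r := by rwa [div_le_iff₀ v0]
  rw [sub_div] at h5
  linarith
end s4


section s4b
variable {n : ℕ} {lam Lam c0 : ℝ} {K : ℝ → ℝ}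

lemma TM_norm_le {B : MM n} (hB : B.PosSemidef) (x : EE n) : ‖TM B x‖ ≤ B.trace * ‖x‖ := by
  have h1 := normsq_TM_le hB x
  have h2 := quad_le_trace hB x
  have h3 := hB.trace_nonneg
  refine abs_le_of_sq_le_sq' ?_ (by positivity) |>.2
  nlinarith
lemma vcen (x : EE n) (r : ℝ) : volume.real (closedBall x r) = volume.real (closedBall (0 : EE n) r) := by
  simp only [measureReal_def, Measure.addHaar_closedBall_center]

set_option maxHeartbeats 1000000 in
lemma s4a (hl : 0 < lam) (hc : 0 < c0) {T : ℝ} (T0 : 0 < T) {R L C1 s : ℝ} (hR : max (2 * √n) (T / c0) ≤ R) (hC1 : 0 ≤ C1)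
    (hL : K (R + 1) + C1 * R ≤ L) (hs : 0 < s) (hs1 : s ≤ 1) {u : EE n → ℝ} {G : EE n → EE n} {A : EE n → MM n} {A0 : MM n} (hu : MZ lam Lam u G A) (hg : GRW K c0 u)
    (h0 : A0.PosDef) (ht : A0.trace ≤ C1) (hd : |A0.det - 1| ≤ 1 / 2) {b : EE n} (hb : ‖b‖ ≤ L) :
    2 * ∫ x in closedBall 0 R, 2 * ct T u 1 x * (u x - ⟪TM A0 x, x⟫ / 2 - ⟪b, x⟫) ≤
      |Lam| * T ^ 2 * ((1 + lam⁻¹) * (∫ x in closedBall 0 R, |(A x).det - 1|) + 3 * |A0.det - 1| * volume.real (closedBall (0 : EE n) R)) +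
      6 * T * L * (∫ x in closedBall 0 R, ‖(A x).det • TM (A x)⁻¹ (G x) - x‖) +
      2 * T * R * (s⁻¹ ^ n * ∫ x in closedBall 0 R, ‖TM (A x) x - G x‖) + s * (2 * T * volume.real (closedBall (0 : EE n) R) * (R * L)) := by
  set V := volume.real (closedBall (0 : EE n) R) with hV
  have hR0 : 0 ≤ R := le_trans (le_max_of_le_right (by positivity)) hR
  have hz : ∀ j, j ≠ 0 → ∀ x, R ≤ ‖x‖ → ct T u j x = 0 := fun j hj x hx => ct_zero hj (hg.rad hc (hR.trans hx))
  have k1 := hu.cct T 1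
  have k2 := hu.cct T 2
  have cu := hu.cu
  have cG := hu.cG
  have cA := hu.cA
  have cg := hu.cg
  have ci := hu.cinv
  have ciG := cont_TM hu.cinv hu.cG
  have cAx := cont_TM hu.cA continuous_id
  simp only [id] at cAx
  have L0 : 0 ≤ L := (norm_nonneg _).trans hb
  have kT : ∀ x, 2 * ct T u 1 x ≤ 2 * T := fun x => by have := ct_le T0.le hu 1 x; rw [pow_one] at this; linarith
  have kk0 : ∀ x, 0 ≤ 2 * ct T u 1 x := fun x => by have := ct0 T u 1 x; linarith
  have ctr : Continuous fun x => ((A x)⁻¹ * (A0 - A x)).trace := (ci.mul (continuous_const.sub cA)).matrix_trace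
  have cAo : Continuous fun x : EE n => TM A0 x := (TM A0).continuous
  have hGL : ∀ x : EE n, ‖x‖ ≤ R → ‖G x‖ + C1 * R ≤ L := fun x hx => by
    have := hu.Gle hg hx; linarith
  have I := I1 hu.toMAS ((HJ.lin A0).sub hu.dG) (continuous_const.sub cA) (hu.dct T 0) (hu.cdct T 0) (hz 2 (by norm_num))
  have I' := I1 hu.toMAS (HJ.cst b) continuous_const (hu.dct T 0) (hu.cdct T 0) (hz 2 (by norm_num))
  rw [gi (R := R) fun x hx => by simp [hz 1 _ x hx, hz 2 _ x hx]] at I I'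
  have e1 : (∫ x in closedBall 0 R, (A x).det * ct T u 2 x * ((A x)⁻¹ * (A0 - A x)).trace) =
      ∫ x in closedBall 0 R, 2 * ct T u 1 x * ⟪TM A0 x - G x, (A x).det • TM (A x)⁻¹ (G x)⟫ := by
    rw [← sub_eq_zero, ← integral_sub (ib (by exact (cg.mul k2).mul ctr) _ _) (ib (by exact (continuous_const.mul k1).mul ((cAo.sub cG).inner (cg.smul ciG))) _ _), ← I]
    congr 1; ext x
    simp only [inner_smul_right]
    rw [inner_TM_symm (hu.pA x).inv.isHermitian]; push_cast; ring
  have e2 : (∫ x in closedBall 0 R, 2 * ct T u 1 x * ⟪b, (A x).det • TM (A x)⁻¹ (G x)⟫) = 0 := by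
    rw [← neg_eq_zero, ← integral_neg, ← I']
    congr 1; ext x
    simp only [inner_smul_right, Matrix.mul_zero, trace_zero, Pi.zero_apply]
    rw [inner_TM_symm (hu.pA x).inv.isHermitian]; push_cast; ring
  have l1 : -(|Lam| * T ^ 2 * ((1 + lam⁻¹) * (∫ x in closedBall 0 R, |(A x).det - 1|) + 3 * |A0.det - 1| * V)) ≤
      ∫ x in closedBall 0 R, (A x).det * ct T u 2 x * ((A x)⁻¹ * (A0 - A x)).trace := by
    have e3 : -(|Lam| * T ^ 2 * ((1 + lam⁻¹) * (∫ x in closedBall 0 R, |(A x).det - 1|) + 3 * |A0.det - 1| * V)) =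
        ∫ x in closedBall 0 R, -(|Lam| * T ^ 2 * ((1 + lam⁻¹) * |(A x).det - 1| + 3 * |A0.det - 1|)) := by
      rw [integral_neg, integral_const_mul, integral_add (ib (by fun_prop) _ _) (ib (by fun_prop) _ _), integral_const_mul (1 + lam⁻¹), integral_const, measureReal_restrict_apply_univ, ← hV, smul_eq_mul]
      ring
    rw [e3]
    refine cb (by fun_prop) (by exact (cg.mul k2).mul ctr) fun x _ => ?_
    have t1 := trace_ge (hu.pA x) h0
    rw [Real.log_div h0.det_pos.ne' (hu.dp x).ne'] at t1
    have t2 := abs_le.1 (abs_log_le hl (hu.lo x))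
    have t3 := abs_le.1 (abs_log_le (lam := 1 / 2) (by norm_num) (by linarith only [(abs_le.1 hd).1] : 1 / 2 ≤ A0.det))
    norm_num at t3
    have t4 : ((A x)⁻¹ * (A0 - A x)).trace = ((A x)⁻¹ * A0).trace - n := by
      rw [Matrix.mul_sub, Matrix.nonsing_inv_mul _ (hu.dp x).ne'.isUnit, trace_sub, trace_one, Fintype.card_fin]
    have w0 : 0 ≤ (A x).det * ct T u 2 x := mul_nonneg (hu.dp x).le (ct0 _ _ _ _)
    have w1 : (A x).det * ct T u 2 x ≤ |Lam| * T ^ 2 := mul_le_mul ((hu.hi x).trans (le_abs_self _)) (ct_le T0.le hu 2 x) (ct0 _ _ _ _) (abs_nonneg _)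
    have w2 : 0 ≤ (1 + lam⁻¹) * |(A x).det - 1| + 3 * |A0.det - 1| := by positivity
    rw [t4]
    have w3 : 0 ≤ ((A x)⁻¹ * A0).trace - n + ((1 + lam⁻¹) * |(A x).det - 1| + 3 * |A0.det - 1|) := by linarith only [t1, t2.2, t3.1]
    have := mul_nonneg w0 w3
    have := mul_le_mul_of_nonneg_right w1 w2
    linarith
  set ζ : EE n → ℝ := fun x => ⟪x, G x⟫ - 2 * u x with hζ
  have dζ : HG ζ (fun x => TM (A x) x - G x) := by
    have := hu.dz.sub (hu.du.cmul 2)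
    have e : (fun x => TM (A x) x - G x) = fun x => G x + TM (A x) x - (2:ℝ) • G x := by ext1 x; module
    rw [e]; exact this
  have cζ := dζ.cont
  have hL1 := LL dζ (cAx.sub cG) (k := fun x => 2 * ct T u 1 x) (by fun_prop) (C := 2 * T) (fun x => by rw [abs_of_nonneg (kk0 x)]; exact kT x) hR0 hs hs1 0
  simp only [norm_zero, add_zero] at hL1
  have main : (2 * ∫ x in closedBall 0 R, 2 * ct T u 1 x * (u x - ⟪TM A0 x, x⟫ / 2 - ⟪b, x⟫)) ≤
      - (∫ x in closedBall 0 R, 2 * ct T u 1 x * ⟪TM A0 x - G x, (A x).det • TM (A x)⁻¹ (G x)⟫)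
      - 2 * (∫ x in closedBall 0 R, 2 * ct T u 1 x * ⟪b, (A x).det • TM (A x)⁻¹ (G x)⟫)
      - (∫ x in closedBall 0 R, 2 * ct T u 1 x * (ζ x - ζ (s • x))) + ((∫ x in closedBall (0 : EE n) R, 2 * T * (s * (R * L))) +
      6 * T * L * ∫ x in closedBall 0 R, ‖(A x).det • TM (A x)⁻¹ (G x) - x‖) := by
    have J : ∀ f : EE n → ℝ, Continuous f → IntegrableOn f (closedBall 0 R) := fun f hf => ib hf _ _
    rw [← integral_const_mul 2, ← integral_const_mul 2, ← integral_neg, ← integral_const_mul (6 * T * L), ← integral_sub (J _ (by fun_prop)) (J _ (by fun_prop)),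
      ← integral_sub (J _ (by fun_prop)) (J _ (by fun_prop)), ← integral_add (J _ (by fun_prop)) (J _ (by fun_prop)), ← integral_add (J _ (by fun_prop)) (J _ (by fun_prop))]
    refine cb (by fun_prop) (by fun_prop) fun x hx => ?_
    rw [sub_zero] at hx
    set X := (A x).det • TM (A x)⁻¹ (G x) with hX
    have i1 := real_inner_le_norm (TM A0 x - G x) (X - x)
    have i2 := real_inner_le_norm b (X - x)
    rw [inner_sub_right] at i1 i2
    have gl := hGL x hx
    have a1 : ‖TM A0 x - G x‖ ≤ L := by
      refine (norm_sub_le _ _).trans ?_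
      have := TM_norm_le h0.posSemidef x
      have : A0.trace * ‖x‖ ≤ C1 * R := by have := h0.posSemidef.trace_nonneg; gcongr
      linarith
    have i3 : ‖TM A0 x - G x‖ * ‖X - x‖ ≤ L * ‖X - x‖ := by gcongr
    have i4 : ‖b‖ * ‖X - x‖ ≤ L * ‖X - x‖ := by gcongr
    have sx : ‖s • x‖ ≤ s * R := by rw [norm_smul, Real.norm_of_nonneg hs.le]; gcongr
    have i5 : -ζ (s • x) ≤ s * (R * L) := by
      have c := hu.conv (s • x) 0
      rw [hu.u0, zero_sub, inner_neg_right, real_inner_comm] at c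
      have c2 := real_inner_le_norm (s • x) (G (s • x))
      have gl2 := hGL (s • x) (sx.trans (mul_le_of_le_one_left hR0 hs1))
      have : ‖s • x‖ * ‖G (s • x)‖ ≤ (s * R) * L := by
        have : 0 ≤ C1 * R := by positivity
        gcongr; linarith only [gl2, this]
      have e5 : -ζ (s • x) = 2 * u (s • x) - ⟪s • x, G (s • x)⟫ := by simp only [hζ]; ring
      rw [e5]; linarith only [c, c2, this]
    have hk := kk0 x
    have hkT := kT x
    have nn := norm_nonneg (X - x)
    have idt : ⟪TM A0 x, x⟫ - ⟪G x, x⟫ = -2 * (u x - ⟪TM A0 x, x⟫ / 2) - ζ x := by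
      simp only [hζ]; rw [real_inner_comm x (G x)]; ring
    have i6 : 0 ≤ s * (R * L) := by positivity
    rw [inner_sub_left _ _ x, idt] at i1
    set k := 2 * ct T u 1 x
    have m1 : 0 ≤ k * (L * ‖X - x‖ - (⟪TM A0 x - G x, X⟫ - (-2 * (u x - ⟪TM A0 x, x⟫ / 2) - ζ x))) := mul_nonneg hk (by linarith only [i1, i3])
    have m2 : 0 ≤ k * (L * ‖X - x‖ - (⟪b, X⟫ - ⟪b, x⟫)) := mul_nonneg hk (by linarith only [i2, i4])
    have m3 : 0 ≤ k * (s * (R * L) + ζ (s • x)) := mul_nonneg hk (by linarith only [i5])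
    have m4 := mul_le_mul_of_nonneg_right hkT i6
    have m5 := mul_le_mul_of_nonneg_right hkT (by positivity : 0 ≤ L * ‖X - x‖)
    linarith only [m1, m2, m3, m4, m5]
  rw [e2, ← e1, integral_const, measureReal_restrict_apply_univ, ← hV, smul_eq_mul] at main
  linarith only [l1, hL1, main, neg_abs_le (∫ x in closedBall 0 R, 2 * ct T u 1 x * (ζ x - ζ (s • x)))]

set_option maxHeartbeats 1000000 in
lemma s4 (hl : 0 < lam) (hc : 0 < c0) (hK : ∀ R, 0 < K R) {C1 : ℝ} (hC1 : 0 < C1) {ε : ℝ} (hε : 0 < ε) :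
    ∃ η > 0, ∃ R1, ∀ u G A A0, MZ (n := n) lam Lam u G A → GRW K c0 u → er G A R1 ≤ η → A0.PosDef → A0.trace ≤ C1 → |A0.det - 1| ≤ η →
      ∫ x in closedBall 0 R1, sd (A x) A0 ≤ η → ∃ b : EE n, ∀ x, ‖x‖ ≤ 1 → |u x - ⟪TM A0 x, x⟫ / 2 - ⟪b, x⟫| ≤ ε := by
  set T := K 2 + 1 with hT
  have T0 : 0 < T := by have := hK 2; linarith
  set R := max (max (2 * √n) (T / c0)) 2 with hR
  have R2 : 2 ≤ R := le_max_right _ _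
  set L := K (R + 1) + C1 * R + (K (R + 2) + C1 * (R + 1)) with hL
  have L0 : 0 < L := by have := hK (R + 1); have := hK (R + 2); positivity
  set V := volume.real (closedBall (0 : EE n) R) with hV
  have V0 : 0 ≤ V := measureReal_nonneg
  obtain ⟨ρ, hρ⟩ : ∃ ρ, ρ = min 1 (ε / (4 * L)) := ⟨_, rfl⟩
  have ρ0 : 0 < ρ := by rw [hρ]; positivity
  have ρ1 : ρ ≤ 1 := hρ ▸ min_le_left _ _
  have ρL : 2 * L * ρ ≤ ε / 2 := by
    have : ρ ≤ ε / (4 * L) := hρ ▸ min_le_right _ _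
    rw [le_div_iff₀ (by positivity)] at this; linarith
  set v := volume.real (closedBall (0 : EE n) ρ) with hv
  have v0 : 0 < v := vpos 0 ρ0
  obtain ⟨τ, hτ⟩ : ∃ τ, τ = min ε (ε * v / (2 * T * V + 1)) := ⟨_, rfl⟩
  have τ0 : 0 < τ := by rw [hτ]; positivity
  have τε : τ ≤ ε := hτ ▸ min_le_left _ _
  have τv : τ * (2 * T * V + 1) ≤ ε * v := by rw [← le_div_iff₀ (by positivity)]; exact hτ ▸ min_le_right _ _
  obtain ⟨r, hr⟩ : ∃ r, r = min 1 (τ / (4 * L)) := ⟨_, rfl⟩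
  have r0 : 0 < r := by rw [hr]; positivity
  have r1 : r ≤ 1 := hr ▸ min_le_left _ _
  have rL : 2 * L * r ≤ τ / 2 := by
    have : r ≤ τ / (4 * L) := hr ▸ min_le_right _ _
    rw [le_div_iff₀ (by positivity)] at this; linarith only [this]
  obtain ⟨s, hs⟩ : ∃ s, s = min 1 (τ / (2 * (2 * T * V * (R * L) + 1))) := ⟨_, rfl⟩
  have s0 : 0 < s := by rw [hs]; positivity
  have s1 : s ≤ 1 := hs ▸ min_le_left _ _
  have sL : s * (2 * T * V * (R * L)) ≤ τ / 2 := by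
    have : s ≤ τ / (2 * (2 * T * V * (R * L) + 1)) := hs ▸ min_le_right _ _
    rw [le_div_iff₀ (by positivity)] at this; linarith only [s0, this]
  set vr := volume.real (closedBall (0 : EE n) r) with hvr
  have vr0 : 0 < vr := vpos 0 r0
  set c := (n:ℝ) ^ 2 * (4 * √C1 + 1) + C1 with hcc
  have cc0 : 0 ≤ c := by positivity
  set q1 := |Lam| * T ^ 2 * (1 + lam⁻¹)
  set q2 := |Lam| * T ^ 2 * 3 * V
  set q3 := 6 * T * L
  set q4 := 2 * T * R * s⁻¹ ^ n with hq4
  set q5 := c * R ^ 2 / vr with hq5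
  have p1 : 0 ≤ q1 := by positivity
  have p2 : 0 ≤ q2 := by positivity
  have p3 : 0 ≤ q3 := by positivity
  have p4 : 0 ≤ q4 := by positivity
  have p5 : 0 ≤ q5 := by positivity
  obtain ⟨η, hη⟩ : ∃ η, η = min (1 / 2) (τ / (2 * (q1 + q2 + q3 + q4 + q5 + 1))) := ⟨_, rfl⟩
  have η0 : 0 < η := by rw [hη]; positivity
  have η2 : η ≤ 1 / 2 := hη ▸ min_le_left _ _
  have ηq : (q1 + q2 + q3 + q4 + q5) * η ≤ τ / 2 := by
    have : η ≤ τ / (2 * (q1 + q2 + q3 + q4 + q5 + 1)) := hη ▸ min_le_right _ _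
    rw [le_div_iff₀ (by positivity)] at this; linarith only [η0, this]
  refine ⟨η, η0, R + 1, fun u G A A0 hu hg he h0 ht hd hsd => ?_⟩
  have cu := hu.cu
  have cG := hu.cG
  have cA := hu.cA
  have cg := hu.cg
  have ciG := cont_TM hu.cinv hu.cG
  have cAx := cont_TM hu.cA continuous_id
  simp only [id] at cAx
  have hdw : HG (fun x => u x - ⟪TM A0 x, x⟫ / 2) (fun x => G x - TM A0 x) := hu.du.sub (HG.quad (pd_symm h0))
  have hLp : ∀ x : EE n, ‖x‖ ≤ R + 1 → ‖G x - TM A0 x‖ ≤ L := fun x hx => by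
    refine (norm_sub_le _ _).trans ?_
    have h1 := TM_norm_le h0.posSemidef x
    have h2 : A0.trace * ‖x‖ ≤ C1 * (R + 1) := by have := h0.posSemidef.trace_nonneg; gcongr
    have h3 := hu.Gle hg hx
    rw [show R + 1 + 1 = R + 2 by ring] at h3
    have := hK (R + 1)
    have : 0 ≤ C1 * R := by positivity
    linarith
  obtain ⟨b, hb, hlow⟩ := cvx_avg hdw (hu.dG.sub (HJ.lin A0)) (cA.sub continuous_const) (R := R) (r := r) (L := L) (c := c) (D := fun x => sd (A x) A0) r0 r1 (by linarith only [R2]) hLp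
    (csd cA continuous_const) (fun x => sd0 _ _) cc0 (fun x v => sd_lower (hu.pA x) h0 ht v) hsd
  refine ⟨b, ?_⟩
  set W : EE n → ℝ := fun x => u x - ⟪TM A0 x, x⟫ / 2 - ⟪b, x⟫ with hW
  have lowW : ∀ x, ‖x‖ ≤ R → -τ ≤ W x := fun x hx => by
    have h1 := hlow x hx
    simp only [hu.u0, inner_zero_right, zero_div, sub_zero, zero_add] at h1
    rw [← hvr, mul_div_right_comm, ← hq5] at h1
    have : q5 * η ≤ (q1 + q2 + q3 + q4 + q5) * η := by gcongr; linarith only [p1, p2, p3, p4]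
    simp only [hW]; linarith only [rL, ηq, h1, this]
  have E := s4a hl hc T0 (R := R) (L := L) (C1 := C1) (s := s) (le_max_left _ _) hC1.le (by
    have := hK (R + 2); have : 0 ≤ C1 * (R + 1) := by positivity
    rw [hL]; linarith) s0 s1 hu hg h0 ht (hd.trans η2) hb
  have mn : ∀ {f : EE n → ℝ}, Continuous f → (∀ x, 0 ≤ f x) → ∫ x in closedBall 0 R, f x ≤ ∫ x in closedBall 0 (R + 1), f x :=
    fun hf hf0 => bmono hf hf0 (closedBall_subset_closedBall (by linarith only []))
  have b1 := mn (f := fun x => |(A x).det - 1|) (by fun_prop) fun x => abs_nonneg _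
  have b2 := mn (f := fun x => ‖(A x).det • TM (A x)⁻¹ (G x) - x‖) (by fun_prop) fun x => norm_nonneg _
  have b3 := mn (f := fun x => ‖TM (A x) x - G x‖) (by fun_prop) fun x => norm_nonneg _
  have z1 := bnn (f := fun x => |(A x).det - 1|) (fun x => abs_nonneg _) 0 (R + 1)
  have z2 := bnn (f := fun x => ‖(A x).det • TM (A x)⁻¹ (G x) - x‖) (fun x => norm_nonneg _) 0 (R + 1)
  have z3 := bnn (f := fun x => ‖TM (A x) x - G x‖) (fun x => norm_nonneg _) 0 (R + 1)
  have he' := he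
  unfold er at he'
  have EE2 : 2 * (∫ x in closedBall 0 R, 2 * ct T u 1 x * W x) ≤ τ := by
    have g1 := mul_le_mul_of_nonneg_left (b1.trans (by linarith only [z2, z3, he'] : _ ≤ η)) p1
    have g2 := mul_le_mul_of_nonneg_left hd p2
    have g3 := mul_le_mul_of_nonneg_left (b2.trans (by linarith only [z1, z3, he'] : _ ≤ η)) p3
    have g4 := mul_le_mul_of_nonneg_left (b3.trans (by linarith only [z1, z2, he'] : _ ≤ η)) p4
    have g5 : 0 ≤ q5 * η := by positivity
    simp only [q1, q2, q3, q4] at g1 g2 g3 g4 ηq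
    simp only [hW]
    linarith only [sL, ηq, E, g1, g2, g3, g4, g5]
  intro x1 hx1
  rw [abs_le]
  have lw1 := lowW x1 (by linarith only [R2, hx1])
  refine ⟨by simp only [hW] at lw1; linarith only [τε, lw1], ?_⟩
  by_contra! hcon
  have dW : HG W (fun x => G x - TM A0 x - b) := hdw.sub (HG.lin b)
  have cW := dW.cont
  have k1 := hu.cct T 1
  have lipW := fun x (hx : ‖x‖ ≤ R) => lip_ball dW (R := R) (L := 2 * L) (fun x hx => (norm_sub_le _ _).trans (by linarith only [hb, hLp x (by linarith only [hx])])) (x := x1) (y := x) (by linarith only [R2, hx1]) hx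
  have hbig : ε * v ≤ ∫ x in closedBall 0 R, 2 * ct T u 1 x * (W x + τ) := by
    have h1 : ∫ x in closedBall x1 ρ, 2 * ct T u 1 x * (W x + τ) ≤ ∫ x in closedBall 0 R, 2 * ct T u 1 x * (W x + τ) := by
      refine setIntegral_mono_set (ib (by fun_prop) _ _) ?_ (LE.le.eventuallyLE (closedBall_subset_closedBall' (by rw [dist_zero_right]; linarith only [R2, ρ1, hx1])))
      refine (ae_restrict_iff' isClosed_closedBall.measurableSet).2 (ae_of_all _ fun x hx => ?_)
      have := lowW x (by simpa using hx)
      have := ct0 T u 1 x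
      exact mul_nonneg (by linarith only [this]) (by linarith)
    refine le_trans ?_ h1
    have h2 := cb (f := fun _ : EE n => ε) continuous_const (g := fun x => 2 * ct T u 1 x * (W x + τ)) (by fun_prop) (x0 := x1) (R := ρ) fun x hx => by
      have hx2 : ‖x‖ ≤ 2 := by
        calc _ = ‖x1 + (x - x1)‖ := by congr 1; abel
          _ ≤ _ := (norm_add_le _ _).trans (by linarith only [ρ1, hx1, hx])
      have h3 := ct_ge (T := T) 1 (x := x) (u := u) (by rw [hT, add_sub_cancel_right]; exact hg.up _ _ hx2)
      have h4 := lipW x (by linarith only [R2, hx2])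
      rw [norm_sub_rev] at h4
      have h5 : 2 * L * ‖x - x1‖ ≤ 2 * L * ρ := by gcongr
      have h6 := le_abs_self (W x1 - W x)
      have h7 : ε / 2 ≤ W x := by
        change ε < W x1 at hcon
        linarith only [ρL, h4, h5, h6, hcon]
      have h8 := mul_le_mul_of_nonneg_right h3 (by linarith only [hε, τ0, h7] : 0 ≤ W x + τ)
      linarith only [τ0, h7, h8]
    rw [integral_const, measureReal_restrict_apply_univ, vcen, ← hv, smul_eq_mul, mul_comm] at h2
    exact h2
  have hsm : ∫ x in closedBall 0 R, 2 * ct T u 1 x * (W x + τ) ≤ (∫ x in closedBall 0 R, 2 * ct T u 1 x * W x) + 2 * T * τ * V := by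
    have e : 2 * T * τ * V = ∫ x in closedBall (0 : EE n) R, 2 * T * τ := by
      rw [integral_const, measureReal_restrict_apply_univ, ← hV, smul_eq_mul]; ring
    rw [e, ← integral_add (ib (by fun_prop) _ _) (ib (by fun_prop) _ _)]
    refine cb (by fun_prop) (by fun_prop) fun x _ => ?_
    have := ct_le T0.le hu 1 x
    rw [pow_one] at this
    have := mul_le_mul_of_nonneg_right this τ0.le
    linarith only [this]
  linarith only [τ0, τv, EE2, hbig, hsm]
end s4b


def Fl {n : ℕ} (u : EE n → ℝ) (A : MM n) (x0 : EE n) (R ε : ℝ) : Prop :=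
  ∃ (b : EE n) (c : ℝ), ∀ x, ⟪TM A (x - x0), x - x0⟫ ≤ R ^ 2 → |u x - c - ⟪b, x⟫ - ⟪TM A (x - x0), x - x0⟫ / 2| ≤ ε * R ^ 2

section qf
variable {n : ℕ} {lam Lam : ℝ} {u : EE n → ℝ} {G : EE n → EE n} {A : EE n → MM n}

theorem qflat (hn : 1 ≤ n) (hl : 0 < lam) (h : MZ lam Lam u G A) {M σ : ℝ} (hM0 : 0 ≤ M) (hσ0 : 0 < σ) (hσ : σ < n)
    (hM : HM M σ fun x => (A x).det) {ε R : ℝ} (hε : 0 < ε) (hR : 0 < R) :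
    ∃ R' ≥ R, ∃ A' : MM n, A'.PosDef ∧ A'.det = 1 ∧ Fl u A' 0 R' ε := by
  obtain ⟨c0, K, hc, hK, hq⟩ := QN hn hl h hM0 hσ0 hσ hM
  obtain ⟨C1, hC1, hp⟩ := pick (n := n) (Lam := Lam) hl hc hK
  obtain ⟨ε1, hε1⟩ : ∃ ε1, ε1 = ε / (4 * C1) := ⟨_, rfl⟩
  have e10 : 0 < ε1 := by rw [hε1]; positivity
  obtain ⟨η, η0, R1, hs⟩ := s4 (n := n) (Lam := Lam) hl hc hK hC1 e10
  have hct : ContinuousAt (fun t : ℝ => t ^ (-1 / (n:ℝ))) 1 := Real.continuousAt_rpow_const _ _ (Or.inl one_ne_zero)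
  obtain ⟨δ1, δ10, hδ1⟩ := Metric.continuousAt_iff.1 hct (min (1/2) (ε1 / C1)) (by positivity)
  obtain ⟨η', η0', R2, hp'⟩ := hp (max R1 1) (by positivity) (min (min η (1/2)) (δ1 / 2)) (by positivity)
  choose P hP hκ hgr hd hg using fun k : ℕ => hq (1 / ((k:ℝ) + 1)) (by positivity) (1 / (2 * C1 * R ^ 2)) (by positivity) ((k:ℝ) + 1) (by positivity)
  have t0 : Tendsto (fun k : ℕ => 1 / ((k:ℝ) + 1)) atTop (𝓝 0) := tendsto_one_div_add_atTop_nhds_zero_nat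
  have hS : SQ lam Lam c0 K (fun k => nu (P k) u) (fun k => nG (P k) G) (fun k => nA (P k) A) := by
    have hm := fun k => MZ.norm hn (hP k) h
    refine ⟨hl, hc, hK, hm, hgr, fun r => ?_, fun r => ?_⟩
    · refine tendsto_of_tendsto_of_tendsto_of_le_of_le' tendsto_const_nhds t0 (Eventually.of_forall fun k => bnn (fun x => (hm k).dd_nonneg x) _ _) ?_
      filter_upwards [eventually_ge_atTop ⌈r⌉₊] with k hk
      exact (bmono (hm k).cdd (fun x => (hm k).dd_nonneg x) (closedBall_subset_closedBall (by linarith only [Nat.le_of_ceil_le hk]))).trans (hd k)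
    · refine tendsto_of_tendsto_of_tendsto_of_le_of_le' tendsto_const_nhds t0 (Eventually.of_forall fun k => bnn (fun x => abs_nonneg _) _ _) ?_
      filter_upwards [eventually_ge_atTop ⌈r⌉₊] with k hk
      exact (bmono ((hm k).cg.sub continuous_const).abs (fun x => abs_nonneg _) (closedBall_subset_closedBall (by linarith [Nat.le_of_ceil_le hk]))).trans (hg k)
  obtain ⟨k, k1, k2, k3⟩ := (((hS.er R1).eventually (ge_mem_nhds η0)).and (((hS.er R2).eventually (ge_mem_nhds η0')).and ((hS.g0 1).eventually (ge_mem_nhds η0')))).exists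
  obtain ⟨A0, hA0, tr, tri, dA, hsd⟩ := hp' _ _ _ (hS.mz k) (hgr k) k2 k3
  have dη := dA.trans ((min_le_left _ _).trans (min_le_left _ _))
  have d2 := dA.trans ((min_le_left _ _).trans (min_le_right _ _))
  have dδ := dA.trans (min_le_right _ _)
  obtain ⟨b, hb⟩ := hs _ _ _ A0 (hS.mz k) (hgr k) k1 hA0 tr dη (((bmono (csd (hS.mz k).cA continuous_const) (fun x => sd0 _ _) (closedBall_subset_closedBall (le_max_left _ _))).trans hsd).trans
    ((min_le_left _ _).trans (min_le_left _ _)))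
  clear hS hp' hs hp hq k1 k2 k3 hsd hd hg t0 hct
  specialize hP k; specialize hκ k
  generalize P k = P at *
  obtain ⟨κ, hκd⟩ : ∃ κ, κ = |P.det| ^ (-2 / (n:ℝ)) := ⟨_, rfl⟩
  rw [← hκd] at hκ
  have κ0 : 0 < κ := by rw [hκd]; positivity
  obtain ⟨s, hsd⟩ : ∃ s, s = A0.det ^ (-1 / (n:ℝ)) := ⟨_, rfl⟩
  have dA0 := hA0.det_pos
  have s0 : 0 < s := by rw [hsd]; positivity
  have hs1 : |s - 1| < min (1/2) (ε1 / C1) := by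
    have := hδ1 (x := A0.det) (by rw [Real.dist_eq]; linarith only [δ10, dδ])
    rwa [Real.one_rpow, Real.dist_eq, ← hsd] at this
  have sn : s ^ n * A0.det = 1 := by
    have hn' : (n:ℝ) ≠ 0 := by positivity
    rw [hsd, ← Real.rpow_natCast, ← Real.rpow_mul dA0.le, div_mul_cancel₀ _ hn', Real.rpow_neg_one, inv_mul_cancel₀ dA0.ne']
  have hPi : (P⁻¹).det ≠ 0 := by rw [det_nonsing_inv, Ring.inverse_eq_inv']; exact inv_ne_zero hP
  have kk := kpow hn hP
  rw [← hκd] at kk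
  have q : ∀ x, ⟪TM ((s / κ) • ((P⁻¹)ᵀ * A0 * P⁻¹)) x, x⟫ = s / κ * ⟪TM A0 (TM P⁻¹ x), TM P⁻¹ x⟫ := fun x => by
    rw [TM_smul, inner_smul_left, TM_mul, TM_mul, inner_TM, transpose_transpose]; rfl
  have sl := (abs_lt.1 (hs1.trans_le (min_le_left _ _))).1
  refine ⟨√(1 / (2 * κ * C1)), ?_, (s / κ) • ((P⁻¹)ᵀ * A0 * P⁻¹), (pd_congr hA0 hPi).smul (by positivity), ?_, κ⁻¹ • TM (P⁻¹)ᵀ b, 0, fun x hx => ?_⟩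
  · refine Real.le_sqrt_of_sq_le ?_
    rw [le_div_iff₀ (by positivity)] at hκ ⊢
    linarith only [hκ]
  · rw [det_aff, mul_comm, mul_comm, det_nonsing_inv, Ring.inverse_eq_inv', div_pow]
    have : κ ^ n ≠ 0 := by positivity
    field_simp
    linear_combination sn - kk
  · rw [sub_zero x, q, Real.sq_sqrt (by positivity)] at hx ⊢
    set y := TM P⁻¹ x with hy
    have hx' : x = TM P y := (TM_PP hP x).symm
    have l1 := pd_lower hA0 y
    have Q0 := psd_nonneg hA0.posSemidef y
    have l2 : A0⁻¹.trace * ⟪TM A0 y, y⟫ ≤ C1 * ⟪TM A0 y, y⟫ := by gcongr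
    have y1 : ‖y‖ ≤ 1 := by
      rw [div_mul_eq_mul_div, div_le_div_iff₀ (by positivity) (by positivity)] at hx
      have : s * (⟪TM A0 y, y⟫ * C1) ≤ 1 / 2 := by
        refine le_of_mul_le_mul_left ?_ κ0; linarith only [hx]
      have : (1/2) * (⟪TM A0 y, y⟫ * C1) ≤ s * (⟪TM A0 y, y⟫ * C1) := by gcongr; linarith only [sl]
      nlinarith [norm_nonneg y]
    have hb' := hb y y1
    have u1 : ⟪TM A0 y, y⟫ ≤ C1 := (quad_le_trace hA0.posSemidef y).trans (by
      have := hA0.posSemidef.trace_nonneg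
      calc _ ≤ C1 * 1 ^ 2 := by gcongr
        _ = _ := by ring)
    have e1 : |(s - 1) * ⟪TM A0 y, y⟫| ≤ ε1 := by
      rw [abs_mul, abs_of_nonneg Q0]
      calc _ ≤ ε1 / C1 * C1 := by gcongr; exact hs1.le.trans (min_le_right _ _)
        _ = _ := by field_simp
    have hbx : ⟪κ⁻¹ • TM (P⁻¹)ᵀ b, x⟫ = κ⁻¹ * ⟪b, y⟫ := by rw [inner_smul_left, inner_TM, transpose_transpose]; rfl
    have e2 : u x - 0 - ⟪κ⁻¹ • TM (P⁻¹)ᵀ b, x⟫ - s / κ * ⟪TM A0 y, y⟫ / 2 =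
        κ⁻¹ * ((nu P u y - ⟪TM A0 y, y⟫ / 2 - ⟪b, y⟫) - (s - 1) * ⟪TM A0 y, y⟫ / 2) := by
      rw [hbx, nu, ← hκd, ← hx']; field_simp; ring
    rw [e2, abs_mul, abs_of_pos (inv_pos.2 κ0)]
    have : |(nu P u y - ⟪TM A0 y, y⟫ / 2 - ⟪b, y⟫) - (s - 1) * ⟪TM A0 y, y⟫ / 2| ≤ 2 * ε1 := by
      rw [abs_le] at *; constructor <;> linarith only [hb'.1, hb'.2, e1.1, e1.2]
    calc _ ≤ κ⁻¹ * (2 * ε1) := by gcongr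
      _ = _ := by rw [hε1]; field_simp; ring
end qf


section mv
variable {n : ℕ} {u W : EE n → ℝ} {G V : EE n → EE n} {A N : EE n → MM n} {y0 : EE n} {R : ℝ}

noncomputable def kz (G : EE n → EE n) (y0 : EE n) (j : ℕ) (ρ : ℝ) (x : EE n) : ℝ := max ((ρ ^ 2 - ‖G x - y0‖ ^ 2) / 2) 0 ^ j
noncomputable def Fm (G : EE n → EE n) (A : EE n → MM n) (y0 : EE n) (R : ℝ) (W : EE n → ℝ) (ρ : ℝ) : ℝ :=
  (∫ x in closedBall 0 R, W x * kz G y0 4 ρ x * (A x).det) / ρ ^ (n + 8)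

lemma kz0 (j : ℕ) (ρ : ℝ) (x : EE n) : 0 ≤ kz G y0 j ρ x := pow_nonneg (le_max_right _ _) _
lemma kz_z {j : ℕ} (hj : j ≠ 0) {ρ : ℝ} (h0 : 0 ≤ ρ) {x : EE n} (h : ρ ≤ ‖G x - y0‖) : kz G y0 j ρ x = 0 := by
  have := pow_le_pow_left₀ h0 h 2
  rw [kz, max_eq_right (by linarith), zero_pow hj]
lemma kz_c (cG : Continuous G) (j : ℕ) : Continuous fun p : ℝ × EE n => kz G y0 j p.1 p.2 := by
  unfold kz; fun_prop
lemma kz_c' (cG : Continuous G) (j : ℕ) (ρ : ℝ) : Continuous (kz G y0 j ρ) := by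
  unfold kz; fun_prop
lemma kz_m (j : ℕ) (ρ : ℝ) (x : EE n) : kz G y0 (j+1) ρ x = (ρ ^ 2 - ‖G x - y0‖ ^ 2) / 2 * kz G y0 j ρ x ∨ j = 0 := by
  rcases Nat.eq_zero_or_pos j with h | h
  · exact Or.inr h
  left; unfold kz; rw [pow_succ']
  rcases le_total ((ρ ^ 2 - ‖G x - y0‖ ^ 2) / 2) 0 with h' | h'
  · rw [max_eq_right h', zero_pow h.ne']; ring
  · rw [max_eq_left h']
lemma kz_d (hG : HJ G A) (hA : ∀ x, (A x)ᵀ = A x) (j : ℕ) (ρ : ℝ) :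
    HG (kz G y0 (j+2) ρ) (fun x => (-((j+2) * kz G y0 (j+1) ρ x)) • TM (A x) (G x - y0)) := by
  have h1 := hG.sub (HJ.cst y0)
  have h2 := (HG.inner h1 h1).comp (φ := fun t => max ((ρ ^ 2 - t) / 2) 0 ^ (j+2)) (φ' := fun t => ((j+2) * max ((ρ ^ 2 - t) / 2) 0 ^ (j+1)) * (-1 / 2)) (fun t =>
    (pw j ((ρ ^ 2 - t) / 2)).comp t (((hasDerivAt_id t).const_sub (ρ ^ 2)).div_const 2))
  unfold kz
  simp only [sub_zero, hA, real_inner_self_eq_norm_sq] at h2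
  convert h2 using 2 with x
  rw [← two_smul ℝ, smul_smul]; congr 1; ring

lemma mvd (h : MAS u G A) (hW : HG W (fun x => TM (A x) (V x))) (hV : HJ V N) (cN : Continuous N)
    (hR : ∀ x, R ≤ ‖x‖ → 1 ≤ ‖G x - y0‖) {ρ : ℝ} (h0 : 0 < ρ) (h1 : ρ ≤ 1) :
    HasDerivAt (Fm G A y0 R W) ((∫ x in closedBall 0 R, (A x).det * (kz G y0 5 ρ x * ((A x)⁻¹ * N x).trace)) / (5 * ρ ^ (n + 9))) ρ := by
  have cW := hW.cont
  have cV := hV.cont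
  have cG := h.cG
  have cA := h.cA
  have cg := h.cg
  have cAG : Continuous fun x => TM (A x) (G x - y0) := cont_TM h.cA (cG.sub continuous_const)
  have k3 := kz_c' (y0 := y0) cG 3 ρ
  have k4 := kz_c' (y0 := y0) cG 4 ρ
  have k5 := kz_c' (y0 := y0) cG 5 ρ
  have p4 := kz_c (y0 := y0) cG 4
  have p3 := kz_c (y0 := y0) cG 3
  have ctr : Continuous fun x => ((A x)⁻¹ * N x).trace := (h.cinv.matrix_mul cN).matrix_trace
  have kv : ∀ j, j ≠ 0 → ∀ x, R ≤ ‖x‖ → kz G y0 j ρ x = 0 := fun j hj x hx => kz_z hj h0.le (h1.trans (hR x hx))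
  have sy : ∀ x, (A x)ᵀ = A x := fun x => pd_symm (h.pA x)
  have hd := deriv_int (K := closedBall 0 R) (F := fun t x => W x * kz G y0 4 t x * (A x).det) (F' := fun t x => W x * (4 * kz G y0 3 t x * t) * (A x).det)
    (isCompact_closedBall 0 R) (a := ρ - 1) (b := ρ + 1) (t0 := ρ) ⟨by linarith, by linarith⟩
    (Continuous.continuousOn (by simp only [Function.uncurry_def]; fun_prop)) (Continuous.continuousOn (by simp only [Function.uncurry_def]; fun_prop)) (fun t _ x _ => by
      refine HasDerivAt.mul_const (HasDerivAt.const_mul _ ?_) _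
      have := (pw 2 ((t ^ 2 - ‖G x - y0‖ ^ 2) / 2)).comp t ((((hasDerivAt_id t).pow 2).sub_const _).div_const 2)
      refine this.congr_deriv ?_
      simp only [kz, id]; push_cast; ring)
  have hV1 := HJ.smul hW (h.dG.sub (HJ.cst y0))
  have E1 := I1 h hV1 (by simp only [sub_zero]; exact (cW.smul cA).add (contvv (cG.sub continuous_const) (cont_TM cA cV))) (kz_d (y0 := y0) h.dG sy 2 ρ) (by fun_prop) (R := R) (kv 4 (by norm_num))
  have E2 := I1 h hV cN (kz_d (y0 := y0) h.dG sy 3 ρ) (by fun_prop) (R := R) (kv 5 (by norm_num))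
  have dp := fun x => (h.pA x).det_pos
  have ii : ∀ x y z, ⟪TM (A x)⁻¹ y, TM (A x) z⟫ = ⟪y, z⟫ := fun x y z => by
    rw [real_inner_comm, inner_TM, sy, TM_inv (dp x), real_inner_comm]
  have tt : ∀ x, ((A x)⁻¹ * A x).trace = n := fun x => by
    rw [nonsing_inv_mul _ (isUnit_iff_ne_zero.2 (dp x).ne')]; simp
  have e1 : (∫ x in closedBall 0 R, (A x).det * (kz G y0 4 ρ x * ⟪G x - y0, V x⟫)) + (n + 8) * (∫ x in closedBall 0 R, W x * kz G y0 4 ρ x * (A x).det)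
      - ρ * ∫ x in closedBall 0 R, W x * (4 * kz G y0 3 ρ x * ρ) * (A x).det = 0 := by
    rw [← integral_const_mul, ← integral_const_mul, ← integral_add (ib (by fun_prop) _ _) (ib (by fun_prop) _ _), ← integral_sub (ib (by fun_prop) _ _) (ib (by fun_prop) _ _)]
    rw [gi (R := R)] at E1
    · rw [← E1]; congr 1; ext x
      simp only [sub_zero, Matrix.mul_add, trace_add, Matrix.mul_smul, trace_smul, tt, trace_mul_vv, ii, inner_smul_left, inner_smul_right, smul_eq_mul, real_inner_self_eq_norm_sq, map_inv₀, RCLike.conj_to_real, TM_smul, map_smul]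
      rcases kz_m (G := G) (y0 := y0) 3 ρ x with h | h
      · rw [h]; push_cast; ring
      · norm_num at h
    · intro x hx
      simp only [kv 4 (by norm_num) x hx, kv 3 (by norm_num) x hx]; simp
  have e2 : 5 * (∫ x in closedBall 0 R, (A x).det * (kz G y0 4 ρ x * ⟪G x - y0, V x⟫)) = ∫ x in closedBall 0 R, (A x).det * (kz G y0 5 ρ x * ((A x)⁻¹ * N x).trace) := by
    rw [← sub_eq_zero, ← integral_const_mul, ← integral_sub (ib (by fun_prop) _ _) (ib (by fun_prop) _ _), ← neg_eq_zero, ← integral_neg]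
    rw [gi (R := R)] at E2
    · rw [← E2]; congr 1; ext x
      simp only [inner_smul_right, ii, real_inner_comm (V x)]; push_cast; ring
    · intro x hx
      simp only [kv 5 (by norm_num) x hx, kv 4 (by norm_num) x hx]; simp
  have := hd.div ((hasDerivAt_id ρ).pow (n + 8)) (by simp; positivity)
  refine this.congr_deriv ?_
  rw [← e2]
  simp only [id, Pi.pow_apply]
  rw [show n + 8 - 1 = n + 7 by rfl, div_eq_div_iff (by positivity) (by positivity)]
  push_cast
  linear_combination (-5 * ρ ^ (n+7) * ρ ^ (n+9)) * e1

lemma mvi (h : MAS u G A) (hW : HG W (fun x => TM (A x) (V x))) (hV : HJ V N) (cN : Continuous N)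
    (hR : ∀ x, R ≤ ‖x‖ → 1 ≤ ‖G x - y0‖) {κ : ℝ} (hκ : 0 ≤ κ)
    (hb : ∀ ρ, 0 < ρ → ρ ≤ 1 → -(κ * ρ ^ (n + 9)) ≤ ∫ x in closedBall 0 R, (A x).det * (kz G y0 5 ρ x * ((A x)⁻¹ * N x).trace))
    {s r : ℝ} (hs : 0 < s) (hsr : s ≤ r) (hr : r ≤ 1) : Fm G A y0 R W s ≤ Fm G A y0 R W r + κ := by
  have hd := fun (ρ : ℝ) (h0 : 0 < ρ) (h1 : ρ ≤ 1) => (mvd (y0 := y0) h hW hV cN hR h0 h1).add ((hasDerivAt_id ρ).const_mul κ)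
  have := monotoneOn_of_deriv_nonneg (convex_Icc s r) (f := Fm G A y0 R W + fun x => κ * id x)
    (fun t ht => (hd t (hs.trans_le ht.1) (ht.2.trans hr)).continuousAt.continuousWithinAt)
    (fun t ht => by rw [interior_Icc] at ht; exact (hd t (hs.trans ht.1) (ht.2.le.trans hr)).differentiableAt.differentiableWithinAt)
    (fun t ht => by
      rw [interior_Icc] at ht
      have t0 := hs.trans ht.1
      rw [(hd t t0 (ht.2.le.trans hr)).deriv]
      have := hb t t0 (ht.2.le.trans hr)
      have tp : 0 < t ^ (n + 9) := by positivity
      have : -κ ≤ (∫ x in closedBall 0 R, (A x).det * (kz G y0 5 t x * ((A x)⁻¹ * N x).trace)) / (5 * t ^ (n + 9)) := by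
        rw [le_div_iff₀ (by positivity)]
        have : 0 ≤ κ * t ^ (n + 9) := by positivity
        linarith
      linarith) ⟨le_rfl, hsr⟩ ⟨hsr, le_rfl⟩ hsr
  simp only [Pi.add_apply, id] at this
  have : κ * r ≤ κ * 1 := by gcongr
  have : 0 ≤ κ * s := by positivity
  linarith

lemma mvm (h : MAS u G A) (hR : ∀ x, R ≤ ‖x‖ → 1 ≤ ‖G x - y0‖) {s : ℝ} (hs : 0 < s) (hr : s ≤ 1) :
    Fm G A y0 R (fun _ => 1) s = Fm G A y0 R (fun _ => 1) 1 := by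
  have key : ∀ c : ℝ, Fm G A y0 R (fun _ => c) s ≤ Fm G A y0 R (fun _ => c) 1 + 0 := fun c =>
    mvi (V := fun _ => 0) (N := fun _ => 0) h (by simpa using HG.cst c) (HJ.cst 0) continuous_const hR le_rfl (fun ρ _ _ => by simp) hs hr le_rfl
  have k1 := key 1
  have k2 := key (-1)
  have e : ∀ ρ, Fm G A y0 R (fun _ => -1) ρ = - Fm G A y0 R (fun _ => 1) ρ := fun ρ => by
    unfold Fm; rw [← neg_div, ← integral_neg]; congr 2; ext x; ring
  rw [e, e] at k2
  linarith

lemma mvp (h : MAS u G A) (hW : HG W (fun x => TM (A x) (V x))) (hV : HJ V N) (cN : Continuous N)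
    (hR : ∀ x, R ≤ ‖x‖ → 1 ≤ ‖G x - y0‖) {κ : ℝ} (hκ : 0 ≤ κ)
    (hb : ∀ ρ, 0 < ρ → ρ ≤ 1 → -(κ * ρ ^ (n + 9)) ≤ ∫ x in closedBall 0 R, (A x).det * (kz G y0 5 ρ x * ((A x)⁻¹ * N x).trace))
    {r : ℝ} (hs : 0 < r) (hr : r ≤ 1) {x1 : EE n} (hx : G x1 = y0) : W x1 * Fm G A y0 R (fun _ => 1) 1 ≤ Fm G A y0 R W r + κ := by
  have cW := hW.cont
  have cG := h.cG
  have cg := h.cg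
  have dp := fun x => (h.pA x).det_pos
  have m0 : 0 ≤ Fm G A y0 R (fun _ => 1) 1 := div_nonneg (bnn (fun x => mul_nonneg (mul_nonneg zero_le_one (kz0 _ _ _)) (dp x).le) _ _) (by positivity)
  refine le_of_forall_pos_le_add fun e he => ?_
  set e' := e / (Fm G A y0 R (fun _ => 1) 1 + 1) with hee
  have e0 : 0 < e' := by positivity
  have hc : IsCompact (closedBall (0 : EE n) R ∩ {x | e' ≤ |W x - W x1|}) := (isCompact_closedBall 0 R).inter_right (isClosed_le continuous_const (by fun_prop))
  obtain ⟨δ, δ0, hδ⟩ := hc.exists_forall_le' (f := fun x => ‖G x - y0‖) (by fun_prop) (a := 0) (fun x hx' => by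
    rw [norm_pos_iff, sub_ne_zero]; rintro e
    have : x = x1 := h.inj (e.trans hx.symm)
    have h2 := hx'.2
    rw [this] at h2; simp at h2; linarith)
  set s := min δ r
  have s0 : 0 < s := lt_min δ0 hs
  have h1 := mvi h hW hV cN hR hκ hb s0 (min_le_right _ _) hr
  have h2 : (W x1 - e') * Fm G A y0 R (fun _ => 1) s ≤ Fm G A y0 R W s := by
    unfold Fm
    rw [← mul_div_assoc, ← integral_const_mul]
    have k4 := kz_c' (y0 := y0) cG 4 s
    refine div_le_div_of_nonneg_right (cb (by fun_prop) (by fun_prop) fun x hxR => ?_) (by positivity)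
    rw [sub_zero] at hxR
    rcases le_or_gt e' |W x - W x1| with hh | hh
    · rw [kz_z (by norm_num) s0.le ((min_le_left _ _).trans (hδ x ⟨by simpa using hxR, hh⟩))]; simp
    · have := (abs_lt.1 hh).1
      have hk := mul_nonneg (kz0 (G := G) (y0 := y0) 4 s x) (dp x).le
      have := mul_nonneg hk (by linarith : 0 ≤ W x - W x1 + e')
      linarith
  rw [mvm h hR s0 ((min_le_right _ _).trans hr)] at h2
  have : e' * Fm G A y0 R (fun _ => 1) 1 ≤ e := by
    have : e' * (Fm G A y0 R (fun _ => 1) 1 + 1) = e := by rw [hee]; field_simp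
    linarith
  linarith
end mv


section fl
variable {n : ℕ} {u : EE n → ℝ} {G : EE n → EE n} {A N : EE n → MM n} {y0 : EE n} {lam Lam K σ : ℝ} {β : EE n → ℝ}

noncomputable def Cv (n : ℕ) (lam Lam : ℝ) : ℝ := 1 + Lam / lam * volume.real (closedBall (0 : EE n) 3) * 2 ^ (n + 8)

lemma Cv1 (hl : 0 < lam) (hL : lam ≤ Lam) : 1 ≤ Cv n lam Lam := by
  have : 0 < Lam := hl.trans_le hL
  unfold Cv; have : 0 ≤ Lam / lam * volume.real (closedBall (0 : EE n) 3) * 2 ^ (n + 8) := by positivity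
  linarith

lemma f3 (h : MAS u G A) (hl : 0 < lam) (hlo : ∀ x, lam ≤ (A x).det) (hhi : ∀ x, (A x).det ≤ Lam)
    (hR : ∀ x, 3 ≤ ‖x‖ → 1 ≤ ‖G x - y0‖) {ρ : ℝ} (h0 : 0 < ρ) (h1 : ρ ≤ 1) :
    volume.real (closedBall 0 3 ∩ {x | ‖G x - y0‖ ≤ ρ}) ≤ Cv n lam Lam * ρ ^ n := by
  have hL : 0 < Lam := hl.trans_le ((hlo 0).trans (hhi 0))
  have h1L : 1 ≤ Lam / lam := by rw [one_le_div hl]; exact (hlo 0).trans (hhi 0)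
  set V := volume.real (closedBall (0 : EE n) 3) with hV
  have V0 : 0 < V := vpos 0 (by norm_num)
  have cG := h.cG
  have cg := h.cg
  have hm : MeasurableSet (closedBall 0 3 ∩ {x | ‖G x - y0‖ ≤ ρ}) := measurableSet_closedBall.inter (isClosed_le (by fun_prop) continuous_const).measurableSet
  have hfin : volume (closedBall (0 : EE n) 3) ≠ ⊤ := measure_closedBall_lt_top.ne
  have pn : 0 < ρ ^ n := by positivity
  rcases le_total ρ (1/2) with hρ | hρ
  · have c4 := kz_c' (y0 := y0) cG 4 (2 * ρ)
    have c41 := kz_c' (y0 := y0) cG 4 1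
    have hmm := mvm (s := 2 * ρ) h hR (by positivity) (by linarith)
    have hb : Fm G A y0 3 (fun _ => 1) 1 ≤ Lam * V := by
      unfold Fm; rw [one_pow, div_one]
      refine cb' (by fun_prop) fun x _ => ?_
      have k1 : kz G y0 4 1 x ≤ 1 := pow_le_one₀ (le_max_right _ _) (max_le (by nlinarith [sq_nonneg ‖G x - y0‖]) zero_le_one)
      have k0 := kz0 (G := G) (y0 := y0) 4 1 x
      calc 1 * kz G y0 4 1 x * (A x).det ≤ 1 * Lam := by rw [one_mul]; exact mul_le_mul k1 (hhi x) (h.dp x).le zero_le_one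
        _ = Lam := one_mul _
    rw [← hmm] at hb; unfold Fm at hb
    rw [div_le_iff₀ (by positivity)] at hb
    have i1 : ∫ x in closedBall 0 3 ∩ {x | ‖G x - y0‖ ≤ ρ}, ρ ^ 8 * lam ≤ ∫ x in closedBall 0 3, 1 * kz G y0 4 (2 * ρ) x * (A x).det := by
      have cc : Continuous fun x => 1 * kz G y0 4 (2 * ρ) x * (A x).det := by fun_prop
      refine (setIntegral_mono_on (integrableOn_const (measure_ne_top_of_subset inter_subset_left hfin)) ((ib cc 0 3).mono_set inter_subset_left) hm fun x hx => ?_).trans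
        (setIntegral_mono_set (ib cc 0 3) (Eventually.of_forall fun x => mul_nonneg (by rw [one_mul]; exact kz0 _ _ _) (h.dp x).le) (LE.le.eventuallyLE inter_subset_left))
      have hx2 : ‖G x - y0‖ ≤ ρ := hx.2
      have := pow_le_pow_left₀ (norm_nonneg _) hx2 2
      rw [one_mul]
      refine mul_le_mul ?_ (hlo x) hl.le (kz0 _ _ _)
      rw [show ρ ^ 8 = (ρ ^ 2) ^ 4 by ring]
      exact pow_le_pow_left₀ (by positivity) (le_max_of_le_left (by nlinarith)) 4
    rw [setIntegral_const, smul_eq_mul] at i1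
    have i2 := i1.trans hb
    have p8 : 0 < ρ ^ 8 * lam := by positivity
    have i3 : volume.real (closedBall 0 3 ∩ {x | ‖G x - y0‖ ≤ ρ}) ≤ (Lam / lam * V * 2 ^ (n+8)) * ρ ^ n := by
      refine le_of_mul_le_mul_right (i2.trans (le_of_eq ?_)) p8
      rw [mul_pow, pow_add ρ]; field_simp
    refine i3.trans (mul_le_mul_of_nonneg_right ?_ pn.le)
    unfold Cv; linarith
  · calc volume.real (closedBall 0 3 ∩ {x | ‖G x - y0‖ ≤ ρ}) ≤ V := measureReal_mono inter_subset_left hfin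
      _ ≤ V * (2 ^ n * ρ ^ n) := le_mul_of_one_le_right V0.le (by rw [← mul_pow]; exact one_le_pow₀ (by linarith))
      _ ≤ Cv n lam Lam * ρ ^ n := by
        rw [← mul_assoc]; refine mul_le_mul_of_nonneg_right ?_ pn.le
        have : V * 2 ^ n ≤ Lam / lam * V * 2 ^ (n+8) := mul_le_mul (le_mul_of_one_le_left V0.le h1L) (pow_le_pow_right₀ (by norm_num) (by omega)) (by positivity) (by positivity)
        unfold Cv; linarith

def HB (K σ : ℝ) (β : EE n → ℝ) : Prop := ∀ S, MeasurableSet S → S ⊆ closedBall (0 : EE n) 3 → ∫ x in S, β x ≤ K * volume.real S ^ (1 - σ / n)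

lemma f4 (h : MAS u G A) (hn : 1 ≤ n) (hl : 0 < lam) (hlo : ∀ x, lam ≤ (A x).det) (hhi : ∀ x, (A x).det ≤ Lam)
    (hR : ∀ x, 3 ≤ ‖x‖ → 1 ≤ ‖G x - y0‖) (hσ0 : 0 < σ) (hσ : σ ≤ 1) (hK : 0 ≤ K) (cβ : Continuous β) (b0 : ∀ x, 0 ≤ β x)
    (hβ : HB K σ β) {c : ℝ} (hc : 0 ≤ c) (cN : Continuous N) (ht : ∀ x, -(c * β x) ≤ ((A x)⁻¹ * N x).trace) {ρ : ℝ} (h0 : 0 < ρ) (h1 : ρ ≤ 1) :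
    -(Lam * c * K * Cv n lam Lam * ρ ^ (n + 9)) ≤ ∫ x in closedBall 0 3, (A x).det * (kz G y0 5 ρ x * ((A x)⁻¹ * N x).trace) := by
  have hL' : lam ≤ Lam := (hlo 0).trans (hhi 0)
  have hL : 0 < Lam := hl.trans_le hL'
  have cG := h.cG
  have cg := h.cg
  have c5 := kz_c' (y0 := y0) cG 5 ρ
  have ctr : Continuous fun x => ((A x)⁻¹ * N x).trace := (h.cinv.matrix_mul cN).matrix_trace
  set S := closedBall 0 3 ∩ {x | ‖G x - y0‖ ≤ ρ} with hS
  have hm : MeasurableSet S := measurableSet_closedBall.inter (isClosed_le (by fun_prop) continuous_const).measurableSet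
  have hv := f3 h hl hlo hhi hR h0 h1
  rw [← hS] at hv
  have hC := Cv1 (n := n) hl hL'
  have hn' : (1 : ℝ) ≤ n := by exact_mod_cast hn
  have hb := hβ S hm inter_subset_left
  have e0 : 0 ≤ 1 - σ / n := by rw [sub_nonneg, div_le_one (by linarith)]; linarith
  have e1 : 1 - σ / n ≤ 1 := by have : 0 < σ / n := by positivity
                                linarith
  have vb : volume.real S ^ (1 - σ / n) ≤ Cv n lam Lam * ρ ^ (n - σ) := by
    refine (Real.rpow_le_rpow measureReal_nonneg hv e0).trans ?_
    rw [Real.mul_rpow (by positivity) (by positivity), ← Real.rpow_natCast, ← Real.rpow_mul h0.le, mul_sub, mul_one, mul_div_cancel₀ _ (by positivity)]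
    refine mul_le_mul_of_nonneg_right ?_ (by positivity)
    conv_rhs => rw [← Real.rpow_one (Cv n lam Lam)]
    exact Real.rpow_le_rpow_of_exponent_le hC e1
  have i1 : ∫ x in closedBall 0 3, -((A x).det * (kz G y0 5 ρ x * ((A x)⁻¹ * N x).trace)) ≤ Lam * c * ρ ^ 10 * ∫ x in S, β x := by
    rw [setIntegral_eq_of_subset_of_forall_sdiff_eq_zero (s := S) (μ := volume) measurableSet_closedBall (t := closedBall 0 3) inter_subset_left ?_, ← integral_const_mul]
    · refine setIntegral_mono_on ((ib (by fun_prop) 0 3).mono_set inter_subset_left) ((ib (by fun_prop) 0 3).mono_set inter_subset_left) hm fun x hx => ?_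
      have k0 := kz0 (G := G) (y0 := y0) 5 ρ x
      have k1 : kz G y0 5 ρ x ≤ ρ ^ 10 := by
        rw [show ρ ^ 10 = (ρ ^ 2) ^ 5 by ring]
        exact pow_le_pow_left₀ (le_max_right _ _) (max_le (by nlinarith [sq_nonneg ‖G x - y0‖]) (by positivity)) 5
      have : -((A x)⁻¹ * N x).trace ≤ c * β x := by linarith [ht x]
      have cb0 : 0 ≤ c * β x := mul_nonneg hc (b0 x)
      calc -((A x).det * (kz G y0 5 ρ x * ((A x)⁻¹ * N x).trace)) = ((A x).det * kz G y0 5 ρ x) * (-((A x)⁻¹ * N x).trace) := by ring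
        _ ≤ ((A x).det * kz G y0 5 ρ x) * (c * β x) := mul_le_mul_of_nonneg_left this (mul_nonneg (h.dp x).le k0)
        _ ≤ (Lam * ρ ^ 10) * (c * β x) := mul_le_mul_of_nonneg_right (mul_le_mul (hhi x) k1 k0 hL.le) cb0
        _ = _ := by ring
    · intro x hx
      have : ρ ≤ ‖G x - y0‖ := by
        by_contra hh; exact hx.2 ⟨hx.1, (not_le.1 hh).le⟩
      rw [kz_z (by norm_num) h0.le this]; simp
  rw [integral_neg] at i1
  have i2 : Lam * c * ρ ^ 10 * ∫ x in S, β x ≤ Lam * c * ρ ^ 10 * (K * (Cv n lam Lam * ρ ^ (n - σ))) :=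
    mul_le_mul_of_nonneg_left (hb.trans (mul_le_mul_of_nonneg_left vb hK)) (by positivity)
  have i3 : ρ ^ 10 * ρ ^ (n - σ) ≤ ρ ^ (n + 9) := by
    rw [← Real.rpow_natCast, ← Real.rpow_natCast, ← Real.rpow_add h0]
    refine Real.rpow_le_rpow_of_exponent_ge h0 h1 ?_
    push_cast; linarith
  have i4 := mul_le_mul_of_nonneg_left i3 (show 0 ≤ Lam * c * K * Cv n lam Lam by positivity)
  linarith
end fl


section fl
variable {n : ℕ} {u : EE n → ℝ} {G : EE n → EE n} {A N : EE n → MM n} {y0 : EE n} {lam Lam K σ s : ℝ} {β : EE n → ℝ}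

structure FD (lam Lam s K σ : ℝ) (u : EE n → ℝ) (G : EE n → EE n) (A : EE n → MM n) : Prop where
  m : MAS u G A
  hl : 0 < lam
  lo : ∀ x, lam ≤ (A x).det
  hi : ∀ x, (A x).det ≤ Lam
  s0 : 0 < s
  s1 : s ≤ 1 / 8
  K0 : 0 ≤ K
  σ0 : 0 < σ
  σ1 : σ ≤ 1
  hw : ∀ x, ‖x‖ ≤ 4 → |u x - ‖x‖ ^ 2 / 2| ≤ s ^ 2
  hB : HB K σ fun x => |(A x).det - 1|

lemma FD.f1 (h : FD lam Lam s K σ u G A) {x : EE n} (hx : ‖x‖ ≤ 3) : ‖G x - x‖ ≤ 2 * s := by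
  have s0 := h.s0
  have s1 := h.s1
  by_contra hc; push Not at hc
  have hp : 0 < ‖G x - x‖ := by linarith
  set e := (‖G x - x‖)⁻¹ • (G x - x) with he
  have ne : ‖e‖ = 1 := by rw [he, norm_smul, norm_inv, norm_norm, inv_mul_cancel₀ hp.ne']
  have ie : ⟪G x - x, e⟫ = ‖G x - x‖ := by rw [he, inner_smul_right, real_inner_self_eq_norm_sq]; field_simp
  have h1 := h.m.conv x (x + (2 * s) • e)
  rw [add_sub_cancel_left, inner_smul_right] at h1
  have ns : ‖(2 * s) • e‖ = 2 * s := by rw [norm_smul, ne, mul_one, Real.norm_of_nonneg (by linarith)]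
  have h2 := abs_le.1 (h.hw (x + (2 * s) • e) ((norm_add_le _ _).trans (by rw [ns]; linarith)))
  have h3 := abs_le.1 (h.hw x (by linarith only [hx]))
  rw [norm_add_sq_real, ns, inner_smul_right] at h2
  rw [inner_sub_left] at ie
  nlinarith [h2.2, h3.1]

lemma FD.f2 (h : FD lam Lam s K σ u G A) {x y : EE n} (hx : 3 ≤ ‖x‖) (hy : ‖y‖ ≤ 1) : 1 ≤ ‖G x - y‖ := by
  have s0 := h.s0
  have s1 := h.s1
  set x' := (3 / ‖x‖) • x with hx'
  have nx : ‖x'‖ = 3 := by rw [hx', norm_smul, norm_div, norm_norm]; norm_num; field_simp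
  have g1 := h.f1 nx.le
  have i1 : 9 - 6 * s ≤ ⟪G x', x'⟫ := by
    have := neg_le_of_abs_le (abs_real_inner_le_norm (G x' - x') x')
    rw [inner_sub_left, real_inner_self_eq_norm_sq, nx] at this
    nlinarith
  have i2 : ⟪G x', x'⟫ ≤ ⟪G x, x'⟫ := by
    rcases eq_or_ne x x' with e | e
    · rw [← e]
    have := h.m.mono e
    have e2 : x - x' = (‖x‖ / 3 - 1) • x' := by
      rw [hx', smul_smul, sub_mul, sub_smul, one_mul]; congr 1
      rw [show ‖x‖ / 3 * (3 / ‖x‖) = 1 by field_simp, one_smul]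
    rw [e2, inner_smul_right, inner_sub_left] at this
    have : 0 ≤ ⟪G x, x'⟫ - ⟪G x', x'⟫ := by
      by_contra hh; push Not at hh
      nlinarith
    linarith
  have i3 := real_inner_le_norm (G x) x'
  rw [nx] at i3
  have := norm_sub_norm_le (G x) y
  linarith

lemma id3 {x y : EE n} (hx : 3 ≤ ‖x‖) (hy : ‖y‖ ≤ 1) : 1 ≤ ‖id x - y‖ := by
  have := norm_sub_norm_le x y
  simp only [id]; linarith

lemma p4lip {a b : ℝ} (ha : a ≤ 1 / 2) (hb : b ≤ 1 / 2) : |max a 0 ^ 4 - max b 0 ^ 4| ≤ |a - b| := by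
  have h1 : |max a 0 - max b 0| ≤ |a - b| := abs_max_sub_max_le_abs a b 0
  have p0 : 0 ≤ max a 0 := le_max_right _ _
  have q0 : 0 ≤ max b 0 := le_max_right _ _
  have p1 : max a 0 ≤ 1 / 2 := max_le ha (by norm_num)
  have q1 : max b 0 ≤ 1 / 2 := max_le hb (by norm_num)
  generalize max a 0 = p at *
  generalize max b 0 = q at *
  rw [show p ^ 4 - q ^ 4 = (p - q) * ((p + q) * (p ^ 2 + q ^ 2)) by ring, abs_mul]
  have : |(p + q) * (p ^ 2 + q ^ 2)| ≤ 1 := by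
    rw [abs_of_nonneg (by positivity)]
    exact mul_le_one₀ (by linarith) (by positivity) (by nlinarith)
  calc |p - q| * |(p + q) * (p ^ 2 + q ^ 2)| ≤ |p - q| * 1 := mul_le_mul_of_nonneg_left this (abs_nonneg _)
    _ ≤ _ := by linarith

lemma FD.kd (h : FD lam Lam s K σ u G A) {x x0 : EE n} (hx : ‖x‖ ≤ 3) (hx0 : ‖x0‖ ≤ 1) : |kz id x0 4 1 x - kz G x0 4 1 x| ≤ 9 * s := by
  have s1 := h.s1
  have s0 := h.s0
  refine (p4lip (by nlinarith [sq_nonneg ‖id x - x0‖]) (by nlinarith [sq_nonneg ‖G x - x0‖])).trans ?_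
  have g1 := h.f1 hx
  have a1 : ‖x - x0‖ ≤ 4 := (norm_sub_le _ _).trans (by linarith)
  have a2 := norm_sub_norm_le (G x - x0) (x - x0)
  have a3 := norm_sub_norm_le (x - x0) (G x - x0)
  rw [sub_sub_sub_cancel_right] at a2 a3
  rw [norm_sub_rev x (G x)] at a3
  simp only [id]
  have b0 := norm_nonneg (G x - x0)
  have b1 := norm_nonneg (x - x0)
  generalize ‖G x - x0‖ = p at *
  generalize ‖x - x0‖ = q at *
  rw [show (1 ^ 2 - q ^ 2) / 2 - (1 ^ 2 - p ^ 2) / 2 = (p - q) * ((p + q) / 2) by ring, abs_mul]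
  have c1 : |p - q| ≤ 2 * s := abs_le.2 ⟨by linarith, by linarith⟩
  have c2 : |(p + q) / 2| ≤ 9 / 2 := by rw [abs_of_nonneg (by linarith)]; linarith
  calc _ ≤ (2 * s) * (9 / 2) := mul_le_mul c1 c2 (abs_nonneg _) (by linarith)
    _ = _ := by ring

noncomputable def wf (u : EE n → ℝ) (x : EE n) : ℝ := u x - ‖x‖ ^ 2 / 2
lemma kz_le1 (x : EE n) : kz G y0 4 1 x ≤ 1 := pow_le_one₀ (le_max_right _ _) (max_le (by nlinarith [sq_nonneg ‖G x - y0‖]) zero_le_one)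

set_option maxHeartbeats 1000000 in
lemma f5 (hn : 1 ≤ n) (lam Lam : ℝ) (hL0 : 0 ≤ Lam) (hl0 : 0 < lam) : ∃ C > 0, ∀ s K σ u G A, FD (n := n) lam Lam s K σ u G A → ∀ x0 : EE n, ‖x0‖ ≤ 1 → ∀ r, 0 < r → r ≤ 1 →
    |wf u x0 * Fm id (fun _ => 1) x0 3 (fun _ => 1) 1 - Fm id (fun _ => 1) x0 3 (wf u) r| ≤ C * (s ^ 3 + K) := by
  obtain ⟨V, hV⟩ : ∃ V, V = volume.real (closedBall (0 : EE n) 3) := ⟨_, rfl⟩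
  have V0 : 0 < V := by rw [hV]; exact vpos 0 (by norm_num)
  obtain ⟨c, hc⟩ : ∃ c, c = 1 + lam⁻¹ := ⟨_, rfl⟩
  have c0 : 0 < c := by rw [hc]; positivity
  obtain ⟨k1, hk1⟩ : ∃ k, k = 1 * c * Cv n 1 1 := ⟨_, rfl⟩
  obtain ⟨k2, hk2⟩ : ∃ k, k = Lam * c * Cv n lam Lam := ⟨_, rfl⟩
  have k10 : 0 < k1 := by have := Cv1 (n := n) one_pos le_rfl; rw [hk1]; positivity
  have k20 : 0 ≤ k2 := by rw [hk2]; unfold Cv; positivity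
  refine ⟨18 * V + (1 + V) + k1 + k2, by positivity, fun s K σ u G A h x0 hx0 r r0 r1 => ?_⟩
  have s0 := h.s0
  have s1 := h.s1
  have K0 := h.K0
  have cg := h.m.cg
  have cG := h.m.cG
  have cu := h.m.cu
  have cA := h.m.cA
  have cw : Continuous (wf u) := by unfold wf; fun_prop
  have cβ : Continuous fun x => |(A x).det - 1| := by fun_prop
  have lg : ∀ x, |Real.log (A x).det| ≤ c * |(A x).det - 1| := fun x => hc ▸ abs_log_le h.hl (h.lo x)
  have R1 : ∀ x : EE n, 3 ≤ ‖x‖ → 1 ≤ ‖id x - x0‖ := fun x hx => id3 hx hx0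
  have R2 : ∀ x : EE n, 3 ≤ ‖x‖ → 1 ≤ ‖G x - x0‖ := fun x hx => h.f2 hx hx0
  have dW : HG (wf u) (fun x => TM ((fun _ => (1 : MM n)) x) (G x - id x)) := by
    simp only [TM_one, ContinuousLinearMap.id_apply]; exact h.m.du.sub MAS_one.du
  have dV : HJ (fun x => G x - id x) (fun x => A x - (fun _ => (1 : MM n)) x) := h.m.dG.sub MAS_one.dG
  have cN : Continuous (fun x => A x - (fun _ => (1 : MM n)) x) := cA.sub continuous_const
  have hb1 : ∀ ρ, 0 < ρ → ρ ≤ 1 → -(k1 * K * ρ ^ (n + 9)) ≤ ∫ x in closedBall (0 : EE n) 3, ((fun _ => (1 : MM n)) x).det * (kz id x0 5 ρ x * (((fun _ => (1 : MM n)) x)⁻¹ * (A x - (fun _ => (1 : MM n)) x)).trace) := fun ρ p0 p1 => by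
    have := f4 (lam := 1) (Lam := 1) (y0 := x0) MAS_one hn one_pos (fun _ => by simp) (fun _ => by simp) R1 h.σ0 h.σ1 K0 cβ (fun _ => abs_nonneg _) h.hB c0.le cN (fun x => by
      have t := trace_ge (PosDef.one (n := Fin n) (R := ℝ)) (h.m.pA x)
      have l := neg_le_of_abs_le (lg x)
      simp only [inv_one, one_mul, det_one, div_one, trace_sub, trace_one, Fintype.card_fin] at t ⊢
      linarith only [l, t]) p0 p1
    refine le_trans (le_of_eq ?_) this
    rw [hk1]; ring
  have low := mvp (κ := k1 * K) (y0 := x0) MAS_one dW dV cN R1 (by positivity) hb1 r0 r1 (x1 := x0) rfl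
  have mid := mvi (κ := k1 * K) (y0 := x0) MAS_one dW dV cN R1 (by positivity) hb1 r0 r1 le_rfl
  obtain ⟨x1, hx1⟩ : ∃ x1, G x1 = x0 := by
    obtain ⟨x1, m1, m2⟩ := (isCompact_closedBall (0 : EE n) 3).exists_isMinOn (f := fun x => u x - ⟪x0, x⟫) ⟨0, by simp⟩ (by fun_prop)
    rcases lt_or_ge ‖x1‖ 3 with l | l
    · have lm : IsLocalMin (fun x => u x - ⟪x0, x⟫) x1 := m2.isLocalMin (closedBall_mem_nhds_of_mem (by simpa using l))
      exact ⟨x1, sub_eq_zero.1 ((h.m.du.sub (HG.lin x0)).min (h.m.dG.sub (HJ.cst x0)) (by fun_prop) lm).1⟩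
    · exfalso
      have e : ‖x1‖ = 3 := le_antisymm (by simpa using m1) l
      have := m2 (show (0 : EE n) ∈ closedBall 0 3 by simp)
      simp only [mem_ofPred_eq, inner_zero_right, sub_zero] at this
      have a1 := abs_le.1 (h.hw x1 (by linarith only [e]))
      have a2 := abs_le.1 (h.hw 0 (by simp))
      rw [e] at a1; rw [norm_zero] at a2
      have a3 := real_inner_le_norm x0 x1
      rw [e] at a3
      nlinarith
  have dW2 : HG (fun x => ⟪x, G x⟫ - u x - ⟪G x, G x⟫ / 2) (fun x => TM (A x) (x - G x)) := by
    have e1 := (h.m.dz.sub h.m.du).sub ((HG.inner h.m.dG h.m.dG).cmul (1/2))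
    convert e1 using 2 with x x
    · rw [one_div, inv_mul_eq_div]
    · rw [pd_symm (h.m.pA x), ← two_smul ℝ (TM (A x) (G x)), smul_smul, map_sub]; norm_num
  have dV2 : HJ (fun x => x - G x) (fun x => (1 : MM n) - A x) := HJ.idd.sub h.m.dG
  have cN2 : Continuous (fun x => (1 : MM n) - A x) := continuous_const.sub cA
  have up := mvp (κ := k2 * K) (y0 := x0) h.m dW2 dV2 cN2 R2 (by positivity) (fun ρ p0 p1 => by
    have := f4 (y0 := x0) h.m hn h.hl h.lo h.hi R2 h.σ0 h.σ1 K0 cβ (fun _ => abs_nonneg _) h.hB c0.le cN2 (fun x => by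
      have t := trace_ge (h.m.pA x) (PosDef.one (n := Fin n) (R := ℝ))
      have l := le_of_abs_le (lg x)
      rw [det_one, one_div, Real.log_inv, mul_one] at t
      rw [Matrix.mul_sub, mul_one, nonsing_inv_mul _ (isUnit_iff_ne_zero.2 (h.m.dp x).ne'), trace_sub, trace_one, Fintype.card_fin]
      linarith only [t, l]) p0 p1
    refine le_trans (le_of_eq ?_) this
    rw [hk2]; ring) one_pos le_rfl hx1
  have w1 : -wf u x0 ≤ ⟪x1, G x1⟫ - u x1 - ⟪G x1, G x1⟫ / 2 := by
    have := h.m.conv x1 x0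
    rw [hx1, inner_sub_right, real_inner_self_eq_norm_sq] at this
    rw [hx1, real_inner_self_eq_norm_sq, real_inner_comm]; unfold wf; linarith only [this]
  have w2 : ∀ x, ⟪x, G x⟫ - u x - ⟪G x, G x⟫ / 2 ≤ -wf u x := fun x => by
    have := norm_sub_sq_real x (G x)
    have := sq_nonneg ‖x - G x‖
    rw [real_inner_self_eq_norm_sq]; unfold wf; linarith
  have c4 := kz_c' (y0 := x0) cG 4 1
  have c4' := kz_c' (y0 := x0) (continuous_id (X := EE n)) 4 1
  have wb : ∀ x, ‖x‖ ≤ 3 → |wf u x - wf u x0| ≤ 2 * s ^ 2 := fun x hx => by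
    have a1 := abs_le.1 (h.hw x (by linarith only [hx]))
    have a2 := abs_le.1 (h.hw x0 (by linarith only [hx0]))
    unfold wf; exact abs_le.2 ⟨by linarith only [a1, a2], by linarith only [a1, a2]⟩
  have cW2 := dW2.cont
  simp only [Fm, one_pow, div_one] at up
  have u1 : ∫ x in closedBall 0 3, (wf u x - wf u x0) * kz G x0 4 1 x * (A x).det ≤ k2 * K := by
    have a1 : (∫ x in closedBall 0 3, (⟪x, G x⟫ - u x - ⟪G x, G x⟫ / 2) * kz G x0 4 1 x * (A x).det) ≤ ∫ x in closedBall 0 3, -(wf u x) * kz G x0 4 1 x * (A x).det :=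
      cb (by fun_prop) (by fun_prop) fun x _ => mul_le_mul_of_nonneg_right (mul_le_mul_of_nonneg_right (w2 x) (kz0 _ _ _)) (h.m.dp x).le
    have a2 : -wf u x0 * (∫ x in closedBall 0 3, 1 * kz G x0 4 1 x * (A x).det) ≤ (⟪x1, G x1⟫ - u x1 - ⟪G x1, G x1⟫ / 2) * (∫ x in closedBall 0 3, 1 * kz G x0 4 1 x * (A x).det) :=
      mul_le_mul_of_nonneg_right w1 (bnn (fun x => mul_nonneg (by rw [one_mul]; exact kz0 _ _ _) (h.m.dp x).le) _ _)
    have a3 := (a2.trans up).trans (add_le_add_left a1 _)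
    rw [← integral_const_mul, ← sub_nonneg, add_sub_right_comm, ← integral_sub (ib (by fun_prop) _ _) (ib (by fun_prop) _ _)] at a3
    have a4 : (∫ x in closedBall 0 3, (wf u x - wf u x0) * kz G x0 4 1 x * (A x).det) = - ∫ x in closedBall 0 3, (-(wf u x) * kz G x0 4 1 x * (A x).det - -wf u x0 * (1 * kz G x0 4 1 x * (A x).det)) := by
      rw [← integral_neg]; congr 1; ext x; ring
    rw [a4]; linarith only [a3]
  have u2 : ∫ x in closedBall 0 3, ((wf u x - wf u x0) * kz id x0 4 1 x - (wf u x - wf u x0) * kz G x0 4 1 x * (A x).det) ≤ 18 * V * s ^ 3 + K * (1 + V) := by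
    have b1 : ∫ x in closedBall 0 3, ((wf u x - wf u x0) * kz id x0 4 1 x - (wf u x - wf u x0) * kz G x0 4 1 x * (A x).det) ≤ ∫ x in closedBall 0 3, (18 * s ^ 3 + |(A x).det - 1|) := by
      refine cb (by fun_prop) (by fun_prop) fun x hx => ?_
      rw [sub_zero] at hx
      have e1 := wb x hx
      have e2 := h.kd hx hx0
      have e3 := kz_le1 (G := G) (y0 := x0) x
      have e4 := kz0 (G := G) (y0 := x0) 4 1 x
      calc (wf u x - wf u x0) * kz id x0 4 1 x - (wf u x - wf u x0) * kz G x0 4 1 x * (A x).det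
          = (wf u x - wf u x0) * (kz id x0 4 1 x - kz G x0 4 1 x) - (wf u x - wf u x0) * kz G x0 4 1 x * ((A x).det - 1) := by ring
        _ ≤ |wf u x - wf u x0| * |kz id x0 4 1 x - kz G x0 4 1 x| + |wf u x - wf u x0| * kz G x0 4 1 x * |(A x).det - 1| := by
          have t1 := le_abs_self ((wf u x - wf u x0) * (kz id x0 4 1 x - kz G x0 4 1 x))
          have t2 := neg_le_abs ((wf u x - wf u x0) * kz G x0 4 1 x * ((A x).det - 1))
          rw [abs_mul] at t1
          rw [abs_mul, abs_mul, abs_of_nonneg e4] at t2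
          linarith only [t1, t2]
        _ ≤ (2 * s ^ 2) * (9 * s) + 1 * 1 * |(A x).det - 1| := by
          refine add_le_add (mul_le_mul e1 e2 (abs_nonneg _) (by positivity)) (mul_le_mul_of_nonneg_right (mul_le_mul (e1.trans ?_) e3 e4 zero_le_one) (abs_nonneg _))
          nlinarith
        _ = _ := by ring
    rw [integral_add (ib continuous_const _ _) (ib cβ _ _), setIntegral_const, smul_eq_mul, ← hV] at b1
    have b2 := h.hB _ measurableSet_closedBall (subset_refl _)
    rw [← hV] at b2
    have hn' : (1 : ℝ) ≤ n := by exact_mod_cast hn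
    have b3 : V ^ (1 - σ / n) ≤ 1 + V := by
      have e0 : 0 ≤ 1 - σ / n := by rw [sub_nonneg, div_le_one (by linarith only [hn'])]; linarith only [hn', h.σ1]
      have e1 : 1 - σ / n ≤ 1 := by have : 0 ≤ σ / n := div_nonneg h.σ0.le (by linarith only [])
                                    linarith only [this]
      calc V ^ (1 - σ / n) ≤ (1 + V) ^ (1 - σ / n) := Real.rpow_le_rpow V0.le (by linarith only []) e0
        _ ≤ (1 + V) ^ (1 : ℝ) := Real.rpow_le_rpow_of_exponent_le (by linarith only [V0]) e1
        _ = _ := Real.rpow_one _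
    have b4 := mul_le_mul_of_nonneg_left b3 K0
    linarith only [b1, b2, b4]
  rw [integral_sub (ib (by fun_prop) _ _) (ib (by fun_prop) _ _)] at u2
  have u3 : Fm id (fun _ => 1) x0 3 (wf u) 1 - wf u x0 * Fm id (fun _ => 1) x0 3 (fun _ => 1) 1 = ∫ x in closedBall 0 3, (wf u x - wf u x0) * kz id x0 4 1 x := by
    simp only [Fm, one_pow, div_one, det_one, mul_one, one_mul]
    rw [← integral_const_mul, ← integral_sub (ib (by fun_prop) _ _) (ib (by fun_prop) _ _)]
    congr 1; ext x; ring
  have p1 : 0 ≤ V * K := by positivity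
  have p2 : 0 ≤ (1 + V + k1 + k2) * s ^ 3 := by positivity
  have p3 : 0 ≤ k2 * K := by positivity
  have p4 : 0 ≤ k1 * K := by positivity
  have p5 : 0 ≤ V * s ^ 3 := by positivity
  rw [abs_le]; constructor <;> linarith only [mid, u1, u2, u3, p1, p2, K0, low, p3, p5]
end fl


section fl
variable {n : ℕ} {u : EE n → ℝ} {G : EE n → EE n} {A N : EE n → MM n} {y0 : EE n} {lam Lam K σ s : ℝ} {β : EE n → ℝ}

lemma t4 (a h : ℝ) : |max (a + h) 0 ^ 4 - max a 0 ^ 4 - 4 * max a 0 ^ 3 * h - 6 * max a 0 ^ 2 * h ^ 2| ≤ |h| ^ 3 * (4 * |a| + 11 * |h|) := by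
  have ah := abs_nonneg h
  rcases le_total 0 a with ha | ha <;> rcases le_total 0 (a + h) with hb | hb
  · rw [max_eq_left ha, max_eq_left hb, show (a + h) ^ 4 - a ^ 4 - 4 * a ^ 3 * h - 6 * a ^ 2 * h ^ 2 = h ^ 3 * (4 * a + h) by ring, abs_mul, abs_pow]
    refine mul_le_mul_of_nonneg_left ((abs_add_le _ _).trans ?_) (by positivity)
    rw [abs_mul, abs_of_pos (by norm_num : (0:ℝ) < 4)]; linarith
  · rw [max_eq_left ha, max_eq_right hb]
    have e : |h| = -h := abs_of_nonpos (by linarith)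
    have hp : a ≤ |h| := by linarith
    have q2 := pow_le_pow_left₀ ha hp 2
    have q3 := pow_le_pow_left₀ ha hp 3
    have q4 := pow_le_pow_left₀ ha hp 4
    rw [show h = -|h| by linarith]
    generalize |h| = p at *
    rw [abs_neg, abs_of_nonneg ah, abs_of_nonneg ha]
    have r1 : 0 ≤ a ^ 3 * p := by positivity
    have r2 : a ^ 3 * p ≤ p ^ 4 := by nlinarith
    have r3 : a ^ 2 * p ^ 2 ≤ p ^ 4 := by nlinarith [sq_nonneg p]
    have r4 : 0 ≤ a ^ 2 * p ^ 2 := by positivity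
    have r5 : 0 ≤ a ^ 4 := by positivity
    have r6 : 0 ≤ p ^ 3 * a := by positivity
    have r7 : 0 ≤ p ^ 4 := by positivity
    rw [abs_le]; constructor <;> nlinarith
  · rw [max_eq_right ha, max_eq_left hb]
    have hp : a + h ≤ |h| := by linarith [le_abs_self h]
    have q4 := pow_le_pow_left₀ hb hp 4
    have : 0 ≤ |h| ^ 3 * |a| := by positivity
    have r7 : 0 ≤ |h| ^ 4 := by positivity
    have r8 : 0 ≤ (a + h) ^ 4 := by positivity
    rw [abs_le]; constructor <;> nlinarith
  · rw [max_eq_right ha, max_eq_right hb]; simp; positivity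

noncomputable def kk (x z : EE n) : ℝ := kz id 0 4 1 z + 4 * kz id 0 3 1 z * ⟪z, x⟫ + (12 * kz id 0 2 1 z * ⟪z, x⟫ ^ 2 - 4 * kz id 0 3 1 z * ‖x‖ ^ 2) / 2

lemma kk_b {x z : EE n} (hz : ‖z‖ ≤ 3) (hx : ‖x‖ ≤ 1) : |kz id x 4 1 z - kk x z| ≤ 3000 * ‖x‖ ^ 3 := by
  have nz := norm_nonneg z
  have nx := norm_nonneg x
  obtain ⟨a, ha⟩ : ∃ a, a = (1 ^ 2 - ‖z‖ ^ 2) / 2 := ⟨_, rfl⟩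
  obtain ⟨h, hh⟩ : ∃ h, h = ⟪z, x⟫ - ‖x‖ ^ 2 / 2 := ⟨_, rfl⟩
  have e : (1 ^ 2 - ‖z - x‖ ^ 2) / 2 = a + h := by rw [norm_sub_sq_real, ha, hh]; ring
  have ab : |a| ≤ 4 := by rw [abs_le]; constructor <;> nlinarith
  have zx : |⟪z, x⟫| ≤ 3 * ‖x‖ := (abs_real_inner_le_norm z x).trans (mul_le_mul_of_nonneg_right hz nx)
  have hb : |h| ≤ 7 / 2 * ‖x‖ := by
    rw [hh]; refine (abs_sub _ _).trans ?_
    rw [abs_of_nonneg (by positivity : 0 ≤ ‖x‖ ^ 2 / 2)]; nlinarith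
  have t := t4 a h
  have p1 : max a 0 ≤ 1 := max_le (by nlinarith) zero_le_one
  have p0 : 0 ≤ max a 0 := le_max_right _ _
  have p2 : max a 0 ^ 2 ≤ 1 := pow_le_one₀ p0 p1
  have t2 : |h| ^ 3 * (4 * |a| + 11 * |h|) ≤ 2500 * ‖x‖ ^ 3 := by
    calc |h| ^ 3 * (4 * |a| + 11 * |h|) ≤ (7 / 2 * ‖x‖) ^ 3 * 55 := mul_le_mul (pow_le_pow_left₀ (abs_nonneg _) hb 3) (by linarith only [hx, ab, hb]) (by positivity) (by positivity)
      _ ≤ _ := by nlinarith [pow_nonneg nx 3]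
  have k : kz id x 4 1 z - kk x z = (max (a + h) 0 ^ 4 - max a 0 ^ 4 - 4 * max a 0 ^ 3 * h - 6 * max a 0 ^ 2 * h ^ 2) + 6 * max a 0 ^ 2 * (‖x‖ ^ 2 * (‖x‖ ^ 2 / 4 - ⟪z, x⟫)) := by
    unfold kk kz; simp only [id, sub_zero]; rw [e, ← ha, hh]; ring
  rw [k]
  refine (abs_add_le _ _).trans ((add_le_add (t.trans t2) (d := 500 * ‖x‖ ^ 3) ?_).trans (by linarith only []))
  rw [abs_mul, abs_of_nonneg (by positivity : 0 ≤ 6 * max a 0 ^ 2), abs_mul, abs_of_nonneg (sq_nonneg ‖x‖)]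
  have : |‖x‖ ^ 2 / 4 - ⟪z, x⟫| ≤ 4 * ‖x‖ := by
    refine (abs_sub _ _).trans ?_
    rw [abs_of_nonneg (by positivity : 0 ≤ ‖x‖ ^ 2 / 4)]; nlinarith
  calc 6 * max a 0 ^ 2 * (‖x‖ ^ 2 * |‖x‖ ^ 2 / 4 - ⟪z, x⟫|) ≤ 6 * 1 * (‖x‖ ^ 2 * (4 * ‖x‖)) :=
        mul_le_mul (by linarith only [p2]) (mul_le_mul_of_nonneg_left this (by positivity)) (by positivity) (by norm_num)
    _ ≤ _ := by nlinarith [pow_nonneg nx 3]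

lemma ti {f g : EE n → ℝ} (hf : Continuous f) (hg : Continuous g) {C : ℝ} {x0 : EE n} {R : ℝ} (h : ∀ x, ‖x - x0‖ ≤ R → |f x - g x| ≤ C) :
    |(∫ x in closedBall x0 R, f x) - ∫ x in closedBall x0 R, g x| ≤ C * volume.real (closedBall x0 R) := by
  rw [← integral_sub (ib hf _ _) (ib hg _ _), abs_le, ← neg_le, ← integral_neg]
  exact ⟨cb' (by fun_prop) fun x hx => neg_le.1 (abs_le.1 (h x hx)).1, cb' (by fun_prop) fun x hx => (abs_le.1 (h x hx)).2⟩

lemma tay {w : EE n → ℝ} (cw : Continuous w) {m : ℝ} (hm : ∀ x, ‖x‖ ≤ 3 → |w x| ≤ m) :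
    ∃ (c : ℝ) (b : EE n) (H : MM n), Hᵀ = H ∧ (∀ i j, |H i j| ≤ 112 * m * volume.real (closedBall (0 : EE n) 3)) ∧ ∀ x, ‖x‖ ≤ 1 →
      |(∫ z in closedBall 0 3, w z * kz id x 4 1 z) - (c + ⟪b, x⟫ + ⟪TM H x, x⟫ / 2)| ≤ 3000 * m * volume.real (closedBall (0 : EE n) 3) * ‖x‖ ^ 3 := by
  have m0 : 0 ≤ m := (abs_nonneg _).trans (hm 0 (by simp))
  have cz : ∀ (x : EE n) j, Continuous (kz id x j 1) := fun x j => kz_c' continuous_id j 1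
  have cz4 := cz 0 4
  have cz3 := cz 0 3
  have cz2 := cz 0 2
  have kb : ∀ (j : ℕ) (z : EE n), |kz id 0 j 1 z| ≤ 1 := fun j z => by
    rw [abs_of_nonneg (kz0 _ _ _)]; exact pow_le_one₀ (le_max_right _ _) (max_le (by nlinarith [sq_nonneg ‖id z - 0‖]) zero_le_one)
  have cv : Continuous fun z : EE n => (w z * (4 * kz id 0 3 1 z)) • z := by fun_prop
  have ci : ∀ i : Fin n, Continuous fun z : EE n => z i := fun i => by fun_prop
  have ch : ∀ i j : Fin n, Continuous fun z : EE n => w z * (12 * kz id 0 2 1 z * z i * z j - 4 * kz id 0 3 1 z * (1 : MM n) i j) := fun i j => by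
    have := ci i
    have := ci j
    fun_prop
  obtain ⟨H, hH⟩ : ∃ H : MM n, ∀ i j, H i j = ∫ z in closedBall (0 : EE n) 3, w z * (12 * kz id 0 2 1 z * z i * z j - 4 * kz id 0 3 1 z * (1 : MM n) i j) := ⟨Matrix.of fun _ _ => _, fun _ _ => rfl⟩
  refine ⟨∫ z in closedBall 0 3, w z * kz id 0 4 1 z, ∫ z in closedBall 0 3, (w z * (4 * kz id 0 3 1 z)) • z,
    H, ?_, fun i j => ?_, fun x hx => ?_⟩
  · ext i j; rw [transpose_apply, hH, hH]; congr 1; ext z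
    rw [show (1 : MM n) j i = (1 : MM n) i j by rw [one_apply, one_apply]; simp only [eq_comm]]; ring
  · have := ti (ch i j) continuous_const (g := fun _ => 0) (C := 112 * m) (x0 := 0) (R := 3) (fun z hz => by
      rw [sub_zero] at hz ⊢
      rw [abs_mul, mul_comm (112 : ℝ)]
      refine mul_le_mul (hm z hz) ((abs_sub _ _).trans ?_) (abs_nonneg _) m0
      have h1 : |(1 : MM n) i j| ≤ 1 := by rw [one_apply]; split_ifs <;> simp
      have zi : |z i| ≤ 3 := (abs_coord z i).trans hz
      have zj : |z j| ≤ 3 := (abs_coord z j).trans hz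
      rw [abs_mul, abs_mul, abs_mul, abs_mul, abs_mul, abs_of_pos (by norm_num : (0:ℝ) < 12), abs_of_pos (by norm_num : (0:ℝ) < 4)]
      have a1 : 12 * |kz id 0 2 1 z| * |z i| * |z j| ≤ 12 * 1 * 3 * 3 := by
        have := kb 2 z
        gcongr
      have a2 : 4 * |kz id 0 3 1 z| * |(1 : MM n) i j| ≤ 4 * 1 * 1 := by
        have := kb 3 z
        gcongr
      linarith)
    rw [hH]; simpa using this
  · have e : (∫ z in closedBall 0 3, w z * kz id 0 4 1 z) + ⟪∫ z in closedBall 0 3, (w z * (4 * kz id 0 3 1 z)) • z, x⟫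
        + ⟪TM H x, x⟫ / 2 = ∫ z in closedBall 0 3, w z * kk x z := by
      have e1 : ⟪∫ z in closedBall 0 3, (w z * (4 * kz id 0 3 1 z)) • z, x⟫ = ∫ z in closedBall 0 3, w z * (4 * kz id 0 3 1 z * ⟪z, x⟫) := by
        rw [real_inner_comm, ← integral_inner (𝕜 := ℝ) (cv.continuousOn.integrableOn_compact (isCompact_closedBall _ _))]
        congr 1; ext z; rw [inner_smul_right, real_inner_comm]; ring
      have e2 : ⟪TM H x, x⟫
          = ∫ z in closedBall 0 3, w z * (12 * kz id 0 2 1 z * ⟪z, x⟫ ^ 2 - 4 * kz id 0 3 1 z * ‖x‖ ^ 2) := by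
        rw [quad_sum]
        simp only [hH, ← integral_mul_const]
        have q1 : ∀ i, (∑ j, ∫ z in closedBall (0 : EE n) 3, w z * (12 * kz id 0 2 1 z * z i * z j - 4 * kz id 0 3 1 z * (1 : MM n) i j) * x i * x j)
            = ∫ z in closedBall (0 : EE n) 3, ∑ j, w z * (12 * kz id 0 2 1 z * z i * z j - 4 * kz id 0 3 1 z * (1 : MM n) i j) * x i * x j := fun i =>
          (integral_finsetSum _ fun j _ => ib (((ch i j).mul continuous_const).mul continuous_const) _ _).symm
        simp only [q1]
        refine (integral_finsetSum _ fun i _ => ib (continuous_finsetSum _ fun j _ => ((ch i j).mul continuous_const).mul continuous_const) _ _).symm.trans ?_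
        congr 1; ext z
        have z1 : ⟪z, x⟫ = ∑ i, z i * x i := by rw [inner_vec]; rfl
        have z2 : ‖x‖ ^ 2 = ∑ i, ∑ j, (1 : MM n) i j * x i * x j := by
          rw [← quad_sum, TM_one]; simp
        rw [z2, z1, pow_two, Finset.sum_mul_sum]
        simp only [Finset.mul_sum, ← Finset.sum_sub_distrib]
        refine Finset.sum_congr rfl fun i _ => Finset.sum_congr rfl fun j _ => by simp only [Pi.mul_apply]; ring
      rw [e1, e2, ← integral_add (ib (by fun_prop) _ _) (ib (by fun_prop) _ _), ← integral_div, ← integral_add (ib (by fun_prop) _ _) (ib (by fun_prop) _ _)]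
      congr 1; ext z; unfold kk; ring
    rw [e]
    have czx := cz x 4
    refine (ti (by fun_prop) (by unfold kk; fun_prop) (C := 3000 * m * ‖x‖ ^ 3) fun z hz => ?_).trans (le_of_eq (by ring))
    rw [sub_zero] at hz
    rw [← mul_sub, abs_mul]
    refine (mul_le_mul (hm z hz) (kk_b hz hx) (abs_nonneg _) m0).trans (le_of_eq (by ring))

lemma kap {x0 : EE n} (hx : ‖x0‖ ≤ 1) : Fm id (fun _ => 1) x0 3 (fun _ => 1) 1 = Fm id (fun _ => 1) (0 : EE n) 3 (fun _ => 1) 1 := by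
  unfold Fm; congr 1
  have z : ∀ x0 : EE n, ‖x0‖ ≤ 1 → ∀ x : EE n, 3 ≤ ‖x‖ → 1 * kz id x0 4 1 x * (1 : MM n).det = 0 := fun x0 h0 x hx => by
    rw [kz_z (by norm_num) zero_le_one (id3 hx h0)]; simp
  rw [← gi (z x0 hx), ← gi (z 0 (by simp))]
  rw [← integral_sub_right_eq_self (fun x : EE n => 1 * kz id 0 4 1 x * (1 : MM n).det) x0]
  simp only [kz, id, sub_zero]

lemma kz_low {j : ℕ} {r : ℝ} (h0 : 0 < r) (h1 : r ≤ 1) : (3 * r ^ 2 / 8) ^ j * ((r / 2) ^ n * volume.real (closedBall (0 : EE n) 1)) ≤ ∫ x in closedBall (0 : EE n) 3, kz id 0 j r x := by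
  have c := kz_c' (y0 := 0) (continuous_id (X := EE n)) j r
  have e : (r / 2) ^ n * volume.real (closedBall (0 : EE n) 1) = volume.real (closedBall (0 : EE n) (r / 2)) := by
    rw [Measure.addHaar_real_closedBall' volume 0 (show 0 ≤ r / 2 by positivity)]; simp
  rw [e]
  refine le_trans ?_ (bmono c (kz0 j r) (closedBall_subset_closedBall (show r / 2 ≤ 3 by linarith)))
  have := cb (f := fun _ => (3 * r ^ 2 / 8) ^ j) continuous_const c (x0 := 0) (R := r / 2) fun x hx => by
    refine pow_le_pow_left₀ (by positivity) (le_max_of_le_left ?_) j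
    have := pow_le_pow_left₀ (norm_nonneg _) hx 2
    simp only [id]; linarith
  rwa [setIntegral_const, smul_eq_mul, mul_comm] at this

lemma kap0 : 0 < Fm id (fun _ => 1) (0 : EE n) 3 (fun _ => 1) 1 := by
  have := kz_low (n := n) (j := 4) one_pos le_rfl
  unfold Fm; simp only [one_mul, det_one, mul_one, one_pow, div_one]
  refine lt_of_lt_of_le ?_ this
  have := vpos (0 : EE n) one_pos
  positivity
end fl


section fl
variable {n : ℕ} {u : EE n → ℝ} {G : EE n → EE n} {A N : EE n → MM n} {y0 : EE n} {lam Lam K σ s : ℝ} {β : EE n → ℝ}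

lemma kq (H : MM n) {r : ℝ} (h0 : 0 < r) (h1 : r ≤ 1) : 5 * (∫ x in closedBall 0 3, ⟪TM H x, x⟫ * kz id 0 4 r x) = H.trace * ∫ x in closedBall (0 : EE n) 3, kz id 0 5 r x := by
  have c4 := kz_c' (y0 := 0) (continuous_id (X := EE n)) 4 r
  have c5 := kz_c' (y0 := 0) (continuous_id (X := EE n)) 5 r
  have hz : ∀ j, j ≠ 0 → ∀ x : EE n, 3 ≤ ‖x‖ → kz id 0 j r x = 0 := fun j hj x hx => kz_z hj h0.le (h1.trans (id3 hx (by simp)))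
  have e := I2 (HJ.lin H) continuous_const (kz_d (y0 := 0) MAS_one.dG (fun _ => transpose_one) 3 r) (by simp only [TM_one, sub_zero, id]; fun_prop) (hz 5 (by norm_num))
  rw [gi (R := 3) fun x hx => by simp [hz 5 (by norm_num) x hx, hz 4 (by norm_num) x hx]] at e
  rw [← integral_const_mul, ← integral_const_mul, ← sub_eq_zero, ← integral_sub (ib (by fun_prop) _ _) (ib (by fun_prop) _ _), ← neg_eq_zero, ← integral_neg, ← e]
  congr 1; ext x
  simp only [TM_one, sub_zero, id, inner_smul_right, ContinuousLinearMap.id_apply]; push_cast; ring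

lemma kodd (b : EE n) (r : ℝ) : ∫ x in closedBall (0 : EE n) 3, ⟪b, x⟫ * kz id 0 4 r x = 0 := by
  have e : ∫ x in closedBall (0 : EE n) 3, ⟪b, x⟫ * kz id 0 4 r x = ∫ x in closedBall (0 : EE n) 3, -(⟪b, x⟫ * kz id 0 4 r x) := by
    rw [← integral_indicator measurableSet_closedBall, ← integral_indicator measurableSet_closedBall, ← integral_neg_eq_self]
    congr 1; ext x
    simp only [indicator, mem_closedBall, dist_zero_right, norm_neg, kz, id, sub_zero, inner_neg_right, neg_mul]
  rw [integral_neg] at e; linarith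

set_option maxHeartbeats 1000000 in
lemma flat0 (hn : 1 ≤ n) (lam Lam : ℝ) (hL0 : 0 ≤ Lam) (hl0 : 0 < lam) : ∃ C > 0, ∀ s K σ u G A, FD (n := n) lam Lam s K σ u G A →
    ∃ (c : ℝ) (b : EE n) (H : MM n), Hᵀ = H ∧ (∀ i j, |H i j| ≤ C * s ^ 2) ∧
      (∀ x, ‖x‖ ≤ 1 → |wf u x - (c + ⟪b, x⟫ + ⟪TM H x, x⟫ / 2)| ≤ C * (s ^ 2 * ‖x‖ ^ 3 + s ^ 3 + K)) ∧
      ∀ r, 0 < r → r ≤ 1 → |H.trace| * r ^ 2 ≤ C * (s ^ 2 * r ^ 3 + s ^ 3 + K) := by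
  obtain ⟨C5, p5, h5⟩ := f5 hn lam Lam hL0 hl0
  obtain ⟨V, hV⟩ : ∃ V, V = volume.real (closedBall (0 : EE n) 3) := ⟨_, rfl⟩
  have V0 : 0 < V := by rw [hV]; exact vpos 0 (by norm_num)
  obtain ⟨V1, hV1⟩ : ∃ V, V = volume.real (closedBall (0 : EE n) 1) := ⟨_, rfl⟩
  have V10 : 0 < V1 := by rw [hV1]; exact vpos 0 (by norm_num)
  obtain ⟨k, hk⟩ : ∃ k, k = Fm id (fun _ => 1) (0 : EE n) 3 (fun _ => 1) 1 := ⟨_, rfl⟩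
  have k0 : 0 < k := hk ▸ kap0
  obtain ⟨C1, hC1⟩ : ∃ C, C = (C5 + 3000 * V) / k := ⟨_, rfl⟩
  have C10 : 0 < C1 := by rw [hC1]; positivity
  obtain ⟨c5, hc5⟩ : ∃ c : ℝ, c = (3 / 8) ^ 5 * (1 / 2) ^ n * V1 := ⟨_, rfl⟩
  have c50 : 0 < c5 := by rw [hc5]; positivity
  obtain ⟨C2, hC2⟩ : ∃ C, C = 10 * (C5 + 2 * C1 * k) / c5 := ⟨_, rfl⟩
  have C20 : 0 < C2 := by rw [hC2]; positivity
  refine ⟨112 * V / k + C1 + C2, by positivity, fun s K σ u G A h => ?_⟩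
  have h5 := h5 s K σ u G A h
  have s0 := h.s0
  have K0 := h.K0
  have cu := h.m.cu
  have cw : Continuous (wf u) := by unfold wf; fun_prop
  obtain ⟨c', b', H', hs, hb, ht⟩ := tay cw (m := s ^ 2) fun x hx => h.hw x (by linarith only [hx])
  rw [← hV] at hb ht
  have hE : ∀ x, ‖x‖ ≤ 1 → |wf u x - (k⁻¹ * c' + ⟪k⁻¹ • b', x⟫ + ⟪TM (k⁻¹ • H') x, x⟫ / 2)| ≤ C1 * (s ^ 2 * ‖x‖ ^ 3 + (s ^ 3 + K)) := fun x hx => by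
    have t1 := ht x hx
    have t2 := h5 x hx 1 one_pos le_rfl
    rw [kap hx, ← hk] at t2
    simp only [Fm, one_pow, div_one, det_one, mul_one] at t2
    have t3 := abs_sub_le (wf u x * k) (∫ z in closedBall 0 3, wf u z * kz id x 4 1 z) (c' + ⟪b', x⟫ + ⟪TM H' x, x⟫ / 2)
    have e : wf u x - (k⁻¹ * c' + ⟪k⁻¹ • b', x⟫ + ⟪TM (k⁻¹ • H') x, x⟫ / 2) = (wf u x * k - (c' + ⟪b', x⟫ + ⟪TM H' x, x⟫ / 2)) / k := by
      rw [TM_smul, inner_smul_left, inner_smul_left, RCLike.conj_to_real]; field_simp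
    rw [e, abs_div, abs_of_pos k0, hC1, div_mul_eq_mul_div]
    refine div_le_div_of_nonneg_right ?_ k0.le
    have q1 : 0 ≤ C5 * (s ^ 2 * ‖x‖ ^ 3) := by positivity
    have q2 : 0 ≤ V * (s ^ 3 + K) := by positivity
    linarith only [t1, t2, t3, q1, q2]
  refine ⟨k⁻¹ * c', k⁻¹ • b', k⁻¹ • H', by rw [transpose_smul, hs], fun i j => ?_, fun x hx => ?_, fun r r0 r1 => ?_⟩
  · rw [Matrix.smul_apply, smul_eq_mul, abs_mul, abs_of_pos (by positivity)]
    calc k⁻¹ * |H' i j| ≤ k⁻¹ * (112 * s ^ 2 * V) := mul_le_mul_of_nonneg_left (hb i j) (by positivity)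
      _ = 112 * V / k * s ^ 2 := by ring
      _ ≤ _ := mul_le_mul_of_nonneg_right (by linarith only [C10, C20]) (by positivity)
  · rw [add_assoc (s ^ 2 * ‖x‖ ^ 3)]
    exact (hE x hx).trans (mul_le_mul_of_nonneg_right (by have : 0 < 112 * V / k := by positivity
                                                          linarith only [C20, this]) (by positivity))
  · generalize k⁻¹ • H' = H at hE ⊢
    generalize k⁻¹ • b' = b at hE
    generalize k⁻¹ * c' = c at hE
    have z4 := kz_c' (y0 := 0) (continuous_id (X := EE n)) 4 r
    have z5 := kz_c' (y0 := 0) (continuous_id (X := EE n)) 5 r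
    obtain ⟨d, hd⟩ : ∃ d, d = s ^ 3 + K := ⟨_, rfl⟩
    have d0 : 0 ≤ d := by rw [hd]; positivity
    rw [add_assoc (s ^ 2 * r ^ 3)]; rw [← hd] at hE h5 ⊢
    obtain ⟨m, hm⟩ : ∃ m, m = C1 * (s ^ 2 * r ^ 3 + d) := ⟨_, rfl⟩
    have m0 : 0 ≤ m := by rw [hm]; positivity
    have hm4 : ∫ x in closedBall (0 : EE n) 3, kz id 0 4 r x = k * r ^ (n + 8) := by
      have := mvm (y0 := 0) (R := 3) (MAS_one (n := n)) (fun x hx => id3 hx (by simp)) r0 r1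
      rw [← hk] at this
      simp only [Fm, det_one, mul_one, one_mul] at this
      rw [div_eq_iff (by positivity)] at this; exact this
    have g1 := h5 0 (by simp) r r0 r1
    rw [← hk] at g1
    simp only [Fm, det_one, mul_one] at g1
    have g2 := hE 0 (by simp)
    simp only [inner_zero_right, norm_zero, add_zero, zero_div, map_zero] at g2
    norm_num at g2
    have cT : Continuous fun x => c + ⟪b, x⟫ + ⟪TM H x, x⟫ / 2 := by fun_prop
    have g3 : |(∫ x in closedBall (0 : EE n) 3, wf u x * kz id 0 4 r x) - ∫ x in closedBall (0 : EE n) 3, (c + ⟪b, x⟫ + ⟪TM H x, x⟫ / 2) * kz id 0 4 r x| ≤ m * (k * r ^ (n + 8)) := by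
      rw [← integral_sub (ib (by fun_prop) _ _) (ib (by fun_prop) _ _), ← hm4, ← integral_const_mul]
      refine (abs_integral_le_integral_abs).trans (cb (by fun_prop) (by fun_prop) fun x _ => ?_)
      rw [← sub_mul, abs_mul, abs_of_nonneg (kz0 _ _ _)]
      rcases le_total r ‖x‖ with hx | hx
      · rw [kz_z (by norm_num) r0.le (by simpa using hx)]; simp
      · refine mul_le_mul_of_nonneg_right ((hE x (hx.trans r1)).trans ?_) (kz0 _ _ _)
        rw [hm]
        have := pow_le_pow_left₀ (norm_nonneg _) hx 3
        gcongr
    have g4 : ∫ x in closedBall (0 : EE n) 3, (c + ⟪b, x⟫ + ⟪TM H x, x⟫ / 2) * kz id 0 4 r x = c * (k * r ^ (n + 8)) + H.trace * (∫ x in closedBall (0 : EE n) 3, kz id 0 5 r x) / 10 := by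
      have e1 := kq H r0 r1
      have e2 := kodd b r
      rw [show H.trace * (∫ x in closedBall (0 : EE n) 3, kz id 0 5 r x) / 10 = 1 / 2 * ∫ x in closedBall 0 3, ⟪TM H x, x⟫ * kz id 0 4 r x by rw [← e1]; ring, ← hm4,
        ← integral_const_mul, ← integral_const_mul, ← add_zero (∫ x in closedBall (0 : EE n) 3, c * kz id 0 4 r x), ← e2,
        ← integral_add (ib (by fun_prop) _ _) (ib (by fun_prop) _ _), ← integral_add (ib (by fun_prop) _ _) (ib (by fun_prop) _ _)]
      congr 1; ext x; ring
    rw [g4] at g3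
    have kl := kz_low (n := n) (j := 5) r0 r1
    rw [← hV1] at kl
    have kl' : c5 * r ^ 2 * r ^ (n + 8) ≤ ∫ x in closedBall (0 : EE n) 3, kz id 0 5 r x := by
      refine le_trans (le_of_eq ?_) kl
      rw [hc5, div_pow r, pow_add, one_div 2, inv_pow]; ring
    have P : 0 < r ^ (n + 8) := by positivity
    generalize (∫ x in closedBall (0 : EE n) 3, kz id 0 5 r x) = I5 at *
    generalize (∫ x in closedBall (0 : EE n) 3, wf u x * kz id 0 4 r x) = Iw at *
    generalize r ^ (n + 8) = p at *
    obtain ⟨q, hq⟩ : ∃ q, q = Iw / p := ⟨_, rfl⟩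
    have hq' : Iw = q * p := by rw [hq]; field_simp
    rw [← hq] at g1
    rw [hq'] at g3
    have g5 : |H.trace| * I5 / 10 ≤ p * (C5 * d + C1 * d * k + m * k) := by
      have I50 : 0 ≤ I5 := le_trans (by positivity) kl'
      have e : H.trace * I5 / 10 = -(q * p - (c * (k * p) + H.trace * I5 / 10)) - p * (wf u 0 * k - q) + p * k * (wf u 0 - c) := by ring
      have e' : |H.trace| * I5 / 10 = |H.trace * I5 / 10| := by rw [abs_div, abs_mul, abs_of_nonneg I50, abs_of_pos (by norm_num : (0:ℝ) < 10)]
      rw [e', e]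
      refine (abs_add_le _ _).trans ((add_le_add (abs_sub _ _) le_rfl).trans ?_)
      rw [abs_neg, abs_mul, abs_mul, abs_of_pos P, abs_of_pos (mul_pos P k0)]
      have a1 := mul_le_mul_of_nonneg_left g1 P.le
      have a2 := mul_le_mul_of_nonneg_left g2 (mul_pos P k0).le
      linarith only [g3, a1, a2]
    have g6 : |H.trace| * (c5 * r ^ 2 * p) / 10 ≤ p * (C5 * d + C1 * d * k + m * k) :=
      (div_le_div_of_nonneg_right (mul_le_mul_of_nonneg_left kl' (abs_nonneg _)) (by norm_num)).trans g5
    have g7 : |H.trace| * r ^ 2 ≤ 10 * (C5 * d + C1 * d * k + m * k) / c5 := by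
      rw [le_div_iff₀ c50]
      refine le_of_mul_le_mul_left ?_ P
      linarith only [g6]
    refine g7.trans ?_
    have g8 : 10 * (C5 * d + C1 * d * k + m * k) / c5 ≤ C2 * (s ^ 2 * r ^ 3 + d) := by
      rw [hC2, div_mul_eq_mul_div, hm]
      refine div_le_div_of_nonneg_right ?_ c50.le
      have q1 : 0 ≤ C5 * (s ^ 2 * r ^ 3) := by positivity
      have q2 : 0 ≤ C1 * k * (s ^ 2 * r ^ 3) := by positivity
      linarith only [q1, q2]
    refine g8.trans (mul_le_mul_of_nonneg_right ?_ (by positivity))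
    have : 0 < 112 * V / k := by positivity
    linarith only [C10, this]
end fl


def Cl {n : ℕ} (η : ℝ) (A B : MM n) : Prop := ∀ v, |⟪TM A v, v⟫ - ⟪TM B v, v⟫| ≤ η * ⟪TM B v, v⟫

theorem ldet {n : ℕ} {H : MM n} (hs : Hᵀ = H) {m : ℝ} (hm : ∀ i j, |H i j| ≤ m) (h2 : (n:ℝ) ^ 2 * m ≤ 1 / 2) :
    (1 + H).PosDef ∧ |Real.log (1 + H).det - H.trace| ≤ 2 * (n ^ 2 * m ^ 2) := by
  have hq := fun v : EE n => (quad_bd hm v).trans (mul_le_mul_of_nonneg_right h2 (sq_nonneg _))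
  have hp : (1 + H).PosDef := pd_of (by simp [hs]) fun x hx => by
    have := abs_le.1 (hq x)
    have : 0 < ‖x‖ ^ 2 := by positivity
    simp only [TM_add, TM_one, inner_add_left, real_inner_self_eq_norm_sq]; linarith
  refine ⟨hp, ?_⟩
  have t1 := trace_ge (PosDef.one (n := Fin n)) hp
  have t2 := trace_ge hp (PosDef.one (n := Fin n))
  have dp := hp.det_pos
  obtain ⟨B, hB⟩ : ∃ B, B = (1 + H)⁻¹ := ⟨_, rfl⟩
  have i1 : (1 + H) * B = 1 := by rw [hB]; exact mul_nonsing_inv _ dp.ne'.isUnit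
  have i2 : B * (1 + H) = 1 := by rw [hB]; exact nonsing_inv_mul _ dp.ne'.isUnit
  have e1 : B = 1 - H + H * B * H := by
    have a1 : H * B = 1 - B := by rw [eq_sub_iff_add_eq, ← i1]; noncomm_ring
    have a2 : B * H = 1 - B := by rw [eq_sub_iff_add_eq, ← i2]; noncomm_ring
    rw [a1, sub_mul, one_mul, a2]; noncomm_ring
  have hBp : B.PosDef := hB ▸ hp.inv
  have hM : (2 - B : MM n).PosSemidef := psd_of (by rw [transpose_sub, pd_symm hBp]; congr 1; exact transpose_ofNat 2) fun x => by
    have h3 := hq (TM B x)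
    have h4 : TM (1 + H) (TM B x) = x := by rw [hB]; exact TM_inv dp x
    have h5 : ⟪TM H (TM B x), TM B x⟫ = ⟪x, TM B x⟫ - ‖TM B x‖ ^ 2 := by
      nth_rw 3 [← h4]; simp only [TM_add, TM_one, inner_add_left, real_inner_self_eq_norm_sq]; ring
    rw [h5] at h3
    have h6 := (abs_le.1 h3).1
    have h7 := real_inner_le_norm x (TM B x)
    have h8 : ‖TM B x‖ ≤ 2 * ‖x‖ := by
      by_contra hc
      push Not at hc
      have := norm_nonneg x
      nlinarith
    have e2 : TM (2 - B : MM n) x = (2:ℝ) • x - TM B x := by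
      rw [show (2 : MM n) = (2:ℝ) • 1 by ext i j; simp [Matrix.smul_apply, ofNat_apply, one_apply, Matrix.diagonal_apply], TM_sub, TM_smul, TM_one]
    rw [e2, inner_sub_left, real_inner_smul_left, real_inner_self_eq_norm_sq, real_inner_comm]
    have := mul_le_mul_of_nonneg_left h8 (norm_nonneg x)
    linarith only [h7, this]
  have h9 : 0 ≤ (H * (2 - B) * H).trace := by
    have := (hM.mul_mul_conjTranspose_same H).trace_nonneg
    rwa [conjTranspose_eq_transpose_of_trivial, hs] at this
  have h10 : (H * (2 - B) * H).trace = 2 * (H * H).trace - (H * B * H).trace := by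
    rw [mul_sub, sub_mul, trace_sub, mul_two, add_mul, trace_add]; ring
  have h11 : (H * H).trace ≤ n ^ 2 * m ^ 2 := by
    simp only [trace, diag, Matrix.mul_apply]
    calc ∑ i, ∑ j, H i j * H j i ≤ ∑ i : Fin n, ∑ j : Fin n, m ^ 2 := Finset.sum_le_sum fun i _ => Finset.sum_le_sum fun j _ => by
          rw [sq]; exact (le_abs_self _).trans (by rw [abs_mul]; exact mul_le_mul (hm _ _) (hm _ _) (abs_nonneg _) ((abs_nonneg _).trans (hm i j)))
      _ = _ := by simp; ring
  rw [inv_one, one_mul, det_one, div_one, trace_add, trace_one, Fintype.card_fin] at t1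
  rw [← hB, mul_one, det_one, one_div, Real.log_inv, e1, trace_add, trace_sub, trace_one, Fintype.card_fin] at t2
  have := sq_nonneg m
  have : 0 ≤ (n:ℝ) ^ 2 * m ^ 2 := by positivity
  rw [abs_le]; constructor <;> linarith only [t2, h9, h10, h11, t1]

theorem flat {n : ℕ} (hn : 1 ≤ n) (lam Lam : ℝ) (hL0 : 0 ≤ Lam) (hl0 : 0 < lam) : ∃ C ≥ (1:ℝ), ∀ s K σ u G (A : EE n → MM n), FD lam Lam s K σ u G A → C * s ^ 2 ≤ 1 →
    ∀ r, 0 < r → r ≤ 1 → ∃ A' : MM n, A'.PosDef ∧ A'.det = 1 ∧ Cl (C * s ^ 2) A' 1 ∧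
      ∃ (b : EE n) (c : ℝ), ∀ x : EE n, ‖x‖ ≤ r → |u x - c - ⟪b, x⟫ - ⟪TM A' x, x⟫ / 2| ≤ C * (s ^ 2 * r ^ 3 + s ^ 3 + K) := by
  obtain ⟨C, C0, hC⟩ := flat0 hn lam Lam hL0 hl0
  obtain ⟨N, hN⟩ : ∃ N : ℝ, N = n := ⟨_, rfl⟩
  have N1 : 1 ≤ N := by rw [hN]; exact_mod_cast hn
  obtain ⟨D, hD⟩ : ∃ D : ℝ, D = N ^ 2 * C := ⟨_, rfl⟩
  have D0 : 0 < D := by rw [hD]; positivity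
  refine ⟨1 + 9 * D + 8 * D ^ 2 + 3 * C, by linarith [sq_nonneg D], fun s K σ u G A h hs r r0 r1 => ?_⟩
  obtain ⟨c, b, H, Hs, Hb, Hw, Ht⟩ := hC s K σ u G A h
  have s0 := h.s0
  have K0 := h.K0
  have s1 := h.s1
  have Ds : D * s ^ 2 ≤ 1 / 9 := by
    have : 0 ≤ (1 + 8 * D ^ 2 + 3 * C) * s ^ 2 := by positivity
    linarith only [hs, this]
  have Ds0 : 0 ≤ D * s ^ 2 := by positivity
  obtain ⟨hp, hL⟩ := ldet Hs Hb (by rw [← hN, ← mul_assoc, ← hD]; linarith only [Ds])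
  have hq := quad_bd Hb
  rw [← hN, ← mul_assoc, ← hD] at hq
  have e4 : 2 * (N ^ 2 * (C * s ^ 2) ^ 2) ≤ 2 * (D * s ^ 2) ^ 2 := by
    rw [hD]
    have : 0 ≤ (N * C * s ^ 2) ^ 2 := by positivity
    have : 1 ≤ N ^ 2 := by nlinarith
    nlinarith
  rw [← hN] at hL
  have hL' := hL.trans e4
  have tb : |H.trace| ≤ D * s ^ 2 := by
    refine (Finset.abs_sum_le_sum_abs _ _).trans ((Finset.sum_le_sum fun i _ => Hb i i).trans ?_)
    rw [Finset.sum_const, Finset.card_univ, Fintype.card_fin, nsmul_eq_mul, ← hN, hD]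
    have := mul_le_mul_of_nonneg_right (le_self_pow₀ N1 two_ne_zero) (by positivity : 0 ≤ C * s ^ 2)
    linarith only [this]
  obtain ⟨L, hLd⟩ : ∃ L, L = Real.log (1 + H).det := ⟨_, rfl⟩
  rw [← hLd] at hL'
  have L1 : |L| ≤ |H.trace| + 2 * (D * s ^ 2) ^ 2 := by
    have := abs_add_le (L - H.trace) H.trace
    rw [sub_add_cancel] at this; linarith only [hL', this]
  have L2 : |L| ≤ 2 * (D * s ^ 2) := by nlinarith
  obtain ⟨e, he⟩ : ∃ e, e = Real.exp (-L / N) := ⟨_, rfl⟩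
  have e0 : 0 < e := by rw [he]; positivity
  have tL : |-L / N| ≤ |L| := by rw [abs_div, abs_neg, abs_of_pos (by linarith only [N1] : 0 < N)]; exact div_le_self (abs_nonneg _) N1
  have e1 : |e - 1| ≤ 2 * |L| := by rw [he]; exact (Real.abs_exp_sub_one_le (by linarith only [Ds, L2, tL])).trans (by linarith only [tL])
  have hQ : ∀ v : EE n, |⟪TM (e • (1 + H)) v, v⟫ - (‖v‖ ^ 2 + ⟪TM H v, v⟫)| ≤ 2 * |L| * (2 * ‖v‖ ^ 2) := fun v => by
    rw [TM_smul, real_inner_smul_left, TM_add, TM_one, inner_add_left, real_inner_self_eq_norm_sq, ← sub_one_mul, abs_mul]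
    refine mul_le_mul e1 ?_ (abs_nonneg _) (by positivity)
    have h1 := hq v
    have h2 : D * s ^ 2 * ‖v‖ ^ 2 ≤ 1 * ‖v‖ ^ 2 := mul_le_mul_of_nonneg_right (by linarith only [Ds]) (sq_nonneg _)
    have h3 := sq_nonneg ‖v‖
    rw [abs_le] at h1 ⊢; constructor <;> linarith only [h1, h2]
  refine ⟨e • (1 + H), hp.smul e0, ?_, fun v => ?_, b, c, fun x hx => ?_⟩
  · rw [det_smul, Fintype.card_fin, he, ← Real.exp_nat_mul, ← hN, mul_div_cancel₀ _ (by linarith only [N1]), hLd, Real.exp_neg, Real.exp_log hp.det_pos, inv_mul_cancel₀ hp.det_pos.ne']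
  · have h1 := hQ v
    have h2 := hq v
    rw [TM_one, real_inner_self_eq_norm_sq]
    have h3 : 2 * |L| * (2 * ‖v‖ ^ 2) ≤ 8 * (D * s ^ 2) * ‖v‖ ^ 2 := by linarith only [mul_le_mul_of_nonneg_right L2 (sq_nonneg ‖v‖)]
    have h4 : 0 ≤ (1 + 8 * D ^ 2 + 3 * C) * s ^ 2 * ‖v‖ ^ 2 := by positivity
    rw [abs_le] at h1 h2 ⊢; constructor <;> linarith only [h1, h2, h3, h4]
  · have h1 := hQ x
    have h2 := Hw x (hx.trans r1)
    have h3 := Ht r r0 r1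
    have x2 := pow_le_pow_left₀ (norm_nonneg x) hx 2
    have x3 := pow_le_pow_left₀ (norm_nonneg x) hx 3
    have h4 : 2 * |L| * (2 * ‖x‖ ^ 2) ≤ 4 * (C * (s ^ 2 * r ^ 3 + s ^ 3 + K)) + 8 * D ^ 2 * s ^ 3 := by
      have a1 : |L| * ‖x‖ ^ 2 ≤ |L| * r ^ 2 := mul_le_mul_of_nonneg_left x2 (abs_nonneg _)
      have a2 := mul_le_mul_of_nonneg_right L1 (sq_nonneg r)
      have a3 : s ^ 4 * r ^ 2 ≤ s ^ 3 * 1 := mul_le_mul (pow_le_pow_of_le_one s0.le (by linarith only [s1]) (by norm_num)) (pow_le_one₀ r0.le r1) (by positivity) (by positivity)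
      have a4 := mul_le_mul_of_nonneg_left a3 (sq_nonneg D)
      linarith only [h3, a1, a2, a4]
    have h5 : C * (s ^ 2 * ‖x‖ ^ 3 + s ^ 3 + K) ≤ C * (s ^ 2 * r ^ 3 + s ^ 3 + K) := by gcongr
    have h6 : 0 ≤ (1 + 9 * D + 4 * D ^ 2) * (s ^ 2 * r ^ 3 + s ^ 3 + K) := by positivity
    have h7 : 0 ≤ D ^ 2 * (s ^ 2 * r ^ 3 + K) := by positivity
    unfold wf at h2
    rw [abs_le] at h1 h2 ⊢; constructor <;> linarith only [h1, h2, h4, h5, h6, h7]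


section st
variable {n : ℕ} {lam Lam d K σ ε R : ℝ} {u g : EE n → ℝ} {G : EE n → EE n} {A : EE n → MM n} {B : MM n} {x0 : EE n}

def KB (g : EE n → ℝ) (d : ℝ) (B : MM n) (x0 : EE n) (R K σ : ℝ) : Prop :=
  ∀ P : MM n, Pᵀ * B * P = (R ^ 2 / 16) • (1 : MM n) → HB K σ fun y => |g (x0 + TM P y) / d - 1|

lemma exP (hB : B.PosDef) (hR : 0 < R) : ∃ P : MM n, P.det ≠ 0 ∧ Pᵀ * B * P = (R ^ 2 / 16) • (1 : MM n) := by
  obtain ⟨Q, hQ⟩ := psd_sqrt hB.posSemidef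
  have hd : Q.det ≠ 0 := by
    intro h
    have := hB.det_pos
    rw [hQ, det_mul, h, mul_zero] at this
    exact lt_irrefl _ this
  have hu : IsUnit Q.det := isUnit_iff_ne_zero.2 hd
  have hi : (Q⁻¹).det ≠ 0 := by rw [det_nonsing_inv, Ring.inverse_eq_inv']; exact inv_ne_zero hd
  refine ⟨(R / 4) • Q⁻¹, by rw [det_smul]; exact mul_ne_zero (by positivity) hi, ?_⟩
  rw [transpose_smul, hQ, Matrix.smul_mul, Matrix.smul_mul, Matrix.mul_smul, smul_smul, Matrix.mul_assoc, Matrix.mul_assoc Qᵀ, mul_nonsing_inv _ hu, Matrix.mul_one,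
    ← transpose_mul, mul_nonsing_inv _ hu, transpose_one]
  congr 1; ring

lemma qP {P : MM n} (x : EE n) : ⟪TM B (TM P x), TM P x⟫ = ⟪TM (Pᵀ * B * P) x, x⟫ := by
  rw [TM_mul, TM_mul, inner_TM Pᵀ, transpose_transpose]

lemma step0 (hn : 1 ≤ n) (lam Lam : ℝ) (hL0 : 0 ≤ Lam) (hl0 : 0 < lam) : ∃ C ≥ (1:ℝ), ∀ d K σ ε R u G (A : EE n → MM n) (B : MM n) (x0 : EE n),
    MAS u G A → 0 < d → (∀ x, lam * d ≤ (A x).det) → (∀ x, (A x).det ≤ Lam * d) → B.PosDef → B.det = d → 0 < R → 0 < ε → C * ε ≤ 1 →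
    0 ≤ K → 0 < σ → σ ≤ 1 → Fl u B x0 R ε → KB (fun x => (A x).det) d B x0 R K σ → ∀ r, 0 < r → r ≤ 1 →
    ∃ B' : MM n, B'.PosDef ∧ B'.det = d ∧ Cl (C * ε) B' B ∧ Fl u B' x0 (r / 8 * R) (C * (ε * r + ε * √ε / r ^ 2 + K / r ^ 2)) := by
  obtain ⟨C, C1, hC⟩ := flat hn lam Lam hL0 hl0
  refine ⟨1024 * C, by linarith, fun d K σ ε R u G A B x0 h hd hlo hhi hB hBd hR hε hCε hK hσ0 hσ1 hF hKB r r0 r1 => ?_⟩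
  obtain ⟨P, P0, hP⟩ := exP hB hR
  obtain ⟨b, c, hF⟩ := hF
  have hPd : P.det ^ 2 * d = (R ^ 2 / 16) ^ n := by
    have := congrArg Matrix.det hP
    rw [det_mul, det_mul, det_transpose, det_smul, det_one, Fintype.card_fin, hBd] at this
    linarith only [this]
  obtain ⟨κ, hκ⟩ : ∃ κ, κ = 16 / R ^ 2 := ⟨_, rfl⟩
  have κ0 : 0 < κ := by rw [hκ]; positivity
  have κi : κ * (R ^ 2 / 16) = 1 := by rw [hκ]; field_simp
  have hD : ∀ M : MM n, (κ • (Pᵀ * M * P)).det = M.det / d := fun M => by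
    rw [det_aff, eq_div_iff hd.ne']
    calc κ ^ n * P.det ^ 2 * M.det * d = κ ^ n * (P.det ^ 2 * d) * M.det := by ring
      _ = _ := by rw [hPd, ← mul_pow, κi, one_pow, one_mul]
  have hQB : ∀ y, ⟪TM B (TM P y), TM P y⟫ = R ^ 2 / 16 * ‖y‖ ^ 2 := fun y => by
    rw [qP, hP, TM_smul, TM_one, real_inner_smul_left, real_inner_self_eq_norm_sq]
  have hs2 : (4 * √ε) ^ 2 = 16 * ε := by rw [mul_pow, Real.sq_sqrt hε.le]; norm_num
  have hs3 : (4 * √ε) ^ 3 = 64 * (ε * √ε) := by rw [pow_succ, hs2]; ring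
  have hv : FD lam Lam (4 * √ε) K σ _ _ _ := {
    m := h.aff κ0 P0 x0 (κ • TM Pᵀ b) (κ * (c + ⟪b, x0⟫))
    hl := hl0
    lo := fun x => by rw [hD, le_div_iff₀ hd]; exact hlo _
    hi := fun x => by rw [hD, div_le_iff₀ hd]; exact hhi _
    s0 := by positivity
    s1 := by
      have : √ε ≤ √((1/32) ^ 2) := Real.sqrt_le_sqrt (by nlinarith)
      rw [Real.sqrt_sq (by norm_num)] at this; linarith only [this]
    K0 := hK
    σ0 := hσ0
    σ1 := hσ1
    hw := fun y hy => by
      have h1 := hF (x0 + TM P y) (by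
        rw [add_sub_cancel_left, hQB]
        have := pow_le_pow_left₀ (norm_nonneg y) hy 2
        have := mul_le_mul_of_nonneg_left this (sq_nonneg R)
        linarith only [this])
      rw [add_sub_cancel_left, hQB] at h1
      have e : κ * u (x0 + TM P y) - ⟪κ • TM Pᵀ b, y⟫ - κ * (c + ⟪b, x0⟫) - ‖y‖ ^ 2 / 2 = κ * (u (x0 + TM P y) - c - ⟪b, x0 + TM P y⟫ - R ^ 2 / 16 * ‖y‖ ^ 2 / 2) := by
        rw [real_inner_smul_left, inner_TM, transpose_transpose, inner_add_right]
        linear_combination (‖y‖ ^ 2 / 2) * κi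
      rw [e, abs_mul, abs_of_pos κ0, hs2]
      calc _ ≤ κ * (ε * R ^ 2) := mul_le_mul_of_nonneg_left h1 κ0.le
        _ = _ := by linear_combination 16 * ε * κi
    hB := by simp only [hD]; exact hKB P hP }
  obtain ⟨A', pA, dA, cA, b1, c1, hA⟩ := hC _ _ _ _ _ _ hv (by rw [hs2]; linarith only [hCε]) r r0 r1
  rw [hs2] at cA
  rw [hs2, hs3] at hA
  clear hv hC hKB
  obtain ⟨W, hW⟩ : ∃ W, W = P⁻¹ := ⟨_, rfl⟩
  have PW : ∀ x, TM P (TM W x) = x := fun x => by rw [hW]; exact TM_PP P0 x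
  have hWd : W.det = P.det⁻¹ := by rw [hW, det_nonsing_inv, Ring.inverse_eq_inv']
  have W0 : W.det ≠ 0 := by rw [hWd]; exact inv_ne_zero P0
  obtain ⟨B', hB'⟩ : ∃ B' : MM n, B' = (R ^ 2 / 16) • (Wᵀ * A' * W) := ⟨_, rfl⟩
  have pB : B'.PosDef := hB' ▸ (pd_congr pA W0).smul (by positivity)
  have qB' : ∀ x, ⟪TM B' x, x⟫ = R ^ 2 / 16 * ⟪TM A' (TM W x), TM W x⟫ := fun x => by rw [hB', TM_smul, real_inner_smul_left, qP]
  have qB : ∀ x, ⟪TM B x, x⟫ = R ^ 2 / 16 * ‖TM W x‖ ^ 2 := fun x => by rw [← hQB, PW]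
  have cB : Cl (C * (16 * ε)) B' B := fun v => by
    have := cA (TM W v)
    rw [TM_one, real_inner_self_eq_norm_sq] at this
    rw [qB', qB, ← mul_sub, abs_mul, abs_of_pos (by positivity : 0 < R ^ 2 / 16)]
    calc _ ≤ R ^ 2 / 16 * (C * (16 * ε) * ‖TM W v‖ ^ 2) := mul_le_mul_of_nonneg_left this (by positivity)
      _ = _ := by ring
  refine ⟨B', pB, ?_, fun v => (cB v).trans ?_, TM Wᵀ ((R ^ 2 / 16) • (b1 + κ • TM Pᵀ b)), (R ^ 2 / 16) * (c1 + κ * (c + ⟪b, x0⟫)) - ⟪TM Wᵀ ((R ^ 2 / 16) • (b1 + κ • TM Pᵀ b)), x0⟫, fun x hx => ?_⟩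
  · rw [hB', det_aff, dA, mul_one, hWd, ← hPd, inv_pow]
    have : P.det ^ 2 ≠ 0 := pow_ne_zero _ P0
    field_simp
  · refine mul_le_mul_of_nonneg_right ?_ (psd_nonneg hB.posSemidef v)
    have : 0 ≤ C * ε := by positivity
    linarith only [this]
  · have h1 : ‖TM W (x - x0)‖ ≤ r := by
      have h2 := cB (x - x0)
      have h3 : C * (16 * ε) * ⟪TM B (x - x0), x - x0⟫ ≤ 1 / 2 * ⟪TM B (x - x0), x - x0⟫ := mul_le_mul_of_nonneg_right (by linarith only [hCε]) (psd_nonneg hB.posSemidef _)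
      have h4 := (abs_le.1 h2).1
      rw [qB] at h3 h4
      have h5 : R ^ 2 * ‖TM W (x - x0)‖ ^ 2 ≤ R ^ 2 * r ^ 2 := by
        have : 0 ≤ R ^ 2 * r ^ 2 := by positivity
        rw [mul_pow, div_pow] at hx
        linarith only [hx, h3, h4, this]
      have h6 := le_of_mul_le_mul_left h5 (by positivity)
      exact le_of_sq_le_sq h6 r0.le
    have h2 := hA _ h1
    rw [PW, add_sub_cancel] at h2
    have e : u x - (R ^ 2 / 16 * (c1 + κ * (c + ⟪b, x0⟫)) - ⟪TM Wᵀ ((R ^ 2 / 16) • (b1 + κ • TM Pᵀ b)), x0⟫) - ⟪TM Wᵀ ((R ^ 2 / 16) • (b1 + κ • TM Pᵀ b)), x⟫ - ⟪TM B' (x - x0), x - x0⟫ / 2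
        = R ^ 2 / 16 * (κ * u x - ⟪κ • TM Pᵀ b, TM W (x - x0)⟫ - κ * (c + ⟪b, x0⟫) - c1 - ⟪b1, TM W (x - x0)⟫ - ⟪TM A' (TM W (x - x0)), TM W (x - x0)⟫ / 2) := by
      rw [qB']
      have e1 : ⟪TM Wᵀ ((R ^ 2 / 16) • (b1 + κ • TM Pᵀ b)), x⟫ - ⟪TM Wᵀ ((R ^ 2 / 16) • (b1 + κ • TM Pᵀ b)), x0⟫ = R ^ 2 / 16 * (⟪b1, TM W (x - x0)⟫ + ⟪κ • TM Pᵀ b, TM W (x - x0)⟫) := by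
        rw [← inner_sub_right, inner_TM, transpose_transpose, real_inner_smul_left, inner_add_left]
      linear_combination (-1) * e1 - u x * κi
    rw [e, abs_mul, abs_of_pos (by positivity : 0 < R ^ 2 / 16)]
    refine (mul_le_mul_of_nonneg_left h2 (by positivity)).trans ?_
    have e2 : 1024 * C * (ε * r + ε * √ε / r ^ 2 + K / r ^ 2) * (r / 8 * R) ^ 2 = 16 * C * R ^ 2 * (ε * r ^ 3 + ε * √ε + K) := by
      field_simp; ring
    rw [e2]
    have : 0 ≤ C * R ^ 2 := by positivity
    have := mul_nonneg this (by positivity : 0 ≤ 15 * (ε * r ^ 3) + 12 * (ε * √ε) + 255 / 16 * K)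
    linarith only [this]

def StP (n : ℕ) (lam Lam β C θ ε0 : ℝ) : Prop := ∀ d K σ ε R u G (A : EE n → MM n) (B : MM n) (x0 : EE n),
    MAS u G A → 0 < d → (∀ x, lam * d ≤ (A x).det) → (∀ x, (A x).det ≤ Lam * d) → B.PosDef → B.det = d → 0 < R → 0 < ε → ε ≤ ε0 →
    0 ≤ K → 0 < σ → σ ≤ 1 → Fl u B x0 R ε → KB (fun x => (A x).det) d B x0 R K σ →
    ∃ B' : MM n, B'.PosDef ∧ B'.det = d ∧ Cl (C * ε) B' B ∧ Fl u B' x0 (θ * R) (θ ^ β * ε + C * K)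

lemma step (hn : 1 ≤ n) (lam Lam : ℝ) (hL0 : 0 ≤ Lam) (hl0 : 0 < lam) {β : ℝ} (hβ : β < 1) : ∃ C ≥ (1:ℝ), ∃ θ, 0 < θ ∧ θ ≤ 1 / 8 ∧ ∃ ε0 > 0, C * ε0 ≤ 1 / 4 ∧ StP n lam Lam β C θ ε0 := by
  obtain ⟨C, C1, hC⟩ := step0 (n := n) hn lam Lam hL0 hl0
  obtain ⟨r, r0, r1, hr⟩ : ∃ r, 0 < r ∧ r ≤ 1 ∧ C * r ≤ (r / 8) ^ β / 2 := by
    obtain ⟨q, hq⟩ : ∃ q, q = (1 / 8) ^ β / (2 * C) := ⟨_, rfl⟩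
    have q0 : 0 < q := by rw [hq]; positivity
    refine ⟨min 1 (q ^ (1 / (1 - β))), by positivity, min_le_left _ _, ?_⟩
    obtain ⟨r, hr⟩ : ∃ r, r = min 1 (q ^ (1 / (1 - β))) := ⟨_, rfl⟩
    have r0 : 0 < r := by rw [hr]; positivity
    rw [← hr]
    have h1 : r ^ (1 - β) ≤ q := by
      have := Real.rpow_le_rpow r0.le (hr ▸ min_le_right _ _ : r ≤ q ^ (1 / (1 - β))) (by linarith : 0 ≤ 1 - β)
      rwa [← Real.rpow_mul q0.le, one_div_mul_cancel (by linarith only [hβ]), Real.rpow_one] at this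
    have h2 : r = r ^ (1 - β) * r ^ β := by rw [← Real.rpow_add r0]; simp
    have h3 : (r / 8) ^ β = r ^ β * (1 / 8) ^ β := by rw [← Real.mul_rpow r0.le (by norm_num)]; congr 1; ring
    rw [h3]
    calc C * r = C * (r ^ (1 - β) * r ^ β) := by rw [← h2]
      _ ≤ C * (q * r ^ β) := by gcongr
      _ = _ := by rw [hq]; field_simp
  obtain ⟨e, he⟩ : ∃ e, e = (r / 8) ^ β * r ^ 2 / (2 * C) := ⟨_, rfl⟩
  have e0 : 0 < e := by rw [he]; positivity
  obtain ⟨D, hD⟩ : ∃ D, D = C / r ^ 2 := ⟨_, rfl⟩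
  have CD : C ≤ D := by rw [hD, le_div_iff₀ (by positivity)]; nlinarith [pow_le_one₀ (n := 2) r0.le r1]
  refine ⟨D, by linarith, r / 8, by positivity, by linarith, min (e ^ 2) (1 / (4 * D)), by have : 0 < D := by linarith
                                                                                           positivity, ?_, ?_⟩
  · calc D * min (e ^ 2) (1 / (4 * D)) ≤ D * (1 / (4 * D)) := mul_le_mul_of_nonneg_left (min_le_right _ _) (by linarith)
      _ = _ := by have : D ≠ 0 := by linarith
                  field_simp
  · intro d K σ ε R u G A B x0 h hd hlo hhi hB hBd hR hε hε0 hK hσ0 hσ1 hF hKB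
    have h1 : D * ε ≤ 1 / 4 := by
      have : 0 < D := by linarith
      have := hε0.trans (min_le_right _ _)
      rw [le_div_iff₀ (by positivity)] at this; linarith only [this]
    have h2 : √ε ≤ e := by rw [← Real.sqrt_sq e0.le]; exact Real.sqrt_le_sqrt (hε0.trans (min_le_left _ _))
    have h3 : C * ε ≤ D * ε := mul_le_mul_of_nonneg_right CD hε.le
    obtain ⟨B', p1, p2, p3, b, c, p4⟩ := hC d K σ ε R u G A B x0 h hd hlo hhi hB hBd hR hε (by linarith only [h1, h3]) hK hσ0 hσ1 hF hKB r r0 r1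
    refine ⟨B', p1, p2, fun v => (p3 v).trans (mul_le_mul_of_nonneg_right h3 (psd_nonneg hB.posSemidef v)), b, c, fun x hx => (p4 x hx).trans (mul_le_mul_of_nonneg_right ?_ (sq_nonneg _))⟩
    have h4 : C * (ε * √ε / r ^ 2) ≤ (r / 8) ^ β / 2 * ε := by
      calc _ ≤ C * (ε * e / r ^ 2) := by gcongr
        _ = _ := by rw [he]; field_simp
    have h5 : C * (K / r ^ 2) = D * K := by rw [hD]; ring
    have h6 := mul_le_mul_of_nonneg_right hr hε.le
    linarith only [h4, h5, h6]
end st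


section it
variable {n : ℕ} {lam Lam d K σ ε η η' R r β C θ ε0 : ℝ} {u g : EE n → ℝ} {G : EE n → EE n} {A : EE n → MM n} {B B' B'' D : MM n} {x0 y : EE n}

lemma Fl.mono (h : Fl u B x0 R ε) (he : ε ≤ η) : Fl u B x0 R η := by
  obtain ⟨b, c, h⟩ := h
  exact ⟨b, c, fun x hx => (h x hx).trans (mul_le_mul_of_nonneg_right he (sq_nonneg _))⟩

lemma Cl.mono (h : Cl η B' B) (hB : B.PosDef) (he : η ≤ η') : Cl η' B' B := fun v => (h v).trans (mul_le_mul_of_nonneg_right he (psd_nonneg hB.posSemidef v))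

lemma Cl.two (h : Cl η B' B) (hB : B.PosDef) (he : η ≤ 1 / 2) (v : EE n) : ⟪TM B v, v⟫ ≤ 2 * ⟪TM B' v, v⟫ ∧ ⟪TM B' v, v⟫ ≤ 2 * ⟪TM B v, v⟫ := by
  have h1 := abs_le.1 (h.mono hB he v)
  have h2 := psd_nonneg hB.posSemidef v
  constructor <;> linarith

lemma Cl.comp (h : Cl η B'' B') (h' : Cl η' B' B) (hB : B.PosDef) (hη : 0 ≤ η) (he : η' ≤ 1 / 2) : Cl (2 * η + η') B'' B := fun v => by
  have h1 := h v
  have h2 := h' v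
  have h3 := mul_le_mul_of_nonneg_left (h'.two hB he v).2 hη
  rw [abs_le] at h1 h2 ⊢; constructor <;> linarith

lemma Fl.chg (h : Fl u B x0 R ε) (hB : B.PosDef) (hc : Cl η B' B) (h0 : 0 ≤ η) (he : η ≤ 1 / 2) (hr : 0 < r) (hrR : 2 * r ^ 2 ≤ R ^ 2) : Fl u B' x0 r ((ε + η) * (R / r) ^ 2) := by
  obtain ⟨b, c, h⟩ := h
  refine ⟨b, c, fun x hx => ?_⟩
  have h1 := (hc.two hB he (x - x0)).1
  have h2 := h x (by linarith)
  have h3 := hc (x - x0)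
  have h4 : η * ⟪TM B (x - x0), x - x0⟫ ≤ η * R ^ 2 := mul_le_mul_of_nonneg_left (by linarith) h0
  have h5 : 0 ≤ η * R ^ 2 := by positivity
  rw [mul_assoc, ← mul_pow, div_mul_cancel₀ _ hr.ne']
  rw [abs_le] at h2 h3 ⊢; constructor <;> linarith

lemma Fl.rec' (h : Fl u B x0 R ε) (hB : B.PosDef) (hy : ⟪TM B (y - x0), y - x0⟫ ≤ R ^ 2 / 4) : Fl u B y (R / 2) (4 * ε) := by
  obtain ⟨b, c, h⟩ := h
  have qs : ∀ a b : EE n, ⟪TM B a, b⟫ = ⟪TM B b, a⟫ := fun a b => by rw [inner_TM_symm hB.1, real_inner_comm]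
  have e0 : ∀ x, ⟪TM B (x - x0), x - x0⟫ = ⟪TM B (x - y), x - y⟫ + 2 * ⟪TM B (y - x0), x - y⟫ + ⟪TM B (y - x0), y - x0⟫ := fun x => by
    have h1 : x - x0 = (x - y) + (y - x0) := by abel
    rw [h1, map_add, inner_add_left, inner_add_right, inner_add_right, qs (x - y) (y - x0)]; ring
  refine ⟨b + TM B (y - x0), c + ⟪TM B (y - x0), y - x0⟫ / 2 - ⟪TM B (y - x0), y⟫, fun x hx => ?_⟩
  have e1 := e0 x
  have e2 : ⟪TM B (y - x0), x - y⟫ = ⟪TM B (y - x0), x⟫ - ⟪TM B (y - x0), y⟫ := inner_sub_right _ _ _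
  have h1 : ⟪TM B (x - x0), x - x0⟫ ≤ R ^ 2 := by
    have h2 := psd_nonneg hB.posSemidef ((x - y) - (y - x0))
    have e3 : ⟪TM B ((x - y) - (y - x0)), (x - y) - (y - x0)⟫ = ⟪TM B (x - y), x - y⟫ - 2 * ⟪TM B (y - x0), x - y⟫ + ⟪TM B (y - x0), y - x0⟫ := by
      generalize x - y = a; generalize y - x0 = b
      rw [map_sub, inner_sub_left, inner_sub_right, inner_sub_right, qs a b]; ring
    rw [div_pow] at hx
    linarith
  have h2 := h x h1
  rw [inner_add_left, div_pow]
  rw [abs_le] at h2 ⊢; constructor <;> linarith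

lemma dle {F F' : ℝ → ℝ} (h : ∀ t, HasDerivAt F (F' t) t) {T : ℝ} (hT : 0 ≤ T) (hF : ∀ t, 0 ≤ t → t ≤ T → F' t ≤ 0) : F T ≤ F 0 := by
  refine antitoneOn_of_deriv_nonpos (convex_Icc 0 T) (fun t _ => (h t).continuousAt.continuousWithinAt) (fun t _ => (h t).differentiableAt.differentiableWithinAt) (fun t ht => ?_)
    (left_mem_Icc.2 hT) (right_mem_Icc.2 hT) hT
  rw [interior_Icc] at ht
  rw [(h t).deriv]; exact hF t ht.1.le ht.2.le

lemma MAS.tayl (h : MAS u G A) (hD : ∀ y, ‖y - x0‖ ≤ r → ∀ v, |⟪TM (A y) v, v⟫ - ⟪TM D v, v⟫| ≤ η * ‖v‖ ^ 2) {x : EE n} (hx : ‖x - x0‖ ≤ r) :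
    |u x - u x0 - ⟪G x0, x - x0⟫ - ⟪TM D (x - x0), x - x0⟫ / 2| ≤ η * ‖x - x0‖ ^ 2 / 2 := by
  obtain ⟨w, hw⟩ : ∃ w, w = x - x0 := ⟨_, rfl⟩
  have ex : x = x0 + (1:ℝ) • w := by rw [hw]; simp
  rw [← hw] at hx ⊢
  obtain ⟨q, hq⟩ : ∃ q, q = ⟪TM D w, w⟫ := ⟨_, rfl⟩
  have hA : ∀ t : ℝ, 0 ≤ t → t ≤ 1 → |⟪TM (A (x0 + t • w)) w, w⟫ - q| ≤ η * ‖w‖ ^ 2 := fun t t0 t1 => by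
    rw [hq]
    refine hD _ ?_ w
    rw [add_sub_cancel_left, norm_smul, Real.norm_of_nonneg t0]
    exact (mul_le_of_le_one_left (norm_nonneg _) t1).trans hx
  have d1 : ∀ t, HasDerivAt (fun t : ℝ => u (x0 + t • w)) ⟪G (x0 + t • w), w⟫ t := fun t => h.du.line x0 w t
  have d2 : ∀ t, HasDerivAt (fun t : ℝ => ⟪G (x0 + t • w), w⟫) ⟪TM (A (x0 + t • w)) w, w⟫ t := fun t => h.dG.line' x0 w w t
  have up : ∀ t : ℝ, 0 ≤ t → t ≤ 1 → ∀ p, (∀ t : ℝ, 0 ≤ t → t ≤ 1 → ⟪TM (A (x0 + t • w)) w, w⟫ ≤ p) → ⟪G (x0 + t • w), w⟫ ≤ ⟪G x0, w⟫ + t * p := fun t t0 t1 p hp => by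
    have := dle (F := fun t => ⟪G (x0 + t • w), w⟫ - t * p) (fun t => (d2 t).sub ((hasDerivAt_id t).mul_const p)) t0 fun s s0 s1 => by linarith [hp s s0 (s1.trans t1)]
    simp only [zero_smul, add_zero, zero_mul] at this; linarith
  have lo : ∀ t : ℝ, 0 ≤ t → t ≤ 1 → ∀ p, (∀ t : ℝ, 0 ≤ t → t ≤ 1 → p ≤ ⟪TM (A (x0 + t • w)) w, w⟫) → ⟪G x0, w⟫ + t * p ≤ ⟪G (x0 + t • w), w⟫ := fun t t0 t1 p hp => by
    have := dle (F := fun t => t * p - ⟪G (x0 + t • w), w⟫) (fun t => ((hasDerivAt_id t).mul_const p).sub (d2 t)) t0 fun s s0 s1 => by linarith [hp s s0 (s1.trans t1)]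
    simp only [zero_smul, add_zero, zero_mul] at this; linarith
  have dq : ∀ p t : ℝ, HasDerivAt (fun t : ℝ => t * ⟪G x0, w⟫ + t ^ 2 * (p / 2)) (⟪G x0, w⟫ + t * p) t := fun p t =>
    (((hasDerivAt_id t).mul_const _).add ((hasDerivAt_pow 2 t).mul_const _)).congr_deriv (by simp; ring)
  have r1 := dle (F := fun t => u (x0 + t • w) - (t * ⟪G x0, w⟫ + t ^ 2 * ((q + η * ‖w‖ ^ 2) / 2))) (fun t => (d1 t).sub (dq _ t)) zero_le_one fun t t0 t1 => by
    have := up t t0 t1 (q + η * ‖w‖ ^ 2) fun s s0 s1 => by linarith [(abs_le.1 (hA s s0 s1)).2]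
    linarith
  have r2 := dle (F := fun t => (t * ⟪G x0, w⟫ + t ^ 2 * ((q - η * ‖w‖ ^ 2) / 2)) - u (x0 + t • w)) (fun t => (dq _ t).sub (d1 t)) zero_le_one fun t t0 t1 => by
    have := lo t t0 t1 (q - η * ‖w‖ ^ 2) fun s s0 s1 => by linarith [(abs_le.1 (hA s s0 s1)).1]
    linarith
  simp only [zero_smul, add_zero, zero_mul, ← ex, one_pow, one_mul, ne_eq, OfNat.ofNat_ne_zero, not_false_eq_true, zero_pow] at r1 r2
  rw [← hq, abs_le]; constructor <;> linarith

lemma kb_pt (hn : 1 ≤ n) : ∃ C ≥ (0:ℝ), ∀ (g : EE n → ℝ) d (B : MM n) x0 R H, (∀ x, ⟪TM B (x - x0), x - x0⟫ ≤ R ^ 2 → |g x / d - 1| ≤ H) → KB g d B x0 R (C * H) 1 := by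
  refine ⟨volume.real (closedBall (0 : EE n) 3) ^ (1 / (n:ℝ)), by positivity, fun g d B x0 R H h P hP S hS hS3 => ?_⟩
  have H0 : 0 ≤ H := (abs_nonneg _).trans (h x0 (by simp; positivity))
  have f3 : volume (closedBall (0 : EE n) 3) < ⊤ := measure_closedBall_lt_top
  have fS : volume S < ⊤ := (measure_mono hS3).trans_lt f3
  have h1 := norm_setIntegral_le_of_norm_le_const (f := fun y => |g (x0 + TM P y) / d - 1|) (C := H) fS fun y hy => by
    rw [Real.norm_of_nonneg (abs_nonneg _)]
    refine h _ ?_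
    rw [add_sub_cancel_left, qP, hP, TM_smul, TM_one, real_inner_smul_left, real_inner_self_eq_norm_sq]
    have h2 : ‖y‖ ≤ 3 := by simpa using hS3 hy
    have := mul_le_mul_of_nonneg_left (pow_le_pow_left₀ (norm_nonneg y) h2 2) (sq_nonneg R)
    linarith [sq_nonneg R]
  refine (le_abs_self _).trans (h1.trans ?_)
  rcases (measureReal_nonneg (μ := volume) (s := S)).eq_or_lt with h0 | h0
  · rw [← h0, mul_zero]; positivity
  · have h2 : volume.real S ≤ volume.real (closedBall (0 : EE n) 3) := measureReal_mono hS3 f3.ne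
    have h3 : volume.real S = volume.real S ^ (1 / (n:ℝ)) * volume.real S ^ (1 - 1 / (n:ℝ)) := by rw [← Real.rpow_add h0]; simp
    calc H * volume.real S = H * (volume.real S ^ (1 / (n:ℝ)) * volume.real S ^ (1 - 1 / (n:ℝ))) := by rw [← h3]
      _ ≤ H * (volume.real (closedBall (0 : EE n) 3) ^ (1 / (n:ℝ)) * volume.real S ^ (1 - 1 / (n:ℝ))) := by gcongr
      _ = _ := by ring

lemma iter (hS : StP n lam Lam β C θ ε0) (hC : 1 ≤ C) (hθ : 0 < θ) (h : MAS u G A) (hd : 0 < d) (hlo : ∀ x, lam * d ≤ (A x).det) (hhi : ∀ x, (A x).det ≤ Lam * d)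
    (hB : B.PosDef) (hBd : B.det = d) (hR : 0 < R) (hσ0 : 0 < σ) (hσ1 : σ ≤ 1) {e K : ℕ → ℝ} {N : ℕ} (he0 : ∀ k, 0 < e k) (heε : ∀ k < N, e k ≤ ε0) (hK : ∀ k, 0 ≤ K k)
    (hek : ∀ k < N, θ ^ β * e k + C * K k ≤ e (k + 1)) (hs : ∀ k ≤ N, 2 * C * ∑ j ∈ Finset.range k, e j ≤ 1 / 2)
    (hKB : ∀ k < N, ∀ B' : MM n, B'.PosDef → B'.det = d → Cl (1 / 2) B' B → KB (fun x => (A x).det) d B' x0 (θ ^ k * R) (K k) σ)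
    (hF : Fl u B x0 R (e 0)) : ∀ k ≤ N, ∃ B' : MM n, B'.PosDef ∧ B'.det = d ∧ Cl (2 * C * ∑ j ∈ Finset.range k, e j) B' B ∧ Fl u B' x0 (θ ^ k * R) (e k) := by
  intro k
  induction k with
  | zero => exact fun _ => ⟨B, hB, hBd, fun v => by simp, by simpa using hF⟩
  | succ k ih =>
    intro hk
    obtain ⟨B1, p1, d1, c1, f1⟩ := ih (by omega)
    have hk' : k < N := by omega
    obtain ⟨B2, p2, d2, c2, f2⟩ := hS d (K k) σ (e k) (θ ^ k * R) u G A B1 x0 h hd hlo hhi p1 d1 (by positivity) (he0 k) (heε k hk') (hK k) hσ0 hσ1 f1 (hKB k hk' B1 p1 d1 (c1.mono hB (hs k hk'.le)))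
    refine ⟨B2, p2, d2, (c2.comp c1 hB (mul_nonneg (by linarith) (he0 k).le) (hs k hk'.le)).mono hB (le_of_eq ?_), ?_⟩
    · rw [Finset.sum_range_succ]; ring
    · rw [pow_succ', mul_assoc]; exact f2.mono (hek k hk')
end it


section pt
variable {n : ℕ} {lam Lam d K σ ε η η' R r β C θ ε0 α H : ℝ} {u g : EE n → ℝ} {G : EE n → EE n} {A : EE n → MM n} {B B' B'' D : MM n} {x0 y : EE n}

structure EL (lam Lam : ℝ) (u : EE n → ℝ) (G : EE n → EE n) (A : EE n → MM n) : Prop where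
  m : MAS u G A
  lo : ∀ x z, lam * (A z).det ≤ (A x).det
  hi : ∀ x z, (A x).det ≤ Lam * (A z).det

def HP (g : EE n → ℝ) (B : MM n) (x0 : EE n) (R H α : ℝ) : Prop := ∀ t, 0 < t → t ≤ 1 → ∀ x, ⟪TM B (x - x0), x - x0⟫ ≤ 4 * t ^ 2 * R ^ 2 → |g x / g x0 - 1| ≤ H * t ^ α

structure PTH (α ε H R : ℝ) (u : EE n → ℝ) (A : EE n → MM n) (B : MM n) (x0 : EE n) : Prop where
  pB : B.PosDef
  dB : B.det = (A x0).det
  R0 : 0 < R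
  e0 : 0 < ε
  H0 : 0 ≤ H
  fl : Fl u B x0 R ε
  hp : HP (fun x => (A x).det) B x0 R H α

lemma iterP (hn : 1 ≤ n) (hL0 : 0 ≤ Lam) (hl0 : 0 < lam) (hα0 : 0 < α) (hα1 : α < 1) : ∃ C ≥ (1:ℝ), ∃ θ, 0 < θ ∧ θ ≤ 1 / 8 ∧ ∃ ε1 > 0, C * ε1 ≤ 1 / 2 ∧
    ∀ u G (A : EE n → MM n) B x0 R ε H, EL lam Lam u G A → PTH α ε H R u A B x0 → ε + H ≤ ε1 →
    ∀ k : ℕ, ∃ B' : MM n, B'.PosDef ∧ B'.det = (A x0).det ∧ Cl (C * (ε + H)) B' B ∧ Fl u B' x0 (θ ^ k * R) (C * (ε + H) * (θ ^ α) ^ k) := by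
  obtain ⟨C, C1, θ, θ0, θ1, ε0, e00, Ce, hS⟩ := step (n := n) hn lam Lam hL0 hl0 (show (1 + α) / 2 < 1 by linarith)
  obtain ⟨Cn, Cn0, hCn⟩ := kb_pt hn
  obtain ⟨τ, hτ⟩ : ∃ τ, τ = θ ^ α := ⟨_, rfl⟩
  have τ0 : 0 < τ := by rw [hτ]; positivity
  have τ1 : τ < 1 := by rw [hτ]; exact Real.rpow_lt_one θ0.le (by linarith only [θ1]) hα0
  have hτ' : θ ^ ((1 + α) / 2) < τ := by rw [hτ]; exact Real.rpow_lt_rpow_of_exponent_gt θ0 (by linarith only [θ1]) (by linarith)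
  obtain ⟨F, hF⟩ : ∃ F, F = 1 + C * Cn / (τ - θ ^ ((1 + α) / 2)) := ⟨_, rfl⟩
  have dp : 0 < τ - θ ^ ((1 + α) / 2) := by linarith
  have dq : 0 < 1 - τ := by linarith only [τ1]
  have F1 : 1 ≤ F := by rw [hF]; linarith only [(by positivity : 0 ≤ C * Cn / (τ - θ ^ ((1 + α) / 2)))]
  obtain ⟨D, hD⟩ : ∃ D, D = F * (2 * C / (1 - τ)) := ⟨_, rfl⟩
  have h2C : 1 ≤ 2 * C / (1 - τ) := by rw [le_div_iff₀ dq]; linarith only [C1, τ0]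
  have FD' : F ≤ D := by rw [hD]; exact le_mul_of_one_le_right (by linarith only [F1]) h2C
  have D0 : 0 < D := by linarith only [F1, FD']
  refine ⟨D, by linarith only [F1, FD'], θ, θ0, θ1, min (1 / (2 * D)) (ε0 / D), by positivity, ?_, fun u G A B x0 R ε H h p hε k => ?_⟩
  · calc D * min (1 / (2 * D)) (ε0 / D) ≤ D * (1 / (2 * D)) := mul_le_mul_of_nonneg_left (min_le_left _ _) D0.le
      _ = _ := by field_simp
  obtain ⟨pB, dB, R0, ep, H0, fl, hp⟩ := p
  have h1 := hε.trans (min_le_left _ _)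
  have h2 := hε.trans (min_le_right _ _)
  rw [le_div_iff₀ (by positivity)] at h1 h2
  have s0 : 0 < ε + H := by linarith only [ep, H0]
  have hd := (h.m.pA x0).det_pos
  rw [← hτ]
  have hsum : ∀ k, ∑ j ∈ Finset.range k, F * (ε + H) * τ ^ j ≤ F * (ε + H) * (1 / (1 - τ)) := fun k => by
    rw [← Finset.mul_sum]
    refine mul_le_mul_of_nonneg_left ?_ (by positivity)
    rw [geom_sum_eq τ1.ne, ← neg_div_neg_eq, neg_sub, neg_sub]
    exact div_le_div_of_nonneg_right (by linarith only [pow_pos τ0 k]) dq.le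
  have hsum' : ∀ k, 2 * C * ∑ j ∈ Finset.range k, F * (ε + H) * τ ^ j ≤ D * (ε + H) := fun k => by
    calc _ ≤ 2 * C * (F * (ε + H) * (1 / (1 - τ))) := mul_le_mul_of_nonneg_left (hsum k) (by linarith only [C1])
      _ = _ := by rw [hD]; ring
  have hFD : F * (ε + H) ≤ D * (ε + H) := mul_le_mul_of_nonneg_right FD' s0.le
  have g1 : ∀ k : ℕ, F * (ε + H) * τ ^ k ≤ ε0 := fun k => by
    calc F * (ε + H) * τ ^ k ≤ F * (ε + H) * 1 := mul_le_mul_of_nonneg_left (pow_le_one₀ τ0.le τ1.le) (by positivity)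
      _ ≤ ε0 := by linarith only [h2, hFD]
  have g2 : ∀ k : ℕ, θ ^ ((1 + α) / 2) * (F * (ε + H) * τ ^ k) + C * (Cn * (H * τ ^ k)) ≤ F * (ε + H) * τ ^ (k + 1) := fun k => by
    have : C * Cn * H ≤ F * (ε + H) * (τ - θ ^ ((1 + α) / 2)) := by
      have e : F * (τ - θ ^ ((1 + α) / 2)) = (τ - θ ^ ((1 + α) / 2)) + C * Cn := by rw [hF]; field_simp
      calc _ ≤ ((τ - θ ^ ((1 + α) / 2)) + C * Cn) * (ε + H) := by
            have a1 : 0 ≤ C * Cn * ε := by positivity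
            have a2 := mul_pos dp s0
            linarith only [a1, a2]
        _ = _ := by rw [← e]; ring
    have := mul_le_mul_of_nonneg_right this (pow_pos τ0 k).le
    simp only [pow_succ]; linarith only [this]
  have g3 : ∀ k : ℕ, ∀ B' : MM n, B'.PosDef → B'.det = (A x0).det → Cl (1 / 2) B' B → KB (fun x => (A x).det) (A x0).det B' x0 (θ ^ k * R) (Cn * (H * τ ^ k)) 1 := fun k B' b1 b2 b3 => by
    refine hCn _ _ _ _ _ _ fun x hx => ?_
    have := hp (θ ^ k) (by positivity) (pow_le_one₀ θ0.le (by linarith only [θ1])) x (by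
      have h3 := (b3.two pB le_rfl (x - x0)).1
      rw [mul_pow] at hx
      have : 0 ≤ (θ ^ k) ^ 2 * R ^ 2 := by positivity
      linarith only [hx, h3, this])
    rwa [← Real.rpow_natCast, ← Real.rpow_mul θ0.le, mul_comm (k:ℝ), Real.rpow_mul θ0.le, Real.rpow_natCast, ← hτ] at this
  have g4 : Fl u B x0 R (F * (ε + H) * τ ^ 0) := by
    refine fl.mono ?_
    rw [pow_zero, mul_one]
    have := mul_le_mul_of_nonneg_right F1 s0.le
    linarith only [H0, this]
  obtain ⟨B', q1, q2, q3, q4⟩ := iter hS C1 θ0 h.m hd (fun x => h.lo x x0) (fun x => h.hi x x0) pB dB R0 one_pos le_rfl (x0 := x0) (e := fun k => F * (ε + H) * τ ^ k) (K := fun k => Cn * (H * τ ^ k)) (N := k)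
    (fun k => by positivity) (fun k _ => g1 k) (fun k => by positivity) (fun k _ => g2 k) (fun k _ => (hsum' k).trans (by linarith only [h1])) (fun k _ => g3 k) g4 k le_rfl
  exact ⟨B', q1, q2, q3.mono pB (hsum' k), q4.mono (mul_le_mul_of_nonneg_right hFD (by positivity))⟩

lemma quad_diff {M N : MM n} {m : ℝ} (h : ∀ i j, |M i j - N i j| ≤ m) (v : EE n) : |⟪TM M v, v⟫ - ⟪TM N v, v⟫| ≤ n ^ 2 * m * ‖v‖ ^ 2 := by
  have := quad_bd (B := M - N) (m := m) (fun i j => h i j) v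
  rwa [TM_sub, inner_sub_left] at this

lemma MAS.nb (h : MAS u G A) (x0 : EE n) (hη : 0 < η) : ∃ ρ > 0, ∀ y, ‖y - x0‖ ≤ ρ → ∀ v, |⟪TM (A y) v, v⟫ - ⟪TM (A x0) v, v⟫| ≤ η * ‖v‖ ^ 2 := by
  have h1 : ∀ i j, ∀ᶠ y in 𝓝 x0, |A y i j - A x0 i j| < η / (n ^ 2 + 1) := fun i j => by
    have c : Continuous fun y => A y i j := (continuous_apply j).comp ((continuous_apply i).comp h.cA)
    exact (Metric.tendsto_nhds.1 (c.tendsto x0)) _ (by positivity)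
  obtain ⟨ρ, ρ0, hρ⟩ := Metric.eventually_nhds_iff.1 (Filter.eventually_all.2 fun i => Filter.eventually_all.2 (h1 i))
  refine ⟨ρ / 2, by positivity, fun y hy v => (quad_diff (fun i j => (hρ (by rw [dist_eq_norm]; linarith) i j).le) v).trans (mul_le_mul_of_nonneg_right ?_ (sq_nonneg _))⟩
  rw [mul_div_assoc', div_le_iff₀ (by positivity)]; linarith

lemma flc (h : MAS u G A) (hF : Fl u B x0 R ε) {ρ : ℝ} (hρ : ∀ y, ‖y - x0‖ ≤ ρ → ∀ v, |⟪TM (A y) v, v⟫ - ⟪TM (A x0) v, v⟫| ≤ η * ‖v‖ ^ 2)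
    {v : EE n} {t : ℝ} (ht : 0 < t) (hv : t ^ 2 * ⟪TM B v, v⟫ = R ^ 2) (htv : ‖t • v‖ ≤ ρ) : |⟪TM (A x0) v, v⟫ - ⟪TM B v, v⟫| ≤ 4 * ε * ⟪TM B v, v⟫ + η * ‖v‖ ^ 2 := by
  obtain ⟨b, c, hF⟩ := hF
  have q : ∀ M : MM n, ⟪TM M (t • v), t • v⟫ = t ^ 2 * ⟪TM M v, v⟫ := fun M => by rw [map_smul, real_inner_smul_left, real_inner_smul_right]; ring
  have q' : ∀ M : MM n, ⟪TM M (-(t • v)), -(t • v)⟫ = t ^ 2 * ⟪TM M v, v⟫ := fun M => by rw [map_neg, inner_neg_neg, q]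
  have f1 := hF (x0 + t • v) (by rw [add_sub_cancel_left, q, hv])
  have f2 := hF (x0 + -(t • v)) (by rw [add_sub_cancel_left, q', hv])
  have f3 := hF x0 (by simp; positivity)
  have g1 := h.tayl hρ (x := x0 + t • v) (by rwa [add_sub_cancel_left])
  have g2 := h.tayl hρ (x := x0 + -(t • v)) (by rwa [add_sub_cancel_left, norm_neg])
  rw [add_sub_cancel_left, q, inner_add_right] at f1
  rw [add_sub_cancel_left, q', inner_add_right, inner_neg_right] at f2
  rw [sub_self, map_zero, inner_zero_left] at f3
  rw [add_sub_cancel_left, q, norm_smul, mul_pow, Real.norm_of_nonneg ht.le] at g1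
  rw [add_sub_cancel_left, q', inner_neg_right, norm_neg, norm_smul, mul_pow, Real.norm_of_nonneg ht.le] at g2
  have t2 : 0 < t ^ 2 := by positivity
  refine le_of_mul_le_mul_left ?_ t2
  have e : t ^ 2 * |⟪TM (A x0) v, v⟫ - ⟪TM B v, v⟫| = |t ^ 2 * ⟪TM (A x0) v, v⟫ - t ^ 2 * ⟪TM B v, v⟫| := by rw [← mul_sub, abs_mul, abs_of_pos t2]
  have e2 : t ^ 2 * (4 * ε * ⟪TM B v, v⟫ + η * ‖v‖ ^ 2) = 4 * (ε * R ^ 2) + η * (t ^ 2 * ‖v‖ ^ 2) := by rw [← hv]; ring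
  rw [e, e2]
  rw [abs_le] at f1 f2 f3 g1 g2 ⊢; constructor <;> linarith only [f1, f2, f3, g1, g2]

lemma point1 (hn : 1 ≤ n) (hL0 : 0 ≤ Lam) (hl0 : 0 < lam) (hα0 : 0 < α) (hα1 : α < 1) : ∃ C ≥ (1:ℝ), ∃ θ, 0 < θ ∧ θ ≤ 1 / 8 ∧ ∃ ε1 > 0, C * ε1 ≤ 1 / 2 ∧
    ∀ u G (A : EE n → MM n) B x0 R ε H, EL lam Lam u G A → PTH α ε H R u A B x0 → ε + H ≤ ε1 → Cl (C * (ε + H)) (A x0) B ∧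
    ∀ k : ℕ, ∃ B' : MM n, B'.PosDef ∧ B'.det = (A x0).det ∧ Cl (C * (ε + H)) B' B ∧ Fl u B' x0 (θ ^ k * R) (C * (ε + H) * (θ ^ α) ^ k) := by
  obtain ⟨C, C1, θ, θ0, θ1, ε1, e10, Ce, hI⟩ := iterP (n := n) hn hL0 hl0 hα0 hα1
  refine ⟨C, C1, θ, θ0, θ1, ε1, e10, Ce, fun u G A B x0 R ε H h p hε => ⟨?_, hI u G A B x0 R ε H h p hε⟩⟩
  have hk := hI u G A B x0 R ε H h p hε
  have hs : C * (ε + H) ≤ 1 / 2 := (mul_le_mul_of_nonneg_left hε (by linarith only [C1])).trans Ce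
  have s0 : 0 < ε + H := by linarith only [p.e0, p.H0]
  intro v
  rcases eq_or_ne v 0 with rfl | hv
  · simp
  have Qp := pd_pos p.pB hv
  have vp : 0 < ‖v‖ := norm_pos_iff.2 hv
  have R0 := p.R0
  refine le_of_forall_pos_le_add fun δ δ0 => ?_
  obtain ⟨ρ, ρ0, hρ⟩ := h.m.nb x0 (η := δ / (2 * ‖v‖ ^ 2)) (by positivity)
  have t1 : Tendsto (fun k : ℕ => θ ^ k) atTop (𝓝 0) := tendsto_pow_atTop_nhds_zero_of_lt_one θ0.le (by linarith only [θ1])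
  have t2 : Tendsto (fun k : ℕ => (θ ^ α) ^ k) atTop (𝓝 0) := tendsto_pow_atTop_nhds_zero_of_lt_one (by positivity) (Real.rpow_lt_one θ0.le (by linarith) hα0)
  obtain ⟨m, hm⟩ : ∃ m, m = ρ / ((R * ‖v‖) * √(2 / ⟪TM B v, v⟫)) := ⟨_, rfl⟩
  have m0 : 0 < m := by rw [hm]; positivity
  obtain ⟨k, k1, k2⟩ := ((t1.eventually (ge_mem_nhds m0)).and (t2.eventually (ge_mem_nhds (show 0 < δ / (8 * ⟪TM B v, v⟫) by positivity)))).exists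
  obtain ⟨B', q1, q2, q3, q4⟩ := hk k
  have Qp' := pd_pos q1 hv
  have tw := q3.two p.pB hs v
  have f := flc h.m q4 hρ (v := v) (t := θ ^ k * R / √⟪TM B' v, v⟫) (by positivity) (by rw [div_pow, Real.sq_sqrt Qp'.le]; field_simp) (by
    have a1 : 1 / √⟪TM B' v, v⟫ ≤ √(2 / ⟪TM B v, v⟫) := by
      rw [one_div, ← Real.sqrt_inv]
      refine Real.sqrt_le_sqrt ?_
      rw [inv_eq_one_div, div_le_div_iff₀ Qp' Qp]; linarith only [tw]
    rw [norm_smul, Real.norm_of_nonneg (by positivity)]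
    calc θ ^ k * R / √⟪TM B' v, v⟫ * ‖v‖ = θ ^ k * (R * ‖v‖) * (1 / √⟪TM B' v, v⟫) := by ring
      _ ≤ m * (R * ‖v‖) * √(2 / ⟪TM B v, v⟫) := by gcongr
      _ = ρ := by rw [hm]; field_simp)
  have e1 : δ / (2 * ‖v‖ ^ 2) * ‖v‖ ^ 2 = δ / 2 := by field_simp
  rw [e1] at f
  have e2 : 4 * (C * (ε + H) * (θ ^ α) ^ k) * ⟪TM B' v, v⟫ ≤ δ / 2 := by
    calc 4 * (C * (ε + H) * (θ ^ α) ^ k) * ⟪TM B' v, v⟫ ≤ 4 * (1 / 2 * (δ / (8 * ⟪TM B v, v⟫))) * (2 * ⟪TM B v, v⟫) := by gcongr; exact tw.2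
      _ = δ / 2 := by field_simp; norm_num
  have f2 := q3 v
  rw [abs_le] at f f2 ⊢; constructor <;> linarith only [f, e2, f2]

lemma point2 (hn : 1 ≤ n) (hL0 : 0 ≤ Lam) (hl0 : 0 < lam) (hα0 : 0 < α) (hα1 : α < 1) : ∃ C ≥ (1:ℝ), ∃ c > 0, ∃ ε1 > 0,
    ∀ u G (A : EE n → MM n) B x0 R ε H, EL lam Lam u G A → PTH α ε H R u A B x0 → ε + H ≤ ε1 → ∀ r, 0 < r → r ≤ c * R →
    Fl u (A x0) x0 r (C * (ε + H) * (r / R) ^ α) := by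
  obtain ⟨C, C1, θ, θ0, θ1, ε1, e10, Ce, hI⟩ := point1 (n := n) hn hL0 hl0 hα0 hα1
  refine ⟨(C + C * (C + 2)) * (2 / θ) ^ 3, ?_, θ / 2, by positivity, ε1 / (C + 2), by positivity, fun u G A B x0 R ε H h p hε r r0 hr => ?_⟩
  · exact one_le_mul_of_one_le_of_one_le (by nlinarith) (one_le_pow₀ (by rw [le_div_iff₀ θ0]; linarith))
  have R0 := p.R0
  have H0 := p.H0
  have s0 : 0 < ε + H := by linarith [p.e0]
  rw [le_div_iff₀ (by linarith only [C1])] at hε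
  have hε1 : ε + H ≤ ε1 := by
    have : 0 ≤ (ε + H) * (C + 1) := by positivity
    linarith only [hε, this]
  have x0' : 0 < 2 * r / R := by positivity
  have x1 : 2 * r / R ≤ θ := by rw [div_le_iff₀ R0]; linarith only [hr]
  obtain ⟨k, k1, k2⟩ := exists_nat_pow_near_of_lt_one x0' (by linarith) θ0 (by linarith)
  have hk : k ≠ 0 := by
    rintro rfl
    simp at k1; linarith only [x1, k1]
  obtain ⟨B', q1, q2, q3, q4⟩ := (hI u G A B x0 R ε H h p hε1).2 k
  obtain ⟨T, hT⟩ : ∃ T, T = θ ^ k := ⟨_, rfl⟩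
  have T0 : 0 < T := by rw [hT]; positivity
  have T1 : T ≤ 1 / 8 := by rw [hT]; exact (pow_le_of_le_one θ0.le (by linarith only [θ1]) hk).trans θ1
  have τk : (θ ^ α) ^ k = T ^ α := by rw [hT, ← Real.rpow_natCast, ← Real.rpow_natCast, ← Real.rpow_mul θ0.le, ← Real.rpow_mul θ0.le, mul_comm]
  rw [pow_succ, ← hT, lt_div_iff₀ R0] at k1
  rw [← hT, div_le_iff₀ R0] at k2
  rw [τk, ← hT] at q4
  have Ta1 : T ^ α ≤ 1 := Real.rpow_le_one T0.le (by linarith only [T1]) hα0.le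
  have Ta0 : 0 < T ^ α := by positivity
  have hs : C * (ε + H) ≤ 1 / 2 := (mul_le_mul_of_nonneg_left hε1 (by linarith only [C1])).trans Ce
  have p' : PTH α (C * (ε + H) * T ^ α) (2 * H * T ^ α) (T * R) u A B' x0 := ⟨q1, q2, by positivity, by positivity, by positivity, q4, fun t t0 t1 x hx => by
    have := p.hp (2 * t * T) (by positivity) (by nlinarith) x (by
      have := (q3.two p.pB hs (x - x0)).1
      have a : 0 ≤ t ^ 2 * T ^ 2 * R ^ 2 := by positivity
      rw [mul_pow] at hx
      rw [mul_pow, mul_pow]; linarith only [hx, this, a])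
    refine this.trans ?_
    rw [Real.mul_rpow (by positivity) T0.le, Real.mul_rpow (by norm_num) t0.le]
    have : (2:ℝ) ^ α ≤ 2 ^ (1:ℝ) := Real.rpow_le_rpow_of_exponent_le (by norm_num) hα1.le
    rw [Real.rpow_one] at this
    calc H * (2 ^ α * t ^ α * T ^ α) ≤ H * (2 * t ^ α * T ^ α) := by gcongr
      _ = _ := by ring⟩
  have hb : C * (ε + H) * T ^ α + 2 * H * T ^ α ≤ (C + 2) * (ε + H) * T ^ α := by
    have : 0 ≤ 2 * ε * T ^ α := by have := p.e0; positivity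
    linarith only [this]
  have hb' : C * (ε + H) * T ^ α + 2 * H * T ^ α ≤ ε1 := by
    have := mul_le_mul_of_nonneg_left Ta1 (by positivity : 0 ≤ (C + 2) * (ε + H))
    linarith only [hε, hb, this]
  have c1 := (hI u G A B' x0 _ _ _ h p' hb').1
  have f := q4.chg q1 c1 (by positivity) ((mul_le_mul_of_nonneg_left hb' (by linarith only [C1])).trans Ce) r0 (by nlinarith)
  refine f.mono ?_
  have a1 : T * R / r ≤ 2 / θ := by rw [div_le_div_iff₀ r0 θ0]; linarith only [k1]
  have a2 : T ^ α ≤ 2 / θ * (r / R) ^ α := by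
    have b1 : T ≤ 2 / θ * (r / R) := by rw [div_mul_div_comm, le_div_iff₀ (by positivity)]; linarith only [k1]
    refine (Real.rpow_le_rpow T0.le b1 hα0.le).trans ?_
    rw [Real.mul_rpow (by positivity) (by positivity)]
    have b2 : 1 ≤ 2 / θ := by rw [le_div_iff₀ θ0]; linarith only [θ1]
    exact mul_le_mul_of_nonneg_right (Real.rpow_le_self_of_one_le b2 hα1.le) (by positivity)
  calc (C * (ε + H) * T ^ α + C * (C * (ε + H) * T ^ α + 2 * H * T ^ α)) * (T * R / r) ^ 2
      ≤ (C * (ε + H) * T ^ α + C * ((C + 2) * (ε + H) * T ^ α)) * (2 / θ) ^ 2 := by gcongr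
    _ = (C + C * (C + 2)) * (ε + H) * T ^ α * (2 / θ) ^ 2 := by ring
    _ ≤ (C + C * (C + 2)) * (ε + H) * (2 / θ * (r / R) ^ α) * (2 / θ) ^ 2 := by gcongr
    _ = _ := by ring

lemma point3 (hn : 1 ≤ n) (hL0 : 0 ≤ Lam) (hl0 : 0 < lam) (hα0 : 0 < α) (hα1 : α < 1) : ∃ C ≥ (1:ℝ), ∃ ε1 > 0, C * ε1 ≤ 1 / 2 ∧
    ∀ u G (A : EE n → MM n) (B : MM n) x0 y R ε H δ, EL lam Lam u G A → B.PosDef → 0 < R → 0 < ε → 0 ≤ H → Fl u B x0 R ε → ⟪TM B (y - x0), y - x0⟫ ≤ R ^ 2 / 4 →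
    (∀ t, 0 < t → t ≤ 1 → ∀ x, ⟪TM B (x - y), x - y⟫ ≤ t ^ 2 * R ^ 2 → |(A x).det / (A y).det - 1| ≤ H * t ^ α) → |(A y).det / B.det - 1| ≤ δ → ε + H + δ ≤ ε1 →
    Cl (C * (ε + H + δ)) (A y) B := by
  obtain ⟨C, C1, θ, θ0, θ1, ε1, e10, Ce, hI⟩ := point1 (n := n) hn hL0 hl0 hα0 hα1
  refine ⟨33 * C, by linarith only [C1], ε1 / 66, by positivity, by linarith, fun u G A B x0 y R ε H δ h pB R0 e0 H0 fl hy hp hδ hs => ?_⟩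
  have δ0 : 0 ≤ δ := (abs_nonneg _).trans hδ
  have e1 : ε1 ≤ 1 / 2 := by nlinarith
  have dB := pB.det_pos
  have dA := (h.m.pA y).det_pos
  obtain ⟨κ, hκ⟩ : ∃ κ, κ = ((A y).det / B.det) ^ (1 / (n:ℝ)) := ⟨_, rfl⟩
  have κ0 : 0 < κ := by rw [hκ]; positivity
  have κn : κ ^ n = (A y).det / B.det := by
    rw [hκ, ← Real.rpow_natCast, ← Real.rpow_mul (by positivity), one_div_mul_cancel (by exact_mod_cast (by omega : n ≠ 0)), Real.rpow_one]
  have κ1 : |κ - 1| ≤ δ := by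
    rw [← κn] at hδ
    rw [abs_le] at hδ ⊢
    obtain ⟨m, rfl⟩ : ∃ m, n = m + 1 := ⟨n - 1, by omega⟩
    rcases le_total κ 1 with k1 | k1
    · have : κ ^ (m + 1) ≤ κ := pow_le_of_le_one κ0.le k1 (by omega)
      constructor <;> linarith only [hδ, this, δ0, k1]
    · have : κ ≤ κ ^ (m + 1) := le_self_pow₀ k1 (by omega)
      constructor <;> linarith only [δ0, k1, hδ, this]
  have c1 : Cl δ (κ • B) B := fun v => by
    rw [TM_smul, real_inner_smul_left, ← sub_one_mul, abs_mul, abs_of_nonneg (psd_nonneg pB.posSemidef v)]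
    exact mul_le_mul_of_nonneg_right κ1 (psd_nonneg pB.posSemidef v)
  have dh : δ ≤ 1 / 2 := by linarith only [e0, H0, hs, e1]
  have f := (fl.rec' pB hy).chg pB c1 δ0 dh (r := R / 4) (by positivity) (by nlinarith [sq_nonneg R])
  have e4 : R / 2 / (R / 4) = 2 := by field_simp; norm_num
  rw [e4] at f
  have p : PTH α ((4 * ε + δ) * 2 ^ 2) H (R / 4) u A (κ • B) y := ⟨pB.smul κ0, by rw [det_smul, Fintype.card_fin, κn]; field_simp, by positivity, by positivity, H0, f, fun t t0 t1 x hx => by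
    refine hp t t0 t1 x ?_
    have := (c1.two pB dh (x - y)).1
    have a : 0 ≤ t ^ 2 * R ^ 2 := by positivity
    rw [div_pow] at hx
    linarith only [hx, this, a]⟩
  have c2 := (hI u G A _ y _ _ _ h p (by linarith only [e0, H0, hs, δ0])).1
  refine (c2.comp c1 pB (by positivity) dh).mono pB ?_
  have b1 : 0 ≤ C * ε := by positivity
  have b2 : 0 ≤ C * H := by positivity
  have b3 : δ ≤ C * δ := le_mul_of_one_le_left δ0 C1
  linarith only [δ0, b1, b2, b3]
end pt


section far
variable {n : ℕ} {lam Lam d K σ ε η η' R r β C θ ε0 α H M : ℝ} {u g : EE n → ℝ} {G : EE n → EE n} {A : EE n → MM n} {B B' B'' D : MM n} {x0 y : EE n}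

lemma Fl.shr (h : Fl u B x0 R ε) (hr : 0 < r) (hrR : r ≤ R) : Fl u B x0 r (ε * (R / r) ^ 2) := by
  obtain ⟨b, c, h⟩ := h
  refine ⟨b, c, fun x hx => (h x (hx.trans (pow_le_pow_left₀ hr.le hrR 2))).trans (le_of_eq ?_)⟩
  field_simp

lemma kb_far (hn : 1 ≤ n) (hM : HM M σ g) (hR : 0 < R) (hBd : B.det = 1) : KB g 1 B 0 R (M * (R / 4) ^ (-σ)) σ := by
  intro P hP S hS hS3
  have hn' : (n:ℝ) ≠ 0 := by positivity
  have e1 : |P.det| = (R / 4) ^ n := by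
    have := congrArg Matrix.det hP
    rw [det_mul, det_mul, det_transpose, hBd, det_smul, det_one, Fintype.card_fin] at this
    have e : P.det ^ 2 = ((R / 4) ^ n) ^ 2 := by rw [← pow_mul, mul_comm n, pow_mul, div_pow]; norm_num; linarith only [this]
    rw [sq_eq_sq_iff_abs_eq_abs, abs_of_pos (by positivity : 0 < (R / 4) ^ n)] at e
    exact e
  have d0 : 0 < |P.det| := by rw [e1]; positivity
  have hd : P.det ≠ 0 := abs_pos.1 d0
  have fS : volume S < ⊤ := (measure_mono hS3).trans_lt measure_closedBall_lt_top
  simp only [zero_add, div_one]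
  rw [cov hd hS fun x => |g x - 1|]
  have m1 : MeasurableSet (TM P '' S) := by
    rw [image_eq_preimage_of_inverse (TM_PP' hd) (TM_PP hd)]
    exact (TM P⁻¹).continuous.measurable hS
  have m2 : volume (TM P '' S) ≠ ⊤ := by
    rw [Measure.addHaar_image_continuousLinearMap]
    exact ENNReal.mul_ne_top ENNReal.ofReal_ne_top fS.ne
  have := hM _ m1 m2
  rw [vol_TM, Real.mul_rpow d0.le measureReal_nonneg] at this
  have e2 : |P.det|⁻¹ * |P.det| ^ (1 - σ / n) = (R / 4) ^ (-σ) := by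
    rw [← Real.rpow_neg_one, ← Real.rpow_add d0, e1, ← Real.rpow_natCast, ← Real.rpow_mul (by positivity)]
    congr 1; field_simp; ring
  calc _ ≤ |P.det|⁻¹ * (M * (|P.det| ^ (1 - σ / n) * volume.real S ^ (1 - σ / n))) := mul_le_mul_of_nonneg_left this (by positivity)
    _ = _ := by rw [← e2]; ring

lemma gs {τ : ℝ} (h0 : 0 < τ) (h1 : τ < 1) (k : ℕ) : ∑ j ∈ Finset.range k, τ⁻¹ ^ j ≤ τ⁻¹ ^ k / (1 - τ) := by
  have h2 : 0 < 1 - τ := by linarith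
  induction k with
  | zero => simp; linarith
  | succ k ih =>
    rw [Finset.sum_range_succ]
    have e : τ⁻¹ ^ k / (1 - τ) + τ⁻¹ ^ k = τ⁻¹ ^ k * ((2 - τ) / (1 - τ)) := by field_simp; ring
    have : (2 - τ) / (1 - τ) ≤ τ⁻¹ / (1 - τ) := by
      refine div_le_div_of_nonneg_right ?_ h2.le
      rw [inv_eq_one_div, le_div_iff₀ h0]; nlinarith [sq_nonneg (1 - τ)]
    calc _ ≤ τ⁻¹ ^ k / (1 - τ) + τ⁻¹ ^ k := by linarith
      _ ≤ τ⁻¹ ^ k * (τ⁻¹ / (1 - τ)) := by rw [e]; exact mul_le_mul_of_nonneg_left this (by positivity)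
      _ = _ := by rw [pow_succ]; ring

lemma gs' {τ : ℝ} (h0 : 0 < τ) (h1 : τ < 1) (k : ℕ) : ∑ j ∈ Finset.range k, τ ^ j ≤ 1 / (1 - τ) := by
  have dq : 0 < 1 - τ := by linarith
  rw [geom_sum_eq h1.ne, ← neg_div_neg_eq, neg_sub, neg_sub]
  exact div_le_div_of_nonneg_right (by linarith [pow_pos h0 k]) dq.le

set_option maxHeartbeats 1000000 in
lemma far1 (hn : 1 ≤ n) (hL0 : 0 ≤ Lam) (hl0 : 0 < lam) (hM0 : 0 ≤ M) : ∃ C ≥ (1:ℝ), ∃ θ, 0 < θ ∧ θ ≤ 1 / 8 ∧ ∃ ε1 > 0, C * ε1 ≤ 1 / 8 ∧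
    ∀ u G (A : EE n → MM n) B R ε, MZ lam Lam u G A → HM M (1/2) (fun x => (A x).det) → B.PosDef → B.det = 1 → 0 < R → 0 < ε → Fl u B 0 R ε →
    ∀ k : ℕ, ε + (θ ^ k * R) ^ (-(1/2):ℝ) ≤ ε1 →
    ∃ B' : MM n, B'.PosDef ∧ B'.det = 1 ∧ Cl (C * (ε + (θ ^ k * R) ^ (-(1/2):ℝ))) B' B ∧ Fl u B' 0 (θ ^ k * R) (C * (ε + (θ ^ k * R) ^ (-(1/2):ℝ))) := by
  obtain ⟨C, C1, θ, θ0, θ1, ε0, e00, Ce, hS⟩ := step (n := n) hn lam Lam hL0 hl0 (show (1/2:ℝ) < 1 by norm_num)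
  obtain ⟨τ, hτ⟩ : ∃ τ, τ = θ ^ (1/2:ℝ) := ⟨_, rfl⟩
  have τ0 : 0 < τ := by rw [hτ]; positivity
  have τ1 : τ < 1 := by rw [hτ]; exact Real.rpow_lt_one θ0.le (by linarith) (by norm_num)
  have dq : 0 < 1 - τ := by linarith only [τ1]
  obtain ⟨M', hM'⟩ : ∃ M', M' = M * (1/4) ^ (-(1/2):ℝ) := ⟨_, rfl⟩
  have M0 : 0 ≤ M' := by rw [hM']; positivity
  obtain ⟨F, hF⟩ : ∃ F, F = C * M' / (1 - τ) := ⟨_, rfl⟩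
  have F0 : 0 ≤ F := by rw [hF]; positivity
  have hF' : C * M' = F * (1 - τ) := by rw [hF]; field_simp
  obtain ⟨D, hD⟩ : ∃ D, D = (1 + F) * (2 * C / (1 - τ)) := ⟨_, rfl⟩
  have h2C : 1 ≤ 2 * C / (1 - τ) := by rw [le_div_iff₀ dq]; linarith only [C1, τ0]
  have FD' : 1 + F ≤ D := by rw [hD]; exact le_mul_of_one_le_right (by linarith only [F0]) h2C
  have D0 : 0 < D := by linarith only [F0, FD']
  refine ⟨D, by linarith only [F0, FD'], θ, θ0, θ1, min (1 / (8 * D)) (ε0 / D), by positivity, ?_, fun u G A B R ε h hM pB dB R0 ep fl N hε => ?_⟩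
  · calc D * min (1 / (8 * D)) (ε0 / D) ≤ D * (1 / (8 * D)) := mul_le_mul_of_nonneg_left (min_le_left _ _) D0.le
      _ = _ := by field_simp
  obtain ⟨X, hX⟩ : ∃ X, X = R ^ (-(1/2):ℝ) := ⟨_, rfl⟩
  have X0 : 0 < X := by rw [hX]; positivity
  have hk : ∀ k : ℕ, (θ ^ k * R) ^ (-(1/2):ℝ) = X * τ⁻¹ ^ k := fun k => by
    rw [Real.mul_rpow (by positivity) R0.le, ← hX, hτ, ← Real.rpow_neg θ0.le, ← Real.rpow_natCast, ← Real.rpow_natCast, ← Real.rpow_mul θ0.le, ← Real.rpow_mul θ0.le, mul_comm, mul_comm (k:ℝ)]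
  have h1 := hε.trans (min_le_left _ _)
  have h2 := hε.trans (min_le_right _ _)
  rw [le_div_iff₀ (by positivity), hk] at h1 h2
  rw [hk]
  have τi : 1 ≤ τ⁻¹ := (one_le_inv₀ τ0).2 τ1.le
  have mono : ∀ k ≤ N, X * τ⁻¹ ^ k ≤ X * τ⁻¹ ^ N := fun k hk => mul_le_mul_of_nonneg_left (pow_le_pow_right₀ τi hk) X0.le
  have s0 : 0 < X * τ⁻¹ ^ N := by positivity
  have g0 : ∀ k ≤ N, ε * τ ^ k + F * X * τ⁻¹ ^ k ≤ (1 + F) * (ε + X * τ⁻¹ ^ N) := fun k hk => by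
    have a1 : ε * τ ^ k ≤ ε := mul_le_of_le_one_right ep.le (pow_le_one₀ τ0.le τ1.le)
    have a2 := mul_le_mul_of_nonneg_left (mono k hk) F0
    have a3 := mul_nonneg F0 ep.le
    linarith only [s0, a1, a2, a3]
  have gD : (1 + F) * (ε + X * τ⁻¹ ^ N) ≤ D * (ε + X * τ⁻¹ ^ N) := mul_le_mul_of_nonneg_right FD' (by linarith only [ep, s0])
  have hsum : ∀ k ≤ N, 2 * C * ∑ j ∈ Finset.range k, (ε * τ ^ j + F * X * τ⁻¹ ^ j) ≤ D * (ε + X * τ⁻¹ ^ N) := fun k hk => by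
    have b1 := mul_le_mul_of_nonneg_left (gs' τ0 τ1 k) ep.le
    have b2 := mul_le_mul_of_nonneg_left (gs τ0 τ1 k) (mul_nonneg F0 X0.le)
    have b3 := mul_le_mul_of_nonneg_right (mul_le_mul_of_nonneg_left (mono k hk) F0) (inv_pos.2 dq).le
    rw [Finset.sum_add_distrib, ← Finset.mul_sum, ← Finset.mul_sum]
    have b4 : 0 ≤ F * ε * (1 - τ)⁻¹ := by positivity
    have b5 : 0 ≤ X * τ⁻¹ ^ N * (1 - τ)⁻¹ := by positivity
    calc _ ≤ 2 * C * ((1 + F) * (ε + X * τ⁻¹ ^ N) * (1 - τ)⁻¹) := by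
          refine mul_le_mul_of_nonneg_left ?_ (by linarith only [C1])
          rw [div_eq_mul_inv] at b1 b2
          linarith only [b1, b2, b3, b4, b5]
      _ = _ := by rw [hD]; ring
  have g2 : ∀ k : ℕ, θ ^ (1/2:ℝ) * (ε * τ ^ k + F * X * τ⁻¹ ^ k) + C * (M' * (X * τ⁻¹ ^ k)) ≤ ε * τ ^ (k + 1) + F * X * τ⁻¹ ^ (k + 1) := fun k => by
    have a1 : F * (X * τ⁻¹ ^ k) ≤ F * (X * τ⁻¹ ^ (k + 1)) := mul_le_mul_of_nonneg_left (mul_le_mul_of_nonneg_left (pow_le_pow_right₀ τi (Nat.le_succ k)) X0.le) F0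
    rw [← hτ, ← mul_assoc C, hF', pow_succ]
    linarith only [a1]
  have g3 : ∀ k : ℕ, ∀ B' : MM n, B'.det = 1 → KB (fun x => (A x).det) 1 B' 0 (θ ^ k * R) (M' * (X * τ⁻¹ ^ k)) (1/2) := fun k B' b2 => by
    have := kb_far hn hM (R := θ ^ k * R) (by positivity) b2
    rwa [div_eq_mul_one_div, Real.mul_rpow (by positivity) (by norm_num), hk, mul_comm (X * _), ← mul_assoc, ← hM'] at this
  obtain ⟨B', q1, q2, q3, q4⟩ := iter hS C1 θ0 h.toMAS one_pos (fun x => by rw [mul_one]; exact h.lo x) (fun x => by rw [mul_one]; exact h.hi x) pB dB R0 (σ := 1/2) (by norm_num) (by norm_num) (x0 := 0)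
    (e := fun k => ε * τ ^ k + F * X * τ⁻¹ ^ k) (K := fun k => M' * (X * τ⁻¹ ^ k)) (N := N)
    (fun k => by positivity) (fun k hk => (g0 k hk.le).trans (by linarith only [h2, gD])) (fun k => by positivity) (fun k _ => g2 k) (fun k hk => (hsum k hk).trans (by linarith only [h1])) (fun k _ B' _ b2 _ => g3 k B' b2)
    (fl.mono (by simp; positivity)) N le_rfl
  exact ⟨B', q1, q2, q3.mono pB (hsum N le_rfl), q4.mono ((g0 N le_rfl).trans gD)⟩

lemma far2 (hn : 1 ≤ n) (hL0 : 0 ≤ Lam) (hl0 : 0 < lam) (hM0 : 0 ≤ M) : ∃ C ≥ (1:ℝ), ∃ ε1 > 0, C * ε1 ≤ 1 / 8 ∧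
    ∀ u G (A : EE n → MM n) B R ε, MZ lam Lam u G A → HM M (1/2) (fun x => (A x).det) → B.PosDef → B.det = 1 → 0 < R → 0 < ε → Fl u B 0 R ε →
    ∀ r, 0 < r → r ≤ R → ε + r ^ (-(1/2):ℝ) ≤ ε1 →
    ∃ B' : MM n, B'.PosDef ∧ B'.det = 1 ∧ Cl (C * (ε + r ^ (-(1/2):ℝ))) B' B ∧ Fl u B' 0 r (C * (ε + r ^ (-(1/2):ℝ))) := by
  obtain ⟨C, C1, θ, θ0, θ1, ε1, e10, Ce, hI⟩ := far1 (n := n) (M := M) hn hL0 hl0 hM0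
  have t1 : 1 ≤ θ⁻¹ ^ 2 := one_le_pow₀ ((one_le_inv₀ θ0).2 (by linarith))
  refine ⟨C * θ⁻¹ ^ 2, by nlinarith, min ε1 (1 / (8 * (C * θ⁻¹ ^ 2))), by positivity, ?_, fun u G A B R ε h hM pB dB R0 ep fl r r0 rR hε => ?_⟩
  · calc _ ≤ C * θ⁻¹ ^ 2 * (1 / (8 * (C * θ⁻¹ ^ 2))) := mul_le_mul_of_nonneg_left (min_le_right _ _) (by positivity)
      _ = _ := by field_simp
  obtain ⟨k, k1, k2⟩ := exists_nat_pow_near_of_lt_one (x := r / R) (y := θ) (by positivity) ((div_le_one R0).2 rR) θ0 (by linarith only [θ1])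
  rw [lt_div_iff₀ R0] at k1
  rw [div_le_iff₀ R0] at k2
  have p1 : (θ ^ k * R) ^ (-(1/2):ℝ) ≤ r ^ (-(1/2):ℝ) := Real.rpow_le_rpow_of_nonpos r0 k2 (by norm_num)
  have s0 : 0 < ε + r ^ (-(1/2):ℝ) := by positivity
  have s1 : C * (ε + (θ ^ k * R) ^ (-(1/2):ℝ)) ≤ C * (ε + r ^ (-(1/2):ℝ)) := mul_le_mul_of_nonneg_left (by linarith only [p1]) (by linarith only [C1])
  obtain ⟨B', q1, q2, q3, q4⟩ := hI u G A B R ε h hM pB dB R0 ep fl k (by linarith only [hε, p1, min_le_left ε1 (1 / (8 * (C * θ⁻¹ ^ 2)))])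
  refine ⟨B', q1, q2, q3.mono pB (s1.trans ?_), ((q4.mono s1).shr r0 k2).mono ?_⟩
  · exact mul_le_mul_of_nonneg_right (le_mul_of_one_le_right (by linarith only [C1]) t1) s0.le
  · have : θ ^ k * R / r ≤ θ⁻¹ := by
      rw [div_le_iff₀ r0, inv_mul_eq_div, le_div_iff₀ θ0]; rw [pow_succ] at k1; linarith only [k1]
    calc _ ≤ C * (ε + r ^ (-(1/2):ℝ)) * θ⁻¹ ^ 2 := mul_le_mul_of_nonneg_left (pow_le_pow_left₀ (by positivity) this 2) (by positivity)
      _ = _ := by ring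

lemma comp (h : MZ lam Lam u G A) (hR : 0 < R) : ∃ c > 0, ∃ C > 0, ∀ B : MM n, B.PosDef → Fl u B 0 R (1 / 8) → ∀ v, c * ‖v‖ ^ 2 ≤ ⟪TM B v, v⟫ ∧ ⟪TM B v, v⟫ ≤ C * ‖v‖ ^ 2 := by
  obtain ⟨T, T0, hT⟩ := h.rad (R ^ 2)
  have c0 : Tendsto u (𝓝 0) (𝓝 0) := by have := h.cu.tendsto 0; rwa [h.u0] at this
  obtain ⟨t, t0, ht⟩ := Metric.eventually_nhds_iff.1 (c0.eventually (gt_mem_nhds (show 0 < R ^ 2 / 4 by positivity)))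
  refine ⟨R ^ 2 / T ^ 2, by positivity, R ^ 2 / t ^ 2, by positivity, fun B pB ⟨b, c, hF⟩ v => ?_⟩
  rcases eq_or_ne v 0 with rfl | hv
  · simp
  have Qp := pd_pos pB hv
  have vp : 0 < ‖v‖ := norm_pos_iff.2 hv
  obtain ⟨s, hs⟩ : ∃ s, s = R / √⟪TM B v, v⟫ := ⟨_, rfl⟩
  have s0 : 0 < s := by rw [hs]; positivity
  have hs2 : s ^ 2 * ⟪TM B v, v⟫ = R ^ 2 := by rw [hs, div_pow, Real.sq_sqrt Qp.le]; field_simp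
  have q : ⟪TM B (s • v), s • v⟫ = R ^ 2 := by rw [map_smul, real_inner_smul_left, real_inner_smul_right, ← hs2]; ring
  have q' : ⟪TM B (-(s • v)), -(s • v)⟫ = R ^ 2 := by rw [map_neg, inner_neg_neg, q]
  have f1 := hF (s • v) (by rw [sub_zero, q])
  have f2 := hF (-(s • v)) (by rw [sub_zero, q'])
  have f3 := hF 0 (by simp; positivity)
  rw [sub_zero, q] at f1
  rw [sub_zero, q', inner_neg_right] at f2
  rw [sub_zero, map_zero, inner_zero_left, inner_zero_right, h.u0] at f3
  rw [abs_le] at f1 f2 f3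
  have R2 : 0 < R ^ 2 := by positivity
  have n1 : ‖s • v‖ ^ 2 = s ^ 2 * ‖v‖ ^ 2 := by rw [norm_smul, mul_pow, Real.norm_of_nonneg s0.le]
  have hle : ‖s • v‖ ≤ T := by
    by_contra hc
    push Not at hc
    have := hT _ hc.le
    have := hT (-(s • v)) (by rw [norm_neg]; exact hc.le)
    linarith
  have hge : t ≤ ‖s • v‖ := by
    by_contra hc
    push Not at hc
    have := ht (y := s • v) (by rw [dist_zero_right]; exact hc)
    have := ht (y := -(s • v)) (by rw [dist_zero_right, norm_neg]; exact hc)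
    linarith
  have a1 := pow_le_pow_left₀ (norm_nonneg _) hle 2
  have a2 := pow_le_pow_left₀ t0.le hge 2
  rw [n1] at a1 a2
  rw [div_mul_eq_mul_div, div_mul_eq_mul_div, div_le_iff₀ (by positivity), le_div_iff₀ (by positivity), ← hs2]
  have b1 := mul_le_mul_of_nonneg_left a1 Qp.le
  have b2 := mul_le_mul_of_nonneg_left a2 Qp.le
  constructor <;> linarith only [b1, b2]

end far


section far
variable {n : ℕ} {lam Lam d K σ ε η η' R r β C θ ε0 α H M D μ ρ : ℝ} {u g : EE n → ℝ} {G : EE n → EE n} {A : EE n → MM n} {B B' B'' N : MM n} {x0 y : EE n}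

lemma polar (hB : Bᵀ = B) (hN : Nᵀ = N) (hη : 0 ≤ η) (h : ∀ v, |⟪TM B v, v⟫ - ⟪TM N v, v⟫| ≤ η * ‖v‖ ^ 2) (i j : Fin n) : |B i j - N i j| ≤ 3 * η := by
  have k : ∀ i j : Fin n, |⟪TM B (eij i j), eij i j⟫ - ⟪TM N (eij i j), eij i j⟫| ≤ 4 * η := fun i j => (h _).trans (by
    have := mul_le_mul_of_nonneg_left (pow_le_pow_left₀ (norm_nonneg _) (eij_norm i j) 2) hη
    linarith)
  have k1 := k i j
  have k2 := k i i
  have k3 := k j j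
  have e1 : B j i = B i j := congrFun (congrFun hB i) j
  have e2 : N j i = N i j := congrFun (congrFun hN i) j
  rw [quad_eij, quad_eij] at k1 k2 k3
  rw [e1, e2] at k1
  rw [abs_le] at k1 k2 k3 ⊢
  constructor <;> linarith

def DK (g : EE n → ℝ) (D μ α ρ : ℝ) : Prop := ∀ x, ρ ≤ ‖x‖ → |g x - 1| ≤ D * ‖x‖ ^ (-μ) ∧
  ∀ z t, 0 < t → t ≤ 1 → ‖z - x‖ ≤ t * (‖x‖ / 2) → |g z / g x - 1| ≤ D * ‖x‖ ^ (-μ) * t ^ α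

def BQ (B : MM n) (c C : ℝ) : Prop := ∀ v, c * ‖v‖ ^ 2 ≤ ⟪TM B v, v⟫ ∧ ⟪TM B v, v⟫ ≤ C * ‖v‖ ^ 2

lemma MZ.el (h : MZ lam Lam u G A) (hl : 0 < lam) : EL (lam / Lam) (Lam / lam) u G A := by
  have hL : 0 < Lam := hl.trans_le ((h.lo 0).trans (h.hi 0))
  refine ⟨h.toMAS, fun x z => ?_, fun x z => ?_⟩
  · rw [div_mul_eq_mul_div, div_le_iff₀ hL]
    exact (mul_le_mul_of_nonneg_left (h.hi z) hl.le).trans (mul_le_mul_of_nonneg_right (h.lo x) hL.le)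
  · rw [div_mul_eq_mul_div, le_div_iff₀ hl]
    exact (mul_le_mul_of_nonneg_right (h.hi x) hl.le).trans (mul_le_mul_of_nonneg_left (h.lo z) hL.le)

set_option maxHeartbeats 1000000 in
lemma far_pt (hn : 1 ≤ n) (hl : 0 < lam) (h : MZ lam Lam u G A) (hM0 : 0 ≤ M) (hM : HM M (1/2) fun x => (A x).det) (hα0 : 0 < α) (hα1 : α < 1) (hD : 0 ≤ D) (hμ : μ ≤ 1 / 2)
    (hdk : DK (fun x => (A x).det) D μ α ρ) {c C : ℝ} (hc : 0 < c) (hC : 0 < C) : ∃ s > 0, ∃ K ≥ (1:ℝ), ∃ F ≥ (0:ℝ), ∀ B : MM n, ∀ R ε, B.PosDef → B.det = 1 → BQ B c C → 0 < R → 0 < ε → Fl u B 0 R ε →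
    ∀ x, 1 ≤ ‖x‖ → ρ ≤ ‖x‖ → K * ‖x‖ ≤ R → ε + ‖x‖ ^ (-μ) ≤ s → ∀ v, |⟪TM (A x) v, v⟫ - ⟪TM B v, v⟫| ≤ F * (ε + ‖x‖ ^ (-μ)) * ‖v‖ ^ 2 := by
  have hL : 0 < Lam := hl.trans_le ((h.lo 0).trans (h.hi 0))
  obtain ⟨C2, C21, e2, e20, Ce2, hf⟩ := far2 (n := n) hn hL.le hl hM0
  obtain ⟨C3, C31, e3, e30, Ce3, hp⟩ := point3 (n := n) (lam := lam / Lam) (Lam := Lam / lam) hn (by positivity) (by positivity) hα0 hα1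
  obtain ⟨K, hK1, hK2⟩ : ∃ K ≥ (1:ℝ), 8 * C ≤ K ^ 2 := ⟨8 * C + 1, by linarith only [hC], by linarith only [hC, sq_nonneg C]⟩
  obtain ⟨κ, k0, k1, k2⟩ : ∃ κ > 0, κ ≤ 1 / 2 ∧ 8 * κ ^ 2 ≤ c := by
    refine ⟨min (1/2) (√(c / 8)), by positivity, min_le_left _ _, ?_⟩
    have := pow_le_pow_left₀ (by positivity) (min_le_right (1/2) (√(c / 8))) 2
    rw [Real.sq_sqrt (by positivity)] at this
    linarith only [this]
  obtain ⟨E, hE⟩ : ∃ E, E = 4 * C2 * (K / (2 * κ)) ^ 2 := ⟨_, rfl⟩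
  have E0 : 0 < E := by rw [hE]; positivity
  refine ⟨min e2 (e3 / (E + 2 * D)), by positivity, K, hK1, C * (2 * (C3 * (E + 2 * D)) + C2), by positivity, fun B R ε pB dB bq R0 ep fl x x1 xρ xR hs v => ?_⟩
  obtain ⟨s, hsd⟩ : ∃ s, s = ε + ‖x‖ ^ (-μ) := ⟨_, rfl⟩
  rw [← hsd] at hs ⊢
  have x0 : 0 < ‖x‖ := by linarith only [x1]
  have p0 : 0 < ‖x‖ ^ (-μ) := by positivity
  have s0 : 0 < s := by linarith only [ep, hsd, p0]
  have h2 := hs.trans (min_le_left _ _)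
  have h3 := hs.trans (min_le_right _ _)
  rw [le_div_iff₀ (by positivity)] at h3
  have r0 : 0 < K * ‖x‖ := by positivity
  have hr : (K * ‖x‖) ^ (-(1/2):ℝ) ≤ ‖x‖ ^ (-μ) :=
    (Real.rpow_le_rpow_of_nonpos x0 (le_mul_of_one_le_left x0.le hK1) (by norm_num)).trans (Real.rpow_le_rpow_of_exponent_le x1 (by linarith only [hμ]))
  obtain ⟨B', q1, q2, q3, q4⟩ := hf u G A B R ε h hM pB dB R0 ep fl (K * ‖x‖) r0 xR (by linarith only [hsd, h2, hr])
  have hle : C2 * (ε + (K * ‖x‖) ^ (-(1/2):ℝ)) ≤ C2 * s := mul_le_mul_of_nonneg_left (by linarith only [hsd, hr]) (by linarith only [C21])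
  have hle' : C2 * s ≤ 1 / 2 := (mul_le_mul_of_nonneg_left h2 (by linarith only [C21])).trans (by linarith only [Ce2])
  have q3 := q3.mono pB hle
  have q4 := q4.mono hle
  have tw := fun v => q3.two pB hle' v
  have q5 := q4.rec' q1 (y := x) (by
    rw [sub_zero]
    have := (tw x).2; have := (bq x).2
    have := mul_le_mul_of_nonneg_right hK2 (sq_nonneg ‖x‖)
    linarith [mul_pow K ‖x‖ 2])
  have kx : 0 < κ * ‖x‖ := by positivity
  have q6 := q5.shr kx (by
    have := mul_le_mul_of_nonneg_right (k1.trans (by linarith only [hK1] : 1 / 2 ≤ K / 2)) x0.le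
    linarith only [this])
  have e : 4 * (C2 * s) * (K * ‖x‖ / 2 / (κ * ‖x‖)) ^ 2 = E * s := by rw [hE]; field_simp
  rw [e] at q6
  have dx := hdk x xρ
  have ps : D * ‖x‖ ^ (-μ) ≤ D * s := mul_le_mul_of_nonneg_left (by linarith only [ep, hsd]) hD
  have q7 := hp u G A B' x x (κ * ‖x‖) (E * s) (D * s) (D * s) (h.el hl) q1 kx (by positivity) (by positivity) q6 (by simp; positivity)
    (fun t t0 t1 z hz => (dx.2 z t t0 t1 (by
      have a1 := (tw (z - x)).1
      have a2 := (bq (z - x)).1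
      have a3 := mul_le_mul_of_nonneg_right k2 (sq_nonneg ‖z - x‖)
      have k3 : 0 < κ ^ 2 := by positivity
      refine le_of_sq_le_sq ?_ (by positivity)
      refine le_of_mul_le_mul_left ?_ k3
      have : (κ * ‖x‖) ^ 2 = κ ^ 2 * ‖x‖ ^ 2 := by ring
      rw [this] at hz
      have : κ ^ 2 * (t * (‖x‖ / 2)) ^ 2 = t ^ 2 * (κ ^ 2 * ‖x‖ ^ 2) / 4 := by ring
      rw [this]
      linarith only [hz, a1, a2, a3])).trans (mul_le_mul_of_nonneg_right ps (by positivity)))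
    (by rw [q2, div_one]; exact dx.1.trans ps) (by linarith only [h3])
  have e' : E * s + D * s + D * s = (E + 2 * D) * s := by ring
  rw [e'] at q7
  have q8 := q7.comp q3 pB (by positivity) hle' v
  refine q8.trans ?_
  calc _ ≤ (2 * (C3 * ((E + 2 * D) * s)) + C2 * s) * (C * ‖v‖ ^ 2) := mul_le_mul_of_nonneg_left (bq v).2 (by positivity)
    _ = _ := by ring

lemma quad_lim {B : ℕ → MM n} {N : MM n} (h : Tendsto B atTop (𝓝 N)) (v : EE n) : Tendsto (fun k => ⟪TM (B k) v, v⟫) atTop (𝓝 ⟪TM N v, v⟫) := by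
  have c : Continuous fun B : MM n => ⟪TM B v, v⟫ := (cont_TM continuous_id continuous_const).inner continuous_const
  exact (c.tendsto N).comp h

set_option maxHeartbeats 1000000 in
lemma far3 (hn : 1 ≤ n) (hl : 0 < lam) (h : MZ lam Lam u G A) (hM0 : 0 ≤ M) (hM : HM M (1/2) fun x => (A x).det) (hα0 : 0 < α) (hα1 : α < 1) (hD : 0 ≤ D) (hμ0 : 0 < μ) (hμ : μ ≤ 1 / 2)
    (hdk : DK (fun x => (A x).det) D μ α ρ) : ∃ N : MM n, N.PosDef ∧ N.det = 1 ∧ ∃ F ≥ (0:ℝ), ∃ ρ' ≥ (1:ℝ), ∀ x, ρ' ≤ ‖x‖ → ∀ v, |⟪TM (A x) v, v⟫ - ⟪TM N v, v⟫| ≤ F * ‖x‖ ^ (-μ) * ‖v‖ ^ 2 := by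
  have hL : 0 < Lam := hl.trans_le ((h.lo 0).trans (h.hi 0))
  have hn' : (1:ℝ) ≤ n := by exact_mod_cast hn
  obtain ⟨C2, C21, e2, e20, Ce2, hf⟩ := far2 (n := n) hn hL.le hl hM0
  have lim : ∀ μ > (0:ℝ), ∀ s > (0:ℝ), ∃ T ≥ (1:ℝ), ∀ t ≥ T, t ^ (-μ) ≤ s := fun μ h0 s s0 => by
    obtain ⟨T, hT⟩ := eventually_atTop.1 ((tendsto_rpow_neg_atTop h0).eventually (ge_mem_nhds s0))
    exact ⟨max 1 T, le_max_left _ _, fun t ht => hT t ((le_max_right _ _).trans ht)⟩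
  obtain ⟨T, T1, hT⟩ := lim (1/2) (by norm_num) (e2 / 2) (by positivity)
  obtain ⟨c, c0, C, C0, hcomp⟩ := comp h (show 0 < T by linarith only [T1])
  have hq : ∀ m : ℕ, ∃ R' ≥ (m + 1 : ℝ), ∃ A' : MM n, A'.PosDef ∧ A'.det = 1 ∧ Fl u A' 0 R' (1 / (m + 1)) := fun m =>
    qflat hn hl h hM0 (by norm_num) (by linarith only [hn']) hM (by positivity) (by positivity)
  choose Rm hRm Bm pB dB flB using hq
  have ex : ∀ T : ℝ, ∃ m0 : ℕ, ∀ m ≥ m0, T ≤ m + 1 := fun T => ⟨⌈T⌉₊, fun m hm => by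
    have h1 : (⌈T⌉₊ : ℝ) ≤ m := by exact_mod_cast hm
    linarith only [h1, Nat.le_ceil T]⟩
  have ex2 : ∀ s > (0:ℝ), ∃ m0 : ℕ, ∀ m ≥ m0, 1 / ((m:ℝ) + 1) ≤ s := fun s s0 => by
    obtain ⟨m0, h0⟩ := ex (1 / s)
    refine ⟨m0, fun m hm => ?_⟩
    have := h0 m hm
    rw [div_le_iff₀ s0] at this
    rw [div_le_iff₀ (by positivity)]; linarith only [this]
  obtain ⟨m1, hm1⟩ := ex T
  obtain ⟨m2, hm2⟩ := ex2 (e2 / 2) (by positivity)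
  have bq : ∀ m ≥ max m1 m2, BQ (Bm m) (c / 2) (2 * C) := fun m hm v => by
    have a1 := hm1 m (le_of_max_le_left hm)
    have a2 := hm2 m (le_of_max_le_right hm)
    have a3 := hT T le_rfl
    obtain ⟨B', q1, q2, q3, q4⟩ := hf u G A (Bm m) (Rm m) (1 / (m + 1)) h hM (pB m) (dB m) (by linarith only [hRm m]) (by positivity) (flB m) T (by linarith only [T1]) (a1.trans (hRm m)) (by linarith only [a2, a3])
    have le : C2 * (1 / (m + 1) + T ^ (-(1/2):ℝ)) ≤ 1 / 8 := (mul_le_mul_of_nonneg_left (by linarith only [a2, a3]) (by linarith only [C21])).trans Ce2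
    have b1 := hcomp B' q1 (q4.mono le) v
    have b2 := q3.two (pB m) (le.trans (by norm_num)) v
    constructor <;> linarith only [b1, b2]
  obtain ⟨s, s0, K, K1, F, F0, hfp⟩ := far_pt hn hl h hM0 hM hα0 hα1 hD hμ hdk (show 0 < c / 2 by positivity) (show 0 < 2 * C by positivity)
  obtain ⟨T', T1', hT'⟩ := lim μ hμ0 (s / 2) (by positivity)
  obtain ⟨m3, hm3⟩ := ex2 (s / 2) (by positivity)
  obtain ⟨S, hS⟩ : ∃ S, S = Set.pi univ fun _ : Fin n => Set.pi univ fun _ : Fin n => Icc (-(6 * C)) (6 * C) := ⟨_, rfl⟩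
  have cS : IsCompact S := by rw [hS]; exact isCompact_univ_pi fun _ => isCompact_univ_pi fun _ => isCompact_Icc
  obtain ⟨m4, h4⟩ : ∃ m4, m4 = max m1 m2 := ⟨_, rfl⟩
  rw [← h4] at bq
  have inS : ∀ k, (fun i j => Bm (k + m4) i j) ∈ S := fun k => by
    rw [hS]
    intro i _ j _
    have := polar (B := Bm (k + m4)) (N := 0) (pd_symm (pB _)) transpose_zero (show 0 ≤ 2 * C by positivity) (fun v => by
      have := bq (k + m4) (by omega) v
      rw [TM_zero, inner_zero_left, sub_zero, abs_of_nonneg (le_trans (by positivity) this.1)]; exact this.2) i j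
    rw [Matrix.zero_apply, sub_zero, abs_le] at this
    constructor <;> linarith only [this]
  obtain ⟨N, -, φ, hφ, hN⟩ := cS.tendsto_subseq inS
  have hN' : Tendsto (fun k => Bm (φ k + m4)) atTop (𝓝 (Matrix.of N)) := hN
  have hq := fun v => quad_lim hN' v
  have hdet : (Matrix.of N).det = 1 := by
    have : Tendsto (fun k => (Bm (φ k + m4)).det) atTop (𝓝 (Matrix.of N).det) := ((continuous_id.matrix_det).tendsto _).comp hN'
    refine tendsto_nhds_unique this ?_
    simp only [dB]; exact tendsto_const_nhds
  have hsym : (Matrix.of N)ᵀ = Matrix.of N := by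
    have : Tendsto (fun k => (Bm (φ k + m4))ᵀ) atTop (𝓝 (Matrix.of N)ᵀ) := ((continuous_id.matrix_transpose).tendsto _).comp hN'
    refine tendsto_nhds_unique this ?_
    simp only [pd_symm (pB _)]; exact hN'
  refine ⟨Matrix.of N, pd_of hsym fun x hx => ?_, hdet, F, F0, max T' ρ, le_trans T1' (le_max_left _ _), fun x hx v => ?_⟩
  · have hh : c / 2 * ‖x‖ ^ 2 ≤ ⟪TM (Matrix.of N) x, x⟫ := ge_of_tendsto' (hq x) fun k => (bq _ (by omega) x).1
    have := norm_pos_iff.2 hx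
    exact lt_of_lt_of_le (by positivity) hh
  · have hxT := hT' ‖x‖ ((le_max_left _ _).trans hx)
    obtain ⟨m5, hm5⟩ := ex (K * ‖x‖)
    have l1 : Tendsto (fun k => |⟪TM (A x) v, v⟫ - ⟪TM (Bm (φ k + m4)) v, v⟫|) atTop (𝓝 |⟪TM (A x) v, v⟫ - ⟪TM (Matrix.of N) v, v⟫|) := (tendsto_const_nhds.sub (hq v)).abs
    have l3 : Tendsto (fun k => φ k + m4) atTop atTop := (tendsto_add_atTop_nat m4).comp hφ.tendsto_atTop
    have l2 : Tendsto (fun k => F * (1 / (((φ k + m4 : ℕ) : ℝ) + 1) + ‖x‖ ^ (-μ)) * ‖v‖ ^ 2) atTop (𝓝 (F * (0 + ‖x‖ ^ (-μ)) * ‖v‖ ^ 2)) :=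
      ((((tendsto_one_div_add_atTop_nhds_zero_nat (𝕜 := ℝ)).comp l3).add tendsto_const_nhds).const_mul F).mul_const _
    rw [zero_add] at l2
    refine le_of_tendsto_of_tendsto l1 l2 ?_
    filter_upwards [l3.eventually_ge_atTop (max m3 m5)] with k hk
    have b3 := hm3 _ (le_of_max_le_left hk)
    have b5 := hm5 _ (le_of_max_le_right hk)
    exact hfp _ _ _ (pB _) (dB _) (bq _ (by omega)) (by linarith only [hRm (φ k + m4), (Nat.cast_nonneg (φ k + m4) : (0:ℝ) ≤ _)]) (by positivity) (flB _) x (T1'.trans ((le_max_left _ _).trans hx)) ((le_max_right _ _).trans hx) (b5.trans (hRm _)) (by linarith only [hxT, b3]) v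

end far


section hol
variable {n : ℕ} {lam Lam d σ ε η η' R r β θ ε0 α H D μ ρ L : ℝ} {u g : EE n → ℝ} {G : EE n → EE n} {A : EE n → MM n} {B B' B'' N : MM n} {x0 y : EE n}

lemma limr : ∀ μ > (0:ℝ), ∀ s > (0:ℝ), ∃ T ≥ (1:ℝ), ∀ t ≥ T, t ^ (-μ) ≤ s := fun μ h0 s s0 => by
  obtain ⟨T, hT⟩ := eventually_atTop.1 ((tendsto_rpow_neg_atTop h0).eventually (ge_mem_nhds s0))
  exact ⟨max 1 T, le_max_left _ _, fun t ht => hT t ((le_max_right _ _).trans ht)⟩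

lemma limz (hα : 0 < α) (L : ℝ) {s : ℝ} (hs : 0 < s) : ∃ T > 0, ∀ t, 0 ≤ t → t ≤ T → L * t ^ α ≤ s := by
  have h1 : Tendsto (fun t : ℝ => L * t ^ α) (𝓝 0) (𝓝 (L * 0 ^ α)) := ((Real.continuousAt_rpow_const 0 α (Or.inr hα.le)).tendsto).const_mul _
  rw [Real.zero_rpow hα.ne', mul_zero] at h1
  obtain ⟨r, hr, hb⟩ := Metric.eventually_nhds_iff.1 (h1.eventually (gt_mem_nhds hs))
  refine ⟨r / 2, by positivity, fun t h0 h1 => (hb ?_).le⟩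
  rw [Real.dist_eq, sub_zero, abs_of_nonneg h0]; linarith

lemma MAS.entc (h : MAS u G A) (i j : Fin n) : Continuous fun x => A x i j := (continuous_apply j).comp ((continuous_apply i).comp h.cA)

lemma unif (h : MAS u G A) (hN : N.PosDef) {F : ℝ} (hF : 0 ≤ F) (hμ : 0 < μ) (hρ : 1 ≤ ρ)
    (hfar : ∀ x, ρ ≤ ‖x‖ → ∀ v, |⟪TM (A x) v, v⟫ - ⟪TM N v, v⟫| ≤ F * ‖x‖ ^ (-μ) * ‖v‖ ^ 2) :
    (∃ C > 0, ∀ x i j, |A x i j - N i j| ≤ C) ∧ (∃ c > 0, ∀ x v, c * ‖v‖ ^ 2 ≤ ⟪TM (A x) v, v⟫) ∧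
    ∀ η > 0, ∃ r > 0, ∀ x y, ‖y - x‖ ≤ r → ∀ i j, |A y i j - A x i j| ≤ η := by
  have hent : ∀ x, ρ ≤ ‖x‖ → ∀ i j, |A x i j - N i j| ≤ 3 * (F * ‖x‖ ^ (-μ)) := fun x hx i j =>
    polar (pd_symm (h.pA x)) (pd_symm hN) (by positivity) (hfar x hx) i j
  have hlim : ∀ i j, Tendsto (fun x => A x i j) (cocompact (EE n)) (𝓝 (N i j)) := fun i j => by
    rw [tendsto_iff_norm_sub_tendsto_zero]
    have l1 : Tendsto (fun x : EE n => 3 * (F * ‖x‖ ^ (-μ))) (cocompact (EE n)) (𝓝 (3 * (F * 0))) :=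
      (((tendsto_rpow_neg_atTop hμ).comp tendsto_norm_cocompact_atTop).const_mul F).const_mul 3
    rw [mul_zero, mul_zero] at l1
    refine tendsto_of_tendsto_of_tendsto_of_le_of_le' tendsto_const_nhds l1 (Eventually.of_forall fun x => norm_nonneg _) ?_
    filter_upwards [tendsto_norm_cocompact_atTop.eventually_ge_atTop ρ] with x hx
    exact hent x hx i j
  refine ⟨?_, ?_, fun η η0 => ?_⟩
  · have hb : ∀ p : Fin n × Fin n, ∃ C, ∀ x ∈ closedBall (0 : EE n) ρ, ‖A x p.1 p.2 - N p.1 p.2‖ ≤ C := fun p =>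
      (isCompact_closedBall 0 ρ).exists_bound_of_continuousOn ((h.entc p.1 p.2).sub continuous_const).continuousOn
    choose Cb hCb using hb
    have Cb0 : ∀ p, 0 ≤ Cb p := fun p => (norm_nonneg _).trans (hCb p 0 (by simp; linarith))
    have S0 : 0 ≤ ∑ p, Cb p := Finset.sum_nonneg fun p _ => Cb0 p
    refine ⟨3 * F + 1 + ∑ p, Cb p, by positivity, fun x i j => ?_⟩
    rcases le_or_gt ρ ‖x‖ with hx | hx
    · have : F * ‖x‖ ^ (-μ) ≤ F := mul_le_of_le_one_right hF (Real.rpow_le_one_of_one_le_of_nonpos (by linarith) (by linarith))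
      linarith [hent x hx i j]
    · have := hCb (i, j) x (by simpa using hx.le)
      have h2 := Finset.single_le_sum (fun p _ => Cb0 p) (Finset.mem_univ (i, j))
      rw [Real.norm_eq_abs] at this
      linarith
  · have tN : 0 < N⁻¹.trace + 1 := by
      have : 0 ≤ N⁻¹.trace := hN.inv.posSemidef.trace_nonneg
      linarith
    obtain ⟨T, T1, hT⟩ := limr μ hμ (1 / (2 * (N⁻¹.trace + 1)) / (F + 1)) (by positivity)
    obtain ⟨c, c0, hc⟩ := h.lower (isCompact_closedBall 0 (max T ρ))
    refine ⟨min c (1 / (2 * (N⁻¹.trace + 1))), by positivity, fun x v => ?_⟩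
    rcases le_or_gt (max T ρ) ‖x‖ with hx | hx
    · have a1 := hfar x ((le_max_right _ _).trans hx) v
      have a2 := hT _ ((le_max_left _ _).trans hx)
      rw [le_div_iff₀ (by positivity)] at a2
      have p0 : 0 ≤ ‖x‖ ^ (-μ) := by positivity
      have a3 : F * ‖x‖ ^ (-μ) * ‖v‖ ^ 2 ≤ 1 / (2 * (N⁻¹.trace + 1)) * ‖v‖ ^ 2 := mul_le_mul_of_nonneg_right (by linarith) (sq_nonneg _)
      have a4 : 2 * (1 / (2 * (N⁻¹.trace + 1))) * ‖v‖ ^ 2 ≤ ⟪TM N v, v⟫ := by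
        have := pd_lower hN v
        have q := psd_nonneg hN.posSemidef v
        rw [← mul_div_assoc, div_mul_eq_mul_div, div_le_iff₀ (by positivity)]
        linarith only [this, q]
      have a5 := mul_le_mul_of_nonneg_right (min_le_right c (1 / (2 * (N⁻¹.trace + 1)))) (sq_nonneg ‖v‖)
      rw [abs_le] at a1
      linarith
    · exact (mul_le_mul_of_nonneg_right (min_le_left _ _) (sq_nonneg _)).trans (hc x (by simpa using hx.le) v)
  · have h1 : ∀ p : Fin n × Fin n, ∃ r > 0, ∀ x y, ‖y - x‖ < r → |A y p.1 p.2 - A x p.1 p.2| ≤ η := fun p => by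
      obtain ⟨r, r0, hr⟩ := Metric.uniformContinuous_iff.1 ((h.entc p.1 p.2).uniformContinuous_of_tendsto_cocompact (hlim p.1 p.2)) η η0
      exact ⟨r, r0, fun x y hxy => (hr (a := y) (b := x) (by rwa [dist_eq_norm])).le⟩
    choose rp rp0 hrp using h1
    rcases isEmpty_or_nonempty (Fin n × Fin n) with he | he
    · exact ⟨1, one_pos, fun x y _ i j => (he.false (i, j)).elim⟩
    obtain ⟨p0, hp0⟩ := Finite.exists_min rp
    exact ⟨rp p0 / 2, by linarith [rp0 p0], fun x y hxy i j => hrp (i, j) x y (by linarith [hp0 (i, j), rp0 p0])⟩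

lemma qsq {c t s : ℝ} (hc : 0 < c) (ht : 0 ≤ t) (h : c * s ^ 2 ≤ t ^ 2) : s ≤ t / √c := by
  rw [le_div_iff₀ (by positivity)]
  refine le_of_sq_le_sq ?_ ht
  rw [mul_pow, Real.sq_sqrt hc.le]; linarith

set_option maxHeartbeats 1000000 in
lemma hold1 (hn : 1 ≤ n) (hl : 0 < lam) (hL0 : 0 ≤ Lam) (h : EL lam Lam u G A) (hα0 : 0 < α) (hα1 : α < 1) {c : ℝ} (hc : 0 < c) (hlo : ∀ x v, c * ‖v‖ ^ 2 ≤ ⟪TM (A x) v, v⟫)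
    (hu : ∀ η > 0, ∃ r > 0, ∀ x y, ‖y - x‖ ≤ r → ∀ i j, |A y i j - A x i j| ≤ η) (hL : 0 ≤ L) (hg : ∀ x y, ‖y - x‖ ≤ 1 → |(A y).det / (A x).det - 1| ≤ L * ‖y - x‖ ^ α) :
    ∃ E > 0, ∃ T > 0, ∀ x r, 0 < r → r ≤ T → Fl u (A x) x r (E * r ^ α) := by
  have hn' : (0:ℝ) < n := by exact_mod_cast hn
  obtain ⟨C2, C21, c2, c20, e2, e20, hp⟩ := point2 (n := n) hn hL0 hl hα0 hα1
  obtain ⟨ε, hε⟩ : ∃ ε, ε = e2 / 2 := ⟨_, rfl⟩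
  have ε0 : 0 < ε := by linarith
  obtain ⟨r1, r10, hr1⟩ := hu (c * ε / n ^ 2) (by positivity)
  obtain ⟨r2, r20, hr2⟩ := limz hα0 L ε0
  obtain ⟨t, ht⟩ : ∃ t, t = min 1 (min r1 r2) := ⟨_, rfl⟩
  have t0 : 0 < t := by rw [ht]; positivity
  have t1 : t ≤ 1 := by rw [ht]; exact min_le_left _ _
  have t2 : t ≤ r1 := by rw [ht]; exact (min_le_right _ _).trans (min_le_left _ _)
  have t3 : t ≤ r2 := by rw [ht]; exact (min_le_right _ _).trans (min_le_right _ _)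
  obtain ⟨R, hR⟩ : ∃ R, R = t * √c / 2 := ⟨_, rfl⟩
  have sc : 0 < √c := by positivity
  have R0 : 0 < R := by rw [hR]; positivity
  have hRt : 2 * R / √c = t := by rw [hR]; field_simp
  refine ⟨C2 * e2 / R ^ α, by positivity, c2 * R, by positivity, fun x r r0 rT => ?_⟩
  have fl : Fl u (A x) x R ε := by
    refine ⟨G x, u x - ⟪G x, x⟫, fun z hz => ?_⟩
    have a1 : ‖z - x‖ ≤ t := by
      have := qsq hc R0.le ((hlo x (z - x)).trans hz)
      have b : R / √c ≤ 2 * R / √c := div_le_div_of_nonneg_right (by linarith only [R0]) sc.le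
      linarith
    have a2 := h.m.tayl (D := A x) (η := c * ε) (r := t) (fun y hy v => by
      have := quad_diff (fun i j => hr1 x y (hy.trans t2) i j) v
      rwa [mul_div_cancel₀ _ (by positivity)] at this) a1
    have a3 := (hlo x (z - x)).trans hz
    have a4 := mul_le_mul_of_nonneg_left a3 ε0.le
    have e : u z - (u x - ⟪G x, x⟫) - ⟪G x, z⟫ - ⟪TM (A x) (z - x), z - x⟫ / 2 = u z - u x - ⟪G x, z - x⟫ - ⟪TM (A x) (z - x), z - x⟫ / 2 := by rw [inner_sub_right (G x)]; ring
    rw [e]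
    have : 0 ≤ ε * R ^ 2 := by positivity
    linarith only [a2, a4, this]
  have := hp u G A (A x) x R ε (L * t ^ α) h ⟨h.m.pA x, rfl, R0, ε0, by positivity, fl, fun s s0 s1 z hz => ?_⟩ (by linarith [hr2 t t0.le t3]) r r0 rT
  · refine this.mono ?_
    rw [Real.div_rpow r0.le R0.le]
    have b : C2 * (ε + L * t ^ α) ≤ C2 * e2 := mul_le_mul_of_nonneg_left (by linarith only [hε, hr2 t t0.le t3]) (by linarith)
    calc _ ≤ C2 * e2 * (r ^ α / R ^ α) := mul_le_mul_of_nonneg_right b (by positivity)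
      _ = _ := by ring
  · have a1 := qsq (t := s * (2 * R)) hc (by positivity) ((hlo x (z - x)).trans (hz.trans (le_of_eq (by ring))))
    rw [mul_div_assoc, hRt] at a1
    refine (hg x z (a1.trans (by nlinarith))).trans ?_
    calc L * ‖z - x‖ ^ α ≤ L * (s * t) ^ α := mul_le_mul_of_nonneg_left (Real.rpow_le_rpow (norm_nonneg _) a1 hα0.le) hL
      _ = _ := by rw [Real.mul_rpow s0.le t0.le]; ring

set_option maxHeartbeats 1000000 in
lemma hold2 (hn : 1 ≤ n) (hl : 0 < lam) (hL0 : 0 ≤ Lam) (h : EL lam Lam u G A) (hα0 : 0 < α) (hα1 : α < 1) {c C : ℝ} (hc : 0 < c) (hlo : ∀ x v, c * ‖v‖ ^ 2 ≤ ⟪TM (A x) v, v⟫)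
    (hC : 0 < C) (hhi : ∀ x v, ⟪TM (A x) v, v⟫ ≤ C * ‖v‖ ^ 2)
    (hu : ∀ η > 0, ∃ r > 0, ∀ x y, ‖y - x‖ ≤ r → ∀ i j, |A y i j - A x i j| ≤ η) (hL : 0 ≤ L) (hg : ∀ x y, ‖y - x‖ ≤ 1 → |(A y).det / (A x).det - 1| ≤ L * ‖y - x‖ ^ α) :
    ∃ E > 0, ∃ T > 0, ∀ x y, ‖y - x‖ ≤ T → ∀ v, |⟪TM (A y) v, v⟫ - ⟪TM (A x) v, v⟫| ≤ E * ‖y - x‖ ^ α * ‖v‖ ^ 2 := by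
  obtain ⟨E, E0, T, T0, hF⟩ := hold1 hn hl hL0 h hα0 hα1 hc hlo hu hL hg
  obtain ⟨C3, C31, e3, e30, Ce3, hp⟩ := point3 (n := n) hn hL0 hl hα0 hα1
  obtain ⟨K, hK1, hK2⟩ : ∃ K ≥ (1:ℝ), 4 * C ≤ K ^ 2 := ⟨4 * C + 1, by linarith only [hC], by linarith only [hC, sq_nonneg C]⟩
  have sc : 0 < √c := by positivity
  have K0 : 0 < K := by linarith
  obtain ⟨E', hE'⟩ : ∃ E', E' = E * K ^ α + L * (K / √c) ^ α + L := ⟨_, rfl⟩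
  have E'0 : 0 < E' := by rw [hE']; positivity
  obtain ⟨r2, r20, hr2⟩ := limz hα0 E' e30
  refine ⟨C3 * E' * C, by positivity, min (min 1 r2) (min (T / K) (√c / K)), by positivity, fun x y hxy v => ?_⟩
  rcases eq_or_ne y x with rfl | hne
  · rw [sub_self, sub_self, abs_zero]; positivity
  obtain ⟨q, hq⟩ : ∃ q, q = ‖y - x‖ := ⟨_, rfl⟩
  have q0 : 0 < q := by rw [hq]; exact norm_pos_iff.2 (sub_ne_zero.2 hne)
  rw [← hq] at hxy ⊢
  have b1 := hxy.trans ((min_le_left _ _).trans (min_le_left _ _))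
  have b2 := hxy.trans ((min_le_left _ _).trans (min_le_right _ _))
  have b3 := hxy.trans ((min_le_right _ _).trans (min_le_left _ _))
  have b4 := hxy.trans ((min_le_right _ _).trans (min_le_right _ _))
  rw [le_div_iff₀ K0] at b3 b4
  have r0 : 0 < K * q := by positivity
  have hs : E * (K * q) ^ α + L * (K * q / √c) ^ α + L * q ^ α = E' * q ^ α := by
    rw [hE', mul_div_right_comm, Real.mul_rpow K0.le q0.le, Real.mul_rpow (by positivity) q0.le]; ring
  have := hp u G A (A x) x y (K * q) (E * (K * q) ^ α) (L * (K * q / √c) ^ α) (L * q ^ α) h (h.m.pA x) r0 (by positivity) (by positivity) (hF x _ r0 (by linarith only [b3]))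
    (by
      refine (hhi x (y - x)).trans ?_
      rw [← hq, mul_pow]
      have := mul_le_mul_of_nonneg_right hK2 (sq_nonneg q)
      linarith only [this])
    (fun t t0 t1 z hz => by
      have a1 := qsq (t := t * (K * q)) hc (by positivity) ((hlo x (z - y)).trans (hz.trans (le_of_eq (by ring))))
      have a2 : K * q / √c ≤ 1 := by rw [div_le_one sc]; linarith only [b4]
      rw [mul_div_assoc] at a1
      refine (hg y z (a1.trans (mul_le_one₀ t1 (by positivity) a2))).trans ?_
      calc L * ‖z - y‖ ^ α ≤ L * (t * (K * q / √c)) ^ α := mul_le_mul_of_nonneg_left (Real.rpow_le_rpow (norm_nonneg _) a1 hα0.le) hL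
        _ = _ := by rw [Real.mul_rpow t0.le (by positivity)]; ring)
    (by have := hg x y (by linarith only [hq, b1]); rwa [← hq] at this) (by rw [hs]; exact hr2 q q0.le b2) v
  refine this.trans ?_
  rw [hs]
  calc _ ≤ C3 * (E' * q ^ α) * (C * ‖v‖ ^ 2) := mul_le_mul_of_nonneg_left (hhi x v) (by positivity)
    _ = _ := by ring

end hol


section fin
variable {n : ℕ} {lam Lam α D μ ρ L M : ℝ} {u f : EE n → ℝ} {G : EE n → EE n} {A : EE n → MM n}

lemma core (hn : 1 ≤ n) (hl : 0 < lam) (h : MZ lam Lam u G A) (hM0 : 0 ≤ M) (hM : HM M (1/2) fun x => (A x).det)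
    (hα0 : 0 < α) (hα1 : α < 1) (hD : 0 ≤ D) (hμ0 : 0 < μ) (hμ : μ ≤ 1/2) (hdk : DK (fun x => (A x).det) D μ α ρ)
    (hL : 0 ≤ L) (hg : ∀ x y, ‖y - x‖ ≤ 1 → |(A y).det / (A x).det - 1| ≤ L * ‖y - x‖ ^ α) :
    ∃ N : MM n, N.PosDef ∧ N.det = 1 ∧ ∃ C > 0, (∀ x i j, |A x i j| ≤ C) ∧ (∀ x y i j, |A x i j - A y i j| ≤ C * ‖x - y‖ ^ α) ∧
      ∀ x, 1 ≤ ‖x‖ → ∀ i j, |A x i j - N i j| ≤ C * ‖x‖ ^ (-μ) := by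
  obtain ⟨N, hN, hNd, F, F0, ρ', hρ', hfar⟩ := far3 hn hl h hM0 hM hα0 hα1 hD hμ0 hμ hdk
  obtain ⟨⟨C1, C10, hC1⟩, ⟨c, c0, hc⟩, hmod⟩ := unif h.toMAS hN F0 hμ0 hρ' hfar
  have hLam : 0 < Lam := hl.trans_le ((h.lo 0).trans (h.hi 0))
  obtain ⟨b, b0, hb⟩ : ∃ b > 0, ∀ i j, |N i j| ≤ b := by
    refine ⟨(∑ i, ∑ j, |N i j|) + 1, by positivity, fun i j => ?_⟩
    have h1 := Finset.single_le_sum (f := fun j => |N i j|) (fun j _ => abs_nonneg _) (Finset.mem_univ j)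
    have h2 := Finset.single_le_sum (f := fun i => ∑ j, |N i j|) (fun i _ => Finset.sum_nonneg fun j _ => abs_nonneg _) (Finset.mem_univ i)
    linarith
  have hbd : ∀ x i j, |A x i j| ≤ C1 + b := fun x i j => by
    have := abs_add_le (A x i j - N i j) (N i j); rw [sub_add_cancel] at this
    linarith [hC1 x i j, hb i j]
  have hhi : ∀ x v, ⟪TM (A x) v, v⟫ ≤ (n ^ 2 * (C1 + b)) * ‖v‖ ^ 2 := fun x v => (le_abs_self _).trans (quad_bd (hbd x) v)
  have n0 : (0:ℝ) < n := by exact_mod_cast hn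
  obtain ⟨E, E0, T, T0, hE⟩ := hold2 hn (div_pos hl hLam) (div_pos hLam hl).le (h.el hl) hα0 hα1 c0 hc (by positivity) hhi hmod hL hg
  have hT : 0 < T ^ (-α) := Real.rpow_pos_of_pos T0 _
  have hP : 0 < ρ' ^ μ := Real.rpow_pos_of_pos (by linarith) _
  refine ⟨N, hN, hNd, (C1 + b) + 3 * E + 2 * (C1 + b) * T ^ (-α) + 3 * F + C1 * ρ' ^ μ, by positivity, fun x i j => ?_, fun x y i j => ?_, fun x hx i j => ?_⟩
  · refine (hbd x i j).trans ?_
    have : 0 ≤ 3 * E + 2 * (C1 + b) * T ^ (-α) + 3 * F + C1 * ρ' ^ μ := by positivity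
    linarith
  · have hz : 0 ≤ ‖x - y‖ ^ α := by positivity
    rcases le_or_gt ‖x - y‖ T with hle | hgt
    · have := polar (pd_symm (h.pA x)) (pd_symm (h.pA y)) (by positivity) (hE y x hle) i j
      have h2 : 0 ≤ ((C1 + b) + 2 * (C1 + b) * T ^ (-α) + 3 * F + C1 * ρ' ^ μ) * ‖x - y‖ ^ α := by positivity
      linarith
    · have h1 : |A x i j - A y i j| ≤ 2 * (C1 + b) := by
        have := abs_sub (A x i j) (A y i j); linarith [hbd x i j, hbd y i j]
      have h3 : 1 ≤ T ^ (-α) * ‖x - y‖ ^ α := by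
        rw [Real.rpow_neg T0.le, ← div_eq_inv_mul, one_le_div (Real.rpow_pos_of_pos T0 _)]
        exact Real.rpow_le_rpow T0.le hgt.le hα0.le
      have h4 := mul_le_mul_of_nonneg_left h3 (by positivity : 0 ≤ 2 * (C1 + b))
      have h2 : 0 ≤ ((C1 + b) + 3 * E + 3 * F + C1 * ρ' ^ μ) * ‖x - y‖ ^ α := by positivity
      linarith
  · have hz : 0 ≤ ‖x‖ ^ (-μ) := by positivity
    rcases le_or_gt ρ' ‖x‖ with hle | hgt
    · have := polar (pd_symm (h.pA x)) (pd_symm hN) (by positivity) (hfar x hle) i j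
      have h2 : 0 ≤ ((C1 + b) + 3 * E + 2 * (C1 + b) * T ^ (-α) + C1 * ρ' ^ μ) * ‖x‖ ^ (-μ) := by positivity
      linarith
    · have x0 : 0 < ‖x‖ := by linarith
      have h3 : 1 ≤ ρ' ^ μ * ‖x‖ ^ (-μ) := by
        rw [Real.rpow_neg x0.le, ← div_eq_mul_inv, one_le_div (Real.rpow_pos_of_pos x0 _)]
        exact Real.rpow_le_rpow x0.le hgt.le hμ0.le
      have h4 := mul_le_mul_of_nonneg_left h3 C10.le
      have h2 : 0 ≤ ((C1 + b) + 3 * E + 2 * (C1 + b) * T ^ (-α) + 3 * F) * ‖x‖ ^ (-μ) := by positivity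
      linarith [hC1 x i j]

lemma mas_of (hu : ContDiff ℝ 2 u) (hconv : ∀ x, (hess u x).PosDef) : ∃ G, MAS u G (hess u) := by
  have h1 : ContDiff ℝ 1 (fderiv ℝ u) := hu.fderiv_right (by norm_num)
  have hh : ∀ x i j, hess u x i j = fderiv ℝ (fderiv ℝ u) x (EuclideanSpace.single i 1) (EuclideanSpace.single j 1) := fun x i j => by
    simp [hess, iteratedFDeriv_two_apply]
  refine ⟨fun x => WithLp.toLp 2 fun i => fderiv ℝ u x (EuclideanSpace.single i 1), ?_, ?_, ?_, hconv⟩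
  · refine HG.of (fun x => (hu.differentiable (by norm_num) x).hasFDerivAt) fun x y => ?_
    conv_lhs => rw [← (EuclideanSpace.basisFun (Fin n) ℝ).sum_repr y]
    rw [inner_vec]
    simp [dotProduct, map_sum, mul_comm]
  · intro x
    rw [← hasFDerivWithinAt_univ, hasFDerivWithinAt_euclidean]
    intro i
    rw [hasFDerivWithinAt_univ]
    have h2 := ((h1.differentiable (by norm_num) x).hasFDerivAt).clm_apply (hasFDerivAt_const (EuclideanSpace.single i (1:ℝ)) x)
    refine h2.congr_fderiv ?_
    ext1 y
    have hs : ∀ j, hess u x i j = hess u x j i := fun j => by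
      conv_lhs => rw [← pd_symm (hconv x)]
      rfl
    have : (TM (hess u x) y).ofLp i = ∑ j, hess u x j i * y j := by
      rw [TM_ofLp]; simp only [mulVec, dotProduct, hs]
    simp only [ContinuousLinearMap.comp_apply, PiLp.proj_apply]
    rw [this]
    conv_lhs => rw [← (EuclideanSpace.basisFun (Fin n) ℝ).sum_repr y]
    simp [map_sum, hh, mul_comm]
  · refine continuous_matrix fun i j => ?_
    simp only [hh]
    have := h1.continuous_fderiv (by norm_num)
    exact (this.clm_apply continuous_const).clm_apply continuous_const

lemma exp_bd {s m : ℝ} (h : |s| ≤ m) : |Real.exp s - 1| ≤ |s| * Real.exp m := by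
  have e1 : 1 ≤ Real.exp m := Real.one_le_exp ((abs_nonneg _).trans h)
  rcases le_total 0 s with h0 | h0
  · rw [abs_of_nonneg h0] at h ⊢
    rw [abs_of_nonneg (by linarith [Real.one_le_exp h0])]
    have h2 := Real.add_one_le_exp (-s)
    have h3 : Real.exp (-s) * Real.exp s = 1 := by rw [← Real.exp_add]; simp
    have h4 := mul_le_mul_of_nonneg_right h2 (Real.exp_pos s).le
    have h5 := mul_le_mul_of_nonneg_left (Real.exp_le_exp.2 h) h0
    linarith
  · rw [abs_of_nonpos h0] at h ⊢
    rw [abs_of_nonpos (by linarith [Real.exp_le_one_iff.2 h0])]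
    have h5 := mul_le_mul_of_nonneg_left e1 (neg_nonneg.2 h0)
    linarith [Real.add_one_le_exp s]

lemma hm_of (hn : 1 ≤ n) {g : EE n → ℝ} {D ζ : ℝ} (hD : 0 ≤ D) (hζ : 1 < ζ) (hg : Continuous g) (h : ∀ x, |g x - 1| ≤ D * (1 + ‖x‖) ^ (-ζ)) :
    ∃ M ≥ 0, HM M (1/2) g := by
  have n0 : (1:ℝ) ≤ n := by exact_mod_cast hn
  have hp : (1:ℝ) < 2 * n := by linarith
  have hpq := Real.HolderConjugate.conjExponent hp
  obtain ⟨q, hq⟩ : ∃ q, q = Real.conjExponent (2 * n) := ⟨_, rfl⟩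
  rw [← hq] at hpq
  have hint : Integrable (fun x : EE n => |g x - 1| ^ (2 * (n:ℝ))) := by
    have h1 : Integrable (fun x : EE n => D ^ (2 * (n:ℝ)) * (1 + ‖x‖) ^ (-(ζ * (2 * n)))) := by
      refine (integrable_one_add_norm (E := EE n) (μ := volume) ?_).const_mul _
      rw [finrank_euclideanSpace_fin]
      have := mul_le_mul_of_nonneg_right hζ.le (by linarith : (0:ℝ) ≤ 2 * n)
      linarith
    refine h1.mono' ?_ (Eventually.of_forall fun x => ?_)
    · exact ((hg.sub continuous_const).abs.rpow_const fun _ => Or.inr (by linarith)).aestronglyMeasurable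
    · rw [Real.norm_of_nonneg (by positivity)]
      have h2 := Real.rpow_le_rpow (abs_nonneg _) (h x) (by linarith : (0:ℝ) ≤ 2 * n)
      rwa [Real.mul_rpow hD (by positivity), ← Real.rpow_mul (by positivity), neg_mul] at h2
  refine ⟨(∫ x, |g x - 1| ^ (2 * (n:ℝ))) ^ (1 / (2 * (n:ℝ))), by positivity, fun S hS hv => ?_⟩
  have hfin : IsFiniteMeasure (volume.restrict S) := ⟨by rw [Measure.restrict_apply_univ]; exact hv.lt_top⟩
  have hm1 : MemLp (fun x => |g x - 1|) (ENNReal.ofReal (2 * n)) (volume.restrict S) := by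
    refine (integrable_norm_rpow_iff (hg.sub continuous_const).abs.aestronglyMeasurable (by simp; omega) ENNReal.ofReal_ne_top).1 ?_
    rw [ENNReal.toReal_ofReal (by linarith)]
    simpa using hint.restrict
  have key := integral_mul_le_Lp_mul_Lq_of_nonneg (μ := volume.restrict S) hpq (f := fun x => |g x - 1|) (g := fun _ => (1:ℝ)) (Eventually.of_forall fun x => abs_nonneg _) (Eventually.of_forall fun x => zero_le_one) hm1 (memLp_const 1)
  simp only [mul_one, Real.one_rpow, integral_const, smul_eq_mul] at key
  refine key.trans ?_
  have e1 : 1 / q = 1 - 1 / 2 / (n:ℝ) := by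
    have := hpq.inv_add_inv_eq_one
    rw [one_div]
    have e2 : (1:ℝ) / 2 / n = (2 * (n:ℝ))⁻¹ := by rw [div_div, one_div]
    rw [e2]; linarith
  rw [e1, measureReal_restrict_apply_univ]
  refine mul_le_mul_of_nonneg_right ?_ (by positivity)
  refine Real.rpow_le_rpow (by positivity) (setIntegral_le_integral hint (Eventually.of_forall fun x => by positivity)) (by positivity)

lemma ffacts {ζ ζ' finf : ℝ} (hα0 : 0 < α) (hζ : 1 < ζ)
    (hf_holder : ∀ K : Set (EuclideanSpace ℝ (Fin n)), IsCompact K → ∃ C : ℝ, ∀ x ∈ K, ∀ y ∈ K, |f x - f y| ≤ C * ‖x - y‖ ^ α)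
    (hf_decay : ∃ C R : ℝ, 0 < C ∧ 0 < R ∧ ∀ x : EuclideanSpace ℝ (Fin n), R ≤ ‖x‖ →
      ‖x‖ ^ ζ * |f x - finf| ≤ C ∧
      ∀ y ∈ Metric.closedBall x (‖x‖ / 2), ∀ z ∈ Metric.closedBall x (‖x‖ / 2),
        ‖x‖ ^ (α + ζ') * |f y - f z| ≤ C * ‖y - z‖ ^ α) (hμ0 : 0 < μ) (hμ : μ ≤ 1/2) (hμ' : μ ≤ ζ') :
    (∃ D ≥ 0, ∀ x, |f x - finf| ≤ D * (1 + ‖x‖) ^ (-ζ)) ∧ (∃ L ≥ 0, ∀ x y, ‖y - x‖ ≤ 1 → |f y - f x| ≤ L * ‖y - x‖ ^ α) ∧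
    ∃ C > 0, ∃ ρ, ∀ x, ρ ≤ ‖x‖ → |f x - finf| ≤ C * ‖x‖ ^ (-μ) ∧ ∀ z t, 0 < t → t ≤ 1 → ‖z - x‖ ≤ t * (‖x‖ / 2) → |f z - f x| ≤ C * ‖x‖ ^ (-μ) * t ^ α := by
  obtain ⟨C, R, C0, R0, hd⟩ := hf_decay
  obtain ⟨r, hr⟩ : ∃ r, r = max R 2 := ⟨_, rfl⟩
  have hrR : R ≤ r := hr ▸ le_max_left _ _
  have hr2 : 2 ≤ r := hr ▸ le_max_right _ _
  obtain ⟨C2, hC2⟩ := hf_holder _ (isCompact_closedBall (0 : EE n) (r + 1))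
  have hC2' : ∀ x y, ‖x‖ ≤ r + 1 → ‖y‖ ≤ r + 1 → |f x - f y| ≤ |C2| * ‖x - y‖ ^ α := fun x y hx hy =>
    (hC2 x (by simpa using hx) y (by simpa using hy)).trans (mul_le_mul_of_nonneg_right (le_abs_self _) (by positivity))
  have h1 : ∀ x, r ≤ ‖x‖ → |f x - finf| ≤ C * ‖x‖ ^ (-ζ) := fun x hx => by
    have x0 : 0 < ‖x‖ := by linarith
    have := (hd x (hrR.trans hx)).1
    rw [Real.rpow_neg x0.le, ← div_eq_mul_inv, le_div_iff₀ (Real.rpow_pos_of_pos x0 _)]; linarith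
  have h2 : ∀ x z, r ≤ ‖x‖ → ‖z - x‖ ≤ ‖x‖ / 2 → |f z - f x| ≤ C * (‖z - x‖ ^ α * ‖x‖ ^ (-(α + ζ'))) := fun x z hx hz => by
    have x0 : 0 < ‖x‖ := by linarith
    have := (hd x (hrR.trans hx)).2 z (by rwa [mem_closedBall, dist_eq_norm]) x (mem_closedBall_self (by linarith))
    rw [Real.rpow_neg x0.le, ← mul_assoc, ← div_eq_mul_inv, le_div_iff₀ (Real.rpow_pos_of_pos x0 _)]; linarith
  refine ⟨?_, ?_, C, C0, r, fun x hx => ⟨(h1 x hx).trans ?_, fun z t t0 t1 hz => ?_⟩⟩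
  · obtain ⟨B, hB⟩ : ∃ B, B = |C2| * r ^ α + |f 0 - finf| := ⟨_, rfl⟩
    have B0 : 0 ≤ B := by rw [hB]; positivity
    refine ⟨C * 2 ^ ζ + B * (1 + r) ^ ζ, by positivity, fun x => ?_⟩
    have x0 := norm_nonneg x
    have hz : 0 < (1 + ‖x‖) ^ (-ζ) := by positivity
    rcases le_or_gt r ‖x‖ with hx | hx
    · have h3 : ‖x‖ ^ (-ζ) ≤ 2 ^ ζ * (1 + ‖x‖) ^ (-ζ) := by
        have h4 := Real.rpow_le_rpow_of_nonpos (by linarith) (by linarith : (1 + ‖x‖) / 2 ≤ ‖x‖) (by linarith : -ζ ≤ 0)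
        rwa [Real.div_rpow (by linarith) (by norm_num), Real.rpow_neg (by norm_num : (0:ℝ) ≤ 2), div_inv_eq_mul, mul_comm] at h4
      have h5 := mul_le_mul_of_nonneg_left h3 C0.le
      have h6 : 0 ≤ B * (1 + r) ^ ζ * (1 + ‖x‖) ^ (-ζ) := by positivity
      linarith [h1 x hx]
    · have h3 : 1 ≤ (1 + r) ^ ζ * (1 + ‖x‖) ^ (-ζ) := by
        rw [Real.rpow_neg (by linarith), ← div_eq_mul_inv, one_le_div (by positivity)]
        exact Real.rpow_le_rpow (by linarith) (by linarith) (by linarith)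
      have h5 := mul_le_mul_of_nonneg_left h3 B0
      have h6 : 0 ≤ C * 2 ^ ζ * (1 + ‖x‖) ^ (-ζ) := by positivity
      have h7 := hC2' x 0 (by linarith) (by rw [norm_zero]; linarith)
      rw [sub_zero] at h7
      have h8 := mul_le_mul_of_nonneg_left (Real.rpow_le_rpow x0 hx.le hα0.le) (abs_nonneg C2)
      have h9 := abs_sub_le (f x) (f 0) finf
      linarith
  · refine ⟨C + |C2|, by positivity, fun x y hxy => ?_⟩
    have hz : 0 ≤ ‖y - x‖ ^ α := by positivity
    rcases le_or_gt r ‖x‖ with hx | hx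
    · refine (h2 x y hx (by linarith)).trans ?_
      have h3 : ‖x‖ ^ (-(α + ζ')) ≤ 1 := Real.rpow_le_one_of_one_le_of_nonpos (by linarith) (by linarith)
      have h4 := mul_le_mul_of_nonneg_left (mul_le_mul_of_nonneg_left h3 hz) C0.le
      have := mul_nonneg (abs_nonneg C2) hz
      linarith
    · have h3 := norm_add_le (y - x) x
      rw [sub_add_cancel] at h3
      have := mul_nonneg C0.le hz
      linarith [hC2' y x (by linarith) (by linarith)]
  · exact mul_le_mul_of_nonneg_left (Real.rpow_le_rpow_of_exponent_le (by linarith) (by linarith)) C0.le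
  · have x0 : 0 < ‖x‖ := by linarith
    have h3 : t * (‖x‖ / 2) ≤ ‖x‖ / 2 := by
      have := mul_le_mul_of_nonneg_right t1 (by linarith : 0 ≤ ‖x‖ / 2); linarith
    refine (h2 x z hx (hz.trans h3)).trans ?_
    have h4 : ‖z - x‖ ^ α ≤ t ^ α * ‖x‖ ^ α := by
      rw [← Real.mul_rpow t0.le x0.le]
      refine Real.rpow_le_rpow (norm_nonneg _) (hz.trans ?_) hα0.le
      exact mul_le_mul_of_nonneg_left (by linarith) t0.le
    have h5 : ‖x‖ ^ α * ‖x‖ ^ (-(α + ζ')) ≤ ‖x‖ ^ (-μ) := by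
      rw [← Real.rpow_add x0]
      exact Real.rpow_le_rpow_of_exponent_le (by linarith) (by linarith)
    have h6 := mul_le_mul_of_nonneg_right h4 (by positivity : 0 ≤ ‖x‖ ^ (-(α + ζ')))
    have h7 := mul_le_mul_of_nonneg_left h5 (by positivity : 0 ≤ t ^ α)
    rw [mul_assoc C]
    refine mul_le_mul_of_nonneg_left ?_ C0.le
    linarith

lemma dexp {s s' k m w : ℝ} (hm : |s - s'| ≤ m) (hk : 0 ≤ k) (hw : |s - s'| ≤ w) : |Real.exp (k * (s - s')) - 1| ≤ k * Real.exp (k * m) * w := by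
  have h1 : |k * (s - s')| ≤ k * m := by rw [abs_mul, abs_of_nonneg hk]; exact mul_le_mul_of_nonneg_left hm hk
  refine (exp_bd h1).trans ?_
  rw [abs_mul, abs_of_nonneg hk]
  have := mul_le_mul_of_nonneg_left hw (by positivity : 0 ≤ k * Real.exp (k * m))
  linarith

end fin

theorem hessian_convergence_MongeAmpere
    (n : ℕ) (hn : 3 ≤ n) (α ζ ζ' : ℝ) (hα₀ : 0 < α) (hα₁ : α < 1)
    (hζ : 1 < ζ) (hζ' : 0 < ζ')
    (f : EuclideanSpace ℝ (Fin n) → ℝ) (finf : ℝ)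
    (hf_holder : ∀ K : Set (EuclideanSpace ℝ (Fin n)), IsCompact K →
      ∃ C : ℝ, ∀ x ∈ K, ∀ y ∈ K, |f x - f y| ≤ C * ‖x - y‖ ^ α)
    (hf_lim : Tendsto f (cocompact _) (nhds finf))
    (hf_decay : ∃ C R : ℝ, 0 < C ∧ 0 < R ∧ ∀ x : EuclideanSpace ℝ (Fin n), R ≤ ‖x‖ →
      ‖x‖ ^ ζ * |f x - finf| ≤ C ∧
      ∀ y ∈ Metric.closedBall x (‖x‖ / 2), ∀ z ∈ Metric.closedBall x (‖x‖ / 2),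
        ‖x‖ ^ (α + ζ') * |f y - f z| ≤ C * ‖y - z‖ ^ α)
    (u : EuclideanSpace ℝ (Fin n) → ℝ) (hu : ContDiff ℝ 2 u)
    (hMA : ∀ x, (hess u x).det = Real.exp (n * f x))
    (hconv : ∀ x, (hess u x).PosDef) :
    ∃ (ε C : ℝ) (A : Matrix (Fin n) (Fin n) ℝ),
      0 < ε ∧ 0 < C ∧ A.PosDef ∧ A.det = Real.exp (n * finf) ∧
      (∀ (x : EuclideanSpace ℝ (Fin n)) (i j : Fin n), |hess u x i j| ≤ C) ∧
      (∀ (x y : EuclideanSpace ℝ (Fin n)) (i j : Fin n),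
        |hess u x i j - hess u y i j| ≤ C * ‖x - y‖ ^ α) ∧
      (∀ x : EuclideanSpace ℝ (Fin n), 1 ≤ ‖x‖ → ∀ i j : Fin n,
        |hess u x i j - A i j| ≤ C * ‖x‖ ^ (-ε)) := by
  have n0 : (0:ℝ) ≤ n := Nat.cast_nonneg _
  obtain ⟨μ, hμ⟩ : ∃ μ, μ = min (1/2) ζ' := ⟨_, rfl⟩
  have μ0 : 0 < μ := by rw [hμ]; exact lt_min (by norm_num) hζ'
  have μ1 : μ ≤ 1/2 := hμ ▸ min_le_left _ _
  have μ2 : μ ≤ ζ' := hμ ▸ min_le_right _ _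
  obtain ⟨⟨m, m0, hm⟩, ⟨L, L0, hL⟩, C, C0, ρ, hf⟩ := ffacts hα₀ hζ hf_holder hf_decay μ0 μ1 μ2
  have hm1 : ∀ x, |f x - finf| ≤ m := fun x => (hm x).trans (mul_le_of_le_one_right m0
    (Real.rpow_le_one_of_one_le_of_nonpos (by linarith [norm_nonneg x]) (by linarith)))
  have hm2 : ∀ x y, |f y - f x| ≤ 2 * m := fun x y => by
    have := abs_sub_le (f y) finf (f x); rw [abs_sub_comm finf] at this; linarith [hm1 x, hm1 y]
  obtain ⟨G, hG⟩ := mas_of hu hconv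
  have hA := hG.aff (Real.exp_pos (-finf)) (P := 1) (by simp) 0 (Real.exp (-finf) • G 0) (Real.exp (-finf) * u 0)
  simp only [transpose_one, one_mul, mul_one, TM_one, zero_add] at hA
  have hdet : ∀ x, (Real.exp (-finf) • hess u x).det = Real.exp (n * (f x - finf)) := fun x => by
    rw [det_smul, hMA, Fintype.card_fin, ← Real.exp_nat_mul, ← Real.exp_add]; congr 1; ring
  have hratio : ∀ x y, (Real.exp (-finf) • hess u y).det / (Real.exp (-finf) • hess u x).det = Real.exp (n * (f y - f x)) := fun x y => by
    rw [hdet, hdet, ← Real.exp_sub]; congr 1; ring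
  have hMZ : MZ (Real.exp (n * -m)) (Real.exp (n * m)) _ _ _ := { hA with
    lo := fun x => by
      rw [hdet]; exact Real.exp_le_exp.2 (mul_le_mul_of_nonneg_left (abs_le.1 (hm1 x)).1 n0)
    hi := fun x => by
      rw [hdet]; exact Real.exp_le_exp.2 (mul_le_mul_of_nonneg_left (abs_le.1 (hm1 x)).2 n0)
    u0 := by simp
    G0 := by simp }
  obtain ⟨K, hK⟩ : ∃ K, K = n * Real.exp (n * (2 * m)) := ⟨_, rfl⟩
  have K0 : 0 ≤ K := by rw [hK]; positivity
  have e1 : ∀ x w, |f x - finf| ≤ w → |Real.exp (n * (f x - finf)) - 1| ≤ K * w := fun x w hw => by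
    rw [hK]; exact dexp (by linarith [hm1 x]) n0 hw
  have e2 : ∀ x y w, |f y - f x| ≤ w → |Real.exp (n * (f y - f x)) - 1| ≤ K * w := fun x y w hw => by
    rw [hK]; exact dexp (hm2 x y) n0 hw
  obtain ⟨M, M0, hM⟩ := hm_of (by omega) (mul_nonneg K0 m0) hζ (g := fun x => (Real.exp (-finf) • hess u x).det) hA.cA.matrix_det fun x => by
    rw [hdet, mul_assoc]; exact e1 x _ (hm x)
  have hdk : DK (fun x => (Real.exp (-finf) • hess u x).det) (K * C) μ α ρ := fun x hx => by
    refine ⟨?_, fun z t t0 t1 hz => ?_⟩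
    · beta_reduce; rw [hdet, mul_assoc]; exact e1 x _ (hf x hx).1
    · beta_reduce; rw [hratio, mul_assoc, mul_assoc, ← mul_assoc C]; exact e2 x z _ ((hf x hx).2 z t t0 t1 hz)
  have hg : ∀ x y, ‖y - x‖ ≤ 1 → |(Real.exp (-finf) • hess u y).det / (Real.exp (-finf) • hess u x).det - 1| ≤ (K * L) * ‖y - x‖ ^ α := fun x y hxy => by
    rw [hratio, mul_assoc]; exact e2 x y _ (hL x y hxy)
  obtain ⟨N, hN, hN1, C', C'0, b1, b2, b3⟩ := core (by omega) (Real.exp_pos _) hMZ M0 hM hα₀ hα₁ (mul_nonneg K0 C0.le) μ0 μ1 hdk (mul_nonneg K0 L0) hg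
  have E0 := Real.exp_pos finf
  have hs : ∀ z, |z| = Real.exp finf * |Real.exp (-finf) * z| := fun z => by
    rw [abs_mul, abs_of_pos (Real.exp_pos _), ← mul_assoc, ← Real.exp_add, add_neg_cancel, Real.exp_zero, one_mul]
  simp only [Matrix.smul_apply, smul_eq_mul] at b1 b2 b3
  refine ⟨μ, Real.exp finf * C', Real.exp finf • N, μ0, by positivity, hN.smul E0, ?_, fun x i j => ?_, fun x y i j => ?_, fun x hx i j => ?_⟩
  · rw [det_smul, hN1, Fintype.card_fin, mul_one, ← Real.exp_nat_mul]
  · rw [hs]; exact mul_le_mul_of_nonneg_left (b1 x i j) E0.le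
  · rw [hs, mul_sub, mul_assoc]; exact mul_le_mul_of_nonneg_left (b2 x y i j) E0.le
  · rw [hs, mul_sub, mul_assoc, Matrix.smul_apply, smul_eq_mul, ← mul_assoc (Real.exp (-finf)) (Real.exp finf), ← Real.exp_add, neg_add_cancel, Real.exp_zero, one_mul]
    exact mul_le_mul_of_nonneg_left (b3 x hx i j) E0.le
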